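/- Every holomorphic action of the multiplicative group ℂ* on ℂ² is analytically linearizable: there exist integers n, m and a biholomorphism H : ℂ² → ℂ² such that (H ∘ φ^s ∘ H⁻¹)(x,y) = (sⁿ·x, sᵐ·y) for every s ∈ ℂ* and every (x,y) ∈ ℂ². -/

import Mathlib

notation "ℂ²" => ℂ × ℂ

namespace Suz
open Complex Metric Set Filter Topology Real InnerProductSpace

/-- Poisson integral over the circle of radius `R`. -/
noncomputable def PI (R : ℝ) (g : ℂ → ℝ) (w : ℂ) : ℝ :=
  Real.circleAverage (fun ζ => poissonKernel 0 w ζ * g ζ) 0 R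

/-- locally the real part of an analytic function -/
def Hm (f : ℂ → ℝ) (x : ℂ) : Prop :=
  ∃ F : ℂ → ℂ, AnalyticAt ℂ F x ∧ f =ᶠ[𝓝 x] fun z => (F z).re

lemma Hm.harmonicAt {f : ℂ → ℝ} {x : ℂ} (h : Hm f x) : HarmonicAt f x := by
  obtain ⟨F, hF, hf⟩ := h
  exact (harmonicAt_congr_nhds hf).2 hF.harmonicAt_re

lemma HarmonicAt.hm {f : ℂ → ℝ} {x : ℂ} (h : HarmonicAt f x) : Hm f x := by
  obtain ⟨r, hr, h'⟩ := eventually_nhds_iff_ball.1 h.eventually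
  obtain ⟨F, hF, hre⟩ := HarmonicOnNhd.exists_analyticOnNhd_ball_re_eq (z := x) (R := r)
    (f := f) (fun y hy => h' y hy)
  refine ⟨F, hF x (mem_ball_self hr), ?_⟩
  filter_upwards [ball_mem_nhds x hr] with z hz
  exact (hre hz).symm

lemma Hm.eventually {f : ℂ → ℝ} {x : ℂ} (h : Hm f x) : ∀ᶠ y in 𝓝 x, Hm f y := by
  obtain ⟨F, hF, hf⟩ := h
  filter_upwards [hF.eventually_analyticAt, hf.eventually_nhds] with y hy hy'
  exact ⟨F, hy, hy'⟩

lemma Hm.congr {f g : ℂ → ℝ} {x : ℂ} (h : Hm f x) (hfg : f =ᶠ[𝓝 x] g) : Hm g x := by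
  obtain ⟨F, hF, hf⟩ := h
  exact ⟨F, hF, hfg.symm.trans hf⟩

lemma Hm.continuousAt {f : ℂ → ℝ} {x : ℂ} (h : Hm f x) : ContinuousAt f x := by
  obtain ⟨F, hF, hf⟩ := h
  exact (Complex.continuous_re.continuousAt.comp hF.continuousAt).congr hf.symm

lemma Hm.sub {f g : ℂ → ℝ} {x : ℂ} (h : Hm f x) (h' : Hm g x) : Hm (fun z => f z - g z) x := by
  obtain ⟨F, hF, hf⟩ := h
  obtain ⟨G, hG, hg⟩ := h'
  refine ⟨fun z => F z - G z, hF.sub hG, ?_⟩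
  filter_upwards [hf, hg] with z h1 h2
  simp [h1, h2]

lemma Hm.add {f g : ℂ → ℝ} {x : ℂ} (h : Hm f x) (h' : Hm g x) : Hm (fun z => f z + g z) x := by
  obtain ⟨F, hF, hf⟩ := h
  obtain ⟨G, hG, hg⟩ := h'
  refine ⟨fun z => F z + G z, hF.add hG, ?_⟩
  filter_upwards [hf, hg] with z h1 h2
  simp [h1, h2]

lemma Hm.mul_const {f : ℂ → ℝ} {x : ℂ} (h : Hm f x) (c : ℝ) : Hm (fun z => c * f z) x := by
  obtain ⟨F, hF, hf⟩ := h
  refine ⟨fun z => (c : ℂ) * F z, analyticAt_const.mul hF, ?_⟩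
  filter_upwards [hf] with z h1
  simp [h1]

lemma Hm.const (c : ℝ) (x : ℂ) : Hm (fun _ => c) x :=
  ⟨fun _ => (c : ℂ), analyticAt_const, by simp⟩

lemma Hm.log {F : ℂ → ℂ} {x : ℂ} (h : AnalyticAt ℂ F x) (h0 : F x ≠ 0) :
    Hm (fun z => Real.log ‖F z‖) x :=
  HarmonicAt.hm (h.harmonicAt_log_norm h0)

lemma Hm.comp {f : ℂ → ℝ} {τ : ℂ → ℂ} {x : ℂ} (h : Hm f (τ x)) (hτ : AnalyticAt ℂ τ x) :
    Hm (fun z => f (τ z)) x := by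
  obtain ⟨F, hF, hf⟩ := h
  exact ⟨fun z => F (τ z), hF.comp hτ, hτ.continuousAt.eventually hf⟩

lemma Hm.mean {f : ℂ → ℝ} {x : ℂ} (h : Hm f x) :
    ∃ r₀ > 0, ∀ r, 0 < r → r < r₀ → Real.circleAverage f x r = f x := by
  obtain ⟨r, hr, h'⟩ := eventually_nhds_iff_ball.1 h.eventually
  refine ⟨r, hr, fun s hs hsr => ?_⟩
  apply InnerProductSpace.HarmonicOnNhd.circleAverage_eq
  intro y hy
  rw [abs_of_pos hs] at hy
  exact (h' y (closedBall_subset_ball hsr hy)).harmonicAt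

section PI
variable {R : ℝ} {g g₁ g₂ : ℂ → ℝ} {w : ℂ}

lemma ker_cont (hw : w ∈ ball (0 : ℂ) R) :
    ContinuousOn (poissonKernel 0 w) (sphere 0 R) := by
  have hR : 0 < R := (norm_nonneg _).trans_lt (mem_ball_zero_iff.1 hw)
  have := continuousOn_herglotzRieszKernel_sphere hw
  rw [abs_of_pos hR] at this
  rw [poissonKernel_eq_re_herglotzRieszKernel]
  exact Complex.continuous_re.comp_continuousOn this

lemma ker_int (hR : 0 < R) (hg : ContinuousOn g (sphere 0 R)) (hw : w ∈ ball (0 : ℂ) R) :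
    CircleIntegrable (fun ζ => poissonKernel 0 w ζ * g ζ) 0 R :=
  ContinuousOn.circleIntegrable hR.le ((ker_cont hw).mul hg)

lemma ker_le {ζ : ℂ} (hζ : ζ ∈ sphere (0 : ℂ) R) (hw : w ∈ ball (0 : ℂ) R) :
    poissonKernel 0 w ζ ≤ (R + ‖w‖) / (R - ‖w‖) := by
  have := re_herglotzRieszKernel_le hζ hw
  rw [poissonKernel_eq_re_herglotzRieszKernel]
  simpa [herglotzRieszKernel_def] using this

lemma le_ker {ζ : ℂ} (hζ : ζ ∈ sphere (0 : ℂ) R) (hw : w ∈ ball (0 : ℂ) R) :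
    (R - ‖w‖) / (R + ‖w‖) ≤ poissonKernel 0 w ζ := by
  have := le_re_herglotzRieszKernel hζ hw
  rw [poissonKernel_eq_re_herglotzRieszKernel]
  simpa [herglotzRieszKernel_def] using this

lemma ker_nonneg {ζ : ℂ} (hζ : ζ ∈ sphere (0 : ℂ) R) (hw : w ∈ ball (0 : ℂ) R) :
    0 ≤ poissonKernel 0 w ζ := by
  refine le_trans ?_ (le_ker hζ hw)
  have : ‖w‖ < R := mem_ball_zero_iff.1 hw
  have := norm_nonneg w
  apply div_nonneg <;> linarith

lemma PI_mono (hR : 0 < R) (h1 : ContinuousOn g₁ (sphere 0 R)) (h2 : ContinuousOn g₂ (sphere 0 R))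
    (h : ∀ ζ ∈ sphere (0 : ℂ) R, g₁ ζ ≤ g₂ ζ) (hw : w ∈ ball (0 : ℂ) R) :
    PI R g₁ w ≤ PI R g₂ w := by
  apply Real.circleAverage_mono (ker_int hR h1 hw) (ker_int hR h2 hw)
  intro ζ hζ
  rw [abs_of_pos hR] at hζ
  exact mul_le_mul_of_nonneg_left (h ζ hζ) (ker_nonneg hζ hw)

lemma PI_sub (hR : 0 < R) (h1 : ContinuousOn g₁ (sphere 0 R)) (h2 : ContinuousOn g₂ (sphere 0 R))
    (hw : w ∈ ball (0 : ℂ) R) :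
    PI R (fun z => g₁ z - g₂ z) w = PI R g₁ w - PI R g₂ w := by
  unfold PI
  rw [← Real.circleAverage_fun_sub (ker_int hR h1 hw) (ker_int hR h2 hw)]
  simp only [mul_sub]

lemma PI_repr {u : ℂ → ℝ} (hu : ContinuousOn u (closedBall 0 R))
    (hh : ∀ z ∈ ball (0 : ℂ) R, Hm u z) (hw : w ∈ ball (0 : ℂ) R) : PI R u w = u w := by
  have hR : 0 < R := (norm_nonneg _).trans_lt (mem_ball_zero_iff.1 hw)
  refine HarmonicContOnCl.circleAverage_poissonKernel_smul (f := u) ⟨fun z hz => (hh z hz).harmonicAt, ?_⟩ hw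
  rwa [closure_ball _ hR.ne']

lemma PI_const (c : ℝ) (hw : w ∈ ball (0 : ℂ) R) : PI R (fun _ => c) w = c :=
  PI_repr (u := fun _ => c) continuousOn_const (fun z _ => Hm.const c z) hw

lemma PI_zero (hR : 0 < R) : PI R g 0 = Real.circleAverage g 0 R := by
  apply Real.circleAverage_congr_sphere
  intro ζ hζ
  rw [abs_of_pos hR] at hζ
  have : ‖ζ‖ = R := by simpa using hζ
  have h2 : ‖ζ‖ ^ 2 ≠ 0 := by rw [this]; positivity
  simp [poissonKernel_def, this, hR.ne']

lemma PI_analytic (hR : 0 < R) (hg : ContinuousOn g (sphere 0 R)) :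
    ∃ F : ℂ → ℂ, AnalyticOnNhd ℂ F (ball 0 R) ∧ ∀ w ∈ ball (0 : ℂ) R, PI R g w = (F w).re := by
  have hi : CircleIntegrable g 0 R := ContinuousOn.circleIntegrable hR.le hg
  have hi' : CircleIntegrable (fun z => (g z : ℂ)) 0 R :=
    ContinuousOn.circleIntegrable hR.le (Complex.continuous_ofReal.comp_continuousOn hg)
  refine ⟨_, analyticOnNhd_circleAverage_herglotzRieszKernel_smul hi', fun w hw => ?_⟩
  rw [re_circleAverage_herglotzRieszKernel_smul hi hw, ← poissonKernel_eq_re_herglotzRieszKernel]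
  rfl

lemma PI_hm (hR : 0 < R) (hg : ContinuousOn g (sphere 0 R)) (hw : w ∈ ball (0 : ℂ) R) :
    Hm (PI R g) w := by
  obtain ⟨F, hF, h⟩ := PI_analytic hR hg
  refine ⟨F, hF w hw, ?_⟩
  filter_upwards [isOpen_ball.mem_nhds hw] with z hz using h z hz

/-- Harnack type estimate. -/
lemma PI_harnack (hR : 0 < R) (h1 : ContinuousOn g₁ (sphere 0 R))
    (h2 : ContinuousOn g₂ (sphere 0 R))
    (h : ∀ ζ ∈ sphere (0 : ℂ) R, g₁ ζ ≤ g₂ ζ) (hw : ‖w‖ ≤ R / 2) :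
    PI R g₂ w - PI R g₁ w ≤ 3 * (PI R g₂ 0 - PI R g₁ 0) ∧
    (PI R g₂ 0 - PI R g₁ 0) / 3 ≤ PI R g₂ w - PI R g₁ w := by
  have hw' : w ∈ ball (0 : ℂ) R := by rw [mem_ball_zero_iff]; linarith
  have h0 : (0 : ℂ) ∈ ball (0 : ℂ) R := mem_ball_self hR
  have hn := norm_nonneg w
  have hc : ContinuousOn (fun z => g₂ z - g₁ z) (sphere 0 R) := h2.sub h1
  rw [← PI_sub hR h2 h1 hw', ← PI_sub hR h2 h1 h0, PI_zero hR]
  have hi : CircleIntegrable (fun z => g₂ z - g₁ z) 0 R := ContinuousOn.circleIntegrable hR.le hc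
  constructor
  · have : 3 * Real.circleAverage (fun z => g₂ z - g₁ z) 0 R
        = Real.circleAverage (fun z => 3 * (g₂ z - g₁ z)) 0 R := by
      have := Real.circleAverage_fun_smul (f := fun z => g₂ z - g₁ z) (c := 0) (R := R) (a := (3:ℝ))
      simpa using this.symm
    rw [this]
    apply Real.circleAverage_mono (ker_int hR hc hw') (hi.const_smul (a := (3:ℝ)))
    intro ζ hζ
    rw [abs_of_pos hR] at hζ
    apply mul_le_mul_of_nonneg_right _ (sub_nonneg.2 (h ζ hζ))
    refine (ker_le hζ hw').trans ?_
    rw [div_le_iff₀ (by linarith)]; linarith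
  · have : Real.circleAverage (fun z => g₂ z - g₁ z) 0 R / 3
        = Real.circleAverage (fun z => (1/3) * (g₂ z - g₁ z)) 0 R := by
      have := Real.circleAverage_fun_smul (f := fun z => g₂ z - g₁ z) (c := 0) (R := R) (a := (1/3:ℝ))
      simp only [smul_eq_mul] at this
      rw [this]; ring
    rw [this]
    apply Real.circleAverage_mono (hi.const_smul (a := (1/3:ℝ))) (ker_int hR hc hw')
    intro ζ hζ
    rw [abs_of_pos hR] at hζ
    apply mul_le_mul_of_nonneg_right _ (sub_nonneg.2 (h ζ hζ))
    refine le_trans ?_ (le_ker hζ hw')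
    rw [le_div_iff₀ (by linarith)]; linarith

lemma PI_tendsto (hR : 0 < R) (hg : ContinuousOn g (sphere 0 R)) {b : ℂ}
    (hb : b ∈ sphere (0 : ℂ) R) : Tendsto (PI R g) (𝓝[ball 0 R] b) (𝓝 (g b)) := by
  obtain ⟨M, hM⟩ := (isCompact_sphere (0 : ℂ) R).exists_bound_of_continuousOn hg
  have hM0 : 0 ≤ M := (norm_nonneg _).trans (hM b hb)
  rw [Metric.tendsto_nhds]
  intro ε hε
  obtain ⟨δ, hδ, hδ'⟩ := Metric.continuousWithinAt_iff.1 (hg b hb) (ε / 2) (half_pos hε)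
  have hlim : Tendsto (fun w : ℂ => ε / 2 + 2 * M * (R ^ 2 - ‖w‖ ^ 2) * 4 / δ ^ 2)
      (𝓝[ball 0 R] b) (𝓝 (ε / 2 + 2 * M * (R ^ 2 - ‖b‖ ^ 2) * 4 / δ ^ 2)) := by
    apply tendsto_nhdsWithin_of_tendsto_nhds
    apply Continuous.tendsto
    fun_prop
  have hb' : ‖b‖ = R := by simpa using hb
  rw [hb'] at hlim
  simp only [sub_self, mul_zero, zero_mul, zero_div, add_zero] at hlim
  have h1 := hlim.eventually (gt_mem_nhds (half_lt_self hε))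
  have h2 : ∀ᶠ w in 𝓝[ball 0 R] b, w ∈ ball b (δ / 2) :=
    mem_nhdsWithin_of_mem_nhds (ball_mem_nhds b (half_pos hδ))
  filter_upwards [h1, h2, self_mem_nhdsWithin] with w hw1 hw2 hw
  refine lt_of_le_of_lt ?_ hw1
  have hcb : ContinuousOn (fun z => g z - g b) (sphere 0 R) := hg.sub continuousOn_const
  have e1 : PI R g w - g b = PI R (fun z => g z - g b) w := by
    rw [PI_sub hR hg continuousOn_const hw, PI_const _ hw]
  rw [Real.dist_eq, e1]
  have hwR : ‖w‖ < R := mem_ball_zero_iff.1 hw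
  have hwn := norm_nonneg w
  have hd : 0 ≤ R ^ 2 - ‖w‖ ^ 2 := by nlinarith
  set A := 2 * M * (R ^ 2 - ‖w‖ ^ 2) * 4 / δ ^ 2 with hA
  have hA0 : 0 ≤ A := by positivity
  have key : ∀ ζ ∈ sphere (0 : ℂ) R,
      |poissonKernel 0 w ζ * (g ζ - g b)| ≤ poissonKernel 0 w ζ * (ε / 2) + A := by
    intro ζ hζ
    have hk := ker_nonneg hζ hw
    rw [abs_mul, abs_of_nonneg hk]
    by_cases hz : dist ζ b < δ
    · have := (hδ' hζ hz).le
      rw [Real.dist_eq] at this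
      nlinarith [mul_le_mul_of_nonneg_left this hk]
    · push Not at hz
      have hζn : ‖ζ‖ = R := by simpa using hζ
      have h3 : δ / 2 ≤ ‖ζ - w‖ := by
        have := dist_triangle ζ w b
        rw [mem_ball] at hw2
        rw [← dist_eq_norm]; linarith
      have h4 : |g ζ - g b| ≤ 2 * M := by
        have a1 := hM ζ hζ
        have a2 := hM b hb
        have := abs_sub (g ζ) (g b)
        simp only [Real.norm_eq_abs] at a1 a2
        linarith
      have h5 : poissonKernel 0 w ζ ≤ (R ^ 2 - ‖w‖ ^ 2) * 4 / δ ^ 2 := by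
        rw [poissonKernel_def]
        simp only [sub_zero, hζn]
        have h30 : 0 < ‖ζ - w‖ := by linarith
        rw [div_le_div_iff₀ (by positivity) (by positivity)]
        have : δ ^ 2 ≤ 4 * ‖ζ - w‖ ^ 2 := by nlinarith
        nlinarith
      have h6 : poissonKernel 0 w ζ * |g ζ - g b| ≤ A := by
        calc _ ≤ ((R ^ 2 - ‖w‖ ^ 2) * 4 / δ ^ 2) * (2 * M) :=
              mul_le_mul h5 h4 (abs_nonneg _) (by positivity)
          _ = A := by rw [hA]; ring
      have : 0 ≤ poissonKernel 0 w ζ * (ε / 2) := by positivity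
      linarith
  have hIn := ker_int hR hcb hw
  have hIn2 : CircleIntegrable (fun ζ => poissonKernel 0 w ζ * (ε / 2) + A) 0 R :=
    ContinuousOn.circleIntegrable hR.le (((ker_cont hw).mul continuousOn_const).add continuousOn_const)
  calc |PI R (fun z => g z - g b) w|
      ≤ Real.circleAverage |fun ζ => poissonKernel 0 w ζ * (g ζ - g b)| 0 R :=
        Real.abs_circleAverage_le_circleAverage_abs
    _ ≤ Real.circleAverage (fun ζ => poissonKernel 0 w ζ * (ε / 2) + A) 0 R := by
        apply Real.circleAverage_mono hIn.abs hIn2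
        intro ζ hζ
        rw [abs_of_pos hR] at hζ
        exact key ζ hζ
    _ = ε / 2 + A := by
        rw [Real.circleAverage_fun_add (ker_int hR continuousOn_const hw) (circleIntegrable_const _ _ _),
          Real.circleAverage_const]
        congr 1
        exact PI_const (ε / 2) hw

/-- The solution of the Dirichlet problem in the disc. -/
noncomputable def DP (R : ℝ) (g : ℂ → ℝ) (w : ℂ) : ℝ := if ‖w‖ < R then PI R g w else g w

lemma DP_cont (hR : 0 < R) (hg : ContinuousOn g (sphere 0 R)) :
    ContinuousOn (DP R g) (closedBall 0 R) := by
  intro b hb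
  by_cases hbR : ‖b‖ < R
  · have hb' : b ∈ ball (0 : ℂ) R := mem_ball_zero_iff.2 hbR
    refine ((PI_hm hR hg hb').continuousAt.congr ?_).continuousWithinAt
    filter_upwards [isOpen_ball.mem_nhds hb'] with z hz
    rw [DP, if_pos (mem_ball_zero_iff.1 hz)]
  · have hbs : b ∈ sphere (0 : ℂ) R := by
      rw [mem_sphere_zero_iff_norm]
      exact le_antisymm (mem_closedBall_zero_iff.1 hb) (not_lt.1 hbR)
    rw [← ball_union_sphere]
    have hval : DP R g b = g b := by rw [DP, if_neg hbR]
    apply ContinuousWithinAt.union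
    · rw [ContinuousWithinAt, hval]
      refine (PI_tendsto hR hg hbs).congr' ?_
      filter_upwards [self_mem_nhdsWithin] with z hz
      rw [DP, if_pos (mem_ball_zero_iff.1 hz)]
    · refine (hg b hbs).congr ?_ hval
      intro z hz
      rw [DP, if_neg (by rw [mem_sphere_zero_iff_norm.1 hz]; exact lt_irrefl _)]

end PI
end Suz

namespace Suz
open Complex Metric Set Filter Topology Real InnerProductSpace

/-- A Riemann surface structure given by centered disc charts (of radius 3). -/
structure RS (X : Type*) [TopologicalSpace X] where
  c : X → ℂ → X
  zero : ∀ a, c a 0 = a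
  cont : ∀ a, ContinuousOn (c a) (ball 0 3)
  inj : ∀ a, InjOn (c a) (ball 0 3)
  opn : ∀ a U, U ⊆ ball 0 3 → IsOpen U → IsOpen (c a '' U)
  compat : ∀ a b z w, z ∈ ball (0 : ℂ) 3 → w ∈ ball (0 : ℂ) 3 → c a z = c b w →
    ∃ τ : ℂ → ℂ, AnalyticAt ℂ τ z ∧ τ z = w ∧ ∀ᶠ z' in 𝓝 z, c a z' = c b (τ z')

namespace RS
variable {X : Type*} [TopologicalSpace X] (S : RS X)

/-- inverse chart -/
noncomputable def iv (a : X) (x : X) : ℂ := Function.invFunOn (S.c a) (ball 0 3) x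

lemma iv_c {a : X} {z : ℂ} (hz : z ∈ ball (0 : ℂ) 3) : S.iv a (S.c a z) = z := by
  have h : ∃ w ∈ ball (0 : ℂ) 3, S.c a w = S.c a z := ⟨z, hz, rfl⟩
  exact S.inj a (Function.invFunOn_mem h) hz (Function.invFunOn_eq h)

lemma map_nhds {a : X} {z : ℂ} (hz : z ∈ ball (0 : ℂ) 3) : map (S.c a) (𝓝 z) = 𝓝 (S.c a z) := by
  apply le_antisymm
  · exact (S.cont a).continuousAt (isOpen_ball.mem_nhds hz)
  · intro N hN
    rw [mem_map] at hN
    obtain ⟨U, hU, hUo, hzU⟩ := _root_.mem_nhds_iff.1 (Filter.inter_mem hN (isOpen_ball.mem_nhds hz))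
    refine mem_of_superset ((S.opn a U (hU.trans inter_subset_right) hUo).mem_nhds ⟨z, hzU, rfl⟩) ?_
    rintro _ ⟨y, hy, rfl⟩
    exact (hU hy).1

lemma map_nhds0 (a : X) : map (S.c a) (𝓝 0) = 𝓝 a := by
  have := S.map_nhds (a := a) (z := 0) (by simp)
  rwa [S.zero] at this

lemma ev_iff {a : X} {z : ℂ} (hz : z ∈ ball (0 : ℂ) 3) {p : X → Prop} :
    (∀ᶠ x in 𝓝 (S.c a z), p x) ↔ ∀ᶠ w in 𝓝 z, p (S.c a w) := by
  rw [← S.map_nhds hz, eventually_map]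

lemma ev0_iff {a : X} {p : X → Prop} :
    (∀ᶠ x in 𝓝 a, p x) ↔ ∀ᶠ w in 𝓝 0, p (S.c a w) := by
  rw [← S.map_nhds0 a, eventually_map]

lemma contOn_image {Z : Type*} [TopologicalSpace Z] {f : X → Z} {a : X} {A : Set ℂ}
    (hA : A ⊆ ball 0 3) (h : ContinuousOn (fun z => f (S.c a z)) A) :
    ContinuousOn f (S.c a '' A) := by
  rintro _ ⟨z, hz, rfl⟩
  have h1 := h z hz
  rw [ContinuousWithinAt] at h1 ⊢
  have : 𝓝[S.c a '' A] (S.c a z) ≤ map (S.c a) (𝓝[A] z) := by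
    intro N hN
    rw [mem_map, mem_nhdsWithin] at hN
    obtain ⟨U, hUo, hzU, hU⟩ := hN
    rw [mem_nhdsWithin]
    refine ⟨S.c a '' (U ∩ ball 0 3), S.opn a _ inter_subset_right (hUo.inter isOpen_ball),
      ⟨z, ⟨hzU, hA hz⟩, rfl⟩, ?_⟩
    rintro _ ⟨⟨y, hy, rfl⟩, ⟨y', hy', he⟩⟩
    have := S.inj a (hA hy') hy.2 he
    subst this
    exact hU ⟨hy.1, hy'⟩
  exact Tendsto.mono_left (tendsto_map'_iff.2 h1) this

lemma contAt_iff {Z : Type*} [TopologicalSpace Z] {f : X → Z} {a : X} {z : ℂ}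
    (hz : z ∈ ball (0 : ℂ) 3) :
    ContinuousAt f (S.c a z) ↔ ContinuousAt (fun z => f (S.c a z)) z := by
  rw [ContinuousAt, ContinuousAt, ← S.map_nhds hz]; rfl

/-- harmonic at a point -/
def HmX (u : X → ℝ) (b : X) : Prop := Hm (fun z => u (S.c b z)) 0

lemma hmX_iff {u : X → ℝ} {a : X} {z : ℂ} (hz : z ∈ ball (0 : ℂ) 3) :
    S.HmX u (S.c a z) ↔ Hm (fun z => u (S.c a z)) z := by
  have h0 : (0 : ℂ) ∈ ball (0 : ℂ) 3 := by simp
  constructor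
  · intro h
    obtain ⟨τ, hτ, hz0, he⟩ := S.compat a (S.c a z) z 0 hz h0 (by rw [S.zero])
    unfold HmX at h
    rw [← hz0] at h
    refine (Hm.comp h hτ).congr ?_
    filter_upwards [he] with w hw
    simp only [hw]
  · intro h
    obtain ⟨τ, hτ, hz0, he⟩ := S.compat (S.c a z) a 0 z h0 hz (by rw [S.zero])
    rw [← hz0] at h
    refine (Hm.comp h hτ).congr ?_
    filter_upwards [he] with w hw
    rw [hw]

lemma HmX.congr {u v : X → ℝ} {b : X} (h : S.HmX u b) (e : u =ᶠ[𝓝 b] v) : S.HmX v b := by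
  refine Hm.congr h ?_
  exact (S.ev0_iff).1 e

lemma HmX.continuousAt {u : X → ℝ} {b : X} (h : S.HmX u b) : ContinuousAt u b := by
  have := Hm.continuousAt h
  have h2 := (S.contAt_iff (a := b) (z := 0) (f := u) (by simp)).2 this
  rwa [S.zero] at h2

lemma HmX.eventually {u : X → ℝ} {b : X} (h : S.HmX u b) : ∀ᶠ x in 𝓝 b, S.HmX u x := by
  rw [S.ev0_iff]
  filter_upwards [Hm.eventually h, ball_mem_nhds (0 : ℂ) (by norm_num : (0 : ℝ) < 3)] with z hz hz3
  exact (S.hmX_iff hz3).2 hz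

/-- submean inequality at a point -/
def SM (v : X → ℝ) (b : X) : Prop :=
  ∃ r₀ > 0, ∀ r, 0 < r → r < r₀ → v b ≤ Real.circleAverage (fun z => v (S.c b z)) 0 r

lemma HmX.mean {u : X → ℝ} {b : X} (h : S.HmX u b) :
    ∃ r₀ > 0, ∀ r, 0 < r → r < r₀ → Real.circleAverage (fun z => u (S.c b z)) 0 r = u b := by
  obtain ⟨r₀, h0, h1⟩ := Hm.mean h
  refine ⟨r₀, h0, fun r hr hr' => ?_⟩
  rw [h1 r hr hr', S.zero]

lemma HmX.sm {u : X → ℝ} {b : X} (h : S.HmX u b) : S.SM u b := by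
  obtain ⟨r₀, h0, h1⟩ := HmX.mean S h
  exact ⟨r₀, h0, fun r hr hr' => (h1 r hr hr').ge⟩

lemma circInt {v : X → ℝ} {b : X} (h : ∀ᶠ x in 𝓝 b, ContinuousAt v x) :
    ∃ r₀ > 0, r₀ ≤ 3 ∧ (∀ z ∈ ball (0 : ℂ) r₀, ContinuousAt (fun z => v (S.c b z)) z) ∧
    ∀ r, 0 < r → r < r₀ → CircleIntegrable (fun z => v (S.c b z)) 0 r := by
  rw [S.ev0_iff] at h
  obtain ⟨r, hr, h'⟩ := eventually_nhds_iff_ball.1 h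
  have hh : ∀ z ∈ ball (0 : ℂ) (min r 3), ContinuousAt (fun z => v (S.c b z)) z := by
    intro z hz
    exact (S.contAt_iff (ball_subset_ball (min_le_right _ _) hz)).1
      (h' z (ball_subset_ball (min_le_left _ _) hz))
  refine ⟨min r 3, by positivity, min_le_right _ _, hh, fun s hs hs' => ?_⟩
  apply ContinuousOn.circleIntegrable hs.le
  intro z hz
  apply (hh z _).continuousWithinAt
  rw [mem_sphere_zero_iff_norm] at hz
  rw [mem_ball_zero_iff, hz]; exact hs'

lemma SM.mono {v v' : X → ℝ} {b : X} (h : S.SM v b) (hc : ∀ᶠ x in 𝓝 b, ContinuousAt v x)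
    (hc' : ∀ᶠ x in 𝓝 b, ContinuousAt v' x) (hle : ∀ᶠ x in 𝓝 b, v x ≤ v' x) (he : v' b = v b) :
    S.SM v' b := by
  obtain ⟨r0, h0, h1⟩ := h
  obtain ⟨r1, p1, -, -, i1⟩ := S.circInt hc
  obtain ⟨r2, p2, -, -, i2⟩ := S.circInt hc'
  rw [S.ev0_iff] at hle
  obtain ⟨r3, p3, h3⟩ := eventually_nhds_iff_ball.1 hle
  refine ⟨min (min r0 r1) (min r2 r3), by positivity, fun r hr hr' => ?_⟩
  simp only [lt_min_iff] at hr'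
  rw [he]
  refine (h1 r hr hr'.1.1).trans ?_
  apply Real.circleAverage_mono (i1 r hr hr'.1.2) (i2 r hr hr'.2.1)
  intro z hz
  rw [abs_of_pos hr, mem_sphere_zero_iff_norm] at hz
  apply h3
  rw [mem_ball_zero_iff, hz]; exact hr'.2.2

lemma SM.congr {v v' : X → ℝ} {b : X} (h : S.SM v b) (he : ∀ᶠ x in 𝓝 b, v x = v' x) :
    S.SM v' b := by
  obtain ⟨r0, h0, h1⟩ := h
  have heb := he.self_of_nhds
  rw [S.ev0_iff] at he
  obtain ⟨r3, p3, h3⟩ := eventually_nhds_iff_ball.1 he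
  refine ⟨min r0 r3, by positivity, fun r hr hr' => ?_⟩
  simp only [lt_min_iff] at hr'
  rw [← heb]
  refine (h1 r hr hr'.1).trans (le_of_eq ?_)
  apply Real.circleAverage_congr_sphere
  intro z hz
  rw [abs_of_pos hr, mem_sphere_zero_iff_norm] at hz
  apply h3
  rw [mem_ball_zero_iff, hz]; exact hr'.2

lemma SM.sub {v u : X → ℝ} {b : X} (h : S.SM v b) (hc : ∀ᶠ x in 𝓝 b, ContinuousAt v x)
    (hu : S.HmX u b) : S.SM (fun x => v x - u x) b := by
  obtain ⟨r0, h0, h1⟩ := h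
  obtain ⟨r1, p1, -, -, i1⟩ := S.circInt hc
  obtain ⟨r2, p2, -, -, i2⟩ := S.circInt
    ((HmX.eventually S hu).mono fun x hx => HmX.continuousAt S hx)
  obtain ⟨r3, p3, h3⟩ := HmX.mean S hu
  refine ⟨min (min r0 r1) (min r2 r3), by positivity, fun r hr hr' => ?_⟩
  simp only [lt_min_iff] at hr'
  rw [Real.circleAverage_fun_sub (i1 r hr hr'.1.2) (i2 r hr hr'.2.1), h3 r hr hr'.2.2]
  linarith [h1 r hr hr'.1.1]

lemma SM.sub_const {v : X → ℝ} {b : X} (h : S.SM v b) (hc : ∀ᶠ x in 𝓝 b, ContinuousAt v x)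
    (k : ℝ) : S.SM (fun x => v x - k) b :=
  SM.sub S h hc (Hm.const k 0)

lemma SM.max {v u : X → ℝ} {b : X} (h : S.SM v b) (h' : S.SM u b)
    (hc : ∀ᶠ x in 𝓝 b, ContinuousAt v x) (hc' : ∀ᶠ x in 𝓝 b, ContinuousAt u x) :
    S.SM (fun x => max (v x) (u x)) b := by
  have hm : ∀ᶠ x in 𝓝 b, ContinuousAt (fun x => Max.max (v x) (u x)) x := by
    filter_upwards [hc, hc'] with x h1 h2 using h1.max h2
  rcases le_total (v b) (u b) with hh | hh
  · exact SM.mono S h' hc' hm (Eventually.of_forall fun x => le_max_right _ _) (max_eq_right hh)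
  · exact SM.mono S h hc hm (Eventually.of_forall fun x => le_max_left _ _) (max_eq_left hh)

lemma circleAverage_eq_max {f : ℂ → ℝ} {r m : ℝ} (hr : 0 < r) (hf : ContinuousOn f (sphere 0 r))
    (hle : ∀ z ∈ sphere (0 : ℂ) r, f z ≤ m) (hav : m ≤ Real.circleAverage f 0 r) :
    ∀ z ∈ sphere (0 : ℂ) r, f z = m := by
  by_contra hcon
  push Not at hcon
  obtain ⟨z, hz, hne⟩ := hcon
  have hlt := lt_of_le_of_ne (hle z hz) hne
  have him : z ∈ circleMap 0 r '' Ioc 0 (2 * π) := by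
    rw [image_circleMap_Ioc, abs_of_pos hr]; exact hz
  obtain ⟨θ, hθ, hθz⟩ := him
  have hmem : ∀ θ, circleMap 0 r θ ∈ sphere (0 : ℂ) r := fun θ => circleMap_mem_sphere 0 hr.le θ
  have hcont : Continuous fun θ => f (circleMap 0 r θ) :=
    hf.comp_continuous (continuous_circleMap 0 r) hmem
  have := intervalIntegral.integral_lt_integral_of_continuousOn_of_le_of_exists_lt
    (a := 0) (b := 2 * π) (f := fun θ => f (circleMap 0 r θ)) (g := fun _ => m) (by positivity)
    hcont.continuousOn continuousOn_const (fun θ _ => hle _ (hmem θ))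
    ⟨θ, Ioc_subset_Icc_self hθ, by rw [hθz]; exact hlt⟩
  rw [intervalIntegral.integral_const, sub_zero, smul_eq_mul] at this
  rw [Real.circleAverage_def, smul_eq_mul] at hav
  have hp : 0 < 2 * π := by positivity
  have h3 := mul_lt_mul_of_pos_left this (inv_pos.2 hp)
  rw [← mul_assoc, inv_mul_cancel₀ hp.ne', one_mul] at h3
  linarith

/-- Maximum principle. -/
lemma maxP [T2Space X] [PreconnectedSpace X] (hX : ¬ CompactSpace X) {K U : Set X}
    (hK : IsCompact K) (hU : IsOpen U) (hUK : U ⊆ K) {v : X → ℝ} {M : ℝ} (hv : ContinuousOn v K)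
    (hsm : ∀ x ∈ U, S.SM v x) (hb : ∀ x ∈ K, x ∉ U → v x ≤ M) : ∀ x ∈ K, v x ≤ M := by
  intro x hx
  by_contra hlt
  push Not at hlt
  obtain ⟨x0, hx0, hmax⟩ := hK.exists_isMaxOn ⟨x, hx⟩ hv
  have hm : M < v x0 := hlt.trans_le (hmax hx)
  have hclopen : IsClopen {y | y ∈ K ∧ v y = v x0} := by
    constructor
    · have : {y | y ∈ K ∧ v y = v x0} = K ∩ v ⁻¹' {v x0} := by ext; simp
      rw [this]
      exact hv.preimage_isClosed_of_isClosed hK.isClosed isClosed_singleton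
    · rw [isOpen_iff_mem_nhds]
      rintro y ⟨hyK, hy⟩
      have hyU : y ∈ U := by
        by_contra h
        have := hb y hyK h
        linarith
      have hcat : ∀ᶠ z in 𝓝 y, z ∈ U ∧ ContinuousAt v z := by
        filter_upwards [hU.mem_nhds hyU] with z hz
        exact ⟨hz, hv.continuousAt (mem_of_superset (hU.mem_nhds hz) hUK)⟩
      obtain ⟨r1, p1, -, c1, -⟩ := S.circInt (hcat.mono fun z hz => hz.2)
      obtain ⟨r0, p0, h0⟩ := hsm y hyU
      have hU' : ∀ᶠ z in 𝓝 (0 : ℂ), S.c y z ∈ U := S.ev0_iff.1 (hcat.mono fun z hz => hz.1)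
      obtain ⟨r2, p2, h2⟩ := eventually_nhds_iff_ball.1 hU'
      change ∀ᶠ z in 𝓝 y, z ∈ K ∧ v z = v x0
      rw [S.ev0_iff]
      filter_upwards [ball_mem_nhds (0 : ℂ) (show 0 < min (min r0 r1) r2 by positivity)] with z hz
      rw [mem_ball_zero_iff] at hz
      simp only [lt_min_iff] at hz
      refine ⟨hUK (h2 z (mem_ball_zero_iff.2 hz.2)), ?_⟩
      by_cases hz0 : z = 0
      · rw [hz0, S.zero, hy]
      have hzp : 0 < ‖z‖ := norm_pos_iff.2 hz0
      refine circleAverage_eq_max (f := fun z => v (S.c y z)) hzp ?_ ?_ ?_ z (by simp)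
      · intro w hw
        apply (c1 w _).continuousWithinAt
        rw [mem_ball_zero_iff, mem_sphere_zero_iff_norm.1 hw]; exact hz.1.2
      · intro w hw
        apply hmax
        apply hUK
        apply h2
        rw [mem_ball_zero_iff, mem_sphere_zero_iff_norm.1 hw]; exact hz.2
      · rw [← hy]; exact h0 _ hzp hz.1.1
  have huniv := hclopen.eq_univ ⟨x0, hx0, rfl⟩
  apply hX
  refine ⟨?_⟩
  have : K = univ := by
    apply eq_univ_of_univ_subset
    rw [← huniv]
    exact fun y hy => hy.1
  rwa [← this]

lemma isCompact_im {a : X} {A : Set ℂ} (hA : IsCompact A) (h : A ⊆ ball 0 3) :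
    IsCompact (S.c a '' A) := hA.image_of_continuousOn ((S.cont a).mono h)

lemma mem_im {a : X} {A : Set ℂ} (h : A ⊆ ball 0 3) {z : ℂ} (hz : z ∈ ball (0 : ℂ) 3) :
    S.c a z ∈ S.c a '' A ↔ z ∈ A := by
  constructor
  · rintro ⟨w, hw, he⟩
    rwa [← S.inj a (h hw) hz he]
  · intro hz'; exact ⟨z, hz', rfl⟩

end RS
end Suz
set_option linter.unusedSectionVars false

namespace Suz
namespace RS
open Complex Metric Set Filter Topology Real InnerProductSpace
variable {X : Type*} [TopologicalSpace X] (S : RS X)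

/-- closed exterior of the unit chart disc -/
def Y (a : X) : Set X := (S.c a '' ball 0 1)ᶜ
def Yo (a : X) : Set X := (S.c a '' closedBall 0 1)ᶜ

/-- Perron family for the exterior problem. -/
structure Fam (a : X) (φ : sphere (0 : ℂ) 1 → ℝ) (v : X → ℝ) : Prop where
  cont : ContinuousOn v (S.Y a)
  sm : ∀ x ∈ S.Yo a, S.SM v x
  bd : ∀ ζ : sphere (0 : ℂ) 1, v (S.c a ζ) ≤ φ ζ
  le : ∀ M, (∀ ζ, φ ζ ≤ M) → ∀ x ∈ S.Y a, v x ≤ M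

/-- Perron solution -/
noncomputable def BB (a : X) (φ : sphere (0 : ℂ) 1 → ℝ) (x : X) : ℝ :=
  sSup {t | ∃ v, S.Fam a φ v ∧ t = v x}

lemma Yo_sub (a : X) : S.Yo a ⊆ S.Y a :=
  compl_subset_compl.2 (image_mono ball_subset_closedBall)

lemma Yo_open [T2Space X] (a : X) : IsOpen (S.Yo a) :=
  (S.isCompact_im (isCompact_closedBall 0 1) (closedBall_subset_ball (by norm_num))).isClosed.isOpen_compl

lemma Y_closed (a : X) : IsClosed (S.Y a) :=
  (S.opn a _ (ball_subset_ball (by norm_num)) isOpen_ball).isClosed_compl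

lemma mem_Y {a : X} {z : ℂ} (hz : z ∈ ball (0 : ℂ) 3) : S.c a z ∈ S.Y a ↔ 1 ≤ ‖z‖ := by
  rw [Y, mem_compl_iff, S.mem_im (ball_subset_ball (by norm_num)) hz, mem_ball_zero_iff, not_lt]

lemma mem_Yo {a : X} {z : ℂ} (hz : z ∈ ball (0 : ℂ) 3) : S.c a z ∈ S.Yo a ↔ 1 < ‖z‖ := by
  rw [Yo, mem_compl_iff, S.mem_im (closedBall_subset_ball (by norm_num)) hz,
    mem_closedBall_zero_iff, not_le]

lemma Fam.contAt [T2Space X] {a : X} {φ : sphere (0 : ℂ) 1 → ℝ} {v : X → ℝ} (h : S.Fam a φ v)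
    {x : X} (hx : x ∈ S.Yo a) : ∀ᶠ y in 𝓝 x, ContinuousAt v y := by
  filter_upwards [(S.Yo_open a).mem_nhds hx] with y hy
  exact h.cont.continuousAt (mem_of_superset ((S.Yo_open a).mem_nhds hy) (S.Yo_sub a))

lemma Fam.const {a : X} {φ : sphere (0 : ℂ) 1 → ℝ} {m : ℝ} (hm : ∀ ζ, m ≤ φ ζ) :
    S.Fam a φ (fun _ => m) :=
  ⟨continuousOn_const, fun x _ => HmX.sm S (Hm.const m 0), hm,
    fun M hM _ _ => (hm ⟨1, by simp⟩).trans (hM _)⟩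

lemma Fam.max [T2Space X] {a : X} {φ : sphere (0 : ℂ) 1 → ℝ} {v u : X → ℝ} (h : S.Fam a φ v)
    (h' : S.Fam a φ u) : S.Fam a φ (fun x => max (v x) (u x)) :=
  ⟨ContinuousOn.sup h.cont h'.cont, fun x hx => SM.max S (h.sm x hx) (h'.sm x hx) (Fam.contAt S h hx)
    (Fam.contAt S h' hx), fun ζ => max_le (h.bd ζ) (h'.bd ζ),
    fun M hM x hx => max_le (h.le M hM x hx) (h'.le M hM x hx)⟩

lemma Fam.shift [T2Space X] {a : X} {φ ψ : sphere (0 : ℂ) 1 → ℝ} {v : X → ℝ} (h : S.Fam a φ v)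
    {k : ℝ} (hk : ∀ ζ, φ ζ ≤ ψ ζ + k) : S.Fam a ψ (fun x => v x - k) := by
  refine ⟨h.cont.sub continuousOn_const, fun x hx => SM.sub_const S (h.sm x hx) (Fam.contAt S h hx) k,
    fun ζ => ?_, fun M hM x hx => ?_⟩
  · linarith [h.bd ζ, hk ζ]
  · have := h.le (M + k) (fun ζ => (hk ζ).trans (by linarith [hM ζ])) x hx
    linarith

section
variable [T2Space X] {a : X} {φ ψ : sphere (0 : ℂ) 1 → ℝ}

lemma exM (hφ : Continuous φ) : ∃ M, 0 ≤ M ∧ ∀ ζ, |φ ζ| ≤ M := by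
  obtain ⟨M, hM⟩ := isCompact_univ.exists_bound_of_continuousOn (f := φ) hφ.continuousOn
  exact ⟨|M|, abs_nonneg _, fun ζ => (hM ζ trivial).trans (le_abs_self _)⟩

lemma le_BB (hφ : Continuous φ) {v : X → ℝ} (h : S.Fam a φ v) {x : X} (hx : x ∈ S.Y a) :
    v x ≤ S.BB a φ x := by
  obtain ⟨M, -, hM⟩ := exM hφ
  apply le_csSup
  · refine ⟨M, ?_⟩
    rintro t ⟨v, hv, rfl⟩
    exact hv.le M (fun ζ => (le_abs_self _).trans (hM ζ)) x hx
  · exact ⟨v, h, rfl⟩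

lemma BB_nonempty (hφ : Continuous φ) (x : X) : {t | ∃ v, S.Fam a φ v ∧ t = v x}.Nonempty := by
  obtain ⟨M, -, hM⟩ := exM hφ
  exact ⟨-M, _, Fam.const S (a := a) (m := -M) (fun ζ => (abs_le.1 (hM ζ)).1), rfl⟩

lemma BB_le (hφ : Continuous φ) {x : X} {M : ℝ} (h : ∀ v, S.Fam a φ v → v x ≤ M) :
    S.BB a φ x ≤ M := by
  apply csSup_le (S.BB_nonempty hφ x)
  rintro t ⟨v, hv, rfl⟩
  exact h v hv

lemma BB_shift (hφ : Continuous φ) (hψ : Continuous ψ) {k : ℝ} (hk : ∀ ζ, φ ζ ≤ ψ ζ + k) {x : X}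
    (hx : x ∈ S.Y a) : S.BB a φ x ≤ S.BB a ψ x + k := by
  apply S.BB_le hφ
  intro v hv
  have := S.le_BB hψ (Fam.shift S hv hk) hx
  linarith

lemma BB_bd (hφ : Continuous φ) {M : ℝ} (hM : ∀ ζ, |φ ζ| ≤ M) {x : X}
    (hx : x ∈ S.Y a) : |S.BB a φ x| ≤ M := by
  rw [abs_le]
  constructor
  · exact S.le_BB hφ (Fam.const S (a := a) (m := -M) (fun ζ => (abs_le.1 (hM ζ)).1)) hx
  · apply S.BB_le hφ
    intro v hv
    exact hv.le M (fun ζ => (abs_le.1 (hM ζ)).2) x hx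

/-- Poisson modification. -/
lemma pmod [PreconnectedSpace X] (hX : ¬ CompactSpace X) {v : X → ℝ} (hv : S.Fam a φ v) {b : X}
    {ρ : ℝ} (hρ : 0 < ρ) (hρ3 : ρ < 3) (hsub : S.c b '' closedBall 0 ρ ⊆ S.Yo a) :
    ∃ v', S.Fam a φ v' ∧ (∀ x ∈ S.Y a, v x ≤ v' x) ∧
      ∀ w ∈ ball (0 : ℂ) ρ, v' (S.c b w) = PI ρ (fun z => v (S.c b z)) w := by
  classical
  have hB3 : closedBall (0 : ℂ) ρ ⊆ ball 0 3 := closedBall_subset_ball hρ3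
  have hb3 : ball (0 : ℂ) ρ ⊆ ball 0 3 := ball_subset_ball hρ3.le
  have hs3 : sphere (0 : ℂ) ρ ⊆ ball 0 3 := sphere_subset_closedBall.trans hB3
  set g : ℂ → ℝ := fun z => v (S.c b z) with hg
  have hgc : ContinuousOn g (closedBall 0 ρ) := by
    refine hv.cont.comp ((S.cont b).mono hB3) ?_
    intro z hz
    exact S.Yo_sub a (hsub ⟨z, hz, rfl⟩)
  have hgs : ContinuousOn g (sphere 0 ρ) := hgc.mono sphere_subset_closedBall
  set v' : X → ℝ := fun x => if x ∈ S.c b '' ball 0 ρ then PI ρ g (S.iv b x) else v x with hv'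
  have hin : ∀ w ∈ ball (0 : ℂ) ρ, v' (S.c b w) = PI ρ g w := by
    intro w hw
    have : S.c b w ∈ S.c b '' ball 0 ρ := ⟨w, hw, rfl⟩
    simp only [hv', if_pos this, S.iv_c (hb3 hw)]
  have hin2 : ∀ w ∈ closedBall (0 : ℂ) ρ, v' (S.c b w) = DP ρ g w := by
    intro w hw
    by_cases hw' : ‖w‖ < ρ
    · rw [hin w (mem_ball_zero_iff.2 hw'), DP, if_pos hw']
    · have : S.c b w ∉ S.c b '' ball 0 ρ := by
        rw [S.mem_im hb3 (hB3 hw), mem_ball_zero_iff]; exact hw'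
      simp only [hv', if_neg this, DP, if_neg hw', hg]
  have hout : ∀ x, x ∉ S.c b '' ball 0 ρ → v' x = v x := by
    intro x hx
    simp only [hv', if_neg hx]
  have hopen : IsOpen (S.c b '' ball 0 ρ) := S.opn b _ hb3 isOpen_ball
  have hcl : IsCompact (S.c b '' closedBall 0 ρ) := S.isCompact_im (isCompact_closedBall _ _) hB3
  have hc1 : ContinuousOn v' (S.c b '' closedBall 0 ρ) := by
    apply S.contOn_image hB3
    exact (DP_cont hρ hgs).congr hin2
  have hc2 : ContinuousOn v' (S.Y a ∩ (S.c b '' ball 0 ρ)ᶜ) :=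
    (hv.cont.mono inter_subset_left).congr fun x hx => hout x hx.2
  have hc : ContinuousOn v' (S.Y a) := by
    have hu := hc1.union_of_isClosed hc2 hcl.isClosed ((S.Y_closed a).inter hopen.isClosed_compl)
    apply hu.mono
    intro x hx
    by_cases h : x ∈ S.c b '' ball 0 ρ
    · exact Or.inl (image_mono ball_subset_closedBall h)
    · exact Or.inr ⟨hx, h⟩
  have hharm : ∀ x ∈ S.c b '' ball 0 ρ, S.HmX v' x := by
    rintro _ ⟨w, hw, rfl⟩
    rw [S.hmX_iff (hb3 hw)]
    refine (PI_hm hρ hgs hw).congr ?_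
    filter_upwards [isOpen_ball.mem_nhds hw] with z hz
    exact (hin z hz).symm
  have hle0 : ∀ x ∈ S.c b '' closedBall 0 ρ, v x - v' x ≤ 0 := by
    refine S.maxP hX hcl hopen (image_mono ball_subset_closedBall) (v := fun x => v x - v' x)
      ((hv.cont.mono (hsub.trans (S.Yo_sub a))).sub hc1) ?_ ?_
    · intro x hx
      have hxY := hsub (image_mono ball_subset_closedBall hx)
      exact SM.sub S (hv.sm x hxY) (Fam.contAt S hv hxY) (hharm x hx)
    · intro x _ hx
      rw [hout x hx, sub_self]
  have hle : ∀ x, v x ≤ v' x := by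
    intro x
    by_cases h : x ∈ S.c b '' ball 0 ρ
    · linarith [hle0 x (image_mono ball_subset_closedBall h)]
    · rw [hout x h]
  have hcat : ∀ x ∈ S.Yo a, ∀ᶠ y in 𝓝 x, ContinuousAt v' y := by
    intro x hx
    filter_upwards [(S.Yo_open a).mem_nhds hx] with y hy
    exact hc.continuousAt (mem_of_superset ((S.Yo_open a).mem_nhds hy) (S.Yo_sub a))
  refine ⟨v', ⟨hc, ?_, ?_, ?_⟩, fun x _ => hle x, hin⟩
  · intro x hx
    by_cases h : x ∈ S.c b '' ball 0 ρ
    · exact HmX.sm S (hharm x h)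
    · exact SM.mono S (hv.sm x hx) (Fam.contAt S hv hx) (hcat x hx)
        (Eventually.of_forall hle) (hout x h)
  · intro ζ
    rw [hout]
    · exact hv.bd ζ
    · intro h
      have h1 := hsub (image_mono ball_subset_closedBall h)
      have hζ : ‖(ζ : ℂ)‖ = 1 := by simp
      rw [S.mem_Yo (by rw [mem_ball_zero_iff, hζ]; norm_num), hζ] at h1
      exact lt_irrefl _ h1
  · intro M hM x hx
    by_cases h : x ∈ S.c b '' ball 0 ρ
    · obtain ⟨w, hw, rfl⟩ := h
      rw [hin w hw, ← PI_const M hw]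
      apply PI_mono hρ hgs continuousOn_const _ hw
      intro ζ hζ
      exact hv.le M hM _ (S.Yo_sub a (hsub ⟨ζ, sphere_subset_closedBall hζ, rfl⟩))
    · rw [hout x h]; exact hv.le M hM x hx

lemma BB_hm [PreconnectedSpace X] (hX : ¬ CompactSpace X) (hφ : Continuous φ) {b : X}
    (hb : b ∈ S.Yo a) : S.HmX (S.BB a φ) b := by
  have hev : ∀ᶠ z in 𝓝 (0 : ℂ), S.c b z ∈ S.Yo a := S.ev0_iff.1 ((S.Yo_open a).mem_nhds hb)
  obtain ⟨r, hr, hr'⟩ := eventually_nhds_iff_ball.1 hev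
  set ρ := min r 2 / 2 with hρd
  have hρ : 0 < ρ := by positivity
  have hρr : ρ < r := by have := min_le_left r 2; rw [hρd]; linarith [lt_min hr (zero_lt_two' ℝ)]
  have hρ3 : ρ < 3 := by have := min_le_right r 2; rw [hρd]; linarith
  have hsub : S.c b '' closedBall 0 ρ ⊆ S.Yo a := by
    rintro _ ⟨z, hz, rfl⟩
    exact hr' z (closedBall_subset_ball hρr hz)
  have hB3 : closedBall (0 : ℂ) ρ ⊆ ball 0 3 := closedBall_subset_ball hρ3
  have hgs : ∀ v, S.Fam a φ v → ContinuousOn (fun z => v (S.c b z)) (sphere 0 ρ) := by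
    intro v hv
    refine hv.cont.comp ((S.cont b).mono (sphere_subset_closedBall.trans hB3)) ?_
    intro z hz
    exact S.Yo_sub a (hsub ⟨z, sphere_subset_closedBall hz, rfl⟩)
  set h : (X → ℝ) → ℂ → ℝ := fun v => PI ρ (fun z => v (S.c b z)) with hh
  have hY : ∀ w ∈ ball (0 : ℂ) ρ, S.c b w ∈ S.Y a :=
    fun w hw => S.Yo_sub a (hsub ⟨w, ball_subset_closedBall hw, rfl⟩)
  have f1 : ∀ v, S.Fam a φ v → ∀ w ∈ ball (0 : ℂ) ρ,
      v (S.c b w) ≤ h v w ∧ h v w ≤ S.BB a φ (S.c b w) := by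
    intro v hv w hw
    obtain ⟨v', hv', hle, hin⟩ := S.pmod hX hv hρ hρ3 hsub
    have := hin w hw
    simp only [hh]
    rw [← this]
    exact ⟨hle _ (hY w hw), S.le_BB hφ hv' (hY w hw)⟩
  set U : ℂ → ℝ := fun w => S.BB a φ (S.c b w) with hU
  have hseq : ∀ n : ℕ, ∃ v, S.Fam a φ v ∧ U 0 - 1 / (n + 1 : ℝ) < v b := by
    intro n
    have hlt : U 0 - 1 / (n + 1 : ℝ) < S.BB a φ b := by
      simp only [hU, S.zero]
      have : (0 : ℝ) < 1 / (n + 1 : ℝ) := by positivity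
      linarith
    obtain ⟨t, ⟨v, hv, rfl⟩, ht⟩ := exists_lt_of_lt_csSup (S.BB_nonempty hφ b) hlt
    exact ⟨v, hv, ht⟩
  choose V hV hVb using hseq
  have h0ρ : (0 : ℂ) ∈ ball (0 : ℂ) ρ := mem_ball_self hρ
  have est : ∀ n, ∀ w ∈ closedBall (0 : ℂ) (ρ / 2), |U w - h (V n) w| ≤ 3 * (1 / (n + 1 : ℝ)) := by
    intro n w hw
    have hw' : ‖w‖ ≤ ρ / 2 := mem_closedBall_zero_iff.1 hw
    have hwb : w ∈ ball (0 : ℂ) ρ := by rw [mem_ball_zero_iff]; linarith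
    have a1 := (f1 (V n) (hV n) w hwb).2
    rw [abs_of_nonneg (sub_nonneg.2 a1)]
    have : U w ≤ h (V n) w + 3 * (1 / (n + 1 : ℝ)) := by
      apply S.BB_le hφ
      intro v hv
      have hm := Fam.max S hv (hV n)
      have a2 := (f1 _ hm w hwb).1
      have a3 := (f1 _ hm 0 h0ρ).2
      have a4 := (f1 _ (hV n) 0 h0ρ).1
      have a5 := (PI_harnack hρ (hgs _ (hV n)) (hgs _ hm) (fun ζ _ => le_max_right _ _) hw').1
      have a6 := le_max_left (v (S.c b w)) (V n (S.c b w))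
      have a7 := hVb n
      simp only [hU, hh, S.zero] at a1 a2 a3 a4 a5 a6 a7 ⊢
      linarith
    linarith
  have hlim0 : Tendsto (fun n : ℕ => 3 * (1 / (n + 1 : ℝ))) atTop (𝓝 0) := by
    simpa using (tendsto_one_div_add_atTop_nhds_zero_nat (𝕜 := ℝ)).const_mul 3
  have hsm : closedBall (0 : ℂ) (ρ / 2) ⊆ ball 0 ρ := closedBall_subset_ball (by linarith)
  have hhc : ∀ n, ContinuousOn (h (V n)) (closedBall 0 (ρ / 2)) := by
    intro n z hz
    exact (PI_hm hρ (hgs _ (hV n)) (hsm hz)).continuousAt.continuousWithinAt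
  have hUc : ContinuousOn U (closedBall 0 (ρ / 2)) := by
    have : TendstoUniformlyOn (fun n => h (V n)) U atTop (closedBall 0 (ρ / 2)) := by
      rw [Metric.tendstoUniformlyOn_iff]
      intro ε hε
      filter_upwards [hlim0.eventually (gt_mem_nhds hε)] with n hn w hw
      rw [Real.dist_eq]
      exact (est n w hw).trans_lt hn
    exact this.continuousOn (Frequently.of_forall hhc)
  have hρ2 : 0 < ρ / 2 := by positivity
  have hUs : ContinuousOn U (sphere 0 (ρ / 2)) := hUc.mono sphere_subset_closedBall
  have key : ∀ w ∈ ball (0 : ℂ) (ρ / 2), U w = PI (ρ / 2) U w := by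
    intro w hw
    have e1 : ∀ n : ℕ, |U w - PI (ρ / 2) U w| ≤ 2 * (3 * (1 / (n + 1 : ℝ))) := by
      intro n
      have hs := (hhc n).mono (sphere_subset_closedBall (x := (0 : ℂ)))
      have r1 : PI (ρ / 2) (h (V n)) w = h (V n) w :=
        PI_repr (hhc n) (fun z hz => PI_hm hρ (hgs _ (hV n)) (hsm (ball_subset_closedBall hz))) hw
      have b1 := abs_le.1 (est n w (ball_subset_closedBall hw))
      have b2 : PI (ρ / 2) (fun z => U z - h (V n) z) w ≤ 3 * (1 / (n + 1 : ℝ)) := by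
        rw [← PI_const (3 * (1 / (n + 1 : ℝ))) hw]
        exact PI_mono hρ2 (hUs.sub hs) continuousOn_const
          (fun ζ hζ => (abs_le.1 (est n ζ (sphere_subset_closedBall hζ))).2) hw
      have b3 : -(3 * (1 / (n + 1 : ℝ))) ≤ PI (ρ / 2) (fun z => U z - h (V n) z) w := by
        rw [← PI_const (-(3 * (1 / (n + 1 : ℝ)))) hw]
        exact PI_mono hρ2 continuousOn_const (hUs.sub hs)
          (fun ζ hζ => (abs_le.1 (est n ζ (sphere_subset_closedBall hζ))).1) hw
      rw [PI_sub hρ2 hUs hs hw, r1] at b2 b3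
      rw [abs_le]
      constructor <;> linarith
    have l2 : Tendsto (fun n : ℕ => 2 * (3 * (1 / (n + 1 : ℝ)))) atTop (𝓝 0) := by
      simpa using hlim0.const_mul 2
    have := ge_of_tendsto' l2 e1
    have h0 := abs_nonpos_iff.1 this
    linarith
  refine (PI_hm hρ2 hUs (mem_ball_self hρ2)).congr ?_
  filter_upwards [ball_mem_nhds (0 : ℂ) hρ2] with w hw
  exact (key w hw).symm

end
end RS
end Suz

namespace Suz
namespace RS
open Complex Metric Set Filter Topology Real InnerProductSpace
variable {X : Type*} [TopologicalSpace X] (S : RS X)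

/-- closed annulus -/
def Ann : Set ℂ := {z | 1 ≤ ‖z‖ ∧ ‖z‖ ≤ 2}
/-- open annulus -/
def AnnO : Set ℂ := {z | 1 < ‖z‖ ∧ ‖z‖ < 2}

lemma Ann_sub : Ann ⊆ ball 0 3 := fun z hz => by
  rw [mem_ball_zero_iff]; linarith [hz.2]
lemma AnnO_sub : AnnO ⊆ Ann := fun _ hz => ⟨hz.1.le, hz.2.le⟩
lemma Ann_compact : IsCompact Ann := by
  apply (isCompact_closedBall (0 : ℂ) 2).of_isClosed_subset
  · exact (isClosed_le continuous_const continuous_norm).inter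
      (isClosed_le continuous_norm continuous_const)
  · intro z hz
    exact mem_closedBall_zero_iff.2 hz.2
lemma AnnO_open : IsOpen AnnO :=
  (isOpen_lt continuous_const continuous_norm).inter (isOpen_lt continuous_norm continuous_const)

section
variable [T2Space X] [PreconnectedSpace X] {a : X}

/-- maximum principle in the annulus, for functions of the form `v ∘ c a - h` -/
lemma ann_le (hX : ¬ CompactSpace X) {v : X → ℝ} {h : ℂ → ℝ}
    (hv : ContinuousOn v (S.c a '' Ann)) (hsm : ∀ x ∈ S.c a '' AnnO, S.SM v x)
    (hh : ContinuousOn h Ann) (hH : ∀ z ∈ AnnO, Hm h z)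
    (hb : ∀ z, ‖z‖ = 1 ∨ ‖z‖ = 2 → v (S.c a z) ≤ h z) : ∀ z ∈ Ann, v (S.c a z) ≤ h z := by
  intro z hz
  have hO : IsOpen (S.c a '' AnnO) := S.opn a _ (AnnO_sub.trans Ann_sub) AnnO_open
  have hharm : ∀ x ∈ S.c a '' AnnO, S.HmX (fun x => h (S.iv a x)) x := by
    rintro _ ⟨w, hw, rfl⟩
    rw [S.hmX_iff (Ann_sub (AnnO_sub hw))]
    refine (hH w hw).congr ?_
    filter_upwards [AnnO_open.mem_nhds hw] with y hy
    rw [S.iv_c (Ann_sub (AnnO_sub hy))]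
  have := S.maxP hX (S.isCompact_im Ann_compact Ann_sub) hO (image_mono AnnO_sub)
    (v := fun x => v x - h (S.iv a x)) (M := 0) (hv.sub ?_) ?_ ?_ (S.c a z) ⟨z, hz, rfl⟩
  · simp only [S.iv_c (Ann_sub hz)] at this
    linarith
  · apply S.contOn_image Ann_sub
    refine hh.congr fun y hy => ?_
    rw [S.iv_c (Ann_sub hy)]
  · intro x hx
    refine SM.sub S (hsm x hx) ?_ (hharm x hx)
    filter_upwards [hO.mem_nhds hx] with y hy
    exact hv.continuousAt (mem_of_superset (hO.mem_nhds hy) (image_mono AnnO_sub))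
  · rintro _ ⟨w, hw, rfl⟩ hx
    rw [S.mem_im (AnnO_sub.trans Ann_sub) (Ann_sub hw)] at hx
    have : ‖w‖ = 1 ∨ ‖w‖ = 2 := by
      by_contra hcon
      push Not at hcon
      exact hx ⟨lt_of_le_of_ne hw.1 (Ne.symm hcon.1), lt_of_le_of_ne hw.2 hcon.2⟩
    have := hb w this
    simp only [S.iv_c (Ann_sub hw)]
    linarith

lemma ann_zero (S : RS X) (hX : ¬ CompactSpace X) (a : X) {f : ℂ → ℝ} (hf : ContinuousOn f Ann)
    (hH : ∀ z ∈ AnnO, Hm f z) (hb : ∀ z, ‖z‖ = 1 ∨ ‖z‖ = 2 → f z = 0) : ∀ z ∈ Ann, f z = 0 := by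
  intro z hz
  have h1 := S.ann_le (a := a) hX (v := fun _ => 0) (h := f) continuousOn_const
    (fun x _ => HmX.sm S (Hm.const 0 0)) hf hH (fun z hz => (hb z hz).ge) z hz
  have h2 := S.ann_le (a := a) hX (v := fun _ => 0) (h := fun z => -1 * f z) continuousOn_const
    (fun x _ => HmX.sm S (Hm.const 0 0)) (continuousOn_const.mul hf)
    (fun z hz => (hH z hz).mul_const _) (fun z hz => by rw [hb z hz]; simp) z hz
  linarith

variable {φ : sphere (0 : ℂ) 1 → ℝ}

lemma BB_est (hX : ¬ CompactSpace X) (hφ : Continuous φ) (b : sphere (0 : ℂ) 1) {ε : ℝ}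
    (hε : 0 < ε) : ∃ K : ℝ, ∀ z ∈ Ann,
      |S.BB a φ (S.c a z) - φ b| ≤ ε + K * Real.log ‖2 * z - b‖ := by
  obtain ⟨M, hM0, hM⟩ := exM hφ
  obtain ⟨δ', hδ', hd⟩ := Metric.continuousAt_iff.1 (hφ.continuousAt (x := b)) ε hε
  set δ := min δ' 1 with hδd
  have hδ : 0 < δ := by positivity
  have hbn : ‖(b : ℂ)‖ = 1 := by simp
  -- barrier
  have hw : ∀ z : ℂ, 1 ≤ ‖z‖ → 1 + 2 * ‖z - b‖ ^ 2 ≤ ‖2 * z - b‖ ^ 2 := by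
    intro z hz
    have hp := parallelogram_law_with_norm ℝ (z - (b : ℂ)) z
    have e1 : z - (b : ℂ) + z = 2 * z - b := by ring
    have e2 : z - (b : ℂ) - z = -b := by ring
    rw [e1, e2, norm_neg, hbn] at hp
    nlinarith
  have hw1 : ∀ z : ℂ, 1 ≤ ‖z‖ → 1 ≤ ‖2 * z - b‖ := by
    intro z hz
    have := hw z hz
    nlinarith [sq_nonneg ‖z - b‖, norm_nonneg (2 * z - b)]
  have hL0 : ∀ z : ℂ, 1 ≤ ‖z‖ → 0 ≤ Real.log ‖2 * z - b‖ := fun z hz => Real.log_nonneg (hw1 z hz)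
  set η := Real.log (1 + 2 * δ ^ 2) / 2 with hη
  have hη0 : 0 < η := by
    have : 0 < Real.log (1 + 2 * δ ^ 2) := Real.log_pos (by nlinarith)
    positivity
  have hL1 : ∀ z : ℂ, 1 ≤ ‖z‖ → δ ≤ ‖z - b‖ → η ≤ Real.log ‖2 * z - b‖ := by
    intro z hz hzb
    have h1 : Real.log (1 + 2 * δ ^ 2) ≤ Real.log (‖2 * z - b‖ ^ 2) := by
      apply Real.log_le_log (by positivity)
      refine le_trans ?_ (hw z hz)
      nlinarith
    rw [Real.log_pow] at h1
    push_cast at h1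
    rw [hη]; linarith
  set K := 2 * M / η with hK
  have hK0 : 0 ≤ K := by positivity
  have hKη : ∀ z : ℂ, 1 ≤ ‖z‖ → δ ≤ ‖z - b‖ → 2 * M ≤ K * Real.log ‖2 * z - b‖ := by
    intro z hz hzb
    have := mul_le_mul_of_nonneg_left (hL1 z hz hzb) hK0
    rw [hK, div_mul_cancel₀ _ hη0.ne'] at this
    exact this
  have h2δ : ∀ z : ℂ, ‖z‖ = 2 → δ ≤ ‖z - b‖ := by
    intro z hz
    have := norm_sub_norm_le z (b : ℂ)
    rw [hz, hbn] at this
    exact (min_le_right _ _).trans (by linarith)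
  have hsph : ∀ ζ : sphere (0 : ℂ) 1, |φ ζ - φ b| ≤ ε + K * Real.log ‖2 * (ζ : ℂ) - b‖ := by
    intro ζ
    have hζn : ‖(ζ : ℂ)‖ = 1 := by simp
    by_cases h : δ ≤ ‖(ζ : ℂ) - b‖
    · have h1 := hKη ζ hζn.ge h
      have h2 := abs_sub (φ ζ) (φ b)
      linarith [hM ζ, hM b]
    · push Not at h
      have : dist ζ b < δ' := by
        rw [Subtype.dist_eq, dist_eq_norm]; exact h.trans_le (min_le_left _ _)
      have h1 := hd this
      rw [Real.dist_eq] at h1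
      have h2 := mul_nonneg hK0 (hL0 ζ hζn.ge)
      linarith
  have hcl : ContinuousOn (fun z : ℂ => Real.log ‖2 * z - b‖) Ann := by
    apply ContinuousOn.log (by fun_prop)
    intro z hz
    have := hw1 z hz.1
    linarith
  have hHl : ∀ z : ℂ, 1 ≤ ‖z‖ → Hm (fun z : ℂ => Real.log ‖2 * z - b‖) z := by
    intro z hz
    apply Hm.log (by fun_prop)
    intro h0
    have := hw1 z hz
    rw [h0, norm_zero] at this
    linarith
  have hAY : S.c a '' Ann ⊆ S.Y a := by
    rintro _ ⟨z, hz, rfl⟩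
    exact (S.mem_Y (Ann_sub hz)).2 hz.1
  have hAYo : S.c a '' AnnO ⊆ S.Yo a := by
    rintro _ ⟨z, hz, rfl⟩
    exact (S.mem_Yo (Ann_sub (AnnO_sub hz))).2 hz.1
  have hφM : ∀ ζ, φ ζ ≤ M := fun ζ => (abs_le.1 (hM ζ)).2
  have hφm : ∀ ζ, -M ≤ φ ζ := fun ζ => (abs_le.1 (hM ζ)).1
  refine ⟨K, fun z hz => ?_⟩
  rw [abs_le]
  constructor
  · -- lower bound
    classical
    set l : ℂ → ℝ := fun z => φ b - ε - K * Real.log ‖2 * z - b‖ with hl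
    have hlc : ContinuousOn l Ann := continuousOn_const.sub (continuousOn_const.mul hcl)
    have hlH : ∀ z : ℂ, 1 ≤ ‖z‖ → Hm l z := fun z hz =>
      (Hm.const (φ b - ε) z).sub ((hHl z hz).mul_const K)
    set v0 : X → ℝ := fun x => if x ∈ S.c a '' Ann then max (l (S.iv a x)) (-M) else -M with hv0
    have hvA : ∀ z ∈ Ann, v0 (S.c a z) = max (l z) (-M) := by
      intro z hz
      have : S.c a z ∈ S.c a '' Ann := ⟨z, hz, rfl⟩
      simp only [hv0, if_pos this, S.iv_c (Ann_sub hz)]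
    have hvge : ∀ x, -M ≤ v0 x := by
      intro x
      simp only [hv0]
      split_ifs
      · exact le_max_right _ _
      · exact le_rfl
    have hl2 : ∀ z : ℂ, ‖z‖ = 2 → l z ≤ -M := by
      intro z hz
      have := hKη z (by rw [hz]; norm_num) (h2δ z hz)
      simp only [hl]
      linarith [hφM b]
    have hball : S.c a '' ball 0 2 ⊆ S.c a '' ball 0 2 := le_rfl
    have hvout : ∀ x ∈ S.Y a, x ∉ S.c a '' ball 0 2 → v0 x = -M := by
      intro x hx hx2
      by_cases h : x ∈ S.c a '' Ann
      · obtain ⟨z, hz, rfl⟩ := h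
        have : ‖z‖ = 2 := by
          apply le_antisymm hz.2
          by_contra hlt
          push Not at hlt
          exact hx2 ⟨z, mem_ball_zero_iff.2 hlt, rfl⟩
        rw [hvA z hz, max_eq_right (hl2 z this)]
      · simp only [hv0, if_neg h]
    have hb2 : IsOpen (S.c a '' ball 0 2) := S.opn a _ (ball_subset_ball (by norm_num)) isOpen_ball
    have hc : ContinuousOn v0 (S.Y a) := by
      have c1 : ContinuousOn v0 (S.c a '' Ann) := by
        apply S.contOn_image Ann_sub
        exact (ContinuousOn.sup hlc continuousOn_const).congr hvA
      have c2 : ContinuousOn v0 (S.Y a ∩ (S.c a '' ball 0 2)ᶜ) :=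
        continuousOn_const.congr fun x hx => hvout x hx.1 hx.2
      have hu := c1.union_of_isClosed c2 (S.isCompact_im Ann_compact Ann_sub).isClosed
        ((S.Y_closed a).inter hb2.isClosed_compl)
      apply hu.mono
      intro x hx
      by_cases h : x ∈ S.c a '' ball 0 2
      · obtain ⟨z, hz, rfl⟩ := h
        rw [S.mem_Y (ball_subset_ball (by norm_num) hz)] at hx
        exact Or.inl ⟨z, ⟨hx, (mem_ball_zero_iff.1 hz).le⟩, rfl⟩
      · exact Or.inr ⟨hx, h⟩
    have hcat : ∀ x ∈ S.Yo a, ∀ᶠ y in 𝓝 x, ContinuousAt v0 y := by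
      intro x hx
      filter_upwards [(S.Yo_open a).mem_nhds hx] with y hy
      exact hc.continuousAt (mem_of_superset ((S.Yo_open a).mem_nhds hy) (S.Yo_sub a))
    have hF : S.Fam a φ v0 := by
      refine ⟨hc, ?_, ?_, ?_⟩
      · intro x hx
        by_cases h : x ∈ S.c a '' ball 0 2
        · obtain ⟨z, hz, rfl⟩ := h
          have hz3 : z ∈ ball (0 : ℂ) 3 := ball_subset_ball (by norm_num) hz
          rw [S.mem_Yo hz3] at hx
          have hzO : z ∈ AnnO := ⟨hx, mem_ball_zero_iff.1 hz⟩
          have hO : IsOpen (S.c a '' AnnO) := S.opn a _ (AnnO_sub.trans Ann_sub) AnnO_open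
          have hHX : ∀ x ∈ S.c a '' AnnO, S.HmX (fun x => l (S.iv a x)) x := by
            rintro _ ⟨y, hy, rfl⟩
            rw [S.hmX_iff (Ann_sub (AnnO_sub hy))]
            refine (hlH y hy.1.le).congr ?_
            filter_upwards [AnnO_open.mem_nhds hy] with w hw
            rw [S.iv_c (Ann_sub (AnnO_sub hw))]
          have hmem : S.c a z ∈ S.c a '' AnnO := ⟨z, hzO, rfl⟩
          refine SM.congr S (SM.max S (HmX.sm S (hHX _ hmem)) (HmX.sm S (u := fun _ => -M) (Hm.const (-M) 0)) ?_
            (Eventually.of_forall fun _ => continuousAt_const)) ?_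
          · filter_upwards [hO.mem_nhds hmem] with y hy
            exact HmX.continuousAt S (hHX y hy)
          · filter_upwards [hO.mem_nhds hmem] with y hy
            obtain ⟨w, hw, rfl⟩ := hy
            rw [hvA w (AnnO_sub hw), S.iv_c (Ann_sub (AnnO_sub hw))]
        · exact SM.mono S (v := fun _ => -M) (HmX.sm S (Hm.const (-M) 0))
            (Eventually.of_forall fun _ => continuousAt_const) (hcat x hx)
            (Eventually.of_forall hvge) (hvout x (S.Yo_sub a hx) h)
      · intro ζ
        have hζn : ‖(ζ : ℂ)‖ = 1 := by simp
        rw [hvA ζ ⟨hζn.ge, by rw [hζn]; norm_num⟩]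
        apply max_le _ (hφm ζ)
        have := (abs_le.1 (hsph ζ)).1
        simp only [hl]
        linarith
      · intro M' hM' x hx
        have hmM : -M ≤ M' := (hφm b).trans (hM' b)
        simp only [hv0]
        split_ifs with h
        · obtain ⟨z, hz, rfl⟩ := h
          rw [S.iv_c (Ann_sub hz)]
          apply max_le _ hmM
          have h2 := mul_nonneg hK0 (hL0 z hz.1)
          simp only [hl]
          linarith [hM' b]
        · exact hmM
    have := S.le_BB hφ hF (hAY ⟨z, hz, rfl⟩)
    rw [hvA z hz] at this
    have h3 := le_max_left (l z) (-M)
    simp only [hl] at h3 this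
    linarith
  · -- upper bound
    have : S.BB a φ (S.c a z) ≤ φ b + ε + K * Real.log ‖2 * z - b‖ := by
      apply S.BB_le hφ
      intro v hv
      refine S.ann_le hX (h := fun z => φ b + ε + K * Real.log ‖2 * z - b‖) (hv.cont.mono hAY)
        (fun x hx => hv.sm x (hAYo hx)) (continuousOn_const.add (continuousOn_const.mul hcl))
        (fun z hz => (Hm.const _ z).add ((hHl z hz.1.le).mul_const K)) ?_ z hz
      rintro w (hw1 | hw2)
      · have h1 := hv.bd ⟨w, by simpa using hw1⟩
        have h2 := (abs_le.1 (hsph ⟨w, by simpa using hw1⟩)).2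
        simp only at h1 h2 ⊢
        linarith
      · have h1 := hv.le M hφM (S.c a w) (by rw [S.mem_Y (by rw [mem_ball_zero_iff, hw2]; norm_num), hw2]; norm_num)
        have h2 := hKη w (by rw [hw2]; norm_num) (h2δ w hw2)
        linarith [hφm b]
    linarith

lemma BB_val (hX : ¬ CompactSpace X) (hφ : Continuous φ) (b : sphere (0 : ℂ) 1) :
    S.BB a φ (S.c a b) = φ b := by
  have hbn : ‖(b : ℂ)‖ = 1 := by simp
  have : |S.BB a φ (S.c a b) - φ b| ≤ 0 := by
    apply le_of_forall_pos_le_add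
    intro ε hε
    obtain ⟨K, hK⟩ := S.BB_est (a := a) hX hφ b hε
    have := hK b ⟨hbn.ge, by rw [hbn]; norm_num⟩
    have e : 2 * (b : ℂ) - b = b := by ring
    rw [e, hbn, Real.log_one] at this
    linarith
  linarith [abs_nonpos_iff.1 this]

lemma BB_cont (hX : ¬ CompactSpace X) (hφ : Continuous φ) :
    ContinuousOn (fun z => S.BB a φ (S.c a z)) Ann := by
  intro z hz
  rcases hz.1.lt_or_eq with h | h
  · have h3 : z ∈ ball (0 : ℂ) 3 := Ann_sub hz
    have := HmX.continuousAt S (S.BB_hm hX hφ ((S.mem_Yo (a := a) h3).2 h))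
    exact ((S.contAt_iff h3).1 this).continuousWithinAt
  · set b : sphere (0 : ℂ) 1 := ⟨z, by simpa using h.symm⟩ with hb
    rw [Metric.continuousWithinAt_iff']
    intro ε hε
    obtain ⟨K, hK⟩ := S.BB_est (a := a) hX hφ b (half_pos hε)
    have hv : S.BB a φ (S.c a z) = φ b := S.BB_val hX hφ b
    have hlim : Tendsto (fun w : ℂ => ε / 2 + K * Real.log ‖2 * w - b‖) (𝓝 z)
        (𝓝 (ε / 2 + K * Real.log ‖2 * z - b‖)) := by
      have e : 2 * z - (b : ℂ) = z := by simp [hb]; ring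
      have : ContinuousAt (fun w : ℂ => Real.log ‖2 * w - b‖) z := by
        apply ContinuousAt.log (by fun_prop)
        rw [e, ← h]; norm_num
      exact (this.tendsto.const_mul K).const_add _
    have e : 2 * z - (b : ℂ) = z := by simp [hb]; ring
    rw [e, ← h, Real.log_one, mul_zero, add_zero] at hlim
    filter_upwards [mem_nhdsWithin_of_mem_nhds (hlim.eventually (gt_mem_nhds (half_lt_self hε))),
      self_mem_nhdsWithin] with w hw hwA
    rw [hv, Real.dist_eq]
    exact (hK w hwA).trans_lt hw

end
end RS

/-- contraction of oscillation gives fixed points modulo constants -/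
lemma fix_osc {K : Type*} [TopologicalSpace K] [CompactSpace K] (k₀ : K) (T : C(K, ℝ) → C(K, ℝ))
    (hT : ∀ f g : C(K, ℝ), ∀ m ω : ℝ, (∀ x, m ≤ f x - g x ∧ f x - g x ≤ m + ω) →
      ∃ m', ∀ x, m' ≤ T f x - T g x ∧ T f x - T g x ≤ m' + 2 / 3 * ω) :
    ∃ (f : C(K, ℝ)) (κ : ℝ), ∀ x, T f x = f x + κ := by
  set Φ : C(K, ℝ) → C(K, ℝ) := fun f => T f - ContinuousMap.const K (T f k₀) with hΦ
  have hΦ0 : ∀ f, Φ f k₀ = 0 := fun f => by simp [hΦ]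
  have hΦs : ∀ f g : C(K, ℝ), ∀ m ω : ℝ, (∀ x, m ≤ f x - g x ∧ f x - g x ≤ m + ω) →
      ∃ m', ∀ x, m' ≤ Φ f x - Φ g x ∧ Φ f x - Φ g x ≤ m' + 2 / 3 * ω := by
    intro f g m ω h
    obtain ⟨m', hm'⟩ := hT f g m ω h
    refine ⟨m' - (T f k₀ - T g k₀), fun x => ?_⟩
    have := hm' x
    simp only [hΦ, ContinuousMap.sub_apply, ContinuousMap.const_apply]
    constructor <;> linarith
  set F : ℕ → C(K, ℝ) := fun n => Φ^[n] 0 with hF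
  have hFs : ∀ n, F (n + 1) = Φ (F n) := fun n => Function.iterate_succ_apply' Φ n 0
  have hF0 : ∀ n, F n k₀ = 0 := by
    intro n
    cases n with
    | zero => simp [hF]
    | succ n => rw [hFs, hΦ0]
  set ω := 2 * ‖F 1 - F 0‖ with hω
  have hosc : ∀ n, ∃ m, ∀ x, m ≤ F (n + 1) x - F n x ∧ F (n + 1) x - F n x ≤ m + (2 / 3) ^ n * ω := by
    intro n
    induction n with
    | zero =>
      refine ⟨-‖F 1 - F 0‖, fun x => ?_⟩
      have := abs_le.1 ((F 1 - F 0).norm_coe_le_norm x)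
      simp only [ContinuousMap.sub_apply] at this
      rw [hω]
      constructor
      · exact this.1
      · rw [zero_add]; linarith [this.2]
    | succ n ih =>
      obtain ⟨m, hm⟩ := ih
      obtain ⟨m', hm'⟩ := hΦs (F (n + 1)) (F n) m _ hm
      refine ⟨m', fun x => ?_⟩
      rw [hFs (n + 1), hFs n, pow_succ]
      have := hm' x
      rw [hFs n] at this
      constructor
      · exact this.1
      · refine this.2.trans (le_of_eq ?_); ring
  have hsup : ∀ {f g : C(K, ℝ)} {m ω : ℝ}, 0 ≤ ω → f k₀ = 0 → g k₀ = 0 →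
      (∀ x, m ≤ f x - g x ∧ f x - g x ≤ m + ω) → dist f g ≤ ω := by
    intro f g m ω h0 hf hg h
    rw [ContinuousMap.dist_le h0]
    intro x
    rw [Real.dist_eq, abs_le]
    have h1 := h k₀
    have h2 := h x
    rw [hf, hg] at h1
    constructor <;> linarith
  have hω0 : 0 ≤ ω := by positivity
  have hcau : CauchySeq F := by
    apply cauchySeq_of_le_geometric (2 / 3) ω (by norm_num)
    intro n
    obtain ⟨m, hm⟩ := hosc n
    rw [dist_comm, mul_comm]
    exact hsup (by positivity) (hF0 _) (hF0 _) hm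
  obtain ⟨f, hf⟩ := cauchySeq_tendsto_of_complete hcau
  have hlip : ∀ g, dist (Φ g) (Φ f) ≤ 2 / 3 * (2 * dist g f) := by
    intro g
    obtain ⟨m, hm⟩ := hΦs g f (-dist g f) (2 * dist g f) (fun x => by
      have := abs_le.1 ((Real.dist_eq (g x) (f x)) ▸ ContinuousMap.dist_apply_le_dist x : |g x - f x| ≤ dist g f)
      constructor <;> linarith)
    exact hsup (by positivity) (hΦ0 _) (hΦ0 _) hm
  have hlim2 : Filter.Tendsto (fun n => F (n + 1)) Filter.atTop (nhds (Φ f)) := by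
    rw [tendsto_iff_dist_tendsto_zero]
    have h0 := (tendsto_iff_dist_tendsto_zero.1 hf).const_mul (2 / 3 * 2)
    rw [mul_zero] at h0
    refine squeeze_zero (fun _ => dist_nonneg) (fun n => ?_) h0
    rw [hFs, mul_assoc]
    exact hlip _
  have hfix : Φ f = f := tendsto_nhds_unique hlim2 ((Filter.tendsto_add_atTop_iff_nat 1).2 hf)
  refine ⟨f, T f k₀, fun x => ?_⟩
  have := congrArg (fun h : C(K, ℝ) => h x) hfix
  simp only [hΦ, ContinuousMap.sub_apply, ContinuousMap.const_apply] at this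
  linarith

end Suz

namespace Suz
namespace RS
open Complex Metric Set Filter Topology Real InnerProductSpace
variable {X : Type*} [TopologicalSpace X] (S : RS X)
variable [T2Space X] [PreconnectedSpace X]

lemma dipole_aux (hX : ¬ CompactSpace X) (a : X) (σ : ℂ) :
    ∃ (κ : ℝ) (u : X → ℝ) (F : ℂ → ℂ) (C : ℝ), AnalyticAt ℂ F 0 ∧ (∀ x, x ≠ a → S.HmX u x) ∧
      (∀ᶠ z in 𝓝 (0 : ℂ), z ≠ 0 → u (S.c a z) = (σ / z + F z).re + κ * Real.log ‖z‖) ∧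
      ∀ x ∈ S.Y a, |u x| ≤ C := by
  set s : ℂ → ℝ := fun z => (σ / z).re with hs
  have hsc : ContinuousOn s {z | z ≠ 0} := by
    apply Complex.continuous_re.comp_continuousOn
    exact continuousOn_const.div continuousOn_id (fun z hz => hz)
  have hsH : ∀ z, z ≠ 0 → Hm s z := fun z hz =>
    ⟨fun z => σ / z, analyticAt_const.div analyticAt_id hz, Eventually.of_forall fun _ => rfl⟩
  have hA0 : Ann ⊆ {z | z ≠ 0} := by
    rintro z hz rfl
    have := hz.1
    simp at this
    linarith
  have hS2 : sphere (0 : ℂ) 2 ⊆ Ann := fun z hz => by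
    have : ‖z‖ = 2 := by simpa using hz
    exact ⟨by linarith, by linarith⟩
  have hS1 : sphere (0 : ℂ) 1 ⊆ Ann := fun z hz => by
    have : ‖z‖ = 1 := by simpa using hz
    exact ⟨by linarith, by linarith⟩
  have h12 : sphere (0 : ℂ) 1 ⊆ ball 0 2 := fun z hz => by
    have : ‖z‖ = 1 := by simpa using hz
    rw [mem_ball_zero_iff]; linarith
  set G : C(sphere (0 : ℂ) 1, ℝ) → ℂ → ℝ := fun φ z => S.BB a φ (S.c a z) - s z with hG
  have hGc : ∀ φ, ContinuousOn (G φ) Ann := fun φ =>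
    (S.BB_cont hX φ.continuous).sub (hsc.mono hA0)
  have hGs : ∀ φ, ContinuousOn (G φ) (sphere 0 2) := fun φ => (hGc φ).mono hS2
  have two : (0 : ℝ) < 2 := by norm_num
  have hTc : ∀ φ, ContinuousOn (fun z => PI 2 (G φ) z + s z) (sphere 0 1) := by
    intro φ
    apply ContinuousOn.add _ (hsc.mono (hS1.trans hA0))
    intro z hz
    exact (PI_hm two (hGs φ) (h12 hz)).continuousAt.continuousWithinAt
  set T : C(sphere (0 : ℂ) 1, ℝ) → C(sphere (0 : ℂ) 1, ℝ) := fun φ =>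
    ⟨fun ζ => PI 2 (G φ) ζ + s ζ, (hTc φ).domRestrict⟩ with hT
  obtain ⟨φ, κ, hκ⟩ := fix_osc (⟨1, by simp⟩ : sphere (0 : ℂ) 1) T (by
    intro f g m ω h
    have hY : ∀ ζ ∈ sphere (0 : ℂ) 2, S.c a ζ ∈ S.Y a := fun ζ hζ =>
      (S.mem_Y (Ann_sub (hS2 hζ))).2 (hS2 hζ).1
    have e1 : ∀ ζ ∈ sphere (0 : ℂ) 2, G g ζ - (-m) ≤ G f ζ := by
      intro ζ hζ
      have := S.BB_shift g.continuous f.continuous (k := -m) (fun x => by linarith [(h x).1]) (hY ζ hζ)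
      simp only [hG]
      linarith
    have e2 : ∀ ζ ∈ sphere (0 : ℂ) 2, G f ζ ≤ G g ζ - (-(m + ω)) := by
      intro ζ hζ
      have := S.BB_shift f.continuous g.continuous (k := m + ω) (fun x => by linarith [(h x).2]) (hY ζ hζ)
      simp only [hG]
      linarith
    have z2 : (0 : ℂ) ∈ ball (0 : ℂ) 2 := by simp
    set A := PI 2 (G f) 0 - PI 2 (G g) 0 with hA
    refine ⟨m + (A - m) / 3, fun x => ?_⟩
    have hx2 : (x : ℂ) ∈ ball (0 : ℂ) 2 := h12 x.2
    have hxn : ‖(x : ℂ)‖ ≤ 2 / 2 := by simp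
    have k1 := (PI_harnack (g₁ := fun ζ => G g ζ - (-m)) two ((hGs g).sub continuousOn_const) (hGs f) e1 hxn).2
    have k2 := (PI_harnack (g₂ := fun ζ => G g ζ - (-(m + ω))) two (hGs f) ((hGs g).sub continuousOn_const) e2 hxn).2
    rw [PI_sub (g₂ := fun _ => -m) two (hGs g) continuousOn_const z2,
      PI_sub (g₂ := fun _ => -m) two (hGs g) continuousOn_const hx2,
      PI_const _ z2, PI_const _ hx2] at k1
    rw [PI_sub (g₂ := fun _ => -(m + ω)) two (hGs g) continuousOn_const z2,
      PI_sub (g₂ := fun _ => -(m + ω)) two (hGs g) continuousOn_const hx2,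
      PI_const _ z2, PI_const _ hx2] at k2
    change _ ≤ (PI 2 (G f) x + s x) - (PI 2 (G g) x + s x) ∧ (PI 2 (G f) x + s x) - (PI 2 (G g) x + s x) ≤ _
    constructor <;> linarith)
  have hκ' : ∀ z : ℂ, ‖z‖ = 1 → PI 2 (G φ) z + s z = S.BB a φ (S.c a z) + κ := by
    intro z hz
    have h1 := hκ ⟨z, by simpa using hz⟩
    have h2 := S.BB_val (a := a) hX φ.continuous ⟨z, by simpa using hz⟩
    simp only at h2
    rw [h2, ← h1]
    rfl
  have hl2 : (0 : ℝ) < Real.log 2 := Real.log_pos (by norm_num)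
  -- comparison in the annulus
  have hcmp := S.ann_zero hX a
    (f := fun z => (DP 2 (G φ) z - G φ z) - (κ - κ / Real.log 2 * Real.log ‖z‖)) (by
      refine ContinuousOn.sub (ContinuousOn.sub ((DP_cont two (hGs φ)).mono ?_) (hGc φ)) ?_
      · intro z hz; simpa using hz.2
      · apply continuousOn_const.sub (continuousOn_const.mul _)
        apply ContinuousOn.log continuous_norm.continuousOn
        intro z hz
        exact norm_ne_zero_iff.2 (hA0 hz)) (by
      intro z hz
      have hz0 : z ≠ 0 := hA0 (AnnO_sub hz)
      have hz2 : z ∈ ball (0 : ℂ) 2 := mem_ball_zero_iff.2 hz.2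
      have hz3 : z ∈ ball (0 : ℂ) 3 := Ann_sub (AnnO_sub hz)
      refine Hm.sub (Hm.sub ?_ (Hm.sub ?_ (hsH z hz0))) ((Hm.const κ z).sub (Hm.mul_const (Hm.log analyticAt_id hz0) _))
      · refine (PI_hm two (hGs φ) hz2).congr ?_
        filter_upwards [isOpen_ball.mem_nhds hz2] with y hy
        rw [DP, if_pos (mem_ball_zero_iff.1 hy)]
      · exact (S.hmX_iff hz3).1 (S.BB_hm hX φ.continuous ((S.mem_Yo hz3).2 hz.1))) (by
      rintro z (hz | hz)
      · rw [DP, if_pos (by rw [hz]; norm_num), hz, Real.log_one]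
        have := hκ' z hz
        simp only [hG] at this ⊢
        linarith
      · rw [DP, if_neg (by rw [hz]; norm_num), hz, div_mul_cancel₀ _ hl2.ne']
        ring)
  classical
  set ui : ℂ → ℝ := fun z => PI 2 (G φ) z + s z - (κ - κ / Real.log 2 * Real.log ‖z‖) with hui
  set u : X → ℝ := fun x => if x ∈ S.Y a then S.BB a φ x else ui (S.iv a x) with hu
  have huY : ∀ x ∈ S.Y a, u x = S.BB a φ x := fun x hx => by simp only [hu, if_pos hx]
  have hui2 : ∀ z ∈ ball (0 : ℂ) 2, u (S.c a z) = ui z := by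
    intro z hz
    have hz3 : z ∈ ball (0 : ℂ) 3 := ball_subset_ball (by norm_num) hz
    by_cases h : 1 ≤ ‖z‖
    · rw [huY _ ((S.mem_Y hz3).2 h)]
      have := hcmp z ⟨h, (mem_ball_zero_iff.1 hz).le⟩
      simp only [DP, if_pos (mem_ball_zero_iff.1 hz), hG] at this
      simp only [hui, hG]
      linarith
    · have : S.c a z ∉ S.Y a := by rwa [S.mem_Y hz3]
      simp only [hu, if_neg this, S.iv_c hz3]
  obtain ⟨F, hF, hFr⟩ := PI_analytic two (hGs φ)
  obtain ⟨M, -, hM⟩ := exM φ.continuous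
  refine ⟨κ / Real.log 2, u, fun z => F z - κ, M, (hF 0 (by simp)).sub analyticAt_const, ?_, ?_, ?_⟩
  · intro x hx
    by_cases h : x ∈ S.c a '' ball 0 2
    · obtain ⟨z, hz, rfl⟩ := h
      have hz3 : z ∈ ball (0 : ℂ) 3 := ball_subset_ball (by norm_num) hz
      have hz0 : z ≠ 0 := by
        rintro rfl
        exact hx (S.zero a)
      rw [S.hmX_iff hz3]
      refine Hm.congr (f := ui) ?_ ?_
      · exact Hm.sub ((PI_hm two (hGs φ) hz).add (hsH z hz0))
          ((Hm.const κ z).sub (Hm.mul_const (Hm.log analyticAt_id hz0) _))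
      · filter_upwards [isOpen_ball.mem_nhds hz] with y hy
        exact (hui2 y hy).symm
    · have hx' : x ∈ S.Yo a := fun h' => h (image_mono (closedBall_subset_ball (by norm_num)) h')
      refine HmX.congr S (S.BB_hm hX φ.continuous hx') ?_
      filter_upwards [(S.Yo_open a).mem_nhds hx'] with y hy
      exact (huY y (S.Yo_sub a hy)).symm
  · filter_upwards [isOpen_ball.mem_nhds (by simp : (0 : ℂ) ∈ ball (0 : ℂ) 2)] with z hz _
    rw [hui2 z hz]
    simp only [hui, hFr z hz, hs, add_re, sub_re, ofReal_re]
    ring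
  · intro x hx
    rw [huY x hx]
    exact S.BB_bd φ.continuous hM hx

lemma dipole (hX : ¬ CompactSpace X) (a : X) :
    ∃ (σ : ℂ) (u : X → ℝ) (F : ℂ → ℂ) (C : ℝ), σ ≠ 0 ∧ AnalyticAt ℂ F 0 ∧
      (∀ x, x ≠ a → S.HmX u x) ∧
      (∀ᶠ z in 𝓝 (0 : ℂ), z ≠ 0 → u (S.c a z) = (σ / z + F z).re) ∧
      ∀ x ∈ S.Y a, |u x| ≤ C := by
  obtain ⟨κ₁, u₁, F₁, C₁, h1, h2, h3, h4⟩ := S.dipole_aux hX a 1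
  obtain ⟨κ₂, u₂, F₂, C₂, k1, k2, k3, k4⟩ := S.dipole_aux hX a I
  by_cases hκ : κ₁ = 0
  · refine ⟨1, u₁, F₁, C₁, one_ne_zero, h1, h2, ?_, h4⟩
    filter_upwards [h3] with z hz hz0
    rw [hz hz0, hκ]; simp
  · refine ⟨κ₂ - κ₁ * I, fun x => κ₂ * u₁ x - κ₁ * u₂ x, fun z => κ₂ * F₁ z - κ₁ * F₂ z,
      |κ₂| * C₁ + |κ₁| * C₂, ?_, (analyticAt_const.mul h1).sub (analyticAt_const.mul k1), ?_, ?_, ?_⟩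
    · intro h
      have := congrArg Complex.im h
      simp at this
      exact hκ this
    · intro x hx
      exact Hm.sub (Hm.mul_const (h2 x hx) _) (Hm.mul_const (k2 x hx) _)
    · filter_upwards [h3, k3] with z hz kz hz0
      rw [hz hz0, kz hz0]
      have e : (κ₂ - κ₁ * I) / z + (κ₂ * F₁ z - κ₁ * F₂ z) =
        κ₂ * (1 / z + F₁ z) - κ₁ * (I / z + F₂ z) := by ring
      rw [e, sub_re, re_ofReal_mul, re_ofReal_mul]
      ring
    · intro x hx
      refine (abs_sub _ _).trans ?_
      rw [abs_mul, abs_mul]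
      gcongr
      · exact h4 x hx
      · exact k4 x hx

end RS
end Suz

namespace Suz
open Complex Metric Set Filter Topology

/-- An injective analytic function has nonvanishing derivative, and an analytic local inverse. -/
lemma inj_inverse {f : ℂ → ℂ} {x : ℂ} (hf : AnalyticAt ℂ f x) {U : Set ℂ} (hU : U ∈ 𝓝 x)
    (hinj : InjOn f U) : ∃ g : ℂ → ℂ, AnalyticAt ℂ g (f x) ∧ (∀ᶠ y in 𝓝 x, g (f y) = y) ∧
      ∀ᶠ w in 𝓝 (f x), f (g w) = w := by
  -- derivative nonzero nearby
  have hnc : ¬ ∀ᶠ y in 𝓝 x, f y = f x := by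
    intro h
    obtain ⟨r, hr, h'⟩ := Metric.mem_nhds_iff.1 (Filter.inter_mem h hU)
    have e : x + (r / 2 : ℝ) = x := by
      refine hinj (h' ?_).2 (h' (mem_ball_self hr)).2 (h' ?_).1 <;>
      · rw [mem_ball, dist_eq_norm]
        simp only [add_sub_cancel_left, norm_real, Real.norm_eq_abs]
        rw [abs_of_pos (by positivity)]; linarith
    have : ((r / 2 : ℝ) : ℂ) = 0 := by simpa using e
    norm_cast at this
    linarith
  have hd : ∀ᶠ y in 𝓝[≠] x, deriv f y ≠ 0 := by
    rcases hf.deriv.eventually_eq_zero_or_eventually_ne_zero with h | h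
    · exfalso
      apply hnc
      obtain ⟨r, hr, h'⟩ := eventually_nhds_iff_ball.1 (h.and hf.eventually_analyticAt)
      filter_upwards [ball_mem_nhds x hr] with y hy
      refine (convex_ball x r).is_const_of_fderivWithin_eq_zero (𝕜 := ℂ) (f := f)
        (fun z hz => (h' z hz).2.differentiableAt.differentiableWithinAt) ?_ hy (mem_ball_self hr)
      intro z hz
      rw [fderivWithin_of_isOpen isOpen_ball hz]
      ext
      simp [(h' z hz).1]
    · exact h
  rw [eventually_nhdsWithin_iff] at hd
  obtain ⟨r, hr, h'⟩ := eventually_nhds_iff_ball.1 ((hd.and hf.eventually_analyticAt).and hU)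
  set B := ball x r with hB
  have hxB : x ∈ B := mem_ball_self hr
  have hBinj : InjOn f B := hinj.mono fun y hy => (h' y hy).2
  have han : AnalyticOnNhd ℂ f B := fun y hy => (h' y hy).1.2
  have hopen : ∀ s ⊆ B, IsOpen s → IsOpen (f '' s) := by
    rcases han.is_constant_or_isOpen (convex_ball x r).isPreconnected with ⟨w, hw⟩ | h
    · exfalso
      apply hnc
      filter_upwards [ball_mem_nhds x hr] with y hy
      rw [hw y hy, hw x hxB]
    · exact h
  set g := Function.invFunOn f B with hg
  have hgf : ∀ y ∈ B, g (f y) = y := fun y hy => hBinj.leftInvOn_invFunOn hy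
  have hfg : ∀ w ∈ f '' B, f (g w) = w := by
    rintro _ ⟨y, hy, rfl⟩
    rw [hgf y hy]
  have hBo : IsOpen (f '' B) := hopen B le_rfl isOpen_ball
  have hgc : ∀ y ∈ B, ContinuousAt g (f y) := by
    intro y hy N hN
    rw [hgf y hy] at hN
    rw [mem_map]
    obtain ⟨V, hV, hVo, hyV⟩ := _root_.mem_nhds_iff.1 (Filter.inter_mem hN (isOpen_ball.mem_nhds hy))
    refine mem_of_superset ((hopen V (fun z hz => (hV hz).2) hVo).mem_nhds ⟨y, hyV, rfl⟩) ?_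
    rintro _ ⟨z, hz, rfl⟩
    rw [mem_preimage, hgf z (hV hz).2]
    exact (hV hz).1
  refine ⟨g, ?_, ?_, ?_⟩
  · apply Complex.analyticAt_of_differentiable_on_punctured_nhds_of_continuousAt _ (hgc x hxB)
    rw [eventually_nhdsWithin_iff]
    filter_upwards [hBo.mem_nhds ⟨x, hxB, rfl⟩] with w hw hwx
    obtain ⟨y, hy, rfl⟩ := hw
    have hyx : y ≠ x := fun h => hwx (by rw [h]; rfl)
    refine (HasDerivAt.of_local_left_inverse (f := f) (f' := deriv f y) (hgc y hy) ?_
      ((h' y hy).1.1 hyx) ?_).differentiableAt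
    · rw [hgf y hy]
      exact (han y hy).differentiableAt.hasDerivAt
    · filter_upwards [hBo.mem_nhds ⟨y, hy, rfl⟩] with w hw
      exact hfg w hw
  · filter_upwards [ball_mem_nhds x hr] with y hy using hgf y hy
  · filter_upwards [hBo.mem_nhds ⟨x, hxB, rfl⟩] with w hw using hfg w hw

lemma inj_deriv {f : ℂ → ℂ} {x : ℂ} (hf : AnalyticAt ℂ f x) {U : Set ℂ} (hU : U ∈ 𝓝 x)
    (hinj : InjOn f U) : deriv f x ≠ 0 := by
  obtain ⟨g, hg, h1, -⟩ := inj_inverse hf hU hinj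
  intro h0
  have := hg.differentiableAt.hasDerivAt.comp x hf.differentiableAt.hasDerivAt
  rw [h0, mul_zero] at this
  have h2 : HasDerivAt (fun y : ℂ => y) 0 x := this.congr_of_eventuallyEq (h1.mono fun y hy => hy.symm)
  exact one_ne_zero ((hasDerivAt_id x).unique h2)

/-- factor out a zero -/
lemma factor_zero {f : ℂ → ℂ} (hf : AnalyticAt ℂ f 0) (h0 : f 0 = 0) :
    ∃ k : ℂ → ℂ, AnalyticAt ℂ k 0 ∧ (∀ z, f z = z * k z) ∧ k 0 = deriv f 0 := by
  refine ⟨dslope f 0, ?_, ?_, by simp⟩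
  · obtain ⟨p, hp⟩ := hf
    exact ⟨_, hp.has_fpower_series_dslope_fslope⟩
  · intro z
    have := sub_smul_dslope f 0 z
    rw [h0, sub_zero, sub_zero] at this
    exact this.symm

namespace RS
variable {X : Type*} [TopologicalSpace X] (S : RS X)

/-- holomorphic at a point -/
def Hol (f : X → ℂ) (b : X) : Prop := AnalyticAt ℂ (fun z => f (S.c b z)) 0

lemma hol_iff {u : X → ℂ} {a : X} {z : ℂ} (hz : z ∈ ball (0 : ℂ) 3) :
    S.Hol u (S.c a z) ↔ AnalyticAt ℂ (fun z => u (S.c a z)) z := by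
  have h0 : (0 : ℂ) ∈ ball (0 : ℂ) 3 := by simp
  constructor
  · intro h
    obtain ⟨τ, hτ, hz0, he⟩ := S.compat a (S.c a z) z 0 hz h0 (by rw [S.zero])
    unfold Hol at h
    refine (AnalyticAt.comp_of_eq h hτ hz0).congr ?_
    filter_upwards [he] with w hw
    simp only [hw, Function.comp]
  · intro h
    obtain ⟨τ, hτ, hz0, he⟩ := S.compat (S.c a z) a 0 z h0 hz (by rw [S.zero])
    refine (AnalyticAt.comp_of_eq h hτ hz0).congr ?_
    filter_upwards [he] with w hw
    simp only [hw, Function.comp]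

lemma Hol.congr {u v : X → ℂ} {b : X} (h : S.Hol u b) (e : u =ᶠ[𝓝 b] v) : S.Hol v b :=
  AnalyticAt.congr h ((S.ev0_iff).1 e)

lemma Hol.continuousAt {u : X → ℂ} {b : X} (h : S.Hol u b) : ContinuousAt u b := by
  have := AnalyticAt.continuousAt h
  have h2 := (S.contAt_iff (a := b) (z := 0) (f := u) (by simp)).2 this
  rwa [S.zero] at h2

/-- a function with a single simple pole, bounded away from it. -/
structure PF (T : X → ℂ) (b : X) : Prop where
  hol : ∀ x, x ≠ b → S.Hol T x
  pole : ∃ g : ℂ → ℂ, AnalyticAt ℂ g 0 ∧ g 0 ≠ 0 ∧ ∀ᶠ z in 𝓝 (0 : ℂ), z ≠ 0 → T (S.c b z) * z = g z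
  bdd : ∀ N ∈ 𝓝 b, ∃ C : ℝ, ∀ x, x ∉ N → ‖T x‖ ≤ C

lemma ne_of_c {a : X} {z : ℂ} (hz : z ∈ ball (0 : ℂ) 3) (h : z ≠ 0) : S.c a z ≠ a := by
  intro h'
  apply h
  apply S.inj a hz (by simp)
  rw [h', S.zero]

lemma PF.large {T : X → ℂ} {b : X} (h : S.PF T b) (C : ℝ) : ∀ᶠ x in 𝓝 b, x ≠ b → C < ‖T x‖ := by
  obtain ⟨g, hg, g0, he⟩ := h.pole
  rw [S.ev0_iff]
  have hc : ∀ᶠ z in 𝓝 (0 : ℂ), C * ‖z‖ < ‖g z‖ := by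
    have h1 : Tendsto (fun z : ℂ => C * ‖z‖) (𝓝 0) (𝓝 (C * ‖(0 : ℂ)‖)) :=
      (continuous_const.mul continuous_norm).tendsto 0
    exact h1.eventually_lt hg.continuousAt.norm (by simpa using g0)
  filter_upwards [he, hc] with z hz hz' hne
  have hz0 : z ≠ 0 := by
    rintro rfl
    exact hne (S.zero b)
  rw [← hz hz0, norm_mul] at hz'
  exact lt_of_mul_lt_mul_right hz' (norm_nonneg z)

/-- identity principle: a pole function is nowhere locally constant. -/
lemma PF.not_const [PreconnectedSpace X] {T : X → ℂ} {b : X} (h : S.PF T b) {x : X}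
    (hx : x ≠ b) [T1Space X] (w : ℂ) : ¬ ∀ᶠ y in 𝓝 x, T y = w := by
  intro hw
  set A : Set X := {x | x ≠ b ∧ ∀ᶠ y in 𝓝 x, T y = w} with hA
  have hAo : IsOpen A := by
    rw [isOpen_iff_mem_nhds]
    rintro y ⟨hy, hy'⟩
    filter_upwards [isOpen_ne.mem_nhds hy, hy'.eventually_nhds] with z hz hz'
    exact ⟨hz, hz'⟩
  have hAc : IsClosed A := by
    rw [isClosed_iff_frequently]
    intro y hy
    have hyb : y ≠ b := by
      rintro rfl
      obtain ⟨z, hz, hz'⟩ := (hy.and_eventually (PF.large S h ‖w‖)).exists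
      have := hz' hz.1
      rw [hz.2.self_of_nhds] at this
      exact lt_irrefl _ this
    refine ⟨hyb, ?_⟩
    have hh : AnalyticAt ℂ (fun z => T (S.c y z)) 0 := h.hol y hyb
    rw [S.ev0_iff]
    rcases hh.eventually_eq_or_eventually_ne (analyticAt_const (v := w)) with h1 | h1
    · exact h1
    · exfalso
      rw [eventually_nhdsWithin_iff] at h1
      have hy2 : ∃ᶠ z in 𝓝 (0 : ℂ), S.c y z ∈ A := by
        rw [Filter.Frequently, ← S.ev0_iff (p := fun x => ¬ x ∈ A)]
        exact hy
      obtain ⟨z, hzA, hz, hz3⟩ := (hy2.and_eventually (h1.eventually_nhds.and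
        (ball_mem_nhds (0 : ℂ) (by norm_num : (0 : ℝ) < 3)))).exists
      have h2 := (S.ev_iff hz3).1 hzA.2
      have h3 : ∀ᶠ z' in 𝓝 z, z' = 0 := by
        filter_upwards [hz, h2] with z' k1 k2
        by_contra hne
        exact k1 hne k2
      have h4 : ∀ᶠ z' in 𝓝[≠] z, False := by
        by_cases hz0 : z = 0
        · rw [eventually_nhdsWithin_iff]
          filter_upwards [h3] with z' k1 k2
          exact k2 (by rw [k1, hz0]; rfl)
        · exact absurd h3.self_of_nhds hz0
      exact (eventually_false_iff_eq_bot.1 h4 ▸ (inferInstance : (𝓝[≠] z).NeBot)).ne rfl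
  have := (IsClopen.eq_univ ⟨hAc, hAo⟩ ⟨x, hx, hw⟩)
  have hb : b ∈ A := by rw [this]; trivial
  exact hb.1 rfl

/-- removable singularity -/
lemma Hol.update [T1Space X] [DecidableEq X] {f : X → ℂ} {b : X} {k : ℂ → ℂ} (hk : AnalyticAt ℂ k 0)
    (h : ∀ᶠ z in 𝓝 (0 : ℂ), z ≠ 0 → f (S.c b z) = k z) :
    S.Hol (Function.update f b (k 0)) b := by
  refine AnalyticAt.congr hk ?_
  filter_upwards [h, ball_mem_nhds (0 : ℂ) (by norm_num : (0 : ℝ) < 3)] with z hz hz3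
  by_cases h0 : z = 0
  · rw [h0, S.zero, Function.update_self]
  · rw [Function.update_of_ne (S.ne_of_c hz3 h0), hz h0]

lemma Hol.update_ne [T1Space X] [DecidableEq X] {f : X → ℂ} {b x : X} {v : ℂ} (h : S.Hol f x)
    (hx : x ≠ b) : S.Hol (Function.update f b v) x := by
  refine Hol.congr S h ?_
  filter_upwards [isOpen_ne.mem_nhds hx] with y hy
  rw [Function.update_of_ne hy]

section
variable [T2Space X] [PreconnectedSpace X]
variable (hL : ∀ f : X → ℂ, (∀ b, S.Hol f b) → (∃ C : ℝ, ∀ x, ‖f x‖ ≤ C) → ∀ x y, f x = f y)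

lemma PF.sep (hL : ∀ f : X → ℂ, (∀ b, S.Hol f b) → (∃ C : ℝ, ∀ x, ‖f x‖ ≤ C) → ∀ x y, f x = f y)
    {T T' : X → ℂ} {b b' : X} (h : S.PF T b) (h' : S.PF T' b')
    (hbb : b ≠ b') {x : X} (hx : x ≠ b) (hx' : x ≠ b') : T x ≠ T b' := by
  classical
  set P : X → ℂ := fun x => (T x - T b') * (T' x - T' b) with hP
  -- local forms
  have key : ∀ {T T' : X → ℂ} {b b' : X}, S.PF T b → S.PF T' b' → b ≠ b' →
      ∃ k : ℂ → ℂ, AnalyticAt ℂ k 0 ∧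
      ∀ᶠ z in 𝓝 (0 : ℂ), z ≠ 0 → (T (S.c b z) - T b') * (T' (S.c b z) - T' b) = k z := by
    intro T T' b b' h h' hbb
    obtain ⟨g, hg, g0, he⟩ := h.pole
    have hh : AnalyticAt ℂ (fun z => T' (S.c b z) - T' b) 0 := (h'.hol b hbb).sub analyticAt_const
    obtain ⟨k, hk, hk', -⟩ := factor_zero hh (by simp [S.zero])
    refine ⟨fun z => (g z - T b' * z) * k z, (hg.sub (analyticAt_const.mul analyticAt_id)).mul hk, ?_⟩
    filter_upwards [he] with z hz hz0
    rw [hk', ← hz hz0]; ring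
  obtain ⟨k, hk, hke⟩ := key h h' hbb
  obtain ⟨k', hk', hke'⟩ := key h' h hbb.symm
  have hke2 : ∀ᶠ z in 𝓝 (0 : ℂ), z ≠ 0 → P (S.c b z) = k z := hke
  have hke2' : ∀ᶠ z in 𝓝 (0 : ℂ), z ≠ 0 → P (S.c b' z) = k' z := by
    filter_upwards [hke'] with z hz hz0
    rw [← hz hz0, hP]; ring
  set P1 := Function.update P b (k 0) with hP1
  have hke3' : ∀ᶠ z in 𝓝 (0 : ℂ), z ≠ 0 → P1 (S.c b' z) = k' z := by
    have : ∀ᶠ x in 𝓝 b', x ≠ b := isOpen_ne.mem_nhds hbb.symm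
    rw [S.ev0_iff] at this
    filter_upwards [hke2', this] with z hz hz1 hz0
    rw [hP1, Function.update_of_ne hz1, hz hz0]
  set P2 := Function.update P1 b' (k' 0) with hP2
  have hPne : ∀ x, x ≠ b → x ≠ b' → P2 x = P x := by
    intro x h1 h2
    rw [hP2, Function.update_of_ne h2, hP1, Function.update_of_ne h1]
  have hhol : ∀ x, S.Hol P2 x := by
    intro x
    by_cases hxb' : x = b'
    · rw [hxb']
      exact Hol.update S hk' hke3'
    · refine Hol.update_ne S ?_ hxb'
      by_cases hxb : x = b
      · rw [hxb]
        exact Hol.update S hk hke2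
      · refine Hol.update_ne S ?_ hxb
        exact ((h.hol x hxb).sub analyticAt_const).mul ((h'.hol x hxb').sub analyticAt_const)
  have hbd : ∃ C : ℝ, ∀ x, ‖P2 x‖ ≤ C := by
    have n1 : ∀ᶠ x in 𝓝 b, ‖P2 x‖ < ‖P2 b‖ + 1 :=
      (Hol.continuousAt S (hhol b)).norm.eventually (gt_mem_nhds (by linarith))
    have n2 : ∀ᶠ x in 𝓝 b', ‖P2 x‖ < ‖P2 b'‖ + 1 :=
      (Hol.continuousAt S (hhol b')).norm.eventually (gt_mem_nhds (by linarith))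
    obtain ⟨C1, hC1⟩ := h.bdd _ n1
    obtain ⟨C2, hC2⟩ := h'.bdd _ n2
    refine ⟨(‖P2 b‖ + 1) + (‖P2 b'‖ + 1) + (|C1| + ‖T b'‖) * (|C2| + ‖T' b‖), fun x => ?_⟩
    have p0 : 0 ≤ (|C1| + ‖T b'‖) * (|C2| + ‖T' b‖) := by positivity
    by_cases x1 : ‖P2 x‖ < ‖P2 b‖ + 1
    · linarith [norm_nonneg (P2 b')]
    by_cases x2 : ‖P2 x‖ < ‖P2 b'‖ + 1
    · linarith [norm_nonneg (P2 b)]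
    have xb : x ≠ b := fun e => x1 (by rw [e]; linarith)
    have xb' : x ≠ b' := fun e => x2 (by rw [e]; linarith)
    have b1 := hC1 x x1
    have b2 := hC2 x x2
    have : ‖P2 x‖ ≤ (|C1| + ‖T b'‖) * (|C2| + ‖T' b‖) := by
      rw [hPne x xb xb', hP, norm_mul]
      gcongr
      · exact (norm_sub_le _ _).trans (by gcongr; exact b1.trans (le_abs_self _))
      · exact (norm_sub_le _ _).trans (by gcongr; exact b2.trans (le_abs_self _))
    linarith [norm_nonneg (P2 b), norm_nonneg (P2 b')]
  have hconst := hL P2 hhol hbd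
  intro hT
  have hx0 : P2 x = 0 := by rw [hPne x hx hx', hP]; simp [hT]
  apply PF.not_const S h hbb.symm (T b')
  filter_upwards [PF.large S h' ‖T' b‖, isOpen_ne.mem_nhds hbb.symm] with y hy hyb
  by_cases hyb' : y = b'
  · rw [hyb']
  · have e := hconst y x
    rw [hx0, hPne y hyb hyb'] at e
    rcases mul_eq_zero.1 e with e | e
    · exact sub_eq_zero.1 e
    · exfalso
      have := hy hyb'
      rw [sub_eq_zero.1 e] at this
      exact lt_irrefl _ this

end
end RS
end Suz

namespace Suz
open Complex Metric Set Filter Topology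

lemma inj_of_deriv {f : ℂ → ℂ} {x : ℂ} (hf : AnalyticAt ℂ f x) (h : deriv f x ≠ 0) :
    (∃ U ∈ 𝓝 x, InjOn f U) ∧ map f (𝓝 x) = 𝓝 (f x) := by
  have hs := hf.hasStrictDerivAt
  have hs' := hs.hasStrictFDerivAt_equiv h
  refine ⟨⟨_, hs'.eventually_left_inverse, ?_⟩, hs.map_nhds_eq h⟩
  intro y hy z hz e
  change _ = y at hy
  change _ = z at hz
  rw [← hy, ← hz, e]

namespace RS
variable {X : Type*} [TopologicalSpace X] (S : RS X)
section
variable [T2Space X] [PreconnectedSpace X]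

lemma exPF (a : X) {N : Set X} (hN : N ∈ 𝓝 a) {σ : ℂ} (hσ : σ ≠ 0) {Q : X → ℂ} {G : ℂ → ℂ} {C : ℝ}
    (hQ : ∀ x, x ≠ a → S.Hol Q x) (hG : AnalyticAt ℂ G 0)
    (he : ∀ᶠ z in 𝓝 (0 : ℂ), z ≠ 0 → Q (S.c a z) = σ / z + G z)
    (hC : ∀ x ∈ S.Y a, |(Q x).re| ≤ C) : ∃ b ∈ N, ∃ T, S.PF T b := by
  classical
  set p : ℂ → ℂ := fun z => z / (σ + z * G z) with hp
  have hden : AnalyticAt ℂ (fun z => σ + z * G z) 0 := analyticAt_const.add (analyticAt_id.mul hG)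
  have hpa : AnalyticAt ℂ p 0 := analyticAt_id.div hden (by simpa using hσ)
  have hdp : deriv p 0 ≠ 0 := by
    have : HasDerivAt p ((1 * (σ + 0 * G 0) - 0 * deriv (fun z => σ + z * G z) 0) / (σ + 0 * G 0) ^ 2) 0 :=
      (hasDerivAt_id (0 : ℂ)).div hden.differentiableAt.hasDerivAt (by simpa using hσ)
    rw [this.deriv]
    simp [hσ]
  obtain ⟨⟨U, hU, hUinj⟩, hmap⟩ := inj_of_deriv hpa hdp
  have hp0 : p 0 = 0 := by simp [hp]
  rw [hp0] at hmap
  have hd0 : ∀ᶠ z in 𝓝 (0 : ℂ), σ + z * G z ≠ 0 := hden.continuousAt.eventually_ne (by simpa using hσ)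
  have hN' := (S.ev0_iff (p := fun x => x ∈ N)).1 hN
  obtain ⟨r', hr', hr⟩ := eventually_nhds_iff_ball.1
    ((hpa.eventually_analyticAt.and (hd0.and he)).and ((show ∀ᶠ z in 𝓝 (0:ℂ), z ∈ U from hU).and hN'))
  set r := min r' 1 with hrd
  have r0 : 0 < r := by positivity
  have hr1 : ball (0 : ℂ) r ⊆ ball 0 r' := ball_subset_ball (min_le_left _ _)
  have hr3 : ball (0 : ℂ) r ⊆ ball 0 3 := ball_subset_ball ((min_le_right _ _).trans (by norm_num))
  have hpan : ∀ z ∈ ball (0 : ℂ) r, AnalyticAt ℂ p z := fun z hz => (hr z (hr1 hz)).1.1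
  have hdn : ∀ z ∈ ball (0 : ℂ) r, σ + z * G z ≠ 0 := fun z hz => (hr z (hr1 hz)).1.2.1
  have hpinj : InjOn p (ball (0 : ℂ) r) := hUinj.mono fun z hz => (hr z (hr1 hz)).2.1
  have hQp : ∀ z ∈ ball (0 : ℂ) r, z ≠ 0 → Q (S.c a z) = 1 / p z := by
    intro z hz hz0
    rw [(hr z (hr1 hz)).1.2.2 hz0, hp]
    have := hdn z hz
    field_simp
  have hpn : ∀ z ∈ ball (0 : ℂ) r, z ≠ 0 → p z ≠ 0 := fun z hz hz0 => div_ne_zero hz0 (hdn z hz)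
  -- bound off the small disc
  have hbd : ∃ C', ∀ x, x ∉ S.c a '' ball 0 (r / 2) → |(Q x).re| ≤ C' := by
    set K : Set ℂ := {z | r / 2 ≤ ‖z‖ ∧ ‖z‖ ≤ 1} with hK
    have hKc : IsCompact K := by
      apply (isCompact_closedBall (0 : ℂ) 1).of_isClosed_subset
      · exact (isClosed_le continuous_const continuous_norm).inter
          (isClosed_le continuous_norm continuous_const)
      · intro z hz
        exact mem_closedBall_zero_iff.2 hz.2
    have hcont : ContinuousOn (fun z => Q (S.c a z)) K := by
      intro z hz
      have hz3 : z ∈ ball (0 : ℂ) 3 := by rw [mem_ball_zero_iff]; linarith [hz.2]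
      have hz0 : z ≠ 0 := by
        rintro rfl
        have := hz.1
        rw [norm_zero] at this
        linarith
      exact ((S.hol_iff hz3).1 (hQ _ (S.ne_of_c hz3 hz0))).continuousAt.continuousWithinAt
    obtain ⟨M, hM⟩ := hKc.exists_bound_of_continuousOn hcont
    refine ⟨max C M, fun x hx => ?_⟩
    by_cases hxY : x ∈ S.Y a
    · exact (hC x hxY).trans (le_max_left _ _)
    · have : x ∈ S.c a '' ball 0 1 := by
        by_contra h; exact hxY h
      obtain ⟨z, hz, rfl⟩ := this
      have hzr : r / 2 ≤ ‖z‖ := by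
        by_contra h
        push Not at h
        exact hx ⟨z, mem_ball_zero_iff.2 h, rfl⟩
      exact ((abs_re_le_norm _).trans (hM z ⟨hzr, (mem_ball_zero_iff.1 hz).le⟩)).trans (le_max_right _ _)
  obtain ⟨C', hC'⟩ := hbd
  have hb2 : ball (0 : ℂ) (r / 2) ⊆ ball 0 r := ball_subset_ball (by linarith)
  -- choose w
  have hev : ∀ᶠ w : ℝ in atTop, ((1 / w : ℝ) : ℂ) ∈ p '' ball 0 (r / 2) := by
    have h1 : Tendsto (fun w : ℝ => ((1 / w : ℝ) : ℂ)) atTop (𝓝 0) := by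
      have := (Complex.continuous_ofReal.tendsto 0).comp tendsto_inv_atTop_zero
      simpa [Function.comp_def] using this
    apply h1
    rw [← hmap]
    exact image_mem_map (ball_mem_nhds 0 (by linarith))
  obtain ⟨w, ⟨z1, hz1, hpz1⟩, hw1, hw2⟩ := (hev.and ((eventually_ge_atTop (C' + 1)).and
    (eventually_gt_atTop 0))).exists
  have hwc : (w : ℂ) ≠ 0 := by exact_mod_cast hw2.ne'
  have hz1r := hb2 hz1
  have hz13 := hr3 hz1r
  have hz10 : z1 ≠ 0 := by
    rintro rfl
    rw [hp0] at hpz1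
    push_cast at hpz1
    exact one_div_ne_zero hwc hpz1.symm
  set b := S.c a z1 with hb
  have hba : b ≠ a := S.ne_of_c hz13 hz10
  set T : X → ℂ := fun x => if x = a then 0 else 1 / (Q x - w) with hT
  have hwp : ∀ z ∈ ball (0 : ℂ) r, z ≠ z1 → 1 - w * p z ≠ 0 := by
    intro z hz hne h
    apply hne
    apply hpinj hz hz1r
    rw [hpz1]
    push_cast
    field_simp
    linear_combination -h
  have hTp : ∀ z ∈ ball (0 : ℂ) r, T (S.c a z) = p z / (1 - w * p z) := by
    intro z hz
    by_cases hz0 : z = 0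
    · simp [hz0, hT, S.zero, hp0]
    · have hpz := hpn z hz hz0
      simp only [hT, if_neg (S.ne_of_c (hr3 hz) hz0), hQp z hz hz0]
      by_cases h : 1 - w * p z = 0
      · have : 1 / p z - w = 0 := by field_simp; linear_combination h
        rw [this, h]; simp
      · have : 1 / p z - w = (1 - w * p z) / p z := by field_simp
        rw [this]; field_simp
  have hout : ∀ x, x ∉ S.c a '' ball 0 (r / 2) → 1 ≤ ‖Q x - w‖ := by
    intro x hx
    have h1 := (abs_le.1 (hC' x hx)).2
    have h2 := abs_re_le_norm (Q x - w)
    rw [sub_re, ofReal_re, abs_sub_comm] at h2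
    have := le_abs_self (w - (Q x).re)
    linarith
  have haim : a ∈ S.c a '' ball 0 (r / 2) := ⟨0, by simp [r0], S.zero a⟩
  have hhol : ∀ x, x ≠ b → S.Hol T x := by
    intro x hx
    by_cases h : x ∈ S.c a '' ball 0 r
    · obtain ⟨z, hz, rfl⟩ := h
      rw [S.hol_iff (hr3 hz)]
      have hzz : z ≠ z1 := fun e => hx (by rw [e])
      refine AnalyticAt.congr ((hpan z hz).div (analyticAt_const.sub (analyticAt_const.mul (hpan z hz)))
        (hwp z hz hzz)) ?_
      filter_upwards [isOpen_ball.mem_nhds hz] with y hy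
      exact (hTp y hy).symm
    · have h2 : x ∉ S.c a '' ball 0 (r / 2) := fun h' => h (image_mono hb2 h')
      have hxa : x ≠ a := fun e => h2 (e ▸ haim)
      have hne : Q x - w ≠ 0 := by
        intro h0
        have := hout x h2
        rw [h0, norm_zero] at this
        linarith
      have h3 : S.Hol (fun x => 1 / (Q x - w)) x :=
        AnalyticAt.div analyticAt_const ((hQ x hxa).sub analyticAt_const) (by simpa [S.zero] using hne)
      refine Hol.congr S h3 ?_
      filter_upwards [isOpen_ne.mem_nhds hxa] with y hy
      simp only [hT, if_neg hy]
  refine ⟨b, (hr z1 (hr1 hz1r)).2.2, T, hhol, ?_, ?_⟩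
  · obtain ⟨τ, hτ, hτ0, hτe⟩ := S.compat b a 0 z1 (by simp) hz13 (S.zero b)
    have hball : ∀ᶠ z in 𝓝 (0 : ℂ), τ z ∈ ball (0 : ℂ) r := by
      apply hτ.continuousAt
      rw [hτ0]
      exact isOpen_ball.mem_nhds hz1r
    have hpτ : AnalyticAt ℂ (fun z => p (τ z)) 0 := AnalyticAt.comp_of_eq (hpan z1 hz1r) hτ hτ0
    set D : ℂ → ℂ := fun z => 1 - w * p (τ z) with hD
    have hDa : AnalyticAt ℂ D 0 := analyticAt_const.sub (analyticAt_const.mul hpτ)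
    have hD0 : D 0 = 0 := by
      simp only [hD, hτ0, hpz1]
      push_cast
      field_simp
      simp
    have hD' : deriv D 0 ≠ 0 := by
      refine inj_deriv hDa (U := {z | (τ z ∈ ball (0 : ℂ) r ∧ S.c b z = S.c a (τ z)) ∧ z ∈ ball (0 : ℂ) 3})
        ((hball.and hτe).and (ball_mem_nhds 0 (by norm_num))) ?_
      intro x hx y hy e
      have e1 : p (τ x) = p (τ y) := by
        have : (w : ℂ) * p (τ x) = w * p (τ y) := by simp only [hD] at e; linear_combination -e
        exact mul_left_cancel₀ hwc this
      have e2 := hpinj hx.1.1 hy.1.1 e1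
      apply S.inj b hx.2 hy.2
      rw [hx.1.2, hy.1.2, e2]
    obtain ⟨k, hk, hk1, hk0⟩ := factor_zero hDa hD0
    have hkne : k 0 ≠ 0 := by rw [hk0]; exact hD'
    refine ⟨fun z => p (τ z) / k z, hpτ.div hk hkne, ?_, ?_⟩
    · simp only [hτ0, hpz1]
      apply div_ne_zero _ hkne
      push_cast
      exact one_div_ne_zero hwc
    · filter_upwards [hball, hτe, hk.continuousAt.eventually_ne hkne] with z h1 h2 h3 hz0
      rw [h2, hTp _ h1]
      have : 1 - w * p (τ z) = z * k z := hk1 z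
      rw [this]
      field_simp
  · intro M hM
    have hKc : IsCompact (S.c a '' closedBall 0 (r / 2) ∩ (interior M)ᶜ) := by
      apply IsCompact.inter_right _ isOpen_interior.isClosed_compl
      apply S.isCompact_im (isCompact_closedBall _ _)
      exact (closedBall_subset_ball (by linarith)).trans hr3
    obtain ⟨C1, hC1⟩ := hKc.exists_bound_of_continuousOn (f := T) (by
      intro x hx
      apply (Hol.continuousAt S (hhol x _)).continuousWithinAt
      rintro rfl
      exact hx.2 (mem_interior_iff_mem_nhds.2 hM))
    refine ⟨max 1 C1, fun x hx => ?_⟩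
    by_cases h : x ∈ S.c a '' ball 0 (r / 2)
    · exact (hC1 x ⟨image_mono ball_subset_closedBall h, fun h' => hx (interior_subset h')⟩).trans
        (le_max_right _ _)
    · refine le_trans ?_ (le_max_left _ _)
      have hxa : x ≠ a := fun e => h (e ▸ haim)
      simp only [hT, if_neg hxa, norm_div, norm_one]
      exact (div_le_one (by linarith [hout x h])).2 (hout x h)

lemma Hol.open {T : X → ℂ} {x : X} (h : S.Hol T x) (hc : ¬ ∀ᶠ y in 𝓝 x, T y = T x)
    {N : Set X} (hN : N ∈ 𝓝 x) : T '' N ∈ 𝓝 (T x) := by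
  have hh : AnalyticAt ℂ (fun z => T (S.c x z)) 0 := h
  rcases hh.eventually_constant_or_nhds_le_map_nhds with h1 | h1
  · exfalso
    apply hc
    rw [S.ev0_iff]
    simpa only [S.zero] using h1
  · simp only [S.zero] at h1
    have : T '' N ∈ map (fun z => T (S.c x z)) (𝓝 0) := by
      rw [mem_map]
      have := (S.ev0_iff (p := fun x => x ∈ N)).1 hN
      filter_upwards [this] with z hz
      exact ⟨_, hz, rfl⟩
    exact h1 this

lemma PF.inj (hL : ∀ f : X → ℂ, (∀ b, S.Hol f b) → (∃ C : ℝ, ∀ x, ‖f x‖ ≤ C) → ∀ x y, f x = f y)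
    (hD : ∀ a, ∀ N ∈ 𝓝 a, ∃ b ∈ N, ∃ T, S.PF T b)
    {T : X → ℂ} {b : X} (h : S.PF T b) {x y : X} (hx : x ≠ b) (hy : y ≠ b) (e : T x = T y) :
    x = y := by
  by_contra hxy
  obtain ⟨U, V, hU, hV, hxU, hyV, hd⟩ := t2_separation hxy
  have h1 : T '' (U ∩ {z | z ≠ b}) ∈ 𝓝 (T x) := Hol.open S (h.hol x hx) (PF.not_const S h hx _)
    (Filter.inter_mem (hU.mem_nhds hxU) (isOpen_ne.mem_nhds hx))
  rw [e] at h1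
  have h2 := (Hol.continuousAt S (h.hol y hy)) h1
  rw [mem_map] at h2
  obtain ⟨b', ⟨hb'1, hb'2, hb'3⟩, T', hT'⟩ := hD y _ (Filter.inter_mem h2
    (Filter.inter_mem (hV.mem_nhds hyV) (isOpen_ne.mem_nhds hy)))
  obtain ⟨x', ⟨hx'1, hx'2⟩, hx'3⟩ := hb'1
  refine PF.sep S hL h hT' (Ne.symm hb'3) hx'2 ?_ hx'3
  rintro rfl
  exact disjoint_left.1 hd hx'1 hb'2

lemma PF.miss (hX : ¬ CompactSpace X)
    {T : X → ℂ} {b : X} (h : S.PF T b)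
    (hinj : ∀ x y, x ≠ b → y ≠ b → T x = T y → x = y) : ∃ w, ∀ x, x ≠ b → T x ≠ w := by
  by_contra hcon
  push Not at hcon
  choose g hg hTg using hcon
  have hgT : ∀ x, x ≠ b → g (T x) = x := fun x hx => hinj _ _ (hg _) hx (hTg _)
  have hgc : Continuous g := by
    rw [continuous_iff_continuousAt]
    intro w N hN
    rw [mem_map]
    have h1 := Hol.open S (h.hol _ (hg w)) (PF.not_const S h (hg w) _)
      (Filter.inter_mem hN (isOpen_ne.mem_nhds (hg w)))
    rw [hTg] at h1
    filter_upwards [h1] with v hv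
    obtain ⟨x, hx, rfl⟩ := hv
    rw [mem_preimage, hgT x hx.2]
    exact hx.1
  have hb3 : closedBall (0 : ℂ) 1 ⊆ ball 0 3 := closedBall_subset_ball (by norm_num)
  have hNb : S.c b '' closedBall 0 1 ∈ 𝓝 b := by
    rw [← S.map_nhds0 b]
    exact image_mem_map (closedBall_mem_nhds 0 (by norm_num))
  obtain ⟨C, hC⟩ := h.bdd _ hNb
  apply hX
  have hc : IsCompact (S.c b '' closedBall 0 1 ∪ g '' closedBall 0 C) :=
    (S.isCompact_im (isCompact_closedBall _ _) hb3).union ((isCompact_closedBall _ _).image hgc)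
  rw [← isCompact_univ_iff]
  convert hc
  symm
  rw [eq_univ_iff_forall]
  intro x
  by_cases hx : x ∈ S.c b '' closedBall 0 1
  · exact Or.inl hx
  · refine Or.inr ⟨T x, mem_closedBall_zero_iff.2 (hC x hx), hgT x ?_⟩
    rintro rfl
    exact hx (mem_of_mem_nhds hNb)

/-- **Theorem U**: uniformization. -/
theorem uniformize [Nonempty X] (hX : ¬ CompactSpace X)
    (hL : ∀ f : X → ℂ, (∀ b, S.Hol f b) → (∃ C : ℝ, ∀ x, ‖f x‖ ≤ C) → ∀ x y, f x = f y)
    (hlog : ∀ f : X → ℂ, (∀ b, S.Hol f b) → (∀ x, f x ≠ 0) →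
      ∃ ξ : X → ℂ, (∀ b, S.Hol ξ b) ∧ ∀ x, f x = exp (ξ x))
    (hdip : ∀ (a : X) (σ : ℂ) (u : X → ℝ) (F : ℂ → ℂ), AnalyticAt ℂ F 0 → (∀ x, x ≠ a → S.HmX u x) →
      (∀ᶠ z in 𝓝 (0 : ℂ), z ≠ 0 → u (S.c a z) = (σ / z + F z).re) →
      ∃ (Q : X → ℂ) (G : ℂ → ℂ), (∀ x, x ≠ a → S.Hol Q x) ∧ (∀ x, x ≠ a → (Q x).re = u x) ∧
        AnalyticAt ℂ G 0 ∧ ∀ᶠ z in 𝓝 (0 : ℂ), z ≠ 0 → Q (S.c a z) = σ / z + G z) :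
    ∃ ζ : X → ℂ, (∀ b, S.Hol ζ b) ∧ Function.Bijective ζ := by
  classical
  have hD : ∀ a, ∀ N ∈ 𝓝 a, ∃ b ∈ N, ∃ T, S.PF T b := by
    intro a N hN
    obtain ⟨σ, u, F, C, hσ, hF, hu, he, hC⟩ := S.dipole hX a
    obtain ⟨Q, G, hQ, hre, hG, hQe⟩ := hdip a σ u F hF hu he
    refine S.exPF a hN hσ hQ hG hQe (C := C) ?_
    intro x hx
    have hxa : x ≠ a := by
      rintro rfl
      exact hx ⟨0, by simp, S.zero x⟩
    rw [hre x hxa]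
    exact hC x hx
  obtain ⟨a⟩ := ‹Nonempty X›
  obtain ⟨b, -, T, hT⟩ := hD a univ univ_mem
  have hinj : ∀ x y, x ≠ b → y ≠ b → T x = T y → x = y := fun x y hx hy e =>
    PF.inj S hL hD hT hx hy e
  obtain ⟨w, hw⟩ := PF.miss S hX hT hinj
  set ζ : X → ℂ := Function.update (fun x => 1 / (T x - w)) b 0 with hζ
  have hζb : ζ b = 0 := by simp [hζ]
  have hζx : ∀ x, x ≠ b → ζ x = 1 / (T x - w) := fun x hx => by rw [hζ, Function.update_of_ne hx]
  have hζn : ∀ x, x ≠ b → ζ x ≠ 0 := fun x hx => by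
    rw [hζx x hx]; exact one_div_ne_zero (sub_ne_zero.2 (hw x hx))
  have hhol : ∀ x, S.Hol ζ x := by
    intro x
    by_cases hx : x = b
    · rw [hx]
      obtain ⟨g, hg, g0, he⟩ := hT.pole
      have hk : AnalyticAt ℂ (fun z => z / (g z - w * z)) 0 :=
        analyticAt_id.div (hg.sub (analyticAt_const.mul analyticAt_id)) (by simpa using g0)
      have := Hol.update S (b := b) (f := fun x => 1 / (T x - w)) hk (by
        filter_upwards [he] with z hz hz0
        rw [← hz hz0]
        have e : T (S.c b z) * z - w * z = (T (S.c b z) - w) * z := by ring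
        rw [e, ← div_div, div_right_comm, div_self hz0])
      simp only [zero_div] at this
      exact this
    · refine Hol.update_ne S ?_ hx
      exact AnalyticAt.div analyticAt_const ((hT.hol x hx).sub analyticAt_const)
        (by simpa [S.zero] using sub_ne_zero.2 (hw x hx))
  have hζinj : Function.Injective ζ := by
    intro x y e
    by_cases hx : x = b
    · by_cases hy : y = b
      · rw [hx, hy]
      · rw [hx, hζb] at e
        exact absurd e.symm (hζn y hy)
    · by_cases hy : y = b
      · rw [hy, hζb] at e
        exact absurd e (hζn x hx)
      · rw [hζx x hx, hζx y hy, one_div, one_div, inv_inj] at e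
        exact hinj x y hx hy (sub_left_injective e)
  refine ⟨ζ, hhol, hζinj, ?_⟩
  intro v
  by_contra hv
  push Not at hv
  obtain ⟨ξ, hξ, hξe⟩ := hlog (fun x => ζ x - v) (fun x => (hhol x).sub analyticAt_const)
    (fun x => sub_ne_zero.2 (hv x))
  have hξinj : Function.Injective ξ := by
    intro x y e
    apply hζinj
    have := (hξe x).trans ((congrArg exp e).trans (hξe y).symm)
    exact sub_left_injective this
  have h13 : (1 : ℂ) ∈ ball (0 : ℂ) 3 := by simp
  have hop : ξ '' univ ∈ 𝓝 (ξ a) := by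
    refine Hol.open S (hξ a) ?_ univ_mem
    intro h
    rw [S.ev0_iff] at h
    obtain ⟨r, hr, h'⟩ := eventually_nhds_iff_ball.1
      (h.and (ball_mem_nhds (0 : ℂ) (by norm_num : (0 : ℝ) < 3)))
    have hmem : ((r / 2 : ℝ) : ℂ) ∈ ball (0 : ℂ) r := by
      rw [mem_ball_zero_iff, norm_real, Real.norm_eq_abs, abs_of_pos (by positivity)]; linarith
    have h1 := hξinj (h' _ hmem).1
    refine S.ne_of_c (h' _ hmem).2 ?_ h1
    norm_cast
    linarith
  obtain ⟨r, hr, hball⟩ := Metric.mem_nhds_iff.1 hop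
  have hfar : ∀ x, r ≤ ‖ξ x - (ξ a + 2 * Real.pi * I)‖ := by
    intro x
    by_contra h
    push Not at h
    have : ξ x - 2 * Real.pi * I ∈ ball (ξ a) r := by
      rw [mem_ball, dist_eq_norm]
      have e : ξ x - 2 * Real.pi * I - ξ a = ξ x - (ξ a + 2 * Real.pi * I) := by ring
      rw [e]; exact h
    obtain ⟨y, -, hy⟩ := hball this
    have e : exp (ξ y) = exp (ξ x) := by
      rw [hy, exp_sub, exp_two_pi_mul_I, div_one]
    rw [← hξe, ← hξe] at e
    have := hζinj (sub_left_injective e)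
    rw [this] at hy
    have h0 : (2 * Real.pi * I : ℂ) = 0 := by linear_combination hy
    exact two_pi_I_ne_zero h0
  have hne : ∀ x, ξ x - (ξ a + 2 * Real.pi * I) ≠ 0 := by
    intro x h
    have := hfar x
    rw [h, norm_zero] at this
    linarith
  have hcst := hL (fun x => 1 / (ξ x - (ξ a + 2 * Real.pi * I)))
    (fun x => AnalyticAt.div analyticAt_const ((hξ x).sub analyticAt_const)
        (by simpa [S.zero] using hne x)) ⟨1 / r, fun x => by
      rw [norm_div, norm_one]
      exact one_div_le_one_div_of_le hr (hfar x)⟩ (S.c a 1) a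
  simp only [one_div, inv_inj] at hcst
  exact S.ne_of_c h13 one_ne_zero (hξinj (sub_left_injective hcst))

end
end RS
end Suz

namespace Suz
open Complex Metric Set Filter Topology

/-- germ-type solution sheaf with local uniqueness up to deck maps -/
structure Sheaf (Sol : (ℂ² → ℂ) → ℂ² → Prop) : Prop where
  congr : ∀ R R' x, Sol R x → R =ᶠ[𝓝 x] R' → Sol R' x
  loc : ∀ x, ∃ R, ∀ᶠ y in 𝓝 x, Sol R y
  uniq : ∀ (U : Set ℂ²) R₁ R₂, Convex ℝ U → IsOpen U → U.Nonempty →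
    (∀ x ∈ U, Sol R₁ x) → (∀ x ∈ U, Sol R₂ x) →
    ∃ e : ℂ → ℂ, (∀ x ∈ U, R₁ x = e (R₂ x)) ∧ ∀ R x, Sol R x → Sol (fun y => e (R y)) x

namespace Sheaf
variable {Sol : (ℂ² → ℂ) → ℂ² → Prop} (hS : Sheaf Sol)

def Good (Sol : (ℂ² → ℂ) → ℂ² → Prop) (C : Set ℂ²) : Prop :=
  ∃ U, IsOpen U ∧ C ⊆ U ∧ ∃ R, ∀ x ∈ U, Sol R x

lemma Good.mono {C D : Set ℂ²} (h : Good Sol D) (hCD : C ⊆ D) : Good Sol C := by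
  obtain ⟨U, hU, hDU, hR⟩ := h
  exact ⟨U, hU, hCD.trans hDU, hR⟩

include hS in
lemma glue {C₁ C₂ : Set ℂ²} (h1 : IsCompact C₁) (k1 : Convex ℝ C₁) (h2 : IsCompact C₂)
    (k2 : Convex ℝ C₂) (g1 : Good Sol C₁) (g2 : Good Sol C₂) : Good Sol (C₁ ∪ C₂) := by
  classical
  obtain ⟨U1, o1, s1, R1, r1⟩ := g1
  obtain ⟨U2, o2, s2, R2, r2⟩ := g2
  obtain ⟨ε1, e1, t1⟩ := h1.exists_thickening_subset_open o1 s1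
  obtain ⟨ε2, e2, t2⟩ := h2.exists_thickening_subset_open o2 s2
  set V1 := thickening ε1 C₁ with hV1
  set V2 := thickening ε2 C₂ with hV2
  have c1 : Convex ℝ V1 := k1.thickening _
  have c2 : Convex ℝ V2 := k2.thickening _
  have p1 : IsOpen V1 := isOpen_thickening
  have p2 : IsOpen V2 := isOpen_thickening
  have : ∃ e : ℂ → ℂ, (∀ x ∈ V1 ∩ V2, R1 x = e (R2 x)) ∧ ∀ R x, Sol R x → Sol (fun y => e (R y)) x := by
    by_cases hne : (V1 ∩ V2).Nonempty
    · exact hS.uniq _ R1 R2 (c1.inter c2) (p1.inter p2) hne (fun x hx => r1 x (t1 hx.1))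
        (fun x hx => r2 x (t2 hx.2))
    · refine ⟨id, fun x hx => absurd ⟨x, hx⟩ hne, fun R x h => h⟩
  obtain ⟨e, he, heS⟩ := this
  refine ⟨V1 ∪ V2, p1.union p2, union_subset_union (self_subset_thickening e1 _)
    (self_subset_thickening e2 _), fun x => if x ∈ V1 then R1 x else e (R2 x), ?_⟩
  rintro x (hx | hx)
  · refine hS.congr _ _ x (r1 x (t1 hx)) ?_
    filter_upwards [p1.mem_nhds hx] with y hy
    rw [if_pos hy]
  · refine hS.congr _ _ x (heS _ x (r2 x (t2 hx))) ?_
    filter_upwards [p2.mem_nhds hx] with y hy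
    split_ifs with h
    · exact (he y ⟨h, hy⟩).symm
    · rfl

include hS in
lemma slice {C : Set ℂ²} (hC : IsCompact C) (hc : Convex ℝ C) (ℓ : ℂ² →L[ℝ] ℝ)
    (h : ∀ t, Good Sol (C ∩ {x | ℓ x = t})) : Good Sol C := by
  have hcl : ∀ s t, IsCompact (C ∩ {x | s ≤ ℓ x ∧ ℓ x ≤ t}) := fun s t =>
    hC.inter_right ((isClosed_le continuous_const ℓ.continuous).inter
      (isClosed_le ℓ.continuous continuous_const))
  have hcv : ∀ s t, Convex ℝ (C ∩ {x | s ≤ ℓ x ∧ ℓ x ≤ t}) := fun s t =>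
    hc.inter ((convex_halfSpace_ge ℓ.toLinearMap.isLinear s).inter
      (convex_halfSpace_le ℓ.toLinearMap.isLinear t))
  -- local
  have hloc : ∀ t, ∃ δ > 0, Good Sol (C ∩ {x | t - δ ≤ ℓ x ∧ ℓ x ≤ t + δ}) := by
    intro t
    obtain ⟨U, hU, hs, R, hR⟩ := h t
    have hK : IsCompact (ℓ '' (C \ U)) := (hC.diff hU).image ℓ.continuous
    have ht : t ∈ (ℓ '' (C \ U))ᶜ := by
      rintro ⟨x, hx, hxt⟩
      exact hx.2 (hs ⟨hx.1, hxt⟩)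
    obtain ⟨δ, hδ, hb⟩ := Metric.isOpen_iff.1 hK.isClosed.isOpen_compl t ht
    refine ⟨δ / 2, by positivity, U, hU, ?_, R, hR⟩
    rintro x ⟨hxC, hx1, hx2⟩
    by_contra hxU
    refine hb (a := ℓ x) ?_ ⟨x, ⟨hxC, hxU⟩, rfl⟩
    rw [mem_ball, Real.dist_eq, abs_lt]
    constructor <;> linarith
  choose δ hδ hg using hloc
  obtain ⟨M, hM⟩ := hC.exists_bound_of_continuousOn (f := ℓ) ℓ.continuous.continuousOn
  set B := |M| with hB
  have hab : -B ≤ B := by have := abs_nonneg M; linarith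
  obtain ⟨t, t0, tm, ⟨m, tM⟩, tc⟩ := exists_monotone_Icc_subset_open_cover_Icc hab
    (c := fun s : ℝ => {x : Icc (-B) B | (x : ℝ) ∈ ball s (δ s)})
    (fun s => isOpen_ball.preimage continuous_subtype_val)
    (fun x _ => mem_iUnion.2 ⟨(x : ℝ), mem_ball_self (hδ _)⟩)
  have hstep : ∀ n, Good Sol (C ∩ {x | -B ≤ ℓ x ∧ ℓ x ≤ t n}) := by
    intro n
    induction n with
    | zero =>
      refine (hg (-B)).mono ?_
      rintro x ⟨hxC, hx1, hx2⟩
      rw [t0] at hx2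
      change ℓ x ≤ -B at hx2
      exact ⟨hxC, by linarith [hδ (-B)], by linarith [hδ (-B)]⟩
    | succ n ih =>
      obtain ⟨s, hs⟩ := tc n
      have hle : t n ≤ t (n + 1) := tm (Nat.le_succ n)
      have g2 : Good Sol (C ∩ {x | (t n : ℝ) ≤ ℓ x ∧ ℓ x ≤ t (n + 1)}) := by
        refine (hg s).mono ?_
        rintro x ⟨hxC, hx1, hx2⟩
        have h1 := hs (left_mem_Icc.2 hle)
        have h2 := hs (right_mem_Icc.2 hle)
        have h1' : |(t n : ℝ) - s| < δ s := h1
        have h2' : |(t (n + 1) : ℝ) - s| < δ s := h2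
        rw [abs_lt] at h1' h2'
        exact ⟨hxC, by linarith, by linarith⟩
      refine (glue hS (hcl _ _) (hcv _ _) (hcl _ _) (hcv _ _) ih g2).mono ?_
      rintro x ⟨hxC, hx1, hx2⟩
      rcases le_total (ℓ x) (t n) with h | h
      · exact Or.inl ⟨hxC, hx1, h⟩
      · exact Or.inr ⟨hxC, h, hx2⟩
  refine (hstep m).mono ?_
  intro x hx
  have := (abs_le.1 ((hM x hx).trans (le_abs_self M)))
  refine ⟨hx, this.1, ?_⟩
  rw [tM m le_rfl]
  exact this.2

include hS in
lemma good {C : Set ℂ²} (hC : IsCompact C) (hc : Convex ℝ C) : Good Sol C := by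
  set ℓ1 : ℂ² →L[ℝ] ℝ := reCLM.comp (ContinuousLinearMap.fst ℝ ℂ ℂ)
  set ℓ2 : ℂ² →L[ℝ] ℝ := imCLM.comp (ContinuousLinearMap.fst ℝ ℂ ℂ)
  set ℓ3 : ℂ² →L[ℝ] ℝ := reCLM.comp (ContinuousLinearMap.snd ℝ ℂ ℂ)
  set ℓ4 : ℂ² →L[ℝ] ℝ := imCLM.comp (ContinuousLinearMap.snd ℝ ℂ ℂ)
  have cl : ∀ (ℓ : ℂ² →L[ℝ] ℝ) t, IsClosed {x | ℓ x = t} := fun ℓ t =>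
    isClosed_eq ℓ.continuous continuous_const
  have cv : ∀ (ℓ : ℂ² →L[ℝ] ℝ) t, Convex ℝ {x | ℓ x = t} := fun ℓ t =>
    convex_hyperplane ℓ.toLinearMap.isLinear t
  refine slice hS hC hc ℓ1 fun t1 => ?_
  refine slice hS (hC.inter_right (cl _ _)) (hc.inter (cv _ _)) ℓ2 fun t2 => ?_
  refine slice hS ((hC.inter_right (cl _ _)).inter_right (cl _ _)) ((hc.inter (cv _ _)).inter (cv _ _)) ℓ3 fun t3 => ?_
  refine slice hS (((hC.inter_right (cl _ _)).inter_right (cl _ _)).inter_right (cl _ _))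
    (((hc.inter (cv _ _)).inter (cv _ _)).inter (cv _ _)) ℓ4 fun t4 => ?_
  obtain ⟨R, hR⟩ := hS.loc (⟨t1, t2⟩, ⟨t3, t4⟩)
  obtain ⟨U, hU, hUo, hxU⟩ := _root_.mem_nhds_iff.1 hR
  refine ⟨U, hUo, ?_, R, hU⟩
  rintro ⟨x, y⟩ ⟨⟨⟨⟨-, h1⟩, h2⟩, h3⟩, h4⟩
  change x.re = t1 at h1
  change x.im = t2 at h2
  change y.re = t3 at h3
  change y.im = t4 at h4
  have : (x, y) = ((⟨t1, t2⟩, ⟨t3, t4⟩) : ℂ²) := Prod.ext (Complex.ext h1 h2) (Complex.ext h3 h4)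
  rw [this]
  exact hxU

include hS in
/-- **Lemma M**: global solutions exist. -/
theorem exists_global : ∃ R, ∀ x, Sol R x := by
  have hball : ∀ n : ℕ, ∃ R, ∀ x ∈ ball (0 : ℂ²) (n + 1), Sol R x := by
    intro n
    obtain ⟨U, -, hU, R, hR⟩ := good hS (isCompact_closedBall (0 : ℂ²) (n + 1)) (convex_closedBall _ _)
    exact ⟨R, fun x hx => hR x (hU (ball_subset_closedBall hx))⟩
  have hstep : ∀ (n : ℕ) (R : {R // ∀ x ∈ ball (0 : ℂ²) (n + 1), Sol R x}),
      ∃ R' : {R // ∀ x ∈ ball (0 : ℂ²) ((n + 1 : ℕ) + 1), Sol R x},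
        ∀ x ∈ ball (0 : ℂ²) (n + 1), R'.1 x = R.1 x := by
    rintro n ⟨R, hR⟩
    obtain ⟨R', hR'⟩ := hball (n + 1)
    have hsub : ball (0 : ℂ²) (n + 1) ⊆ ball 0 ((n + 1 : ℕ) + 1) := ball_subset_ball (by push_cast; linarith)
    obtain ⟨e, he, heS⟩ := hS.uniq (ball (0 : ℂ²) (n + 1)) R R' (convex_ball _ _) isOpen_ball
      ⟨0, mem_ball_self (by positivity)⟩ hR (fun x hx => hR' x (hsub hx))
    exact ⟨⟨fun y => e (R' y), fun x hx => heS _ x (hR' x hx)⟩, fun x hx => (he x hx).symm⟩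
  choose f hf using hstep
  obtain ⟨R0, hR0⟩ := hball 0
  let g : ∀ n : ℕ, {R // ∀ x ∈ ball (0 : ℂ²) (n + 1), Sol R x} := fun n =>
    Nat.rec ⟨R0, hR0⟩ (fun n R => f n R) n
  have hg : ∀ n : ℕ, ∀ x ∈ ball (0 : ℂ²) (n + 1), (g (n + 1)).1 x = (g n).1 x := fun n x hx => hf n (g n) x hx
  have hg2 : ∀ n k : ℕ, ∀ x ∈ ball (0 : ℂ²) (n + 1), (g (n + k)).1 x = (g n).1 x := by
    intro n k x hx
    induction k with
    | zero => rfl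
    | succ k ih =>
      rw [← ih]
      exact hg (n + k) x (ball_subset_ball (by push_cast; linarith [(Nat.cast_nonneg k : (0:ℝ) ≤ k)]) hx)
  refine ⟨fun x => (g ⌈‖x‖⌉₊).1 x, fun x => ?_⟩
  obtain ⟨n, hn⟩ := exists_nat_gt ‖x‖
  have hxn : x ∈ ball (0 : ℂ²) n := mem_ball_zero_iff.2 hn
  refine hS.congr _ _ x ((g n).2 x (ball_subset_ball (by linarith) hxn)) ?_
  filter_upwards [isOpen_ball.mem_nhds hxn] with y hy
  have hyn : ‖y‖ < n := mem_ball_zero_iff.1 hy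
  have h1 : ⌈‖y‖⌉₊ ≤ n := Nat.ceil_le.2 hyn.le
  obtain ⟨k, hk⟩ := Nat.exists_eq_add_of_le h1
  have := hg2 ⌈‖y‖⌉₊ k y (by
    rw [mem_ball_zero_iff]
    linarith [Nat.le_ceil ‖y‖])
  rw [← hk] at this
  exact this

end Sheaf
end Suz

namespace Suz
open Complex Metric Set Filter Topology

lemma push1 {y T : ℂ → ℂ} {x : ℂ} (hy : AnalyticAt ℂ y x) (hnc : ¬ ∀ᶠ x' in 𝓝 x, y x' = y x)
    (hT : AnalyticAt ℂ (fun x' => T (y x')) x) : AnalyticAt ℂ T (y x) := by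
  have hop : 𝓝 (y x) ≤ map y (𝓝 x) := hy.eventually_constant_or_nhds_le_map_nhds.resolve_left hnc
  have hd : ∀ᶠ t in 𝓝[≠] x, deriv y t ≠ 0 := by
    refine hy.deriv.eventually_eq_zero_or_eventually_ne_zero.resolve_left fun h => hnc ?_
    obtain ⟨r, hr, hb⟩ := eventually_nhds_iff_ball.1 (h.and hy.eventually_analyticAt)
    filter_upwards [ball_mem_nhds x hr] with t ht
    exact isOpen_ball.is_const_of_deriv_eq_zero (convex_ball x r).isPreconnected
      (fun s hs => (hb s hs).2.differentiableAt.differentiableWithinAt)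
      (fun s hs => (hb s hs).1) ht (mem_ball_self hr)
  have hd' : ∀ᶠ t in 𝓝 x, t ≠ x → deriv y t ≠ 0 := eventually_nhdsWithin_iff.1 hd
  have h1 : ∀ᶠ w in 𝓝 (y x), w ≠ y x → AnalyticAt ℂ T w := by
    refine hop ?_
    change ∀ᶠ t in 𝓝 x, y t ≠ y x → AnalyticAt ℂ T (y t)
    filter_upwards [hd', hy.eventually_analyticAt, hT.eventually_analyticAt] with t h1 h2 h3 hne
    have hd := h1 (fun h => hne (by rw [h]))
    obtain ⟨⟨U, hU, hi⟩, -⟩ := inj_of_deriv h2 hd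
    obtain ⟨g, hg, hg1, hg2⟩ := inj_inverse h2 hU hi
    have hgt : g (y t) = t := hg1.self_of_nhds
    have : AnalyticAt ℂ (fun w => T (y (g w))) (y t) := by
      have h3' : AnalyticAt ℂ (fun x' => T (y x')) (g (y t)) := by rw [hgt]; exact h3
      exact h3'.comp hg
    refine this.congr ?_
    filter_upwards [hg2] with w hw
    rw [hw]
  refine Complex.analyticAt_of_differentiable_on_punctured_nhds_of_continuousAt ?_ ?_
  · rw [eventually_nhdsWithin_iff]
    filter_upwards [h1] with w hw hne
    exact (hw hne).differentiableAt
  · have : Tendsto T (map y (𝓝 x)) (𝓝 (T (y x))) := tendsto_map'_iff.2 hT.continuousAt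
    exact this.mono_left hop

variable {F : Type*} [NormedAddCommGroup F] [NormedSpace ℂ F]

lemma exists_line {y : F → ℂ} {x : F} (hy : AnalyticAt ℂ y x) (hnc : ¬ ∀ᶠ x' in 𝓝 x, y x' = y x) :
    ∃ v : F, ¬ ∀ᶠ t in 𝓝 (0 : ℂ), y (x + t • v) = y x := by
  by_contra hcon
  push Not at hcon
  apply hnc
  obtain ⟨r, hr, hb⟩ := eventually_nhds_iff_ball.1 hy.eventually_analyticAt
  filter_upwards [ball_mem_nhds x hr] with x' hx'
  have hl : ∀ t : ℂ, AnalyticAt ℂ (fun t : ℂ => x + t • (x' - x)) t := fun t =>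
    analyticAt_const.add (analyticAt_id.smul analyticAt_const)
  set D := {t : ℂ | x + t • (x' - x) ∈ ball x r} with hD
  have hDe : D = (fun t : ℂ => t • (x' - x)) ⁻¹' ball 0 r := by
    ext t
    change x + t • (x' - x) ∈ ball x r ↔ t • (x' - x) ∈ ball 0 r
    simp
  have hDc : Convex ℝ D := by
    rw [hDe]
    exact (convex_ball (0 : F) r).is_linear_preimage
      ⟨fun a b => add_smul _ _ _, fun c a => smul_assoc c a _⟩
  have h0 : (0 : ℂ) ∈ D := by change x + (0 : ℂ) • (x' - x) ∈ ball x r; simpa using hr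
  have h1 : (1 : ℂ) ∈ D := by change x + (1 : ℂ) • (x' - x) ∈ ball x r; simpa using hx'
  have := AnalyticOnNhd.eqOn_of_preconnected_of_eventuallyEq (𝕜 := ℂ) (f := fun t : ℂ => y (x + t • (x' - x)))
    (g := fun _ => y x) (U := D) (fun t ht => AnalyticAt.comp (f := fun t : ℂ => x + t • (x' - x)) (hb _ ht) (hl t)) (fun t _ => analyticAt_const)
    hDc.isPreconnected h0 (hcon _) h1
  simpa using this

lemma push {y : F → ℂ} {T : ℂ → ℂ} {x : F} (hy : AnalyticAt ℂ y x) (hnc : ¬ ∀ᶠ x' in 𝓝 x, y x' = y x)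
    (hT : AnalyticAt ℂ (fun x' => T (y x')) x) : AnalyticAt ℂ T (y x) := by
  obtain ⟨v, hv⟩ := exists_line hy hnc
  have hl : AnalyticAt ℂ (fun t : ℂ => x + t • v) 0 :=
    analyticAt_const.add (analyticAt_id.smul analyticAt_const)
  have h0 : x + (0 : ℂ) • v = x := by simp
  have h1 : AnalyticAt ℂ (fun t : ℂ => y (x + t • v)) 0 := AnalyticAt.comp (by rw [h0]; exact hy) hl
  have h2 : AnalyticAt ℂ (fun t : ℂ => T (y (x + t • v))) 0 :=
    AnalyticAt.comp (g := fun x' => T (y x')) (by rw [h0]; exact hT) hl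
  have := push1 h1 (by simpa using hv) h2
  simpa using this

lemma open_at {y : F → ℂ} {x : F} (hy : AnalyticAt ℂ y x) (hnc : ¬ ∀ᶠ x' in 𝓝 x, y x' = y x) :
    map y (𝓝 x) = 𝓝 (y x) :=
  le_antisymm hy.continuousAt (hy.eventually_constant_or_nhds_le_map_nhds.resolve_left hnc)

/-- analytic with eventually zero real part is eventually constant -/
lemma const_of_re {D : F → ℂ} {x : F} (hD : AnalyticAt ℂ D x) (h : ∀ᶠ x' in 𝓝 x, (D x').re = 0) :
    ∀ᶠ x' in 𝓝 x, D x' = D x := by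
  refine hD.eventually_constant_or_nhds_le_map_nhds.resolve_right fun hle => ?_
  have h1 : ∀ᶠ w in 𝓝 (D x), w.re = 0 := hle h
  have h2 : Tendsto (fun t : ℝ => D x + t) (𝓝[≠] 0) (𝓝 (D x)) := by
    have : Continuous (fun t : ℝ => D x + t) := by fun_prop
    have := (this.tendsto 0).mono_left (nhdsWithin_le_nhds (s := {0}ᶜ))
    simpa using this
  obtain ⟨t, ht, ht0⟩ := ((h2.eventually h1).and self_mem_nhdsWithin).exists
  have hx := h.self_of_nhds
  simp [hx] at ht
  exact ht0 ht

/-- Gluing local solutions which agree up to the action of a group. -/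
lemma global_of_local {G : Type*} [Group G] [MulAction G ℂ] (L : ℂ² → ℂ² → ℂ)
    (hfree : ∀ x (g g' : G), (∀ᶠ x' in 𝓝 x, g • L x x' = g' • L x x') → g = g')
    (hloc : ∀ x, ∀ᶠ y in 𝓝 x, ∃ g : G, ∀ᶠ x' in 𝓝 y, L x x' = g • L y x') :
    ∃ R : ℂ² → ℂ, ∀ x, ∃ g : G, ∀ᶠ x' in 𝓝 x, R x' = g • L x x' := by
  refine Sheaf.exists_global (Sol := fun R x => ∃ g : G, ∀ᶠ x' in 𝓝 x, R x' = g • L x x') ⟨?_, ?_, ?_⟩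
  · rintro R R' x ⟨g, hg⟩ he
    refine ⟨g, ?_⟩
    filter_upwards [hg, he] with x' h1 h2
    rw [← h2, h1]
  · intro x
    exact ⟨L x, hloc x⟩
  · intro U R₁ R₂ hc ho hne h1 h2
    have hl : ∀ x ∈ U, ∃ g : G, ∀ᶠ x' in 𝓝 x, R₁ x' = g • R₂ x' := by
      intro x hx
      obtain ⟨g1, e1⟩ := h1 x hx
      obtain ⟨g2, e2⟩ := h2 x hx
      refine ⟨g1 * g2⁻¹, ?_⟩
      filter_upwards [e1, e2] with x' k1 k2
      rw [k1, k2, mul_smul, inv_smul_smul]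
    have hu : ∀ x ∈ U, ∀ g g' : G, (∀ᶠ x' in 𝓝 x, R₁ x' = g • R₂ x') →
        (∀ᶠ x' in 𝓝 x, R₁ x' = g' • R₂ x') → g = g' := by
      intro x hx g g' k k'
      obtain ⟨g2, e2⟩ := h2 x hx
      have : g * g2 = g' * g2 := by
        refine hfree x _ _ ?_
        filter_upwards [k, k', e2] with x' a b c
        rw [mul_smul, mul_smul, ← c, ← a, ← b]
      exact mul_right_cancel this
    obtain ⟨x0, hx0⟩ := hne
    obtain ⟨g, hg⟩ := hl x0 hx0
    have key : U ⊆ {x | ∀ᶠ x' in 𝓝 x, R₁ x' = g • R₂ x'} := by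
      refine hc.isPreconnected.subset_left_of_subset_union (u := {x | ∀ᶠ x' in 𝓝 x, R₁ x' = g • R₂ x'})
        (v := {x | ∃ g', g' ≠ g ∧ x ∈ U ∧ ∀ᶠ x' in 𝓝 x, R₁ x' = g' • R₂ x'}) ?_ ?_ ?_ ?_ ⟨x0, hx0, hg⟩
      · exact isOpen_setOfPred_eventually_nhds
      · rw [isOpen_iff_eventually]
        rintro x ⟨g', hne, hx, h⟩
        filter_upwards [h.eventually_nhds, ho.mem_nhds hx] with x' h' hx'
        exact ⟨g', hne, hx', h'⟩
      · rw [Set.disjoint_left]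
        rintro x ha ⟨g', hne, hx, h⟩
        exact hne (hu x hx _ _ h ha)
      · intro x hx
        obtain ⟨g', h⟩ := hl x hx
        by_cases hg' : g' = g
        · left; rw [hg'] at h; exact h
        · exact Or.inr ⟨g', hg', hx, h⟩
    refine ⟨fun w => g • w, fun x hx => (key hx).self_of_nhds, ?_⟩
    rintro R x ⟨g', h⟩
    refine ⟨g * g', ?_⟩
    filter_upwards [h] with x' hx'
    rw [hx', mul_smul]

/-- locally constant on a preconnected set -/
lemma const_on_preconn {X : Type*} [TopologicalSpace X] {C : Set X} (hC : IsPreconnected C) {R : X → ℂ}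
    (h : ∀ x ∈ C, ∀ᶠ x' in 𝓝[C] x, R x' = R x) {x x' : X} (hx : x ∈ C) (hx' : x' ∈ C) : R x = R x' := by
  refine hC.induction₂ (fun a b => R a = R b) (fun a ha => ?_) (fun a b c _ _ _ => Eq.trans)
    (fun a b _ _ => Eq.symm) hx hx'
  filter_upwards [h a ha] with b hb
  exact hb.symm

end Suz

namespace Suz
open Complex Metric Set Filter Topology BoundedContinuousFunction

lemma bil {K : ℝ → ℝ → ℂ} (hK : Continuous (Function.uncurry K)) (a b c d : ℝ) :
    ∃ L : (ℝ →ᵇ ℂ) →L[ℂ] (ℝ →ᵇ ℂ) →L[ℂ] ℂ,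
      ∀ g h, L g h = ∫ θ in a..b, g θ * ∫ θ' in c..d, h θ' * K θ θ' := by
  have hin : ∀ (h : ℝ →ᵇ ℂ) θ, IntervalIntegrable (fun θ' => h θ' * K θ θ') MeasureTheory.volume c d := by
    intro h θ
    apply Continuous.intervalIntegrable
    have : Continuous (fun θ' => K θ θ') := hK.comp (by fun_prop : Continuous fun θ' : ℝ => (θ, θ'))
    exact h.continuous.mul this
  have hcont : ∀ h : ℝ →ᵇ ℂ, Continuous fun θ => ∫ θ' in c..d, h θ' * K θ θ' := by
    intro h
    apply intervalIntegral.continuous_parametric_intervalIntegral_of_continuous'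
    exact (h.continuous.comp continuous_snd).mul hK
  have hout : ∀ g h : ℝ →ᵇ ℂ, IntervalIntegrable (fun θ => g θ * ∫ θ' in c..d, h θ' * K θ θ')
      MeasureTheory.volume a b := fun g h => (g.continuous.mul (hcont h)).intervalIntegrable _ _
  obtain ⟨M, hM⟩ := ((isCompact_uIcc (a := a) (b := b)).prod (isCompact_uIcc (a := c) (b := d))).exists_bound_of_continuousOn
    (f := Function.uncurry K) hK.continuousOn
  let B := LinearMap.mk₂ ℂ (fun g h : ℝ →ᵇ ℂ => ∫ θ in a..b, g θ * ∫ θ' in c..d, h θ' * K θ θ')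
    (by
      intro g1 g2 h
      rw [← intervalIntegral.integral_add (hout g1 h) (hout g2 h)]
      congr 1; ext θ
      simp only [BoundedContinuousFunction.coe_add, Pi.add_apply]
      ring)
    (by
      intro k g h
      rw [smul_eq_mul, ← intervalIntegral.integral_const_mul]
      congr 1; ext θ
      simp only [BoundedContinuousFunction.coe_smul, smul_eq_mul]
      ring)
    (by
      intro g h1 h2
      rw [← intervalIntegral.integral_add (hout g h1) (hout g h2)]
      congr 1; ext θ
      rw [← mul_add, ← intervalIntegral.integral_add (hin h1 θ) (hin h2 θ)]
      congr 2; ext θ'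
      simp only [BoundedContinuousFunction.coe_add, Pi.add_apply]
      ring)
    (by
      intro k g h
      rw [smul_eq_mul, ← intervalIntegral.integral_const_mul]
      congr 1; ext θ
      rw [mul_left_comm, ← intervalIntegral.integral_const_mul k]
      congr 2; ext θ'
      simp only [BoundedContinuousFunction.coe_smul, smul_eq_mul]
      ring)
  refine ⟨B.mkContinuous₂ (M * |d - c| * |b - a|) ?_, fun g h => rfl⟩
  intro g h
  change ‖∫ θ in a..b, g θ * ∫ θ' in c..d, h θ' * K θ θ'‖ ≤ _
  have : ‖∫ θ in a..b, g θ * ∫ θ' in c..d, h θ' * K θ θ'‖ ≤ (‖g‖ * (‖h‖ * M * |d - c|)) * |b - a| := by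
    apply intervalIntegral.norm_integral_le_of_norm_le_const
    intro θ hθ
    rw [norm_mul]
    refine mul_le_mul (g.norm_coe_le_norm θ) ?_ (norm_nonneg _) (norm_nonneg _)
    apply intervalIntegral.norm_integral_le_of_norm_le_const
    intro θ' hθ'
    rw [norm_mul]
    exact mul_le_mul (h.norm_coe_le_norm θ') (hM (θ, θ') ⟨uIoc_subset_uIcc hθ, uIoc_subset_uIcc hθ'⟩)
      (norm_nonneg _) (norm_nonneg _)
  refine this.trans (le_of_eq ?_)
  ring

/-- the Cauchy kernel as an analytic function with values in a Banach algebra -/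
lemma kernel (a : ℂ) {r : ℝ} (hr : 0 < r) : ∃ k : ℂ → (ℝ →ᵇ ℂ), (∀ x ∈ ball a r, AnalyticAt ℂ k x) ∧
    ∀ x ∈ ball a r, ∀ θ, k x θ = (circleMap a r θ - x)⁻¹ := by
  let e : ℝ →ᵇ ℂ := BoundedContinuousFunction.ofNormedAddCommGroup (fun θ => circleMap a r θ)
    (continuous_circleMap a r) (‖a‖ + r) (fun θ => by
      have h2 : circleMap a r θ = a + (circleMap a r θ - a) := by ring
      rw [h2]
      refine (norm_add_le _ _).trans ?_
      have := circleMap_mem_sphere a hr.le θ; rw [mem_sphere_iff_norm] at this; linarith)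
  have hu : ∀ x ∈ ball a r, IsUnit (e - x • (1 : ℝ →ᵇ ℂ)) := by
    intro x hx
    have hx' : ‖x - a‖ < r := by rwa [← mem_ball_iff_norm]
    have hne : ∀ θ, r - ‖x - a‖ ≤ ‖circleMap a r θ - x‖ := by
      intro θ
      have h1 : ‖circleMap a r θ - a‖ = r := mem_sphere_iff_norm.1 (circleMap_mem_sphere a hr.le θ)
      have h2 := norm_sub_norm_le (circleMap a r θ - a) (x - a)
      rw [h1, sub_sub_sub_cancel_right] at h2
      exact h2
    let i : ℝ →ᵇ ℂ := BoundedContinuousFunction.ofNormedAddCommGroup (fun θ => (circleMap a r θ - x)⁻¹)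
      (((continuous_circleMap a r).sub continuous_const).inv₀ (fun θ h0 => by
        have := hne θ
        change circleMap a r θ - x = 0 at h0
        rw [h0, norm_zero] at this
        linarith)) (r - ‖x - a‖)⁻¹ (fun θ => by
        rw [norm_inv]
        exact inv_anti₀ (by linarith) (hne θ))
    refine IsUnit.of_mul_eq_one i ?_
    ext θ
    have h0 : circleMap a r θ - x ≠ 0 := by
      intro h0
      have := hne θ
      rw [h0, norm_zero] at this
      linarith
    have : (circleMap a r θ - x) * (circleMap a r θ - x)⁻¹ = 1 := mul_inv_cancel₀ h0
    simpa [e, i] using this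
  refine ⟨fun x => Ring.inverse (e - x • (1 : ℝ →ᵇ ℂ)), ?_, ?_⟩
  · intro x hx
    have h1 : AnalyticAt ℂ (fun x : ℂ => e - x • (1 : ℝ →ᵇ ℂ)) x :=
      analyticAt_const.sub (analyticAt_id.smul analyticAt_const)
    have h2 := analyticAt_inverse (𝕜 := ℂ) (hu x hx).unit
    exact AnalyticAt.comp (g := Ring.inverse) (f := fun x : ℂ => e - x • (1 : ℝ →ᵇ ℂ)) h2 h1
  · intro x hx θ
    have h := Ring.mul_inverse_cancel _ (hu x hx)
    have h' := congrArg (fun f : ℝ →ᵇ ℂ => f θ) h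
    have h3 : (circleMap a r θ - x) * (Ring.inverse (e - x • (1 : ℝ →ᵇ ℂ))) θ = 1 := by simpa [e] using h'
    exact eq_inv_of_mul_eq_one_right h3

lemma cauchy_real {f : ℂ → ℂ} {a : ℂ} {r : ℝ} (h : DiffContOnCl ℂ f (ball a r)) {x : ℂ} (hx : x ∈ ball a r) :
    f x = ∫ θ in (0 : ℝ)..2 * Real.pi, (circleMap a r θ - x)⁻¹ *
      ((2 * Real.pi * I)⁻¹ * deriv (circleMap a r) θ * f (circleMap a r θ)) := by
  have h1 := h.circleIntegral_sub_inv_smul hx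
  have h2 : (2 * (Real.pi : ℂ) * I) ≠ 0 := by simp [Real.pi_ne_zero]
  rw [circleIntegral, smul_eq_mul] at h1
  have h3 : f x = (2 * (Real.pi : ℂ) * I)⁻¹ * ((2 * (Real.pi : ℂ) * I) * f x) := by
    rw [← mul_assoc, inv_mul_cancel₀ h2, one_mul]
  rw [h3, ← h1, ← intervalIntegral.integral_const_mul]
  congr 1; ext θ
  simp only [smul_eq_mul]
  ring

lemma cont_dcm (a : ℂ) (r : ℝ) : Continuous (deriv (circleMap a r)) := by
  have : deriv (circleMap a r) = fun θ => circleMap 0 r θ * I := by ext θ; exact deriv_circleMap a r θ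
  rw [this]
  exact (continuous_circleMap 0 r).mul continuous_const

/-- Osgood -/
theorem osgood {f : ℂ² → ℂ} {a b : ℂ} {r : ℝ} (hr : 0 < r)
    (hc : ContinuousOn f (closedBall a r ×ˢ closedBall b r))
    (h1 : ∀ y ∈ closedBall b r, DifferentiableOn ℂ (fun x => f (x, y)) (ball a r))
    (h2 : ∀ x ∈ closedBall a r, DifferentiableOn ℂ (fun y => f (x, y)) (ball b r)) :
    AnalyticAt ℂ f (a, b) := by
  have D1 : ∀ y ∈ closedBall b r, DiffContOnCl ℂ (fun x => f (x, y)) (ball a r) := fun y hy =>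
    ⟨h1 y hy, by
      rw [closure_ball a hr.ne']
      exact hc.comp (by fun_prop) (fun x hx => ⟨hx, hy⟩)⟩
  have D2 : ∀ x ∈ closedBall a r, DiffContOnCl ℂ (fun y => f (x, y)) (ball b r) := fun y hy =>
    ⟨h2 y hy, by
      rw [closure_ball b hr.ne']
      exact hc.comp (by fun_prop) (fun x hx => ⟨hy, hx⟩)⟩
  obtain ⟨k1, ka1, kv1⟩ := kernel a hr
  obtain ⟨k2, ka2, kv2⟩ := kernel b hr
  set C : ℂ := (2 * Real.pi * I)⁻¹ with hC
  have m1 : ∀ θ, circleMap a r θ ∈ closedBall a r := fun θ => circleMap_mem_closedBall a hr.le θ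
  have m2 : ∀ θ, circleMap b r θ ∈ closedBall b r := fun θ => circleMap_mem_closedBall b hr.le θ
  obtain ⟨L, hL⟩ := bil (K := fun θ θ' => C * deriv (circleMap a r) θ * (C * deriv (circleMap b r) θ' *
    f (circleMap a r θ, circleMap b r θ'))) (by
      have e1 : Continuous fun p : ℝ × ℝ => f (circleMap a r p.1, circleMap b r p.2) := by
        rw [← continuousOn_univ]
        refine hc.comp (Continuous.continuousOn ?_) (fun p _ => ⟨m1 _, m2 _⟩)
        exact ((continuous_circleMap a r).comp continuous_fst).prodMk
          ((continuous_circleMap b r).comp continuous_snd)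
      have e2 := (cont_dcm a r).comp (continuous_fst (X := ℝ) (Y := ℝ))
      have e3 := (cont_dcm b r).comp (continuous_snd (X := ℝ) (Y := ℝ))
      exact (continuous_const.mul e2).mul ((continuous_const.mul e3).mul e1)) 0 (2 * Real.pi) 0 (2 * Real.pi)
  have hf : ∀ x ∈ ball a r, ∀ y ∈ ball b r, f (x, y) = L (k1 x) (k2 y) := by
    intro x hx y hy
    rw [hL, cauchy_real (D1 y (ball_subset_closedBall hy)) hx]
    congr 1; ext θ
    rw [kv1 x hx, cauchy_real (D2 _ (m1 θ)) hy, ← intervalIntegral.integral_const_mul]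
    congr 2; ext θ'
    rw [kv2 y hy]
    ring
  have hA : AnalyticAt ℂ (fun p : ℂ² => L (k1 p.1) (k2 p.2)) (a, b) := by
    have e1 : AnalyticAt ℂ (fun p : ℂ² => k1 p.1) (a, b) :=
      AnalyticAt.comp (f := Prod.fst) (ka1 a (mem_ball_self hr)) analyticAt_fst
    have e2 : AnalyticAt ℂ (fun p : ℂ² => k2 p.2) (a, b) :=
      AnalyticAt.comp (f := Prod.snd) (ka2 b (mem_ball_self hr)) analyticAt_snd
    exact AnalyticAt.comp (g := fun q : (ℝ →ᵇ ℂ) × (ℝ →ᵇ ℂ) => L q.1 q.2)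
      (f := fun p : ℂ² => (k1 p.1, k2 p.2)) (L.analyticAt_bilinear _) (e1.prod e2)
  refine hA.congr ?_
  filter_upwards [prod_mem_nhds (ball_mem_nhds a hr) (ball_mem_nhds b hr)] with p hp
  exact (hf p.1 hp.1 p.2 hp.2).symm

lemma analytic_of_sep {f : ℂ² → ℂ} {U : Set ℂ²} (hU : IsOpen U) (hc : ContinuousOn f U)
    (h1 : ∀ p ∈ U, DifferentiableAt ℂ (fun x => f (x, p.2)) p.1)
    (h2 : ∀ p ∈ U, DifferentiableAt ℂ (fun y => f (p.1, y)) p.2) : AnalyticOnNhd ℂ f U := by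
  rintro ⟨a, b⟩ hp
  obtain ⟨ε, hε, hb⟩ := Metric.isOpen_iff.1 hU _ hp
  have hsub : closedBall a (ε / 2) ×ˢ closedBall b (ε / 2) ⊆ U := by
    rw [closedBall_prod_same]
    exact (closedBall_subset_ball (by linarith)).trans hb
  refine osgood (r := ε / 2) (by positivity) (hc.mono hsub) ?_ ?_
  · intro y hy x hx
    exact (h1 (x, y) (hsub ⟨ball_subset_closedBall hx, hy⟩)).differentiableWithinAt
  · intro x hx y hy
    exact (h2 (x, y) (hsub ⟨hx, ball_subset_closedBall hy⟩)).differentiableWithinAt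

theorem analyticOn_of_diff {f : ℂ² → ℂ} {U : Set ℂ²} (hU : IsOpen U) (h : DifferentiableOn ℂ f U) :
    AnalyticOnNhd ℂ f U := by
  refine analytic_of_sep hU h.continuousOn ?_ ?_
  · intro p hp
    exact DifferentiableAt.comp (g := f) (f := fun x : ℂ => (x, p.2)) p.1 (h.differentiableAt (hU.mem_nhds hp))
      (by fun_prop)
  · intro p hp
    exact DifferentiableAt.comp (g := f) (f := fun x : ℂ => (p.1, x)) p.2 (h.differentiableAt (hU.mem_nhds hp))
      (by fun_prop)

theorem analytic_of_diff {f : ℂ² → ℂ} (h : Differentiable ℂ f) (x : ℂ²) : AnalyticAt ℂ f x :=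
  analyticOn_of_diff isOpen_univ h.differentiableOn x (mem_univ x)

/-- holomorphic dependence on parameters, one variable -/
lemma diff_integral1 {f : ℝ → ℂ → ℂ} (hc : Continuous (Function.uncurry f)) (hd : ∀ t, Differentiable ℂ (f t))
    (a b : ℝ) : Differentiable ℂ (fun x => ∫ t in a..b, f t x) := by
  intro x0
  obtain ⟨k, ka, kv⟩ := kernel x0 one_pos
  set C : ℂ := (2 * Real.pi * I)⁻¹ with hC
  obtain ⟨L, hL⟩ := bil (K := fun t θ => C * deriv (circleMap x0 1) θ * f t (circleMap x0 1 θ)) (by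
      have e1 : Continuous fun p : ℝ × ℝ => f p.1 (circleMap x0 1 p.2) :=
        hc.comp (continuous_fst.prodMk ((continuous_circleMap x0 1).comp continuous_snd))
      have e3 := (cont_dcm x0 1).comp (continuous_snd (X := ℝ) (Y := ℝ))
      exact (continuous_const.mul e3).mul e1) a b 0 (2 * Real.pi)
  have hf : ∀ x ∈ ball x0 1, ∫ t in a..b, f t x = L 1 (k x) := by
    intro x hx
    rw [hL]
    congr 1; ext t
    rw [cauchy_real (hd t).diffContOnCl hx]
    simp only [BoundedContinuousFunction.coe_one, Pi.one_apply, one_mul]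
    congr 1; ext θ
    rw [kv x hx]
  have hA : DifferentiableAt ℂ (fun x => L 1 (k x)) x0 :=
    (L 1).differentiableAt.comp x0 (ka x0 (mem_ball_self one_pos)).differentiableAt
  refine hA.congr_of_eventuallyEq ?_
  filter_upwards [ball_mem_nhds x0 one_pos] with x hx
  exact hf x hx

theorem diff_integral {f : ℝ → ℂ² → ℂ} (hc : Continuous (Function.uncurry f)) (hd : ∀ t, Differentiable ℂ (f t))
    (a b : ℝ) : Differentiable ℂ (fun x => ∫ t in a..b, f t x) := by
  intro p
  refine (analytic_of_sep isOpen_univ ?_ ?_ ?_ p (mem_univ p)).differentiableAt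
  · apply Continuous.continuousOn
    apply intervalIntegral.continuous_parametric_intervalIntegral_of_continuous'
    exact hc.comp continuous_swap
  · intro p _
    exact diff_integral1 (f := fun t x => f t (x, p.2)) (hc.comp (by fun_prop :
      Continuous fun q : ℝ × ℂ => (q.1, (q.2, p.2)))) (fun t => (hd t).comp (by fun_prop)) a b p.1
  · intro p _
    exact diff_integral1 (f := fun t x => f t (p.1, x)) (hc.comp (by fun_prop :
      Continuous fun q : ℝ × ℂ => (q.1, (p.1, q.2)))) (fun t => (hd t).comp (by fun_prop)) a b p.2

end Suz

namespace Suz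
open Complex Metric Set Filter Topology

lemma exists_log {U : Set ℂ²} (hc : Convex ℝ U) (ho : IsOpen U) {f : ℂ² → ℂ} (hf : AnalyticOnNhd ℂ f U)
    (h0 : ∀ x ∈ U, f x ≠ 0) : ∃ R : ℂ² → ℂ, AnalyticOnNhd ℂ R U ∧ ∀ x ∈ U, exp (R x) = f x := by
  rcases U.eq_empty_or_nonempty with rfl | hne
  · exact ⟨0, by simp [AnalyticOnNhd], by simp⟩
  have hcs : ContractibleSpace U := hc.contractibleSpace hne
  obtain ⟨R, hR, he⟩ := Complex.exists_continuousOn_eqOn_exp_comp (U := U)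
    (show IsSimplyConnected U from inferInstanceAs (SimplyConnectedSpace U)) ho hf.continuousOn
    (by rintro ⟨x, hx, h⟩; exact h0 x hx h)
  refine ⟨R, ?_, he⟩
  intro x hx
  have hd : deriv exp (R x) ≠ 0 := by rw [Complex.deriv_exp]; exact exp_ne_zero _
  obtain ⟨⟨V, hV, hi⟩, -⟩ := inj_of_deriv (f := exp) (x := R x) (analyticAt_cexp) hd
  obtain ⟨g, hg, hg1, hg2⟩ := inj_inverse (f := exp) (x := R x) (analyticAt_cexp) hV hi
  have hc := hR.continuousAt (ho.mem_nhds hx)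
  have hex : exp (R x) = f x := he hx
  have : AnalyticAt ℂ (fun x' => g (f x')) x :=
    AnalyticAt.comp (by rw [← hex]; exact hg) (hf x hx)
  refine this.congr ?_
  filter_upwards [hc.eventually hg1, ho.mem_nhds hx] with x' h1 h2
  have h3 : exp (R x') = f x' := he h2
  rw [← h3]
  exact h1

noncomputable abbrev dxy (p q : ℂ) : ℂ² →L[ℂ] ℂ :=
  p • ContinuousLinearMap.fst ℂ ℂ ℂ + q • ContinuousLinearMap.snd ℂ ℂ ℂ

lemma poincare {U : Set ℂ²} (hc : Convex ℝ U) (ho : IsOpen U) {p q : ℂ² → ℂ}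
    (hp : DifferentiableOn ℂ p U) (hq : DifferentiableOn ℂ q U)
    (hcl : ∀ a ∈ U, fderiv ℂ p a (0, 1) = fderiv ℂ q a (1, 0)) :
    ∃ f : ℂ² → ℂ, ∀ a ∈ U, HasFDerivAt f (dxy (p a) (q a)) a := by
  have hd : ∀ a ∈ U, HasFDerivAt (fun a => dxy (p a) (q a))
      ((fderiv ℂ p a).smulRight (ContinuousLinearMap.fst ℂ ℂ ℂ) +
        (fderiv ℂ q a).smulRight (ContinuousLinearMap.snd ℂ ℂ ℂ)) a := by
    intro a ha
    have h1 : HasFDerivAt (fun a => p a • ContinuousLinearMap.fst ℂ ℂ ℂ)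
      ((fderiv ℂ p a).smulRight (ContinuousLinearMap.fst ℂ ℂ ℂ)) a :=
      (hp.differentiableAt (ho.mem_nhds ha)).hasFDerivAt.smul_const (ContinuousLinearMap.fst ℂ ℂ ℂ)
    have h2 : HasFDerivAt (fun a => q a • ContinuousLinearMap.snd ℂ ℂ ℂ)
      ((fderiv ℂ q a).smulRight (ContinuousLinearMap.snd ℂ ℂ ℂ)) a :=
      (hq.differentiableAt (ho.mem_nhds ha)).hasFDerivAt.smul_const (ContinuousLinearMap.snd ℂ ℂ ℂ)
    exact h1.add h2
  suffices h : ∃ f : ℂ² → ℂ, ∀ a ∈ U, HasFDerivWithinAt f (dxy (p a) (q a)) U a by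
    obtain ⟨f, hf⟩ := h
    exact ⟨f, fun a ha => (hf a ha).hasFDerivAt (ho.mem_nhds ha)⟩
  refine hc.exists_forall_hasFDerivWithinAt_of_hasFDerivWithinAt_symmetric
    (ω := fun a => dxy (p a) (q a)) (fun a ha => ((hd a ha).restrictScalars ℝ).hasFDerivWithinAt) ?_
  intro a ha x hx y hy
  change ((fderiv ℂ p a).smulRight (ContinuousLinearMap.fst ℂ ℂ ℂ) +
        (fderiv ℂ q a).smulRight (ContinuousLinearMap.snd ℂ ℂ ℂ)) x y =
        ((fderiv ℂ p a).smulRight (ContinuousLinearMap.fst ℂ ℂ ℂ) +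
        (fderiv ℂ q a).smulRight (ContinuousLinearMap.snd ℂ ℂ ℂ)) y x
  have hL : ∀ (L : ℂ² →L[ℂ] ℂ) (v : ℂ²), L v = v.1 * L (1, 0) + v.2 * L (0, 1) := by
    intro L v
    have : v = v.1 • ((1, 0) : ℂ²) + v.2 • ((0, 1) : ℂ²) := by ext <;> simp
    conv_lhs => rw [this, map_add, map_smul, map_smul]
    simp
  simp only [add_apply, ContinuousLinearMap.smulRight_apply, smul_apply,
    ContinuousLinearMap.coe_fst', ContinuousLinearMap.coe_snd', smul_eq_mul]
  rw [hL (fderiv ℂ p a) x, hL (fderiv ℂ q a) x, hL (fderiv ℂ p a) y, hL (fderiv ℂ q a) y, hcl a ha]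
  ring

/-- A holomorphic foliation-like equivalence relation on the plane. -/
structure Fol (r : Setoid ℂ²) : Prop where
  chart : ∀ a, ∃ (W : Set ℂ²) (y : ℂ² → ℂ), IsOpen W ∧ a ∈ W ∧ (∀ x x', r x x' → x ∈ W → x' ∈ W) ∧
    DifferentiableOn ℂ y W ∧ (∀ x ∈ W, ∀ x' ∈ W, y x = y x' ↔ r x x')
  closed : IsClosed {p : ℂ² × ℂ² | r p.1 p.2}
  conn : ∀ x, IsPreconnected {x' | r x x'}
  inv : ∃ h : ℂ² → ℂ, Differentiable ℂ h ∧ (∀ x x', r x x' → h x = h x') ∧ ∃ x x', h x ≠ h x'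

namespace Fol
variable {r : Setoid ℂ²} (hF : Fol r)

include hF in
lemma thin (x a : ℂ²) : ¬ ∀ᶠ x' in 𝓝 x, r a x' := by
  intro hc
  obtain ⟨h, hd, hr, b, c, hbc⟩ := hF.inv
  have := AnalyticOnNhd.eqOn_of_preconnected_of_eventuallyEq (𝕜 := ℂ) (f := h) (g := fun _ => h a) (U := univ)
    (fun t _ => analytic_of_diff hd t) (fun _ _ => analyticAt_const) isPreconnected_univ (mem_univ x)
    (by filter_upwards [hc] with x' hx'; exact (hr _ _ hx').symm)
  exact hbc ((this (mem_univ b)).trans (this (mem_univ c)).symm)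

include hF in
lemma chart_open {W : Set ℂ²} {y : ℂ² → ℂ} (hW : IsOpen W) (hd : DifferentiableOn ℂ y W)
    (hy : ∀ x ∈ W, ∀ x' ∈ W, y x = y x' ↔ r x x') {x : ℂ²} (hx : x ∈ W) :
    ¬ ∀ᶠ x' in 𝓝 x, y x' = y x := by
  intro hc
  refine hF.thin x x ?_
  filter_upwards [hc, hW.mem_nhds hx] with x' h1 h2
  exact (hy x hx x' h2).1 h1.symm

include hF in
lemma chart3 (a : ℂ²) : ∃ (W : Set ℂ²) (y : ℂ² → ℂ), IsOpen W ∧ a ∈ W ∧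
    (∀ x x', r x x' → x ∈ W → x' ∈ W) ∧
    DifferentiableOn ℂ y W ∧ (∀ x ∈ W, ∀ x' ∈ W, y x = y x' ↔ r x x') ∧ y a = 0 ∧
    (∀ x ∈ W, y x ∈ ball (0 : ℂ) 3) ∧ (∀ z ∈ ball (0 : ℂ) 3, ∃ x ∈ W, y x = z) := by
  obtain ⟨W, y, hW, ha, hs, hd, hy⟩ := hF.chart a
  have hop := open_at (analyticOn_of_diff hW hd a ha) (hF.chart_open hW hd hy ha)
  have h1 : y '' W ∈ 𝓝 (y a) := by rw [← hop]; exact image_mem_map (hW.mem_nhds ha)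
  obtain ⟨ε, hε, hb⟩ := Metric.mem_nhds_iff.1 h1
  have hε0 : (ε : ℂ) ≠ 0 := by exact_mod_cast hε.ne'
  have key : ∀ x, (3 / ε * (y x - y a) ∈ ball (0 : ℂ) 3 ↔ y x ∈ ball (y a) ε) := by
    intro x
    rw [mem_ball_zero_iff, mem_ball_iff_norm, norm_mul, norm_div, Complex.norm_real, Real.norm_of_nonneg hε.le]
    simp only [Complex.norm_ofNat]
    rw [div_mul_eq_mul_div, div_lt_iff₀ hε, mul_lt_mul_iff_right₀ (by norm_num : (0 : ℝ) < 3)]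
  refine ⟨W ∩ y ⁻¹' ball (y a) ε, fun x => 3 / ε * (y x - y a), hd.continuousOn.isOpen_inter_preimage hW isOpen_ball,
    ⟨ha, mem_ball_self hε⟩, ?_, ?_, ?_, by simp, ?_, ?_⟩
  · rintro x x' hr ⟨hx, hx2⟩
    refine ⟨hs x x' hr hx, ?_⟩
    have := (hy x hx x' (hs x x' hr hx)).2 hr
    change y x' ∈ Metric.ball (y a) ε
    rw [← this]; exact hx2
  · exact ((hd.mono inter_subset_left).sub_const _).const_mul _
  · intro x hx x' hx'
    rw [← hy x hx.1 x' hx'.1]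
    have h3 : (3 / ε : ℂ) ≠ 0 := div_ne_zero (by norm_num) hε0
    constructor
    · intro h
      have := mul_left_cancel₀ h3 h
      exact sub_left_injective this
    · intro h; simp only [h]
  · intro x hx
    exact (key x).2 hx.2
  · intro z hz
    have : y a + ε / 3 * z ∈ ball (y a) ε := by
      rw [mem_ball_iff_norm, add_sub_cancel_left, norm_mul, norm_div, Complex.norm_real, Real.norm_of_nonneg hε.le]
      rw [mem_ball_zero_iff] at hz
      simp only [Complex.norm_ofNat]
      rw [div_mul_eq_mul_div, div_lt_iff₀ (by norm_num)]
      exact mul_lt_mul_of_pos_left hz hε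
    obtain ⟨x, hx, hxe⟩ := hb this
    refine ⟨x, ⟨hx, by change y x ∈ Metric.ball (y a) ε; rw [hxe]; exact this⟩, ?_⟩
    simp only [hxe]
    field_simp
    ring

include hF in
lemma openQ : IsOpenQuotientMap (Quotient.mk r) := by
  refine ⟨Quotient.mk_surjective, continuous_quot_mk, ?_⟩
  intro U hU
  rw [← isQuotientMap_quotient_mk'.isOpen_preimage, isOpen_iff_eventually]
  rintro x ⟨x0, hx0, he⟩
  have hr : r x0 x := Quotient.exact he
  obtain ⟨W, y, hW, ha, hs, hd, hy⟩ := hF.chart x0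
  have hxW := hs _ _ hr ha
  have hop := open_at (analyticOn_of_diff hW hd x0 ha) (hF.chart_open hW hd hy ha)
  have h1 : y '' (W ∩ U) ∈ 𝓝 (y x) := by
    rw [← (hy x0 ha x hxW).2 hr, ← hop]; exact image_mem_map (inter_mem (hW.mem_nhds ha) (hU.mem_nhds hx0))
  filter_upwards [(hd.continuousOn.continuousAt (hW.mem_nhds hxW)).eventually h1, hW.mem_nhds hxW] with x' h2 h3
  obtain ⟨x1, ⟨hx1, hx1U⟩, he1⟩ := h2
  exact ⟨x1, hx1U, Quotient.sound ((hy x1 hx1 x' h3).1 he1)⟩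

include hF in
lemma t2 : T2Space (Quotient r) := by
  rw [t2Space_iff_of_isOpenQuotientMap hF.openQ]
  convert hF.closed using 1
  ext p
  exact Quotient.eq

include hF in
lemma noncompact : ¬ CompactSpace (Quotient r) := by
  intro hX
  obtain ⟨h, hd, hr, b, c, hbc⟩ := hF.inv
  let f : Quotient r → ℂ := Quotient.lift h (fun x x' hx => hr x x' hx)
  have hf : Continuous f := hd.continuous.quotient_lift _
  refine hbc (hd.apply_eq_apply_of_bounded ?_ b c)
  refine (isCompact_range hf).isBounded.subset ?_
  rintro _ ⟨x, rfl⟩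
  exact ⟨Quotient.mk r x, rfl⟩

/-- the Riemann surface structure on the quotient -/
structure Str (r : Setoid ℂ²) where
  S : RS (Quotient r)
  W : Quotient r → Set ℂ²
  y : Quotient r → ℂ² → ℂ
  op : ∀ a, IsOpen (W a)
  sat : ∀ a x x', r x x' → x ∈ W a → x' ∈ W a
  diff : ∀ a, DifferentiableOn ℂ (y a) (W a)
  mem : ∀ x, x ∈ W (Quotient.mk r x)
  c_y : ∀ a, ∀ x ∈ W a, S.c a (y a x) = Quotient.mk r x
  ball : ∀ a, ∀ x ∈ W a, y a x ∈ ball (0 : ℂ) 3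
  y_zero : ∀ x, y (Quotient.mk r x) x = 0
  iff : ∀ a, ∀ x ∈ W a, ∀ x' ∈ W a, y a x = y a x' ↔ r x x'
  nc : ∀ a, ∀ x ∈ W a, ¬ ∀ᶠ x' in 𝓝 x, y a x' = y a x

include hF in
lemma exists_str : Nonempty (Str r) := by
  classical
  choose W y hW ha hs hd hy h0 hb hsurj using hF.chart3
  let W' : Quotient r → Set ℂ² := fun a => W a.out
  let y' : Quotient r → ℂ² → ℂ := fun a => y a.out
  let c : Quotient r → ℂ → Quotient r := fun a z => if h : ∃ x ∈ W' a, y' a x = z then Quotient.mk r h.choose else a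
  have hmem : ∀ x, x ∈ W' (Quotient.mk r x) := fun x =>
    hs _ _ _ (Quotient.exact (Quotient.out_eq (Quotient.mk r x))) (ha _)
  have hcy : ∀ a, ∀ x ∈ W' a, c a (y' a x) = Quotient.mk r x := by
    intro a x hx
    have h : ∃ x' ∈ W' a, y' a x' = y' a x := ⟨x, hx, rfl⟩
    simp only [c]
    rw [dif_pos h]
    exact Quotient.sound ((hy _ _ h.choose_spec.1 _ hx).1 h.choose_spec.2)
  have hnc : ∀ a, ∀ x ∈ W' a, ¬ ∀ᶠ x' in 𝓝 x, y' a x' = y' a x := fun a x hx =>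
    hF.chart_open (hW _) (hd _) (hy _) hx
  have han : ∀ a, ∀ x ∈ W' a, AnalyticAt ℂ (y' a) x := fun a x hx => analyticOn_of_diff (hW _) (hd _) x hx
  have hop : ∀ a, ∀ x ∈ W' a, map (y' a) (𝓝 x) = 𝓝 (y' a x) := fun a x hx => open_at (han a x hx) (hnc a x hx)
  have hzero : ∀ x, y' (Quotient.mk r x) x = 0 := by
    intro x
    rw [← h0 (Quotient.mk r x).out]
    exact ((hy _ _ (ha _) _ (hmem x)).2 (Quotient.exact (Quotient.out_eq (Quotient.mk r x)))).symm
  have hccont : ∀ a, ∀ x ∈ W' a, ContinuousAt (c a) (y' a x) := by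
    intro a x hx
    unfold ContinuousAt
    rw [← hop a x hx, tendsto_map'_iff, hcy a x hx]
    have : Tendsto (Quotient.mk r) (𝓝 x) (𝓝 (Quotient.mk r x)) := continuous_quot_mk.continuousAt
    refine this.congr' ?_
    filter_upwards [(hW _).mem_nhds hx] with x' hx'
    exact (hcy a x' hx').symm
  let S : RS (Quotient r) :=
    { c := c
      zero := by
        intro a
        obtain ⟨x, rfl⟩ := Quotient.mk_surjective a
        have := hcy _ x (hmem x)
        rwa [hzero] at this
      cont := by
        intro a z hz
        obtain ⟨x, hx, rfl⟩ := hsurj a.out z hz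
        exact (hccont a x hx).continuousWithinAt
      inj := by
        intro a z hz w hw he
        obtain ⟨x, hx, rfl⟩ := hsurj a.out z hz
        obtain ⟨x', hx', rfl⟩ := hsurj a.out w hw
        have h1 := hcy a x hx
        have h2 := hcy a x' hx'
        exact (hy _ x hx x' hx').2 (Quotient.exact (h1.symm.trans (he.trans h2)))
      opn := by
        intro a U hU hUo
        have : c a '' U = Quotient.mk r '' (W' a ∩ y' a ⁻¹' U) := by
          ext b
          constructor
          · rintro ⟨z, hz, rfl⟩
            obtain ⟨x, hx, rfl⟩ := hsurj a.out z (hU hz)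
            exact ⟨x, ⟨hx, hz⟩, (hcy a x hx).symm⟩
          · rintro ⟨x, ⟨hx, hz⟩, rfl⟩
            exact ⟨y' a x, hz, hcy a x hx⟩
        rw [this]
        exact hF.openQ.isOpenMap _ ((hd _).continuousOn.isOpen_inter_preimage (hW _) hUo)
      compat := by
        intro a b z w hz hw he
        obtain ⟨x, hx, rfl⟩ := hsurj a.out z hz
        obtain ⟨x', hx', rfl⟩ := hsurj b.out w hw
        have h1 := hcy a x hx
        have h2 := hcy b x' hx'
        have hr : r x' x := Quotient.exact (h2.symm.trans (he.symm.trans h1))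
        have hxb : x ∈ W' b := hs _ _ _ hr hx'
        have hyb : y' b x' = y' b x := (hy _ x' hx' x hxb).2 hr
        have hτ : ∀ x'' ∈ W' a ∩ W' b, y' b (c a (y' a x'')).out = y' b x'' := by
          rintro x'' ⟨k1, k2⟩
          rw [hcy a x'' k1]
          have hrr : r (Quotient.mk r x'').out x'' := Quotient.exact (Quotient.out_eq _)
          exact (hy _ _ (hs _ _ _ (r.symm hrr) k2) _ k2).2 hrr
        have hab : ∀ᶠ x'' in 𝓝 x, x'' ∈ W' a ∩ W' b := ((hW _).inter (hW _)).mem_nhds ⟨hx, hxb⟩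
        refine ⟨fun z => y' b (c a z).out, ?_, ?_, ?_⟩
        · refine push (han a x hx) (hnc a x hx) ?_
          refine (han b x hxb).congr ?_
          filter_upwards [hab] with x'' h
          exact (hτ x'' h).symm
        · exact (hτ x ⟨hx, hxb⟩).trans hyb.symm
        · change ∀ᶠ z' in 𝓝 (y' a x), _
          rw [← hop a x hx, eventually_map]
          filter_upwards [hab] with x'' h
          rw [hτ x'' h, hcy a x'' h.1, hcy b x'' h.2] }
  exact ⟨⟨S, W', y', fun a => hW _, fun a => hs _, fun a => hd _, hmem, hcy, fun a => hb _, hzero, fun a => hy _, hnc⟩⟩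

namespace Str
variable (T : Str r)

lemma an (a : Quotient r) {x : ℂ²} (hx : x ∈ T.W a) : AnalyticAt ℂ (T.y a) x :=
  analyticOn_of_diff (T.op a) (T.diff a) x hx

lemma mapn (a : Quotient r) {x : ℂ²} (hx : x ∈ T.W a) : map (T.y a) (𝓝 x) = 𝓝 (T.y a x) :=
  open_at (T.an a hx) (T.nc a x hx)

lemma hol_iff {f : Quotient r → ℂ} {x : ℂ²} :
    T.S.Hol f (Quotient.mk r x) ↔ AnalyticAt ℂ (fun x => f (Quotient.mk r x)) x := by
  set a := Quotient.mk r x with ha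
  have hx : x ∈ T.W a := T.mem x
  have hev : (fun x' => f (T.S.c a (T.y a x'))) =ᶠ[𝓝 x] fun x => f (Quotient.mk r x) := by
    filter_upwards [(T.op a).mem_nhds hx] with x' hx'
    rw [T.c_y a x' hx']
  have h0 : T.y a x = 0 := T.y_zero x
  constructor
  · intro h
    refine AnalyticAt.congr ?_ hev
    exact AnalyticAt.comp (g := fun z => f (T.S.c a z)) (by rw [h0]; exact h) (T.an a hx)
  · intro h
    have := push (T := fun z => f (T.S.c a z)) (T.an a hx) (T.nc a x hx) (h.congr hev.symm)
    rwa [h0] at this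

lemma dip (hF : Fol r) (a : Quotient r) (σ : ℂ) (u : Quotient r → ℝ) (F : ℂ → ℂ) (hFa : AnalyticAt ℂ F 0)
    (hu : ∀ x, x ≠ a → T.S.HmX u x)
    (he : ∀ᶠ z in 𝓝 (0 : ℂ), z ≠ 0 → u (T.S.c a z) = (σ / z + F z).re) :
    ∃ (Q : Quotient r → ℂ) (G : ℂ → ℂ), (∀ x, x ≠ a → T.S.Hol Q x) ∧ (∀ x, x ≠ a → (Q x).re = u x) ∧
        AnalyticAt ℂ G 0 ∧ ∀ᶠ z in 𝓝 (0 : ℂ), z ≠ 0 → Q (T.S.c a z) = σ / z + G z := by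
  classical
  have hF' : ∀ b : Quotient r, ∃ f : ℂ → ℂ, AnalyticAt ℂ f 0 ∧ (b ≠ a → ∀ᶠ z in 𝓝 (0 : ℂ), u (T.S.c b z) = (f z).re) := by
    intro b
    by_cases hb : b = a
    · exact ⟨0, analyticAt_const, fun h => absurd hb h⟩
    · obtain ⟨f, hf, hfe⟩ := hu b hb
      exact ⟨f, hf, fun _ => hfe⟩
  choose f hfa hfe using hF'
  let q := Quotient.mk r
  -- basic local solution, as a function of the chart variable
  let f' : Quotient r → ℂ → ℂ := fun b z => if b = a then σ / z + F z else f b z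
  let L : ℂ² → ℂ² → ℂ := fun x x' => f' (q x) (T.y (q x) x')
  have hf'ne : ∀ b, b ≠ a → f' b = f b := fun b hb => by ext z; simp [f', hb]
  have hf'a : f' a = fun z => σ / z + F z := by ext z; simp [f']
  have hmemx : ∀ x, ∀ᶠ x' in 𝓝 x, x' ∈ T.W (q x) := fun x => (T.op _).mem_nhds (T.mem x)
  have hty : ∀ x, Tendsto (T.y (q x)) (𝓝 x) (𝓝 0) := by
    intro x
    have := T.mapn (q x) (T.mem x)
    rw [T.y_zero] at this
    exact this.le
  -- away from a, L is analytic with real part u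
  have hA : ∀ x, ∀ᶠ x' in 𝓝 x, q x' ≠ a → AnalyticAt ℂ (L x) x' ∧ (L x x').re = u (q x') := by
    intro x
    by_cases hx : q x = a
    · have hev : ∀ᶠ z in 𝓝 (0 : ℂ), AnalyticAt ℂ F z := hFa.eventually_analyticAt
      filter_upwards [(hty x).eventually hev, (hty x).eventually (hx ▸ he), hmemx x] with x' h1 h2 h3 hne
      have hy0 : T.y (q x) x' ≠ 0 := by
        intro h0
        have h4 := T.c_y (q x) x' h3
        rw [h0, T.S.zero] at h4
        exact hne (h4.symm.trans hx)
      have h5 := h2 hy0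
      rw [T.c_y (q x) x' h3] at h5
      refine ⟨?_, ?_⟩
      · change AnalyticAt ℂ (fun x' => f' (q x) (T.y (q x) x')) x'
        have hA1 : AnalyticAt ℂ (f' (q x)) (T.y (q x) x') := by
          rw [hx] at hy0 h1 ⊢
          rw [hf'a]
          exact (analyticAt_const.div analyticAt_id hy0).add h1
        exact hA1.comp (T.an _ h3)
      · change (f' (q x) (T.y (q x) x')).re = _
        rw [h5]
        have : f' (q x) = fun z => σ / z + F z := by rw [hx]; exact hf'a
        rw [this]
    · have hev : ∀ᶠ z in 𝓝 (0 : ℂ), AnalyticAt ℂ (f (q x)) z := (hfa _).eventually_analyticAt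
      filter_upwards [(hty x).eventually hev, (hty x).eventually (hfe _ hx), hmemx x] with x' h1 h2 h3 hne
      rw [T.c_y (q x) x' h3] at h2
      have hLx : L x = fun x' => f (q x) (T.y (q x) x') := by ext x'; simp only [L]; rw [hf'ne _ hx]
      rw [hLx]
      exact ⟨h1.comp (T.an _ h3), h2.symm⟩
  have hclosed : IsClosed {x : ℂ² | q x = a} := by
    have := hF.t2
    exact isClosed_singleton.preimage (hF.openQ.continuous)
  have hoff : ∀ x, q x ≠ a → ∀ᶠ x' in 𝓝 x, q x' ≠ a := fun x hx => hclosed.isOpen_compl.mem_nhds hx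
  let A : AddSubgroup ℂ := (Complex.reAddGroupHom).ker
  have hAm : ∀ w, w ∈ A ↔ w.re = 0 := fun w => Iff.rfl
  obtain ⟨R, hR⟩ := global_of_local (G := Multiplicative A) L
    (by
      intro x g g' h
      have := h.self_of_nhds
      change ((g.toAdd : A) : ℂ) + L x x = ((g'.toAdd : A) : ℂ) + L x x at this
      have := add_right_cancel this
      exact Multiplicative.toAdd.injective (Subtype.ext this))
    (by
      intro x
      have hoff2 : ∀ᶠ y in 𝓝 x, q x ≠ a → q y ≠ a := by
        by_cases hx : q x = a
        · exact Eventually.of_forall fun y h => absurd hx h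
        · filter_upwards [hoff x hx] with y hy _ using hy
      filter_upwards [(hA x).eventually_nhds, hoff2] with y hy hy2
      by_cases hya : q y = a
      · by_cases hxa : q x = a
        · refine ⟨1, Eventually.of_forall fun x' => ?_⟩
          rw [one_smul]
          simp only [L]
          rw [hxa, hya]
        · exact absurd hya (hy2 hxa)
      · have h1 := hy.and (hoff y hya)
        have h2 := (hA y).and (hoff y hya)
        have h3 : AnalyticAt ℂ (fun x' => L x x' - L y x') y :=
          (h1.self_of_nhds.1 hya).1.sub (h2.self_of_nhds.1 hya).1
        have h4 : ∀ᶠ x' in 𝓝 y, (L x x' - L y x').re = 0 := by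
          filter_upwards [h1, h2] with x' k1 k2
          rw [sub_re, (k1.1 k1.2).2, (k2.1 k2.2).2, sub_self]
        have h5 := const_of_re h3 h4
        refine ⟨Multiplicative.ofAdd (⟨L x y - L y y, h4.self_of_nhds⟩ : A), ?_⟩
        filter_upwards [h5] with x' k
        change L x x' = (L x y - L y y) + L y x'
        rw [← k]; ring)
  have hR' : ∀ x, ∃ κ : ℂ, κ.re = 0 ∧ ∀ᶠ x' in 𝓝 x, R x' = κ + L x x' := by
    intro x
    obtain ⟨g, hg⟩ := hR x
    exact ⟨((g.toAdd : A) : ℂ), (g.toAdd : A).2, hg⟩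
  have hconst : ∀ x x', r x x' → R x = R x' := by
    intro x0 x1 hr
    refine const_on_preconn (hF.conn x0) ?_ (r.refl x0) hr
    intro x hx
    obtain ⟨κ, -, hκ⟩ := hR' x
    filter_upwards [nhdsWithin_le_nhds hκ, self_mem_nhdsWithin] with x' h1 h2
    have hrr : r x x' := r.trans (r.symm hx) h2
    rw [h1, hκ.self_of_nhds]
    simp only [L]
    rw [(T.iff _ x (T.mem x) x' (T.sat _ _ _ hrr (T.mem x))).2 hrr]
  let Q : Quotient r → ℂ := Quotient.lift R hconst
  have hQq : ∀ x, Q (Quotient.mk r x) = R x := fun x => rfl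
  obtain ⟨x0, hx0⟩ := Quotient.mk_surjective a
  obtain ⟨κ0, -, hκ0⟩ := hR' x0
  refine ⟨Q, fun z => κ0 + F z, ?_, ?_, analyticAt_const.add hFa, ?_⟩
  · intro b hb
    obtain ⟨x, rfl⟩ := Quotient.mk_surjective b
    rw [hol_iff]
    obtain ⟨κ, -, hκ⟩ := hR' x
    refine AnalyticAt.congr (analyticAt_const.add ((hA x).self_of_nhds hb).1 : AnalyticAt ℂ (fun x' => κ + L x x') x) ?_
    filter_upwards [hκ] with x' h
    exact h.symm
  · intro b hb
    obtain ⟨x, rfl⟩ := Quotient.mk_surjective b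
    obtain ⟨κ, hκ0, hκ⟩ := hR' x
    rw [hQq, hκ.self_of_nhds, add_re, hκ0, zero_add]
    exact ((hA x).self_of_nhds hb).2
  · have hm := T.mapn a (hx0 ▸ T.mem x0)
    have hy0 : T.y a x0 = 0 := by rw [← hx0]; exact T.y_zero x0
    rw [hy0] at hm
    rw [← hm, eventually_map]
    filter_upwards [hκ0, (T.op a).mem_nhds (hx0 ▸ T.mem x0)] with x' h1 h2 _
    rw [T.c_y a x' h2, hQq, h1]
    have : L x0 x' = σ / T.y a x' + F (T.y a x') := by
      have h3 : q x0 = a := hx0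
      simp only [L]
      rw [h3, hf'a]
    rw [this]; ring

end Str

include hF in
/-- **Theorem U'** -/
theorem exists_coord : ∃ z : ℂ² → ℂ, Differentiable ℂ z ∧ Function.Surjective z ∧
    ∀ x x', z x = z x' ↔ r x x' := by
  obtain ⟨T⟩ := hF.exists_str
  have := hF.t2
  have hpc : PreconnectedSpace (Quotient r) := inferInstance
  have hne : Nonempty (Quotient r) := ⟨Quotient.mk r 0⟩
  have hdiff : ∀ f : Quotient r → ℂ, (∀ b, T.S.Hol f b) → Differentiable ℂ (fun x => f (Quotient.mk r x)) :=
    fun f hf x => (T.hol_iff.1 (hf _)).differentiableAt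
  obtain ⟨ζ, hζ, hb⟩ := T.S.uniformize hF.noncompact
    (by
      rintro f hf ⟨C, hC⟩ a b
      obtain ⟨x, rfl⟩ := Quotient.mk_surjective a
      obtain ⟨x', rfl⟩ := Quotient.mk_surjective b
      refine (hdiff f hf).apply_eq_apply_of_bounded ?_ x x'
      refine (isBounded_iff_forall_norm_le).2 ⟨C, ?_⟩
      rintro _ ⟨y, rfl⟩
      exact hC _)
    (by
      intro f hf h0
      obtain ⟨R, hRa, hR⟩ := exists_log convex_univ isOpen_univ (f := fun x => f (Quotient.mk r x))
        (fun x _ => T.hol_iff.1 (hf _)) (fun x _ => h0 _)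
      have hconst : ∀ x x', r x x' → R x = R x' := by
        intro x0 x1 hr
        refine const_on_preconn (hF.conn x0) ?_ (r.refl x0) hr
        intro x hx
        have hd : deriv exp (R x) ≠ 0 := by rw [Complex.deriv_exp]; exact exp_ne_zero _
        obtain ⟨⟨V, hV, hi⟩, -⟩ := inj_of_deriv (f := exp) (x := R x) (analyticAt_cexp) hd
        filter_upwards [nhdsWithin_le_nhds ((hRa x (mem_univ x)).continuousAt.eventually hV),
          self_mem_nhdsWithin] with x' h1 h2
        refine hi h1 (mem_of_mem_nhds hV) ?_
        rw [hR x (mem_univ _), hR x' (mem_univ _)]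
        exact congrArg f (Quotient.sound (r.trans (r.symm h2) hx))
      refine ⟨Quotient.lift R hconst, ?_, ?_⟩
      · intro b
        obtain ⟨x, rfl⟩ := Quotient.mk_surjective b
        rw [T.hol_iff]
        exact hRa x (mem_univ x)
      · intro b
        obtain ⟨x, rfl⟩ := Quotient.mk_surjective b
        exact (hR x (mem_univ x)).symm)
    (T.dip hF)
  refine ⟨fun x => ζ (Quotient.mk r x), hdiff ζ hζ, hb.surjective.comp Quotient.mk_surjective, ?_⟩
  intro x x'
  exact hb.injective.eq_iff.trans Quotient.eq

end Fol

lemma deriv_cauchy {f : ℂ → ℂ} {x : ℂ} {r : ℝ} (hr : 0 < r) (hd : DifferentiableOn ℂ f (closedBall x (2 * r))) :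
    deriv f x = ∫ t in (0 : ℝ)..2 * Real.pi, (2 * Real.pi * I)⁻¹ * (deriv (circleMap x r) t *
      (((circleMap x r t - x) ^ 2)⁻¹ * f (circleMap x r t))) := by
  have h := Complex.two_pi_I_inv_smul_circleIntegral_sub_sq_inv_smul_of_differentiable
    (f := f) (U := ball x (2 * r)) (c := x) (w₀ := x) (R := r) isOpen_ball
    (closedBall_subset_ball (by linarith)) (hd.mono ball_subset_closedBall) (mem_ball_self hr)
  rw [← h, circleIntegral, smul_eq_mul, intervalIntegral.integral_const_mul]
  rfl

lemma cont_deriv {T : Type*} [TopologicalSpace T] {f : T → ℂ → ℂ} {x : ℂ} {r : ℝ} (hr : 0 < r)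
    (hc : Continuous (fun p : T × ℝ => f p.1 (circleMap x r p.2)))
    (hd : ∀ t, DifferentiableOn ℂ (f t) (closedBall x (2 * r))) : Continuous (fun t => deriv (f t) x) := by
  have : (fun t => deriv (f t) x) = fun t => ∫ θ in (0 : ℝ)..2 * Real.pi, (2 * Real.pi * I)⁻¹ * (deriv (circleMap x r) θ *
      (((circleMap x r θ - x) ^ 2)⁻¹ * f t (circleMap x r θ))) := by
    ext t; exact deriv_cauchy hr (hd t)
  rw [this]
  apply intervalIntegral.continuous_parametric_intervalIntegral_of_continuous'
  have e1 : Continuous fun p : T × ℝ => ((circleMap x r p.2 - x) ^ 2)⁻¹ := by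
    have : Continuous fun θ : ℝ => ((circleMap x r θ - x) ^ 2)⁻¹ := by
      apply Continuous.inv₀
      · exact ((continuous_circleMap x r).sub continuous_const).pow 2
      · intro θ
        simp [hr.ne']
    exact this.comp continuous_snd
  exact continuous_const.mul (((cont_dcm x r).comp continuous_snd).mul (e1.mul hc))

lemma deriv_int {f : ℝ → ℂ → ℂ} (hc : Continuous (Function.uncurry f)) (hd : ∀ t, Differentiable ℂ (f t))
    (a b : ℝ) (x : ℂ) : Continuous (fun t => deriv (f t) x) ∧
    HasDerivAt (fun x => ∫ t in a..b, f t x) (∫ t in a..b, deriv (f t) x) x := by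
  have hcd : Continuous (fun t => deriv (f t) x) := by
    refine cont_deriv (r := 1) one_pos ?_ (fun t => (hd t).differentiableOn)
    exact hc.comp (continuous_fst.prodMk ((continuous_circleMap x 1).comp continuous_snd))
  refine ⟨hcd, ?_⟩
  obtain ⟨M, hM⟩ := ((isCompact_uIcc (a := a) (b := b)).prod (isCompact_closedBall x 2)).exists_bound_of_continuousOn
    (f := Function.uncurry f) hc.continuousOn
  refine (intervalIntegral.hasDerivAt_integral_of_dominated_loc_of_deriv_le (F := fun x t => f t x)
    (F' := fun x t => deriv (f t) x) (bound := fun _ => M / 1) (ball_mem_nhds x one_pos) ?_ ?_ ?_ ?_ ?_ ?_).2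
  · refine Eventually.of_forall fun y => ?_
    exact (hc.comp (by fun_prop : Continuous fun t : ℝ => (t, y))).aestronglyMeasurable
  · exact (hc.comp (by fun_prop : Continuous fun t : ℝ => (t, x))).intervalIntegrable _ _
  · exact hcd.aestronglyMeasurable
  · refine Eventually.of_forall fun t ht y hy => ?_
    refine Complex.norm_deriv_le_of_forall_mem_sphere_norm_le one_pos (hd t).diffContOnCl ?_
    intro w hw
    refine hM (t, w) ⟨uIoc_subset_uIcc ht, ?_⟩
    rw [mem_closedBall]
    have := dist_triangle w y x
    rw [mem_sphere] at hw
    rw [mem_ball] at hy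
    linarith
  · exact intervalIntegrable_const
  · exact Eventually.of_forall fun t ht y hy => (hd t y).hasDerivAt

lemma fourier_zero {c : ℝ → ℂ} (hc : Continuous c) (hp : ∀ t, c (t + 1) = c t)
    (h : ∀ n : ℤ, ∫ t in (0 : ℝ)..1, exp (-(2 * Real.pi * I * n * t)) * c t = 0) (t : ℝ) : c t = 0 := by
  have hp' : Function.Periodic c 1 := hp
  let f : C(AddCircle (1 : ℝ), ℂ) := ⟨hp'.lift, by
    refine continuous_coinduced_dom.2 ?_
    exact hc⟩
  have hf : ∀ t : ℝ, f (t : AddCircle (1 : ℝ)) = c t := fun t => rfl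
  have h0 : fourierCoeff (T := 1) f = 0 := by
    ext n
    rw [fourierCoeff_eq_intervalIntegral _ _ 0]
    simp only [zero_add, Pi.zero_apply]
    have : ∫ x in (0 : ℝ)..1, @fourier 1 (-n) x • f x = 0 := by
      rw [← h n]
      congr 1; ext t
      rw [hf, fourier_coe_apply, smul_eq_mul]
      congr 2
      push_cast
      ring
    rw [this, smul_zero]
  have hs := has_pointwise_sum_fourier_series_of_summable (T := 1) (f := f) (by rw [h0]; exact summable_zero) t
  rw [h0] at hs
  simp only [Pi.zero_apply, zero_smul] at hs
  rw [← hf]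
  exact hs.unique hasSum_zero

/-- A holomorphic action of the multiplicative group. -/
structure Act (φ : ℂ → ℂ² → ℂ²) : Prop where
  hol : DifferentiableOn ℂ (fun p : ℂ × ℂ² => φ p.1 p.2) ({z : ℂ | z ≠ 0} ×ˢ Set.univ)
  one : φ 1 = id
  mul : ∀ z w, z ≠ 0 → w ≠ 0 → φ (z * w) = φ z ∘ φ w

variable {φ : ℂ → ℂ² → ℂ²}

/-- semi-invariant functions -/
def Semi (φ : ℂ → ℂ² → ℂ²) (k : ℤ) (f : ℂ² → ℂ) : Prop :=
  Differentiable ℂ f ∧ ∀ s, s ≠ 0 → ∀ x, f (φ s x) = s ^ k * f x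

/-- parametrisation of the circle -/
noncomputable def ec (t : ℝ) : ℂ := exp (2 * Real.pi * I * t)

lemma ec_ne (t : ℝ) : ec t ≠ 0 := exp_ne_zero _
lemma ec_cont : Continuous ec := by unfold ec; fun_prop
lemma ec_add (t t' : ℝ) : ec (t + t') = ec t * ec t' := by
  unfold ec; rw [← exp_add]; congr 1; push_cast; ring
lemma ec_one : ec 1 = 1 := by unfold ec; simp [exp_two_pi_mul_I]
lemma ec_zero : ec 0 = 1 := by unfold ec; simp
lemma ec_per (t : ℝ) : ec (t + 1) = ec t := by rw [ec_add, ec_one, mul_one]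
lemma ec_zpow (t : ℝ) (n : ℤ) : exp (-(2 * Real.pi * I * n * t)) = (ec t ^ n)⁻¹ := by
  unfold ec; rw [← exp_int_mul, ← exp_neg]; congr 1; ring

/-- isotypic components -/
noncomputable def cpt (φ : ℂ → ℂ² → ℂ²) (n : ℤ) (h : ℂ² → ℂ) (x : ℂ²) : ℂ :=
  ∫ t in (0 : ℝ)..1, exp (-(2 * Real.pi * I * n * t)) * h (φ (ec t) x)

lemma punct_open : IsOpen {z : ℂ | z ≠ 0} := isOpen_ne
lemma punct_conn : IsPreconnected {z : ℂ | z ≠ 0} := by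
  have := (isConnected_compl_singleton_of_one_lt_rank (by simp) (0 : ℂ)).isPreconnected
  exact this

/-- functions on the punctured plane that agree on the unit circle agree -/
lemma eq_of_circle {f g : ℂ → ℂ} (hf : DifferentiableOn ℂ f {z | z ≠ 0}) (hg : DifferentiableOn ℂ g {z | z ≠ 0})
    (h : ∀ t, f (ec t) = g (ec t)) {s : ℂ} (hs : s ≠ 0) : f s = g s := by
  refine (hf.analyticOnNhd punct_open).eqOn_of_preconnected_of_frequently_eq (hg.analyticOnNhd punct_open)
    punct_conn (z₀ := 1) one_ne_zero ?_ hs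
  have h1 : Tendsto ec (𝓝[≠] 0) (𝓝[≠] 1) := by
    refine tendsto_nhdsWithin_iff.2 ⟨?_, ?_⟩
    · have := ec_cont.tendsto 0
      rw [ec_zero] at this
      exact this.mono_left nhdsWithin_le_nhds
    · rw [eventually_nhdsWithin_iff]
      filter_upwards [ball_mem_nhds (0 : ℝ) (one_pos)] with t ht ht0 h1
      unfold ec at h1
      rw [mem_singleton_iff, exp_eq_one_iff] at h1
      obtain ⟨n, hn⟩ := h1
      have h2 : (2 * Real.pi * I) * ((t : ℂ) - n) = 0 := by rw [mul_sub, hn]; ring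
      have h3 : (2 * (Real.pi : ℂ) * I) ≠ 0 := by simp [Real.pi_ne_zero]
      have h4 := (mul_eq_zero.1 h2).resolve_left h3
      have h5 : t = n := by
        have : (t : ℂ) = ((n : ℝ) : ℂ) := by rw [sub_eq_zero] at h4; rw [h4]; push_cast; rfl
        exact_mod_cast this
      rw [mem_ball_zero_iff, h5, Real.norm_eq_abs] at ht
      have h6 : |n| < 1 := by exact_mod_cast ht
      have h7 : n = 0 := Int.abs_lt_one_iff.1 h6
      exact ht0 (by rw [h5, h7]; simp)
  exact h1.frequently (Eventually.frequently (Eventually.of_forall fun t => h t))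

namespace Act
variable (A : Act φ)
include A

lemma dAt {s : ℂ} (hs : s ≠ 0) (x : ℂ²) : DifferentiableAt ℂ (fun p : ℂ × ℂ² => φ p.1 p.2) (s, x) :=
  A.hol.differentiableAt ((punct_open.prod isOpen_univ).mem_nhds ⟨hs, mem_univ _⟩)

lemma diff {s : ℂ} (hs : s ≠ 0) : Differentiable ℂ (φ s) := fun x =>
  (A.dAt hs x).comp x (f := fun x : ℂ² => (s, x)) (by fun_prop)

lemma orb (x : ℂ²) {s : ℂ} (hs : s ≠ 0) : DifferentiableAt ℂ (fun s => φ s x) s :=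
  (A.dAt hs x).comp s (f := fun s : ℂ => (s, x)) (by fun_prop)

lemma mul' {z w : ℂ} (hz : z ≠ 0) (hw : w ≠ 0) (x : ℂ²) : φ z (φ w x) = φ (z * w) x := by
  rw [A.mul z w hz hw]; rfl

lemma one' (x : ℂ²) : φ 1 x = x := by rw [A.one]; rfl

lemma inv {s : ℂ} (hs : s ≠ 0) (x : ℂ²) : φ s⁻¹ (φ s x) = x := by
  rw [A.mul' (inv_ne_zero hs) hs, inv_mul_cancel₀ hs, A.one']

lemma inv' {s : ℂ} (hs : s ≠ 0) (x : ℂ²) : φ s (φ s⁻¹ x) = x := by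
  rw [A.mul' hs (inv_ne_zero hs), mul_inv_cancel₀ hs, A.one']

lemma cont_ec : Continuous (fun p : ℝ × ℂ² => φ (ec p.1) p.2) := by
  rw [continuous_iff_continuousAt]
  intro p
  exact (A.dAt (ec_ne p.1) p.2).continuousAt.comp (f := fun p : ℝ × ℂ² => (ec p.1, p.2))
    (by have := ec_cont; fun_prop)

lemma cont_ec' {h : ℂ² → ℂ} (hh : Continuous h) (k : ℝ → ℂ) (hk : Continuous k) :
    Continuous (Function.uncurry fun (t : ℝ) (x : ℂ²) => k t * h (φ (ec t) x)) :=
  (hk.comp continuous_fst).mul (hh.comp A.cont_ec)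

lemma cpt_diff {h : ℂ² → ℂ} (hh : Differentiable ℂ h) (n : ℤ) : Differentiable ℂ (cpt φ n h) :=
  diff_integral (A.cont_ec' hh.continuous _ (by fun_prop)) (fun t => (hh.comp (A.diff (ec_ne t))).const_mul _) 0 1

lemma cpt_semi {h : ℂ² → ℂ} (hh : Differentiable ℂ h) (n : ℤ) : Semi φ n (cpt φ n h) := by
  refine ⟨A.cpt_diff hh n, fun s hs x => ?_⟩
  refine eq_of_circle (f := fun s => cpt φ n h (φ s x)) (g := fun s => s ^ n * cpt φ n h x) ?_ ?_ ?_ hs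
  · intro s hs
    exact ((A.cpt_diff hh n _).comp s (A.orb x hs)).differentiableWithinAt
  · intro s hs
    exact ((differentiableAt_zpow.2 (Or.inl hs)).mul_const _).differentiableWithinAt
  · intro τ
    simp only [cpt]
    have e1 : ∀ t : ℝ, exp (-(2 * Real.pi * I * n * t)) * h (φ (ec t) (φ (ec τ) x)) =
        ec τ ^ n * (fun t : ℝ => exp (-(2 * Real.pi * I * n * t)) * h (φ (ec t) x)) (t + τ) := by
      intro t
      simp only
      rw [A.mul' (ec_ne t) (ec_ne τ), ← ec_add, ec_zpow, ec_zpow, ec_add, mul_zpow]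
      have := zpow_ne_zero n (ec_ne τ)
      field_simp
    simp_rw [e1]
    rw [intervalIntegral.integral_const_mul, intervalIntegral.integral_comp_add_right
      (fun t : ℝ => exp (-(2 * Real.pi * I * n * t)) * h (φ (ec t) x))]
    congr 1
    have hp : Function.Periodic (fun t : ℝ => exp (-(2 * Real.pi * I * n * t)) * h (φ (ec t) x)) 1 := by
      intro t
      simp only
      rw [ec_zpow, ec_zpow, ec_per]
    have := hp.intervalIntegral_add_eq τ 0
    rw [zero_add] at this
    rw [zero_add, add_comm]
    exact this

/-- an entire function is determined by its isotypic components -/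
lemma sep1 {h : ℂ² → ℂ} (hh : Differentiable ℂ h) {x x' : ℂ²} (H : ∀ n, cpt φ n h x = cpt φ n h x') :
    h x = h x' := by
  have hc : ∀ x, Continuous fun t => h (φ (ec t) x) := fun x =>
    hh.continuous.comp (A.cont_ec.comp (by fun_prop : Continuous fun t : ℝ => (t, x)))
  have := fourier_zero (c := fun t => h (φ (ec t) x) - h (φ (ec t) x')) ((hc x).sub (hc x'))
    (fun t => by rw [ec_per]) (fun n => by
      simp_rw [mul_sub]
      rw [intervalIntegral.integral_sub, sub_eq_zero]
      · exact H n
      · exact (Continuous.mul (by fun_prop) (hc x)).intervalIntegrable _ _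
      · exact (Continuous.mul (by fun_prop) (hc x')).intervalIntegrable _ _) 0
  simp only [ec_zero, A.one', sub_eq_zero] at this
  exact this

/-- semi-invariants separate points -/
lemma sep {x x' : ℂ²} (H : ∀ k f, Semi φ k f → f x = f x') : x = x' :=
  Prod.ext (A.sep1 (h := fun x => x.1) (by fun_prop) fun n => H n _ (A.cpt_semi (by fun_prop) n))
    (A.sep1 (h := fun x => x.2) (by fun_prop) fun n => H n _ (A.cpt_semi (by fun_prop) n))

lemma span1 {h : ℂ² → ℂ} (hh : Differentiable ℂ h) {x v : ℂ²} (H : ∀ n, fderiv ℂ (cpt φ n h) x v = 0) :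
    fderiv ℂ h x v = 0 := by
  have hl : ∀ (g : ℂ² → ℂ), Differentiable ℂ g → HasDerivAt (fun τ : ℂ => g (x + τ • v)) (fderiv ℂ g x v) 0 := by
    intro g hg
    have h1 : HasDerivAt (fun τ : ℂ => x + τ • v) v 0 := by
      simpa using ((hasDerivAt_id (0 : ℂ)).smul_const v).const_add x
    have h2 := (hg (x + (0 : ℂ) • v)).hasFDerivAt.comp_hasDerivAt (0 : ℂ) h1
    rw [zero_smul, add_zero] at h2
    exact h2
  have hcc : ∀ n : ℤ, Continuous (Function.uncurry fun (t : ℝ) (τ : ℂ) =>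
      exp (-(2 * Real.pi * I * n * t)) * h (φ (ec t) (x + τ • v))) := by
    intro n
    have := A.cont_ec' hh.continuous (fun t : ℝ => exp (-(2 * Real.pi * I * n * t))) (by fun_prop)
    exact this.comp (by fun_prop : Continuous fun p : ℝ × ℂ => (p.1, x + p.2 • v))
  have hdd : ∀ t : ℝ, Differentiable ℂ fun τ : ℂ => h (φ (ec t) (x + τ • v)) := fun t =>
    (hh.comp (A.diff (ec_ne t))).comp (by fun_prop : Differentiable ℂ fun τ : ℂ => x + τ • v)
  have hcc0 : Continuous (Function.uncurry fun (t : ℝ) (τ : ℂ) => h (φ (ec t) (x + τ • v))) := by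
    have := hcc 0
    simpa using this
  have hdc := (deriv_int hcc0 hdd 0 1 0).1
  have := fourier_zero (c := fun t => deriv (fun τ : ℂ => h (φ (ec t) (x + τ • v))) 0) hdc
    (fun t => by rw [ec_per]) (fun n => by
      have h1 := (deriv_int (hcc n) (fun t => (hdd t).const_mul _) 0 1 0).2
      have h2 := hl _ (A.cpt_diff hh n)
      rw [H n] at h2
      have h3 := h1.unique h2
      refine Eq.trans ?_ h3
      congr 1; ext t
      rw [deriv_const_mul _ (hdd t 0)]) 0
  rw [← this, ec_zero]
  simp only [A.one']
  exact (hl h hh).deriv.symm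

/-- the differentials of semi-invariants span the cotangent space -/
lemma span {x v : ℂ²} (hv : v ≠ 0) : ∃ k f, Semi φ k f ∧ fderiv ℂ f x v ≠ 0 := by
  by_contra hcon
  push Not at hcon
  apply hv
  have h1 := A.span1 (h := fun x => x.1) (x := x) (v := v) (by fun_prop) (fun n => hcon n _ (A.cpt_semi (by fun_prop) n))
  have h2 := A.span1 (h := fun x => x.2) (x := x) (v := v) (by fun_prop) (fun n => hcon n _ (A.cpt_semi (by fun_prop) n))
  have e1 : fderiv ℂ (fun x : ℂ² => x.1) x = ContinuousLinearMap.fst ℂ ℂ ℂ := (hasFDerivAt_fst).fderiv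
  have e2 : fderiv ℂ (fun x : ℂ² => x.2) x = ContinuousLinearMap.snd ℂ ℂ ℂ := (hasFDerivAt_snd).fderiv
  rw [e1] at h1
  rw [e2] at h2
  exact Prod.ext h1 h2

end Act

/-- the generating vector field -/
noncomputable def VF (φ : ℂ → ℂ² → ℂ²) (x : ℂ²) : ℂ² := deriv (fun s => φ s x) 1

lemma ne_zero_of_ball {s : ℂ} (hs : s ∈ closedBall (1 : ℂ) (2 * (1 / 4))) : s ≠ 0 := by
  rintro rfl
  rw [mem_closedBall, dist_eq_norm] at hs
  norm_num at hs

lemma diff_of_comp {f : ℂ² → ℂ²} (h1 : Differentiable ℂ fun x => (f x).1)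
    (h2 : Differentiable ℂ fun x => (f x).2) : Differentiable ℂ f := fun x =>
  (h1 x).prodMk (h2 x)

namespace Act
variable (A : Act φ)
include A

lemma diff_deriv {h : ℂ² → ℂ} (hh : Differentiable ℂ h) :
    Differentiable ℂ (fun x => deriv (fun s => h (φ s x)) 1) := by
  have hq : (0 : ℝ) < 1 / 4 := by norm_num
  have e : (fun x => deriv (fun s => h (φ s x)) 1) = fun x => ∫ t in (0 : ℝ)..2 * Real.pi,
      (2 * Real.pi * I)⁻¹ * (deriv (circleMap 1 (1 / 4)) t *
      (((circleMap 1 (1 / 4) t - 1) ^ 2)⁻¹ * h (φ (circleMap 1 (1 / 4) t) x))) := by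
    ext x
    refine deriv_cauchy hq ?_
    intro s hs
    exact ((hh _).comp s (A.orb x (ne_zero_of_ball hs))).differentiableWithinAt
  have hne : ∀ t, circleMap (1 : ℂ) (1 / 4) t ≠ 0 := fun t =>
    ne_zero_of_ball (closedBall_subset_closedBall (by norm_num) (circleMap_mem_closedBall 1 hq.le t))
  rw [e]
  refine diff_integral ?_ ?_ _ _
  · have e0 : Continuous fun p : ℝ × ℂ² => φ (circleMap 1 (1 / 4) p.1) p.2 := by
      rw [continuous_iff_continuousAt]
      intro p
      exact (A.dAt (hne p.1) p.2).continuousAt.comp (f := fun p : ℝ × ℂ² => (circleMap 1 (1 / 4) p.1, p.2))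
        (by have := continuous_circleMap 1 (1 / 4); fun_prop)
    have e1 : Continuous fun θ : ℝ => ((circleMap 1 (1 / 4) θ - 1) ^ 2)⁻¹ := by
      apply Continuous.inv₀
      · exact ((continuous_circleMap 1 (1 / 4)).sub continuous_const).pow 2
      · intro θ
        simp
    exact continuous_const.mul (((cont_dcm 1 (1 / 4)).comp continuous_fst).mul
      ((e1.comp continuous_fst).mul (hh.continuous.comp e0)))
  · intro t
    exact (((hh.comp (A.diff (hne t))).const_mul _).const_mul _).const_mul _

lemma hV (x : ℂ²) : HasDerivAt (fun s => φ s x) (VF φ x) 1 := (A.orb x one_ne_zero).hasDerivAt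

lemma V_diff : Differentiable ℂ (VF φ) := by
  refine diff_of_comp ?_ ?_
  · have : (fun x => (VF φ x).1) = fun x => deriv (fun s => (φ s x).1) 1 := by
      ext x
      exact ((hasFDerivAt_fst (𝕜 := ℂ) (p := φ 1 x)).comp_hasDerivAt (1 : ℂ) (A.hV x)).deriv.symm
    rw [this]
    exact A.diff_deriv (h := fun x => x.1) (by fun_prop)
  · have : (fun x => (VF φ x).2) = fun x => deriv (fun s => (φ s x).2) 1 := by
      ext x
      exact ((hasFDerivAt_snd (𝕜 := ℂ) (p := φ 1 x)).comp_hasDerivAt (1 : ℂ) (A.hV x)).deriv.symm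
    rw [this]
    exact A.diff_deriv (h := fun x => x.2) (by fun_prop)

lemma orb_deriv (x : ℂ²) {s : ℂ} (hs : s ≠ 0) : HasDerivAt (fun s => φ s x) (s⁻¹ • VF φ (φ s x)) s := by
  have h1 := A.hV (φ s x)
  have h2 : HasDerivAt (fun u : ℂ => u * s⁻¹) s⁻¹ s := by
    simpa using (hasDerivAt_id s).mul_const s⁻¹
  have h3 : HasDerivAt (fun u => φ (u * s⁻¹) (φ s x)) (s⁻¹ • VF φ (φ s x)) s := by
    rw [← mul_inv_cancel₀ hs] at h1
    exact h1.scomp s h2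
  refine h3.congr_of_eventuallyEq ?_
  filter_upwards [punct_open.mem_nhds hs] with u hu
  rw [A.mul' (mul_ne_zero hu (inv_ne_zero hs)) hs, inv_mul_cancel_right₀ hs]

/-- derivative of a function along the orbits -/
lemma along {f : ℂ² → ℂ} {x : ℂ²} {s : ℂ} (hs : s ≠ 0) (hf : DifferentiableAt ℂ f (φ s x)) :
    HasDerivAt (fun s => f (φ s x)) (s⁻¹ * fderiv ℂ f (φ s x) (VF φ (φ s x))) s := by
  have := hf.hasFDerivAt.comp_hasDerivAt s (A.orb_deriv x hs)
  rw [map_smul, smul_eq_mul] at this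
  exact this

lemma semi_V {k : ℤ} {f : ℂ² → ℂ} (hf : Semi φ k f) (x : ℂ²) : fderiv ℂ f x (VF φ x) = k * f x := by
  have h1 := A.along (x := x) one_ne_zero (hf.1 (φ 1 x))
  rw [inv_one, one_mul, A.one'] at h1
  have h2 : HasDerivAt (fun s : ℂ => s ^ k * f x) (k * (1 : ℂ) ^ (k - 1) * f x) 1 :=
    (hasDerivAt_zpow k (1 : ℂ) (Or.inl one_ne_zero)).mul_const _
  rw [one_zpow, mul_one] at h2
  refine h1.unique (h2.congr_of_eventuallyEq ?_)
  filter_upwards [punct_open.mem_nhds one_ne_zero] with u hu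
  exact hf.2 u hu x

lemma semi_of_V {k : ℤ} {f : ℂ² → ℂ} (hf : Differentiable ℂ f) (h : ∀ x, fderiv ℂ f x (VF φ x) = k * f x) :
    Semi φ k f := by
  refine ⟨hf, fun s hs x => ?_⟩
  have hd : ∀ u : ℂ, u ≠ 0 → HasDerivAt (fun u : ℂ => u ^ (-k) * f (φ u x)) 0 u := by
    intro u hu
    have h1 := A.along (x := x) hu (hf (φ u x))
    have h2 := (hasDerivAt_zpow (-k) u (Or.inl hu)).mul h1
    convert! h2 using 1
    rw [h, zpow_sub_one₀ hu]
    push_cast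
    ring
  have h3 := punct_open.is_const_of_deriv_eq_zero punct_conn
    (fun u hu => (hd u hu).differentiableAt.differentiableWithinAt) (fun u hu => (hd u hu).deriv) hs
    (one_ne_zero : (1 : ℂ) ≠ 0)
  simp only [one_zpow, one_mul, A.one'] at h3
  rw [← h3, zpow_neg, mul_inv_cancel_left₀ (zpow_ne_zero k hs)]

lemma fixed_iff (x : ℂ²) : VF φ x = 0 ↔ ∀ s, s ≠ 0 → φ s x = x := by
  constructor
  · intro h s hs
    refine A.sep fun k f hf => ?_
    rw [hf.2 s hs]
    have := A.semi_V hf x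
    rw [h, map_zero] at this
    rcases mul_eq_zero.1 this.symm with h0 | h0
    · have : k = 0 := by exact_mod_cast h0
      rw [this, zpow_zero, one_mul]
    · rw [h0, mul_zero]
  · intro h
    have h1 : HasDerivAt (fun s => φ s x) 0 1 := by
      refine (hasDerivAt_const (1 : ℂ) x).congr_of_eventuallyEq ?_
      filter_upwards [punct_open.mem_nhds one_ne_zero] with u hu
      exact h u hu
    exact (A.hV x).unique h1

/-- solving the cohomological equation -/
lemma exists_primitive {δ : ℂ² → ℂ} (hδ : Differentiable ℂ δ) :
    ∃ m : ℂ² → ℂ, Differentiable ℂ m ∧ ∀ x, fderiv ℂ m x (VF φ x) = cpt φ 0 δ x - δ x := by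
  have hmd : Differentiable ℂ (fun x => ∫ t in (0 : ℝ)..1, (-(2 * Real.pi * I) * t) * δ (φ (ec t) x)) :=
    diff_integral (A.cont_ec' hδ.continuous (fun t : ℝ => (-(2 * Real.pi * I) * t)) (by fun_prop))
      (fun t => (hδ.comp (A.diff (ec_ne t))).const_mul _) 0 1
  refine ⟨_, hmd, fun x => ?_⟩
  set m : ℂ² → ℂ := fun x => ∫ t in (0 : ℝ)..1, (-(2 * Real.pi * I) * t) * δ (φ (ec t) x) with hm
  set c : ℝ → ℂ := fun t => δ (φ (ec t) x) with hc
  have hcc : Continuous c := hδ.continuous.comp (A.cont_ec.comp (by fun_prop : Continuous fun t : ℝ => (t, x)))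
  have h2pi : (2 * (Real.pi : ℂ) * I) ≠ 0 := by simp [Real.pi_ne_zero]
  -- first computation
  have h1 : HasDerivAt (fun τ : ℝ => m (φ (ec τ) x)) (2 * Real.pi * I * fderiv ℂ m x (VF φ x)) 0 := by
    have h0 : HasDerivAt (fun u => m (φ u x)) (fderiv ℂ m x (VF φ x)) (ec 0) := by
      have := A.along (x := x) one_ne_zero (hmd (φ 1 x))
      rw [inv_one, one_mul, A.one'] at this
      rw [ec_zero]
      exact this
    have he : HasDerivAt ec (2 * Real.pi * I) 0 := by
      have h3 : HasDerivAt (fun t : ℂ => exp (2 * Real.pi * I * t)) (2 * Real.pi * I) ((0 : ℝ) : ℂ) := by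
        have := ((hasDerivAt_id ((0 : ℝ) : ℂ)).const_mul (2 * Real.pi * I)).cexp
        simpa using this
      exact h3.comp_ofReal
    have := h0.comp (0 : ℝ) he
    rw [mul_comm] at this
    exact this
  -- second computation
  have hF : ∀ (k : ℝ → ℂ), Continuous k → ∀ b : ℝ, HasDerivAt (fun τ : ℝ => ∫ t in (0 : ℝ)..τ + b, k t) (k b) 0 := by
    intro k hk b
    have h3 := intervalIntegral.integral_hasDerivAt_right (hk.intervalIntegrable 0 (0 + b))
      (hk.stronglyMeasurableAtFilter _ _) hk.continuousAt
    have h4 : HasDerivAt (fun τ : ℝ => τ + b) 1 0 := (hasDerivAt_id (0 : ℝ)).add_const b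
    have := h3.scomp (0 : ℝ) h4
    rw [one_smul, zero_add] at this
    exact this
  have h2 : HasDerivAt (fun τ : ℝ => m (φ (ec τ) x)) (-(2 * Real.pi * I) * (c 0 - cpt φ 0 δ x)) 0 := by
    have e : (fun τ : ℝ => m (φ (ec τ) x)) = fun τ : ℝ => -(2 * Real.pi * I) *
        (((∫ t in (0 : ℝ)..τ + 1, (t : ℂ) * c t) - ∫ t in (0 : ℝ)..τ + 0, (t : ℂ) * c t) -
          (τ : ℂ) * ((∫ t in (0 : ℝ)..τ + 1, c t) - ∫ t in (0 : ℝ)..τ + 0, c t)) := by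
      ext τ
      have hi1 : ∀ a b : ℝ, IntervalIntegrable (fun t : ℝ => (t : ℂ) * c t) MeasureTheory.volume a b := fun a b =>
        (Continuous.mul (by fun_prop) hcc).intervalIntegrable _ _
      have hi2 : ∀ a b : ℝ, IntervalIntegrable c MeasureTheory.volume a b := fun a b => hcc.intervalIntegrable _ _
      rw [intervalIntegral.integral_interval_sub_left (hi1 _ _) (hi1 _ _),
        intervalIntegral.integral_interval_sub_left (hi2 _ _) (hi2 _ _),
        ← intervalIntegral.integral_const_mul, ← intervalIntegral.integral_sub (hi1 _ _) ((hi2 _ _).const_mul _),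
        ← intervalIntegral.integral_const_mul]
      simp only [hm]
      have e1 : ∀ t : ℝ, -(2 * Real.pi * I) * (t : ℂ) * δ (φ (ec t) (φ (ec τ) x)) =
          (fun t : ℝ => -(2 * Real.pi * I) * ((t : ℂ) * c t - (τ : ℂ) * c t)) (t + τ) := by
        intro t
        simp only [hc]
        rw [A.mul' (ec_ne t) (ec_ne τ), ← ec_add]
        push_cast
        ring
      simp_rw [e1]
      rw [intervalIntegral.integral_comp_add_right (fun t : ℝ => -(2 * Real.pi * I) * ((t : ℂ) * c t - (τ : ℂ) * c t))]
      rw [zero_add, add_zero, add_comm]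
    rw [e]
    have hk1 : Continuous fun t : ℝ => (t : ℂ) * c t := Continuous.mul (by fun_prop) hcc
    have d1 := (hF _ hk1 1).sub (hF _ hk1 0)
    have d2 := (hF _ hcc 1).sub (hF _ hcc 0)
    have d3 : HasDerivAt (fun τ : ℝ => (τ : ℂ)) 1 0 := (hasDerivAt_id ((0 : ℝ) : ℂ)).comp_ofReal
    have d4 := (d1.sub (d3.mul d2)).const_mul (-(2 * Real.pi * I))
    convert! d4 using 1
    have e3 : cpt φ 0 δ x = ∫ t in (0 : ℝ)..1, c t := by
      simp only [cpt]
      congr 1; ext t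
      simp [hc]
    have e4 : c 1 = c 0 := by simp [hc, ec_one, ec_zero]
    rw [e3, e4]
    simp
  have h5 := h1.unique h2
  have h6 : c 0 = δ x := by simp [hc, ec_zero, A.one']
  rw [h6] at h5
  apply mul_left_cancel₀ h2pi
  rw [h5]
  ring

end Act

/-- Jacobian determinant -/
noncomputable def Jac (f g : ℂ² → ℂ) (x : ℂ²) : ℂ :=
  fderiv ℂ f x (1, 0) * fderiv ℂ g x (0, 1) - fderiv ℂ f x (0, 1) * fderiv ℂ g x (1, 0)

lemma lin_apply (L : ℂ² →L[ℂ] ℂ) (v : ℂ²) : L v = v.1 * L (1, 0) + v.2 * L (0, 1) := by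
  have : v = v.1 • ((1 : ℂ), (0 : ℂ)) + v.2 • ((0 : ℂ), (1 : ℂ)) := by ext <;> simp
  conv_lhs => rw [this]
  rw [map_add, map_smul, map_smul]; rfl

lemma lin_det (L M : ℂ² →L[ℂ] ℂ) (u v : ℂ²) : L u * M v - L v * M u =
    (L (1, 0) * M (0, 1) - L (0, 1) * M (1, 0)) * (u.1 * v.2 - u.2 * v.1) := by
  rw [lin_apply L u, lin_apply L v, lin_apply M u, lin_apply M v]; ring

lemma Jac_ne_of {f g : ℂ² → ℂ} {x u v : ℂ²} (h : fderiv ℂ f x u * fderiv ℂ g x v - fderiv ℂ f x v * fderiv ℂ g x u ≠ 0) :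
    Jac f g x ≠ 0 := by
  rw [lin_det] at h
  exact left_ne_zero_of_mul h

lemma Jac_inj {f g : ℂ² → ℂ} {x v : ℂ²} (h : Jac f g x ≠ 0) (h1 : fderiv ℂ f x v = 0) (h2 : fderiv ℂ g x v = 0) :
    v = 0 := by
  unfold Jac at h
  rw [lin_apply] at h1 h2
  set a := fderiv ℂ f x (1, 0)
  set b := fderiv ℂ f x (0, 1)
  set c := fderiv ℂ g x (1, 0)
  set d := fderiv ℂ g x (0, 1)
  have e1 : v.1 * (a * d - b * c) = 0 := by linear_combination d * h1 - b * h2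
  have e2 : v.2 * (a * d - b * c) = 0 := by linear_combination a * h2 - c * h1
  exact Prod.ext ((mul_eq_zero.1 e1).resolve_right h) ((mul_eq_zero.1 e2).resolve_right h)

/-- two functions with independent differentials from a spanning family -/
lemma exists_eqv {f g : ℂ² → ℂ} {x : ℂ²} (h : Jac f g x ≠ 0) :
    ∃ e : ℂ² ≃L[ℂ] ℂ², (e : ℂ² →L[ℂ] ℂ²) = (fderiv ℂ f x).prod (fderiv ℂ g x) := by
  let L : ℂ² →ₗ[ℂ] ℂ² := ((fderiv ℂ f x).prod (fderiv ℂ g x) : ℂ² →L[ℂ] ℂ²)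
  have hi : Function.Injective L := by
    rw [← LinearMap.ker_eq_bot, LinearMap.ker_eq_bot']
    intro v hv
    have := Prod.ext_iff.1 hv
    exact Jac_inj h this.1 this.2
  refine ⟨(LinearEquiv.ofInjectiveEndo L hi).toContinuousLinearEquiv, ?_⟩
  ext <;> rfl

lemma fderiv_diff {f : ℂ² → ℂ} {U : Set ℂ²} (hU : IsOpen U) (hf : DifferentiableOn ℂ f U) (v : ℂ²) :
    DifferentiableOn ℂ (fun x => fderiv ℂ f x v) U := by
  have := (analyticOn_of_diff hU hf).fderiv
  intro x hx
  exact ((this x hx).differentiableAt.clm_apply (differentiableAt_const v)).differentiableWithinAt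

lemma Jac_diff {f g : ℂ² → ℂ} {U : Set ℂ²} (hU : IsOpen U) (hf : DifferentiableOn ℂ f U)
    (hg : DifferentiableOn ℂ g U) : DifferentiableOn ℂ (Jac f g) U :=
  ((fderiv_diff hU hf _).mul (fderiv_diff hU hg _)).sub ((fderiv_diff hU hf _).mul (fderiv_diff hU hg _))

lemma loc_inv {f g : ℂ² → ℂ} {U : Set ℂ²} (hU : IsOpen U) (hf : DifferentiableOn ℂ f U)
    (hg : DifferentiableOn ℂ g U) {x : ℂ²} (hx : x ∈ U) (hJ : Jac f g x ≠ 0) :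
    ∃ (N : Set ℂ²) (ε : ℝ) (G : ℂ² → ℂ²), IsOpen N ∧ x ∈ N ∧ N ⊆ U ∧ 0 < ε ∧
      InjOn (fun x => (f x, g x)) N ∧ (∀ x' ∈ N, Jac f g x' ≠ 0) ∧
      (∀ q ∈ ball (f x, g x) ε, G q ∈ N ∧ (f (G q), g (G q)) = q) ∧
      DifferentiableOn ℂ G (ball (f x, g x) ε) := by
  have haf := analyticOn_of_diff hU hf
  have hag := analyticOn_of_diff hU hg
  have hst : ∀ y ∈ U, HasStrictFDerivAt (fun x => (f x, g x)) ((fderiv ℂ f y).prod (fderiv ℂ g y)) y := fun y hy =>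
    (haf y hy).hasStrictFDerivAt.prodMk (hag y hy).hasStrictFDerivAt
  obtain ⟨e, he⟩ := exists_eqv hJ
  have hs := hst x hx
  rw [← he] at hs
  let P := hs.toOpenPartialHomeomorph (fun x => (f x, g x))
  have hPc : (P : ℂ² → ℂ²) = fun x => (f x, g x) := rfl
  let N : Set ℂ² := P.source ∩ (U ∩ {y | Jac f g y ≠ 0})
  have hopen : IsOpen (U ∩ {y | Jac f g y ≠ 0}) :=
    (Jac_diff hU hf hg).continuousOn.isOpen_inter_preimage hU isOpen_ne
  have hN : IsOpen N := P.open_source.inter hopen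
  have hxN : x ∈ N := ⟨hs.mem_toOpenPartialHomeomorph_source, hx, hJ⟩
  have hTo : IsOpen (P.target ∩ P.symm ⁻¹' N) := P.isOpen_inter_preimage_symm hN
  have hxT : (f x, g x) ∈ P.target ∩ P.symm ⁻¹' N := by
    refine ⟨P.map_source hxN.1, ?_⟩
    change P.symm (P x) ∈ N
    rw [P.left_inv hxN.1]
    exact hxN
  obtain ⟨ε, hε, hb⟩ := Metric.isOpen_iff.1 hTo _ hxT
  refine ⟨N, ε, P.symm, hN, hxN, fun y hy => hy.2.1, hε, ?_, fun y hy => hy.2.2, ?_, ?_⟩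
  · exact P.injOn.mono inter_subset_left
  · intro q hq
    exact ⟨(hb hq).2, P.right_inv (hb hq).1⟩
  · intro q hq
    have h1 := (hb hq).2
    obtain ⟨e', he'⟩ := exists_eqv h1.2.2
    have h2 := (hst _ h1.2.1).hasFDerivAt
    rw [← he'] at h2
    exact (P.hasFDerivAt_symm (hb hq).1 h2).differentiableAt.differentiableWithinAt

lemma inv_diff {f g : ℂ² → ℂ} (hf : Differentiable ℂ f) (hg : Differentiable ℂ g)
    (hJ : ∀ x, Jac f g x ≠ 0) (hb : Function.Bijective fun x => (f x, g x)) :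
    Differentiable ℂ (Function.invFun fun x => (f x, g x)) := by
  intro q
  obtain ⟨x, rfl⟩ := hb.2 q
  obtain ⟨N, ε, G, -, -, -, hε, -, -, hG, hGd⟩ := loc_inv isOpen_univ hf.differentiableOn hg.differentiableOn
    (mem_univ x) (hJ x)
  have h1 := hGd.differentiableAt (ball_mem_nhds (f x, g x) hε)
  refine h1.congr_of_eventuallyEq ?_
  filter_upwards [ball_mem_nhds (f x, g x) hε] with q hq
  apply hb.1
  exact (Function.invFun_eq (hb.2 q)).trans (hG q hq).2.symm

/-- what has to be shown -/
def Lin (φ : ℂ → ℂ² → ℂ²) : Prop := ∃ (n m : ℤ) (H : ℂ² → ℂ²), Function.Bijective H ∧ Differentiable ℂ H ∧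
  Differentiable ℂ (Function.invFun H) ∧ ∀ s : ℂ, s ≠ 0 → ∀ x y : ℂ, H (φ s (Function.invFun H (x, y))) = (s ^ n * x, s ^ m * y)

lemma lin_of {n m : ℤ} {f g : ℂ² → ℂ} (hf : Semi φ n f) (hg : Semi φ m g)
    (hJ : ∀ x, Jac f g x ≠ 0) (hb : Function.Bijective fun x => (f x, g x)) : Lin φ := by
  refine ⟨n, m, fun x => (f x, g x), hb, fun x => (hf.1 x).prodMk (hg.1 x), inv_diff hf.1 hg.1 hJ hb, ?_⟩
  intro s hs x y
  have := Function.invFun_eq (hb.2 (x, y))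
  obtain ⟨h1, h2⟩ := Prod.ext_iff.1 this
  simp only at h1 h2
  simp only [hf.2 s hs, hg.2 s hs, h1, h2]

/-- change of the Jacobian under the action -/
lemma jac_move (A : Act φ) {n m : ℤ} {f g : ℂ² → ℂ} (hf : Semi φ n f) (hg : Semi φ m g)
    {s : ℂ} (hs : s ≠ 0) {x : ℂ²} (h : Jac f g (φ s x) ≠ 0) : Jac f g x ≠ 0 := by
  have key : ∀ {k : ℤ} {f : ℂ² → ℂ}, Semi φ k f → ∀ y v, fderiv ℂ f y v = s ^ k * fderiv ℂ f (φ s⁻¹ y) (fderiv ℂ (φ s⁻¹) y v) := by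
    intro k f hf y v
    have e : f = fun y => s ^ k * f (φ s⁻¹ y) := by
      ext y
      rw [← hf.2 s hs, A.inv' hs]
    have h1 : HasFDerivAt (fun y => s ^ k * f (φ s⁻¹ y)) (s ^ k • (fderiv ℂ f (φ s⁻¹ y)).comp (fderiv ℂ (φ s⁻¹) y)) y :=
      ((hf.1 _).hasFDerivAt.comp y (A.diff (inv_ne_zero hs) y).hasFDerivAt).const_mul _
    rw [← e] at h1
    rw [h1.fderiv]; rfl
  have e1 := key hf (φ s x) (1, 0)
  have e2 := key hf (φ s x) (0, 1)
  have e3 := key hg (φ s x) (1, 0)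
  have e4 := key hg (φ s x) (0, 1)
  rw [A.inv hs] at e1 e2 e3 e4
  apply Jac_ne_of (u := fderiv ℂ (φ s⁻¹) (φ s x) (1, 0)) (v := fderiv ℂ (φ s⁻¹) (φ s x) (0, 1))
  intro h0
  apply h
  unfold Jac
  rw [e1, e2, e3, e4]
  linear_combination s ^ n * s ^ m * h0

/-- analytic functions of two variables form a domain -/
lemma mul_zero_germ {u v : ℂ² → ℂ} {x : ℂ²} (hu : AnalyticAt ℂ u x) (hv : AnalyticAt ℂ v x)
    (h : ∀ᶠ y in 𝓝 x, u y * v y = 0) : (∀ᶠ y in 𝓝 x, u y = 0) ∨ ∀ᶠ y in 𝓝 x, v y = 0 := by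
  obtain ⟨ε, hε, hb⟩ := eventually_nhds_iff_ball.1 (h.and (hu.eventually_analyticAt.and hv.eventually_analyticAt))
  by_cases h1 : ∀ y ∈ ball x ε, u y = 0
  · exact Or.inl (eventually_nhds_iff_ball.2 ⟨ε, hε, h1⟩)
  push Not at h1
  obtain ⟨y, hy, hy0⟩ := h1
  have hv' : AnalyticOnNhd ℂ v (ball x ε) := fun z hz => (hb z hz).2.2
  have h2 : v =ᶠ[𝓝 y] 0 := by
    filter_upwards [(hb y hy).2.1.continuousAt.eventually_ne hy0, isOpen_ball.mem_nhds hy] with z h3 h4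
    exact (mul_eq_zero.1 (hb z h4).1).resolve_left h3
  have h3 := hv'.eqOn_zero_of_preconnected_of_eventuallyEq_zero (convex_ball x ε).isPreconnected hy h2
  exact Or.inr (eventually_nhds_iff_ball.2 ⟨ε, hε, h3⟩)

lemma prod_zero_germ {ι : Type*} (S : Finset ι) {u : ι → ℂ² → ℂ} {x : ℂ²} (hu : ∀ i, AnalyticAt ℂ (u i) x)
    (h : ∀ᶠ y in 𝓝 x, ∏ i ∈ S, u i y = 0) : ∃ i ∈ S, ∀ᶠ y in 𝓝 x, u i y = 0 := by
  classical
  induction S using Finset.induction_on with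
  | empty =>
    obtain ⟨y, hy⟩ := h.exists
    simp at hy
  | insert a S ha ih =>
    simp_rw [Finset.prod_insert ha] at h
    rcases mul_zero_germ (hu a) (by
      exact S.analyticAt_fun_prod (fun i _ => hu i)) h with h1 | h1
    · exact ⟨a, Finset.mem_insert_self _ _, h1⟩
    · obtain ⟨i, hi, hi'⟩ := ih h1
      exact ⟨i, Finset.mem_insert_of_mem hi, hi'⟩

lemma root_unique {u v : ℂ² → ℂ} {x : ℂ²} {n : ℕ} (hn : 0 < n) (hu : AnalyticAt ℂ u x) (hv : AnalyticAt ℂ v x)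
    (h : ∀ᶠ y in 𝓝 x, u y ^ n = v y ^ n) : ∃ ζ : ℂ, ζ ^ n = 1 ∧ ∀ᶠ y in 𝓝 x, u y = ζ * v y := by
  have hp := isPrimitiveRoot_exp n hn.ne'
  obtain ⟨ζ, hζ, h1⟩ := prod_zero_germ (Polynomial.nthRootsFinset n (1 : ℂ)) (u := fun ζ y => u y - ζ * v y) (x := x)
    (fun ζ => hu.sub (analyticAt_const.mul hv)) (by
      filter_upwards [h] with y hy
      rw [← hp.pow_sub_pow_eq_prod_sub_mul _ _ hn, hy, sub_self])
  refine ⟨ζ, (Polynomial.mem_nthRootsFinset hn 1).1 hζ, ?_⟩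
  filter_upwards [h1] with y hy
  exact sub_eq_zero.1 hy

lemma mem_ball0 {q : ℂ²} {ε : ℝ} : q ∈ ball (0 : ℂ²) ε ↔ ‖q.1‖ < ε ∧ ‖q.2‖ < ε := by
  rw [mem_ball_zero_iff, Prod.norm_def, max_lt_iff]

lemma convex_exp (k : ℤ) (q : ℂ) (ε : ℝ) : Convex ℝ {u : ℂ | ‖exp (k * u) * q‖ < ε} := by
  have h1 : Convex ℝ {t : ℝ | Real.exp t * ‖q‖ < ε} := by
    apply Set.OrdConnected.convex
    apply IsLowerSet.ordConnected
    intro a b hba ha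
    have ha' : Real.exp a * ‖q‖ < ε := ha
    change Real.exp b * ‖q‖ < ε
    refine lt_of_le_of_lt ?_ ha'
    have := Real.exp_le_exp.2 hba
    gcongr
  have h2 := h1.linear_preimage ((k : ℝ) • Complex.reLm)
  convert! h2 using 1
  ext u
  simp only [mem_setOf_eq, norm_mul, norm_exp, mem_preimage]
  have : ((k : ℂ) * u).re = k * u.re := by simp
  rw [this]; rfl

lemma zpow_exp_log {s : ℂ} (hs : s ≠ 0) (k : ℤ) : exp (k * log s) = s ^ k := by
  rw [exp_int_mul, exp_log hs]

namespace Act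
variable (A : Act φ)
include A

lemma two_of {x u : ℂ²} {f : ℂ² → ℂ} (hu : fderiv ℂ f x u ≠ 0) : ∃ k g, Semi φ k g ∧ Jac f g x ≠ 0 := by
  let v : ℂ² := (- fderiv ℂ f x (0, 1), fderiv ℂ f x (1, 0))
  have hv0 : fderiv ℂ f x v = 0 := by rw [lin_apply]; simp only [v]; ring
  have hv : v ≠ 0 := by
    intro h
    have := Prod.ext_iff.1 h
    simp only [v, Prod.fst_zero, Prod.snd_zero, neg_eq_zero] at this
    apply hu
    rw [lin_apply, this.1, this.2]; ring
  obtain ⟨k, g, hg, hgv⟩ := A.span (x := x) hv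
  refine ⟨k, g, hg, Jac_ne_of (u := u) (v := v) ?_⟩
  rw [hv0, zero_mul, sub_zero]
  exact mul_ne_zero hu hgv

lemma two (x : ℂ²) : ∃ k l f g, Semi φ k f ∧ Semi φ l g ∧ Jac f g x ≠ 0 := by
  obtain ⟨k, f, hf, h1⟩ := A.span (x := x) (v := (1, 0)) (by simp)
  obtain ⟨l, g, hg, h2⟩ := A.two_of h1
  exact ⟨k, l, f, g, hf, hg, h2⟩

lemma semi_fixed {p : ℂ²} (hp : VF φ p = 0) {k : ℤ} {f : ℂ² → ℂ} (hf : Semi φ k f) (hk : k ≠ 0) : f p = 0 := by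
  have := A.semi_V hf p
  rw [hp, map_zero] at this
  refine (mul_eq_zero.1 this.symm).resolve_left ?_
  exact_mod_cast hk

lemma semi_norm {p : ℂ²} (hp : VF φ p = 0) {k : ℤ} {f : ℂ² → ℂ} (hf : Semi φ k f) : Semi φ k (fun x => f x - f p) := by
  by_cases hk : k = 0
  · subst hk
    refine ⟨hf.1.sub_const _, fun s hs x => ?_⟩
    beta_reduce
    rw [hf.2 s hs]; simp
  · rw [A.semi_fixed hp hf hk]; simpa using hf

lemma two_fixed {p : ℂ²} (hp : VF φ p = 0) : ∃ k l f g, Semi φ k f ∧ Semi φ l g ∧ f p = 0 ∧ g p = 0 ∧ Jac f g p ≠ 0 := by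
  obtain ⟨k, l, f, g, hf, hg, hJ⟩ := A.two p
  refine ⟨k, l, _, _, A.semi_norm hp hf, A.semi_norm hp hg, sub_self _, sub_self _, ?_⟩
  unfold Jac at *
  simpa [fderiv_sub_const] using hJ

/-- equivariant chart at a fixed point -/
lemma fix_chart {p : ℂ²} (hp : VF φ p = 0) {k l : ℤ} {f g : ℂ² → ℂ} (hf : Semi φ k f) (hg : Semi φ l g)
    (hf0 : f p = 0) (hg0 : g p = 0) (hJ : Jac f g p ≠ 0) {U : Set ℂ²} (hU : IsOpen U) (hpU : p ∈ U) :
    ∃ (N : Set ℂ²) (ε : ℝ) (G : ℂ² → ℂ²), IsOpen N ∧ p ∈ N ∧ N ⊆ U ∧ 0 < ε ∧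
      InjOn (fun x => (f x, g x)) N ∧ (∀ x' ∈ N, Jac f g x' ≠ 0) ∧
      (∀ q ∈ ball (0 : ℂ²) ε, G q ∈ N ∧ (f (G q), g (G q)) = q) ∧
      DifferentiableOn ℂ G (ball 0 ε) ∧ (∀ x ∈ N, (f x, g x) ∈ ball (0 : ℂ²) ε → G (f x, g x) = x) ∧
      ∀ q ∈ ball (0 : ℂ²) ε, ∀ s : ℂ, s ≠ 0 → (s ^ k * q.1, s ^ l * q.2) ∈ ball (0 : ℂ²) ε →
        φ s (G q) = G (s ^ k * q.1, s ^ l * q.2) := by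
  obtain ⟨N, ε, G, hN, hpN, hNU, hε, hi, hj, hG, hGd⟩ := loc_inv hU hf.1.differentiableOn hg.1.differentiableOn hpU hJ
  rw [hf0, hg0] at hG hGd
  refine ⟨N, ε, G, hN, hpN, hNU, hε, hi, hj, hG, hGd, fun x hx hx' => hi (hG _ hx').1 hx (hG _ hx').2, ?_⟩
  intro q hq s hs hsq
  set C : Set ℂ := {u : ℂ | ‖exp (k * u) * q.1‖ < ε} ∩ {u : ℂ | ‖exp (l * u) * q.2‖ < ε} with hC
  have hCc : IsPreconnected C := ((convex_exp k q.1 ε).inter (convex_exp l q.2 ε)).isPreconnected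
  have hCo : IsOpen C := (isOpen_lt (by fun_prop) continuous_const).inter (isOpen_lt (by fun_prop) continuous_const)
  have hCm : ∀ u ∈ C, (exp (k * u) * q.1, exp (l * u) * q.2) ∈ ball (0 : ℂ²) ε := fun u hu => mem_ball0.2 hu
  have h0 : (0 : ℂ) ∈ C := by
    have := mem_ball0.1 hq
    refine ⟨?_, ?_⟩ <;> simp [this.1, this.2]
  have hlog : log s ∈ C := by
    have := mem_ball0.1 hsq
    refine ⟨?_, ?_⟩
    · change ‖exp (k * log s) * q.1‖ < ε
      rw [zpow_exp_log hs]; exact this.1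
    · change ‖exp (l * log s) * q.2‖ < ε
      rw [zpow_exp_log hs]; exact this.2
  have hd1 : DifferentiableOn ℂ (fun u => φ (exp u) (G q)) C := fun u _ =>
    ((A.orb (G q) (exp_ne_zero u)).comp u differentiableAt_exp).differentiableWithinAt
  have hd2 : DifferentiableOn ℂ (fun u => G (exp (k * u) * q.1, exp (l * u) * q.2)) C :=
    hGd.comp (f := fun u : ℂ => (exp (k * u) * q.1, exp (l * u) * q.2)) (by fun_prop) hCm
  have hev : (fun u => φ (exp u) (G q)) =ᶠ[𝓝 0] (fun u => G (exp (k * u) * q.1, exp (l * u) * q.2)) := by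
    have hc : ContinuousAt (fun u => φ (exp u) (G q)) 0 := (hd1.differentiableAt (hCo.mem_nhds h0)).continuousAt
    have hm : ∀ᶠ u in 𝓝 (0 : ℂ), φ (exp u) (G q) ∈ N := by
      apply hc.eventually
      change ∀ᶠ y in 𝓝 (φ (exp 0) (G q)), y ∈ N
      rw [exp_zero, A.one']
      exact hN.mem_nhds (hG q hq).1
    filter_upwards [hm, hCo.mem_nhds h0] with u hu huC
    apply hi hu (hG _ (hCm u huC)).1
    refine Eq.trans ?_ (hG _ (hCm u huC)).2.symm
    have := Prod.ext_iff.1 (hG q hq).2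
    simp only at this
    simp only [hf.2 _ (exp_ne_zero u), hg.2 _ (exp_ne_zero u), this.1, this.2, exp_int_mul]
  have := (hd1.analyticOnNhd hCo).eqOn_of_preconnected_of_eventuallyEq (hd2.analyticOnNhd hCo) hCc h0 hev hlog
  simpa only [exp_log hs, zpow_exp_log hs] using this

/-- the identity theorem for the maps of the action -/
lemma eq_id_of_nhds {s : ℂ} (hs : s ≠ 0) {x : ℂ²} (h : ∀ᶠ y in 𝓝 x, φ s y = y) : φ s = id := by
  have hd := A.diff hs
  have key : ∀ (L : ℂ² → ℂ), Differentiable ℂ L → ∀ y, L (φ s y) = L y := by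
    intro L hL y
    have h1 : AnalyticOnNhd ℂ (fun y => L (φ s y)) univ := fun y _ => analytic_of_diff (hL.comp hd) y
    have h2 : AnalyticOnNhd ℂ L univ := fun y _ => analytic_of_diff hL y
    refine h1.eqOn_of_preconnected_of_eventuallyEq h2 isPreconnected_univ (mem_univ x) ?_ (mem_univ y)
    filter_upwards [h] with z hz
    rw [hz]
  ext y
  · exact key (fun x => x.1) (by fun_prop) y
  · exact key (fun x => x.2) (by fun_prop) y

/-- if the semi-invariants forming a local chart at x are invariant under `s ∈ Stab x`, then `φ s = id` -/
lemma eq_id_of_weights {s : ℂ} (hs : s ≠ 0) {x : ℂ²} (hx : φ s x = x) {k l : ℤ} {f g : ℂ² → ℂ} (hf : Semi φ k f)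
    (hg : Semi φ l g) (hJ : Jac f g x ≠ 0) (hk : s ^ k = 1) (hl : s ^ l = 1) : φ s = id := by
  obtain ⟨N, ε, G, hN, hxN, -, hε, hi, -⟩ := loc_inv isOpen_univ hf.1.differentiableOn hg.1.differentiableOn (mem_univ x) hJ
  refine A.eq_id_of_nhds hs (x := x) ?_
  have hc : ∀ᶠ y in 𝓝 x, φ s y ∈ N := by
    apply (A.diff hs).continuous.continuousAt.eventually
    rw [hx]
    exact hN.mem_nhds hxN
  filter_upwards [hc, hN.mem_nhds hxN] with y h1 h2
  apply hi h1 h2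
  simp only [hf.2 s hs, hg.2 s hs, hk, hl, one_mul]

end Act

/-- inverse action -/
lemma Act.symm (A : Act φ) : Act (fun s => φ s⁻¹) := by
  refine ⟨?_, ?_, ?_⟩
  · intro p hp
    have h0 : p.1 ≠ 0 := hp.1
    exact ((A.dAt (inv_ne_zero h0) p.2).comp p (f := fun p : ℂ × ℂ² => (p.1⁻¹, p.2))
      ((differentiableAt_fst.inv h0).prodMk differentiableAt_snd)).differentiableWithinAt
  · simp [A.one]
  · intro z w hz hw
    rw [mul_inv]
    exact A.mul _ _ (inv_ne_zero hz) (inv_ne_zero hw)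

lemma Semi.symm {k : ℤ} {f : ℂ² → ℂ} (h : Semi φ k f) : Semi (fun s => φ s⁻¹) (-k) f :=
  ⟨h.1, fun s hs x => by rw [h.2 _ (inv_ne_zero hs), inv_zpow, zpow_neg]⟩

lemma Semi.symm' {k : ℤ} {f : ℂ² → ℂ} (h : Semi (fun s => φ s⁻¹) k f) : Semi φ (-k) f := by
  have := h.symm
  simpa using this

lemma Lin.symm (h : Lin (fun s => φ s⁻¹)) : Lin φ := by
  obtain ⟨n, m, H, hb, h1, h2, h3⟩ := h
  refine ⟨-n, -m, H, hb, h1, h2, fun s hs x y => ?_⟩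
  have := h3 s⁻¹ (inv_ne_zero hs) x y
  simp only [inv_inv] at this
  rw [this, inv_zpow, inv_zpow, zpow_neg, zpow_neg]

lemma VF_symm (A : Act φ) {x : ℂ²} (h : VF φ x = 0) : VF (fun s => φ s⁻¹) x = 0 :=
  (A.symm.fixed_iff x).2 fun s hs => (A.fixed_iff x).1 h _ (inv_ne_zero hs)

/-- effectivity -/
def Eff (φ : ℂ → ℂ² → ℂ²) : Prop := ∀ s : ℂ, s ≠ 0 → φ s = id → s = 1

lemma Eff.symm (h : Eff φ) : Eff (fun s => φ s⁻¹) := fun s hs h1 =>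
  inv_eq_one.1 (h s⁻¹ (inv_ne_zero hs) h1)

lemma Semi.mul {k l : ℤ} {f g : ℂ² → ℂ} (hf : Semi φ k f) (hg : Semi φ l g) :
    Semi φ (k + l) (fun x => f x * g x) :=
  ⟨hf.1.mul hg.1, fun s hs x => by beta_reduce; rw [hf.2 s hs, hg.2 s hs, zpow_add₀ hs]; ring⟩

lemma Semi.pow {k : ℤ} {f : ℂ² → ℂ} (hf : Semi φ k f) (n : ℕ) :
    Semi φ (k * n) (fun x => f x ^ n) :=
  ⟨hf.1.pow n, fun s hs x => by beta_reduce; rw [hf.2 s hs, mul_pow, zpow_mul, zpow_natCast]⟩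

lemma Semi.sub {k : ℤ} {f g : ℂ² → ℂ} (hf : Semi φ k f) (hg : Semi φ k g) (c : ℂ) :
    Semi φ k (fun x => f x - c * g x) :=
  ⟨hf.1.sub (hg.1.const_mul c), fun s hs x => by beta_reduce; rw [hf.2 s hs, hg.2 s hs]; ring⟩

/-- vanishing of the principal part outside -/
lemma cauchy_out {u : ℂ → ℂ} (hu : DifferentiableOn ℂ u {z | z ≠ 0}) {r : ℝ} (hr : 0 < r)
    (h : ∀ n : ℕ, (∮ z in C(0, r), z ^ n * u z) = 0) {s : ℂ} (hs : r < ‖s‖) :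
    (∮ z in C(0, r), (z - s)⁻¹ * u z) = 0 := by
  have hs0 : s ≠ 0 := norm_pos_iff.1 (hr.trans hs)
  have hne : ∀ z ∈ sphere (0 : ℂ) r, z ≠ 0 := fun z hz h0 => by
    rw [mem_sphere_zero_iff_norm, h0, norm_zero] at hz; exact hr.ne hz
  have hne' : ∀ z ∈ sphere (0 : ℂ) r, z - s ≠ 0 := fun z hz h0 => by
    rw [mem_sphere_zero_iff_norm, sub_eq_zero.1 h0] at hz; exact hs.ne' hz
  have huc : ContinuousOn u (sphere 0 r) := hu.continuousOn.mono fun z hz => hne z hz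
  have hic : ContinuousOn (fun z => (z - s)⁻¹ * u z) (sphere 0 r) :=
    ((continuousOn_id.sub continuousOn_const).inv₀ hne').mul huc
  have step : ∀ N : ℕ, (∮ z in C(0, r), (z - s)⁻¹ * u z) = ∮ z in C(0, r), (z / s) ^ N * ((z - s)⁻¹ * u z) := by
    intro N
    induction N with
    | zero => simp
    | succ N ih =>
      rw [ih]
      have h1 : CircleIntegrable (fun z => (z / s) ^ N * ((z - s)⁻¹ * u z)) 0 r :=
        (ContinuousOn.mul (by fun_prop) hic).circleIntegrable hr.le
      have h2 : CircleIntegrable (fun z => (z / s) ^ (N + 1) * ((z - s)⁻¹ * u z)) 0 r :=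
        (ContinuousOn.mul (by fun_prop) hic).circleIntegrable hr.le
      rw [← sub_eq_zero, ← circleIntegral.integral_sub h1 h2]
      have : (∮ z in C(0, r), ((z / s) ^ N * ((z - s)⁻¹ * u z) - (z / s) ^ (N + 1) * ((z - s)⁻¹ * u z))) =
          ∮ z in C(0, r), (-(s ^ (N + 1))⁻¹) * (z ^ N * u z) := by
        apply circleIntegral.integral_congr hr.le
        intro z hz
        have := hne' z hz
        simp only [div_pow]
        field_simp
        ring
      rw [this, circleIntegral.integral_const_mul, h N, mul_zero]
  obtain ⟨M, hM⟩ := (isCompact_sphere (0 : ℂ) r).exists_bound_of_continuousOn hic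
  have hb : ∀ N : ℕ, ‖∮ z in C(0, r), (z - s)⁻¹ * u z‖ ≤ 2 * Real.pi * r * ((r / ‖s‖) ^ N * M) := by
    intro N
    rw [step N]
    apply circleIntegral.norm_integral_le_of_norm_le_const hr.le
    intro z hz
    rw [norm_mul, norm_pow, norm_div, mem_sphere_zero_iff_norm.1 hz]
    have := hM z hz
    gcongr
  have ht : Tendsto (fun N : ℕ => 2 * Real.pi * r * ((r / ‖s‖) ^ N * M)) atTop (𝓝 (2 * Real.pi * r * (0 * M))) :=
    ((tendsto_pow_atTop_nhds_zero_of_lt_one (by positivity) ((div_lt_one (hr.trans hs)).2 hs)).mul_const _).const_mul _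
  have := ge_of_tendsto' ht hb
  rw [zero_mul, mul_zero] at this
  exact norm_le_zero_iff.1 this

/-- extension to the origin of functions with no principal part -/
lemma ext_zero {u : ℂ → ℂ} (hu : DifferentiableOn ℂ u {z | z ≠ 0})
    (h : ∀ r : ℝ, 0 < r → ∀ n : ℕ, (∮ z in C(0, r), z ^ n * u z) = 0) :
    Tendsto u (𝓝[≠] 0) (𝓝 ((2 * Real.pi * I : ℂ)⁻¹ * ∮ z in C(0, 1), z⁻¹ * u z)) := by
  have huc : ContinuousOn u (sphere 0 1) := hu.continuousOn.mono fun z hz h0 => by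
    rw [mem_sphere_zero_iff_norm, h0, norm_zero] at hz; exact zero_ne_one hz
  have hps := hasFPowerSeriesOn_cauchy_integral (R := 1) (c := 0) (f := u)
    (by simpa using huc.circleIntegrable zero_le_one) one_pos
  have hcont := hps.analyticAt.continuousAt
  have h0 : Tendsto (fun w => (2 * Real.pi * I : ℂ)⁻¹ • ∮ z in C(0, 1), (z - w)⁻¹ • u z) (𝓝[≠] 0)
      (𝓝 ((2 * Real.pi * I : ℂ)⁻¹ * ∮ z in C(0, 1), z⁻¹ * u z)) := by
    have := hcont.tendsto.mono_left (nhdsWithin_le_nhds (s := {0}ᶜ))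
    simpa using this
  refine h0.congr' ?_
  have hb : ball (0 : ℂ) 1 ∈ 𝓝[≠] (0 : ℂ) := mem_nhdsWithin_of_mem_nhds (ball_mem_nhds _ one_pos)
  filter_upwards [hb, self_mem_nhdsWithin] with s hs hs0
  have hs0 : s ≠ 0 := hs0
  have hs1 : ‖s‖ < 1 := mem_ball_zero_iff.1 hs
  set r := ‖s‖ / 2 with hr
  have hsp : 0 < ‖s‖ := norm_pos_iff.2 hs0
  have hr0 : 0 < r := by positivity
  have hrs : r < ‖s‖ := by linarith
  have hcF : DifferentiableOn ℂ (dslope u s) {z | z ≠ 0} :=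
    (differentiableOn_dslope (punct_open.mem_nhds hs0)).2 hu
  have hsub : ∀ z ∈ closedBall (0 : ℂ) 1 \ ball 0 r, z ≠ 0 := fun z hz h0 => by
    apply hz.2; rw [h0]; exact mem_ball_self hr0
  have e1 := circleIntegral_eq_of_differentiable_on_annulus_off_countable (c := 0) hr0 (by linarith : r ≤ 1)
    (f := dslope u s) (s := ∅) countable_empty (hcF.continuousOn.mono hsub)
    (fun z hz => hcF.differentiableAt (punct_open.mem_nhds (hsub z
      ⟨ball_subset_closedBall hz.1.1, fun hb => hz.1.2 (ball_subset_closedBall hb)⟩)))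
  have split : ∀ R : ℝ, 0 < R → R ≠ ‖s‖ → (∮ z in C(0, R), dslope u s z) =
      (∮ z in C(0, R), (z - s)⁻¹ * u z) - (∮ z in C(0, R), (z - s)⁻¹) * u s := by
    intro R hR hRs
    have hne' : ∀ z ∈ sphere (0 : ℂ) R, z - s ≠ 0 := fun z hz h0 => by
      rw [mem_sphere_zero_iff_norm, sub_eq_zero.1 h0] at hz; exact hRs hz.symm
    have hi1 : ContinuousOn (fun z => (z - s)⁻¹) (sphere 0 R) := (continuousOn_id.sub continuousOn_const).inv₀ hne'
    have huc : ContinuousOn u (sphere 0 R) := hu.continuousOn.mono fun z hz h0 => by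
      rw [mem_sphere_zero_iff_norm, h0, norm_zero] at hz; exact hR.ne hz
    have i1 : CircleIntegrable (fun z => (z - s)⁻¹ * u z) 0 R := (hi1.mul huc).circleIntegrable hR.le
    have i2 : CircleIntegrable (fun z => u s * (z - s)⁻¹) 0 R := (continuousOn_const.mul hi1).circleIntegrable hR.le
    rw [mul_comm, ← circleIntegral.integral_const_mul, ← circleIntegral.integral_sub i1 i2]
    apply circleIntegral.integral_congr hR.le
    intro z hz
    have : z ≠ s := sub_ne_zero.1 (hne' z hz)
    simp only
    rw [dslope_of_ne _ this, slope_def_field]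
    field_simp
  rw [split 1 one_pos hs1.ne', split r hr0 hrs.ne, cauchy_out hu hr0 (h r hr0) hrs,
    circleIntegral.integral_sub_inv_of_mem_ball hs] at e1
  have e2 : (∮ z in C(0, r), (z - s)⁻¹) = 0 := by
    apply circleIntegral_eq_zero_of_differentiable_on_off_countable hr0.le countable_empty
    · refine (continuousOn_id.sub continuousOn_const).inv₀ fun z hz h0 => ?_
      have h0' : z - s = 0 := h0
      rw [mem_closedBall_zero_iff, sub_eq_zero.1 h0'] at hz; linarith
    · intro z hz
      refine (differentiableAt_id.sub_const s).inv fun h0 => ?_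
      have hz := hz.1
      have h0' : z - s = 0 := h0
      rw [mem_ball_zero_iff, sub_eq_zero.1 h0'] at hz; linarith
  rw [e2, zero_mul, sub_zero, sub_eq_zero] at e1
  simp only [smul_eq_mul]
  rw [e1]
  have : (2 * Real.pi * I : ℂ) ≠ 0 := by simp [Real.pi_ne_zero]
  field_simp

/-- circle integral of an orbit function -/
lemma circ_cpt (A : Act φ) (h : ℂ² → ℂ) (x : ℂ²) {r : ℝ} (hr : 0 < r) (n : ℤ) :
    (∮ z in C(0, r), z ^ n * h (φ z x)) = 2 * Real.pi * I * (r : ℂ) ^ (n + 1) * cpt φ (-(n + 1)) h (φ r x) := by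
  have hr' : (r : ℂ) ≠ 0 := by exact_mod_cast hr.ne'
  unfold circleIntegral cpt
  have h2 : (2 * Real.pi : ℝ) ≠ 0 := by positivity
  have := intervalIntegral.integral_comp_mul_left (a := 0) (b := 1)
    (fun θ : ℝ => deriv (circleMap 0 r) θ • (circleMap 0 r θ ^ n * h (φ (circleMap 0 r θ) x))) h2
  rw [mul_zero, mul_one] at this
  have h3 : (∫ θ in (0 : ℝ)..2 * Real.pi, deriv (circleMap 0 r) θ • (circleMap 0 r θ ^ n * h (φ (circleMap 0 r θ) x))) =
    (2 * Real.pi : ℝ) • ∫ t in (0 : ℝ)..1, deriv (circleMap 0 r) (2 * Real.pi * t) • (circleMap 0 r (2 * Real.pi * t) ^ n * h (φ (circleMap 0 r (2 * Real.pi * t)) x)) := by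
    rw [this, smul_smul, mul_inv_cancel₀ h2, one_smul]
  rw [h3]
  have e : ∀ t : ℝ, circleMap 0 r (2 * Real.pi * t) = ec t * r := by
    intro t
    simp only [circleMap, ec, zero_add]
    rw [mul_comm]; congr 2; push_cast; ring
  have h4 : ∀ t : ℝ, deriv (circleMap 0 r) (2 * Real.pi * t) • (circleMap 0 r (2 * Real.pi * t) ^ n * h (φ (circleMap 0 r (2 * Real.pi * t)) x))
      = I * (r : ℂ) ^ (n + 1) * (exp (-(2 * Real.pi * I * (-(n + 1) : ℤ) * t)) * h (φ (ec t) (φ r x))) := by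
    intro t
    rw [deriv_circleMap, e, ec_zpow, A.mul' (ec_ne t) hr', smul_eq_mul, mul_zpow, zpow_neg, inv_inv, zpow_add_one₀ (ec_ne t),
      zpow_add_one₀ hr']
    ring
  simp_rw [h4]
  rw [intervalIntegral.integral_const_mul, real_smul]
  push_cast
  ring

noncomputable def avg (φ : ℂ → ℂ² → ℂ²) (x : ℂ²) : ℂ² := (cpt φ 0 Prod.fst x, cpt φ 0 Prod.snd x)

namespace Act
variable (A : Act φ)
include A

lemma avg_diff : Differentiable ℂ (avg φ) := (A.cpt_diff differentiable_fst 0).prodMk (A.cpt_diff differentiable_snd 0)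

lemma avg_inv {s : ℂ} (hs : s ≠ 0) (x : ℂ²) : avg φ (φ s x) = avg φ x := by
  unfold avg
  rw [(A.cpt_semi differentiable_fst 0).2 s hs, (A.cpt_semi differentiable_snd 0).2 s hs]
  simp

lemma cpt_fix (h : ℂ² → ℂ) {p : ℂ²} (hp : VF φ p = 0) : cpt φ 0 h p = h p := by
  have := (A.fixed_iff p).1 hp
  unfold cpt
  simp [fun t => this (ec t) (ec_ne t)]

lemma avg_fix {p : ℂ²} (hp : VF φ p = 0) : avg φ p = p := by
  unfold avg
  rw [A.cpt_fix _ hp, A.cpt_fix _ hp]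

lemma lim_h {h : ℂ² → ℂ} (hh : Differentiable ℂ h) {x : ℂ²} (hx : ∀ k f, k < 0 → Semi φ k f → f x = 0) :
    Tendsto (fun s => h (φ s x)) (𝓝[≠] 0) (𝓝 (cpt φ 0 h x)) := by
  have hu : DifferentiableOn ℂ (fun s => h (φ s x)) {z | z ≠ 0} := fun s hs =>
    ((hh _).comp s (A.orb x hs)).differentiableWithinAt
  have := ext_zero hu (fun r hr n => by
    have h1 := circ_cpt A h x hr n
    have hr' : (r : ℂ) ≠ 0 := by exact_mod_cast hr.ne'
    have h2 : cpt φ (-((n : ℤ) + 1)) h (φ r x) = 0 := by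
      rw [(A.cpt_semi hh _).2 r hr', hx _ _ (by omega) (A.cpt_semi hh _), mul_zero]
    rw [h2, mul_zero] at h1
    simpa using h1)
  convert! this using 2
  have h1 := circ_cpt A h x one_pos (-1)
  simp only [zpow_neg_one, ofReal_one, neg_add_cancel, zpow_zero, mul_one, neg_zero, A.one'] at h1
  rw [h1]
  have : (2 * Real.pi * I : ℂ) ≠ 0 := by simp [Real.pi_ne_zero]
  field_simp

lemma lim {x : ℂ²} (hx : ∀ k f, k < 0 → Semi φ k f → f x = 0) :
    Tendsto (fun s => φ s x) (𝓝[≠] 0) (𝓝 (avg φ x)) :=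
  (A.lim_h differentiable_fst hx).prodMk_nhds (A.lim_h differentiable_snd hx)

lemma avg_fixed {x : ℂ²} (hx : ∀ k f, k < 0 → Semi φ k f → f x = 0) : VF φ (avg φ x) = 0 := by
  refine (A.fixed_iff _).2 fun w hw => ?_
  have h1 : Tendsto (fun s => φ w (φ s x)) (𝓝[≠] 0) (𝓝 (φ w (avg φ x))) :=
    ((A.diff hw).continuous.tendsto _).comp (A.lim hx)
  have h2 : Tendsto (fun s : ℂ => w * s) (𝓝[≠] 0) (𝓝[≠] 0) := by
    refine tendsto_nhdsWithin_iff.2 ⟨?_, ?_⟩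
    · have : Tendsto (fun s : ℂ => w * s) (𝓝 0) (𝓝 (w * 0)) := (continuous_const.mul continuous_id).tendsto 0
      rw [mul_zero] at this
      exact this.mono_left nhdsWithin_le_nhds
    · filter_upwards [self_mem_nhdsWithin] with s hs
      exact mul_ne_zero hw hs
  refine tendsto_nhds_unique (h1.congr' ?_) ((A.lim hx).comp h2)
  filter_upwards [self_mem_nhdsWithin] with s hs
  exact A.mul' hw hs x

end Act

lemma tendsto_zpow0 {n : ℤ} (hn : 0 < n) (a : ℂ) : Tendsto (fun s : ℂ => s ^ n * a) (𝓝[≠] 0) (𝓝 0) := by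
  obtain ⟨k, rfl⟩ := Int.eq_ofNat_of_zero_le hn.le
  have hk : k ≠ 0 := by rintro rfl; simp at hn
  have : Tendsto (fun s : ℂ => s ^ k * a) (𝓝 0) (𝓝 (0 ^ k * a)) :=
    ((continuous_pow k).mul continuous_const).tendsto 0
  rw [zero_pow hk, zero_mul] at this
  simpa using this.mono_left nhdsWithin_le_nhds

namespace Act
variable (A : Act φ)
include A

/-- linearisation by two semi-invariants when all orbits flow to fixed points -/
lemma lin_of_pos (hneg : ∀ x k f, k < 0 → Semi φ k f → f x = 0) {n m : ℤ} {f g : ℂ² → ℂ} (hf : Semi φ n f)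
    (hg : Semi φ m g) (hJ : ∀ p, VF φ p = 0 → Jac f g p ≠ 0)
    (hinj : ∀ x x', f x = f x' → g x = g x' → avg φ x = avg φ x')
    (hsurj : ∀ q : ℂ², ∃ p, VF φ p = 0 ∧ Tendsto (fun s : ℂ => (s ^ n * q.1, s ^ m * q.2)) (𝓝[≠] 0) (𝓝 (f p, g p))) :
    Lin φ := by
  have loc : ∀ p, VF φ p = 0 → _ := fun p hp =>
    loc_inv isOpen_univ hf.1.differentiableOn hg.1.differentiableOn (mem_univ p) (hJ p hp)
  have nz : ∀ᶠ s in 𝓝[≠] (0 : ℂ), s ≠ 0 := self_mem_nhdsWithin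
  refine lin_of hf hg ?_ ⟨?_, ?_⟩
  · intro x
    have hp := A.avg_fixed (hneg x)
    obtain ⟨N, ε, G, hN, hpN, -, hε, hi, hj, -⟩ := loc _ hp
    obtain ⟨s, hs, hs0⟩ := (((A.lim (hneg x)).eventually (hN.mem_nhds hpN)).and nz).exists
    exact jac_move A hf hg hs0 (hj _ hs)
  · intro x x' h
    have h1 := (Prod.ext_iff.1 h).1
    have h2 := (Prod.ext_iff.1 h).2
    simp only at h1 h2
    have hp := A.avg_fixed (hneg x)
    obtain ⟨N, ε, G, hN, hpN, -, hε, hi, hj, -⟩ := loc _ hp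
    have l1 := A.lim (hneg x)
    have l2 := A.lim (hneg x')
    rw [← hinj x x' h1 h2] at l2
    obtain ⟨s, ⟨hs, hs'⟩, hs0⟩ := (((l1.eventually (hN.mem_nhds hpN)).and (l2.eventually (hN.mem_nhds hpN))).and nz).exists
    have : φ s x = φ s x' := hi hs hs' (by simp only [hf.2 s hs0, hg.2 s hs0, h1, h2])
    rw [← A.inv hs0 x, this, A.inv hs0]
  · intro q
    obtain ⟨p, hp, ht⟩ := hsurj q
    obtain ⟨N, ε, G, hN, hpN, -, hε, hi, hj, hG, -⟩ := loc _ hp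
    obtain ⟨s, hs, hs0⟩ := ((ht.eventually (ball_mem_nhds _ hε)).and nz).exists
    refine ⟨φ s⁻¹ (G (s ^ n * q.1, s ^ m * q.2)), ?_⟩
    have := Prod.ext_iff.1 (hG _ hs).2
    simp only at this
    simp only [hf.2 _ (inv_ne_zero hs0), hg.2 _ (inv_ne_zero hs0), this.1, this.2]
    have a1 := zpow_ne_zero n hs0
    have a2 := zpow_ne_zero m hs0
    simp only [inv_zpow]
    ext <;> simp <;> field_simp

/-- elliptic case -/
lemma lin_elliptic (hneg : ∀ x k f, k < 0 → Semi φ k f → f x = 0) {n m : ℤ} {f g : ℂ² → ℂ} (hf : Semi φ n f)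
    (hg : Semi φ m g) (hn : 0 < n) (hm : 0 < m) {p : ℂ²} (hp : VF φ p = 0) (hJ : Jac f g p ≠ 0) : Lin φ := by
  have zf : ∀ q, VF φ q = 0 → f q = 0 := fun q hq => A.semi_fixed hq hf hn.ne'
  have zg : ∀ q, VF φ q = 0 → g q = 0 := fun q hq => A.semi_fixed hq hg hm.ne'
  obtain ⟨N, ε, G, hN, hpN, -, hε, hi, hj, hG, -⟩ :=
    loc_inv isOpen_univ hf.1.differentiableOn hg.1.differentiableOn (mem_univ p) hJ
  have hav : ∀ x, avg φ x = p := by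
    have hev : ∀ᶠ x in 𝓝 p, avg φ x = p := by
      have : ∀ᶠ x in 𝓝 p, avg φ x ∈ N := by
        apply A.avg_diff.continuous.continuousAt.eventually
        rw [A.avg_fix hp]
        exact hN.mem_nhds hpN
      filter_upwards [this] with x hx
      have hq := A.avg_fixed (hneg x)
      exact hi hx hpN (by simp only [zf _ hq, zg _ hq, zf _ hp, zg _ hp])
    intro x
    have h1 : AnalyticOnNhd ℂ (fun x => (avg φ x).1) univ := fun y _ => analytic_of_diff A.avg_diff.fst y
    have h2 : AnalyticOnNhd ℂ (fun x => (avg φ x).2) univ := fun y _ => analytic_of_diff A.avg_diff.snd y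
    ext
    · refine h1.eqOn_of_preconnected_of_eventuallyEq (g := fun _ => p.1) (fun _ _ => analyticAt_const) isPreconnected_univ (mem_univ p) ?_ (mem_univ x)
      filter_upwards [hev] with y hy
      rw [hy]
    · refine h2.eqOn_of_preconnected_of_eventuallyEq (g := fun _ => p.2) (fun _ _ => analyticAt_const) isPreconnected_univ (mem_univ p) ?_ (mem_univ x)
      filter_upwards [hev] with y hy
      rw [hy]
  have huniq : ∀ q, VF φ q = 0 → q = p := fun q hq => by rw [← A.avg_fix hq, hav]
  refine A.lin_of_pos hneg hf hg (fun q hq => by rw [huniq q hq]; exact hJ) (fun x x' _ _ => by rw [hav, hav]) ?_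
  intro q
  refine ⟨p, hp, ?_⟩
  rw [zf p hp, zg p hp]
  exact (tendsto_zpow0 hn _).prodMk_nhds (tendsto_zpow0 hm _)

end Act

lemma factor {W : Set ℂ²} (hW : IsOpen W) {x : ℂ²} (hx : x ∈ W) {y z : ℂ² → ℂ} (hy : DifferentiableOn ℂ y W)
    (hz : DifferentiableOn ℂ z W) (h : ∀ a ∈ W, ∀ b ∈ W, y a = y b ↔ z a = z b) (hnc : ¬ ∀ᶠ x' in 𝓝 x, y x' = y x) :
    ∃ T : ℂ → ℂ, AnalyticAt ℂ T (y x) ∧ deriv T (y x) ≠ 0 ∧ ∀ a ∈ W, z a = T (y a) := by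
  classical
  let T : ℂ → ℂ := fun t => if ht : ∃ a ∈ W, y a = t then z ht.choose else 0
  have hT : ∀ a ∈ W, z a = T (y a) := by
    intro a ha
    have ht : ∃ b ∈ W, y b = y a := ⟨a, ha, rfl⟩
    simp only [T, dif_pos ht]
    exact ((h _ ht.choose_spec.1 a ha).1 ht.choose_spec.2).symm
  have hya := analyticOn_of_diff hW hy x hx
  have hza := analyticOn_of_diff hW hz x hx
  have hTa : AnalyticAt ℂ T (y x) := by
    apply push hya hnc
    refine hza.congr ?_
    filter_upwards [hW.mem_nhds hx] with a ha
    exact hT a ha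
  refine ⟨T, hTa, ?_, hT⟩
  have hop := open_at hya hnc
  apply inj_deriv hTa (U := y '' W)
  · rw [← hop]
    exact image_mem_map (hW.mem_nhds hx)
  · rintro _ ⟨a, ha, rfl⟩ _ ⟨b, hb, rfl⟩ hab
    rw [← hT a ha, ← hT b hb] at hab
    exact (h a ha b hb).2 hab

namespace Act
variable (A : Act φ)
include A

lemma fderiv_move {z : ℂ² → ℂ} (hz : Semi φ 0 z) {s : ℂ} (hs : s ≠ 0) {x : ℂ²}
    (h : fderiv ℂ z (φ s x) ≠ 0) : fderiv ℂ z x ≠ 0 := by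
  intro h0
  apply h
  have e : z = fun y => z (φ s⁻¹ y) := by
    funext y
    rw [hz.2 _ (inv_ne_zero hs)]; simp
  have h1 : HasFDerivAt (fun y => z (φ s⁻¹ y)) ((fderiv ℂ z (φ s⁻¹ (φ s x))).comp (fderiv ℂ (φ s⁻¹) (φ s x))) (φ s x) :=
    (hz.1 _).hasFDerivAt.comp _ ((A.diff (inv_ne_zero hs)) _).hasFDerivAt
  rw [← e, A.inv hs, h0, ContinuousLinearMap.zero_comp] at h1
  exact h1.fderiv

lemma orbit_conn (x : ℂ²) : IsPreconnected ((fun s => φ s x) '' {s | s ≠ 0}) :=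
  punct_conn.image _ fun s hs => (A.orb x hs).continuousAt.continuousWithinAt

/-- the orbit with its limit point is connected -/
lemma orbit_lim_conn {x : ℂ²} {p : ℂ²} (hx : Tendsto (fun s => φ s x) (𝓝[≠] 0) (𝓝 p)) :
    IsPreconnected (insert p ((fun s => φ s x) '' {s | s ≠ 0})) := by
  refine (A.orbit_conn x).subset_closure (subset_insert _ _) ?_
  rw [insert_subset_iff]
  refine ⟨?_, subset_closure⟩
  refine mem_closure_of_tendsto hx ?_
  filter_upwards [self_mem_nhdsWithin] with s hs
  exact ⟨s, hs, rfl⟩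

lemma semi_lim {z : ℂ² → ℂ} (hz : Semi φ 0 z) {x p : ℂ²} (hx : Tendsto (fun s => φ s x) (𝓝[≠] 0) (𝓝 p)) :
    z p = z x := by
  have h1 : Tendsto (fun s => z (φ s x)) (𝓝[≠] 0) (𝓝 (z p)) := (hz.1.continuous.tendsto _).comp hx
  refine tendsto_nhds_unique h1 (tendsto_const_nhds.congr' ?_)
  filter_upwards [self_mem_nhdsWithin] with s hs
  rw [hz.2 s hs]; simp

lemma avg_fol (hneg : ∀ x k f, k < 0 → Semi φ k f → f x = 0)
    (hpar : ∀ p, VF φ p = 0 → ∃ f g, Semi φ 1 f ∧ Semi φ 0 g ∧ Jac f g p ≠ 0) : Fol (Setoid.ker (avg φ)) := by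
  have hlim := fun x => A.lim (hneg x)
  have hfix := fun x => A.avg_fixed (hneg x)
  refine ⟨?_, ?_, ?_, ?_⟩
  · intro a
    obtain ⟨f, g, hf, hg, hJ⟩ := hpar _ (hfix a)
    obtain ⟨N, ε, G, hN, hpN, -, hε, hi, hj, hG, -⟩ :=
      loc_inv isOpen_univ hf.1.differentiableOn hg.1.differentiableOn (mem_univ _) hJ
    refine ⟨avg φ ⁻¹' N, g, hN.preimage A.avg_diff.continuous, hpN, ?_, hg.1.differentiableOn, ?_⟩
    · intro x x' h hx
      have h : avg φ x = avg φ x' := h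
      change avg φ x' ∈ N
      rw [← h]; exact hx
    · intro x hx x' hx'
      change g x = g x' ↔ avg φ x = avg φ x'
      constructor
      · intro h
        apply hi hx hx'
        simp only [A.semi_fixed (hfix _) hf one_ne_zero, A.semi_lim hg (hlim _), h]
      · intro h
        rw [← A.semi_lim hg (hlim x), h, A.semi_lim hg (hlim x')]
  · exact isClosed_eq (A.avg_diff.continuous.comp continuous_fst) (A.avg_diff.continuous.comp continuous_snd)
  · intro x
    refine isPreconnected_of_forall (avg φ x) ?_
    intro y hy
    have hy : avg φ x = avg φ y := hy
    refine ⟨_, ?_, ?_, ?_, A.orbit_lim_conn (hlim y)⟩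
    · rw [insert_subset_iff]
      refine ⟨?_, ?_⟩
      · change avg φ x = avg φ (avg φ y)
        rw [A.avg_fix (hfix y), hy]
      · rintro _ ⟨s, hs, rfl⟩
        change avg φ x = avg φ (φ s y)
        rw [A.avg_inv hs, hy]
    · rw [hy]; exact mem_insert _ _
    · exact mem_insert_of_mem _ ⟨1, one_ne_zero, A.one' y⟩
  · obtain ⟨f, g, hf, hg, hJ⟩ := hpar _ (hfix 0)
    refine ⟨g, hg.1, ?_, ?_⟩
    · intro x x' h
      have h : avg φ x = avg φ x' := h
      rw [← A.semi_lim hg (hlim x), h, A.semi_lim hg (hlim x')]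
    · by_contra! hc
      apply hJ
      have : g = fun _ => g 0 := funext fun x => hc x 0
      unfold Jac
      rw [this]; simp

/-- the divergence -/
noncomputable def dv (φ : ℂ → ℂ² → ℂ²) (x : ℂ²) : ℂ :=
  fderiv ℂ (fun x => (VF φ x).1) x (1, 0) + fderiv ℂ (fun x => (VF φ x).2) x (0, 1)

lemma V1d : Differentiable ℂ (fun x => (VF φ x).1) := A.V_diff.fst
lemma V2d : Differentiable ℂ (fun x => (VF φ x).2) := A.V_diff.snd

lemma dfun {f : ℂ² → ℂ} (hf : Differentiable ℂ f) (v : ℂ²) : Differentiable ℂ (fun x => fderiv ℂ f x v) := by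
  have := fderiv_diff isOpen_univ hf.differentiableOn v
  rwa [differentiableOn_univ] at this

lemma dv_diff : Differentiable ℂ (dv φ) := (A.dfun A.V1d _).add (A.dfun A.V2d _)

/-- derivative of the equation `df(V) = k f` -/
lemma semi_V' {k : ℤ} {f : ℂ² → ℂ} (hf : Semi φ k f) {p : ℂ²} (hp : VF φ p = 0) (u : ℂ²) :
    fderiv ℂ (fun x => (VF φ x).1) p u * fderiv ℂ f p (1, 0) + fderiv ℂ (fun x => (VF φ x).2) p u * fderiv ℂ f p (0, 1)
      = k * fderiv ℂ f p u := by
  have e : (fun x => (VF φ x).1 * fderiv ℂ f x (1, 0) + (VF φ x).2 * fderiv ℂ f x (0, 1)) = fun x => (k : ℂ) * f x := by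
    funext x
    rw [← A.semi_V hf x, lin_apply _ (VF φ x)]
  have h1 := (((A.V1d p).hasFDerivAt.mul (A.dfun hf.1 (1, 0) p).hasFDerivAt).add
    ((A.V2d p).hasFDerivAt.mul (A.dfun hf.1 (0, 1) p).hasFDerivAt))
  have h2 := (hf.1 p).hasFDerivAt.const_mul (k : ℂ)
  have h3 : HasFDerivAt (fun x => (k : ℂ) * f x) _ p := h1.congr_of_eventuallyEq (Eventually.of_forall fun x => (congrFun e x).symm)
  have h4 := congrArg (fun L : ℂ² →L[ℂ] ℂ => L u) (h3.unique h2)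
  simp only [add_apply, smul_apply, smul_eq_mul, hp, Prod.fst_zero, Prod.snd_zero, zero_mul, zero_add] at h4
  linear_combination h4

lemma lin_parabolic (hneg : ∀ x k f, k < 0 → Semi φ k f → f x = 0)
    (hpar : ∀ p, VF φ p = 0 → ∃ f g, Semi φ 1 f ∧ Semi φ 0 g ∧ Jac f g p ≠ 0) : Lin φ := by
  have hlim := fun x => A.lim (hneg x)
  have hfix := fun x => A.avg_fixed (hneg x)
  have hF := A.avg_fol hneg hpar
  obtain ⟨z, hzd, hzs, hz⟩ := hF.exists_coord
  have hz : ∀ x x', z x = z x' ↔ avg φ x = avg φ x' := hz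
  have hz0 : Semi φ 0 z := ⟨hzd, fun s hs x => by rw [zpow_zero, one_mul]; exact (hz _ _).2 (A.avg_inv hs x)⟩
  have hdz : ∀ x, fderiv ℂ z x ≠ 0 := by
    intro x
    obtain ⟨f, g, hf, hg, hJ⟩ := hpar _ (hfix x)
    set p := avg φ x with hp
    obtain ⟨N, ε, G, hN, hpN, -, hε, hi, hj, hG, -⟩ :=
      loc_inv isOpen_univ hf.1.differentiableOn hg.1.differentiableOn (mem_univ _) hJ
    have hiff : ∀ a ∈ avg φ ⁻¹' N, ∀ b ∈ avg φ ⁻¹' N, g a = g b ↔ z a = z b := by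
      intro a ha b hb
      rw [hz]
      constructor
      · intro h
        apply hi ha hb
        simp only [A.semi_fixed (hfix _) hf one_ne_zero, A.semi_lim hg (hlim _), h]
      · intro h
        rw [← A.semi_lim hg (hlim a), h, A.semi_lim hg (hlim b)]
    have hWo := hN.preimage A.avg_diff.continuous
    have hpW : p ∈ avg φ ⁻¹' N := by
      change avg φ p ∈ N
      rw [A.avg_fix (hfix x)]; exact hpN
    have hnc := hF.chart_open hWo hg.1.differentiableOn (fun a ha b hb => (hiff a ha b hb).trans (hz a b)) hpW
    obtain ⟨T, hTa, hT0, hT⟩ := factor hWo hpW hg.1.differentiableOn hzd.differentiableOn hiff hnc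
    have hdp : fderiv ℂ z p ≠ 0 := by
      have h1 : HasFDerivAt z (deriv T (g p) • fderiv ℂ g p) p := by
        refine (hTa.differentiableAt.hasDerivAt.comp_hasFDerivAt p (hg.1 p).hasFDerivAt).congr_of_eventuallyEq ?_
        filter_upwards [hWo.mem_nhds hpW] with a ha
        exact hT a ha
      rw [h1.fderiv]
      intro h00
      have h0 : fderiv ℂ g p = 0 := (smul_eq_zero.1 h00).resolve_left hT0
      apply hJ
      unfold Jac
      rw [h0]; simp
    have hc : Continuous (fun x => fderiv ℂ z x) := continuous_iff_continuousAt.2 fun x => (analytic_of_diff hzd x).fderiv.continuousAt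
    have hev := (hlim x).eventually (hc.continuousAt.eventually_ne hdp)
    obtain ⟨s, hs, hs0⟩ := (hev.and self_mem_nhdsWithin).exists
    exact A.fderiv_move hz0 hs0 hs
  -- the factor k
  set zx := fun x => fderiv ℂ z x (1, 0) with hzx
  set zy := fun x => fderiv ℂ z x (0, 1) with hzy
  have dzx : Differentiable ℂ zx := A.dfun hzd _
  have dzy : Differentiable ℂ zy := A.dfun hzd _
  have hor : ∀ x, zy x = 0 → zx x ≠ 0 := by
    intro x h1 h2
    apply hdz x
    ext
    · simpa using h2
    · simpa using h1
  have hV0 : ∀ x, (VF φ x).1 * zx x + (VF φ x).2 * zy x = 0 := by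
    intro x
    have := A.semi_V hz0 x
    rw [lin_apply] at this
    simpa using this
  let k : ℂ² → ℂ := fun x => if zy x = 0 then - (VF φ x).2 / zx x else (VF φ x).1 / zy x
  have hk1 : ∀ x, (VF φ x).1 = k x * zy x := by
    intro x
    by_cases h : zy x = 0
    · have := hV0 x
      rw [h, mul_zero, add_zero] at this
      rw [h, mul_zero]
      exact (mul_eq_zero.1 this).resolve_right (hor x h)
    · simp only [k, if_neg h]; field_simp
  have hk2 : ∀ x, (VF φ x).2 = - (k x * zx x) := by
    intro x
    by_cases h : zy x = 0
    · have := hor x h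
      simp only [k, if_pos h]; field_simp
    · have := hV0 x
      simp only [k, if_neg h]
      field_simp
      linear_combination this
  have hkd : Differentiable ℂ k := by
    intro x
    by_cases h : zy x = 0
    · have h' := hor x h
      have : DifferentiableAt ℂ (fun x => - (VF φ x).2 / zx x) x := by
        simp only [div_eq_mul_inv]
        exact (A.V2d x).neg.mul ((dzx x).inv h')
      refine this.congr_of_eventuallyEq ?_
      filter_upwards [dzx.continuous.continuousAt.eventually_ne h'] with y hy
      rw [hk2 y]; field_simp
    · have : DifferentiableAt ℂ (fun x => (VF φ x).1 / zy x) x := by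
        simp only [div_eq_mul_inv]
        exact (A.V1d x).mul ((dzy x).inv h)
      refine this.congr_of_eventuallyEq ?_
      filter_upwards [dzy.continuous.continuousAt.eventually_ne h] with y hy
      simp only [k, if_neg hy]
  obtain ⟨m, hm, hmV⟩ := A.exists_primitive A.dv_diff
  have hdiv : ∀ x, cpt φ 0 (dv φ) x = 1 := by
    intro x
    have h1 := A.semi_lim (A.cpt_semi A.dv_diff 0) (hlim x)
    rw [A.cpt_fix _ (hfix x)] at h1
    rw [← h1]
    obtain ⟨f, g, hf, hg, hJ⟩ := hpar _ (hfix x)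
    have e1 := A.semi_V' hf (hfix x) (1, 0)
    have e2 := A.semi_V' hf (hfix x) (0, 1)
    have e3 := A.semi_V' hg (hfix x) (1, 0)
    have e4 := A.semi_V' hg (hfix x) (0, 1)
    unfold Jac at hJ
    unfold dv
    generalize fderiv ℂ f (avg φ x) (1, 0) = f1 at *
    generalize fderiv ℂ f (avg φ x) (0, 1) = f2 at *
    generalize fderiv ℂ g (avg φ x) (1, 0) = g1 at *
    generalize fderiv ℂ g (avg φ x) (0, 1) = g2 at *
    apply mul_right_cancel₀ hJ
    push_cast at e1 e2 e3 e4
    linear_combination g2 * e1 - f2 * e3 - g1 * e2 + f1 * e4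
  set F : ℂ² → ℂ := fun x => exp (m x) * k x with hFdef
  have hFd : Differentiable ℂ F := hm.cexp.mul hkd
  have hJF : ∀ x, Jac F z x = exp (m x) := by
    intro x
    have hsymm : fderiv ℂ zy x (1, 0) = fderiv ℂ zx x (0, 1) := by
      have h2 : HasFDerivAt (fderiv ℂ z) (fderiv ℂ (fderiv ℂ z) x) x :=
        (analytic_of_diff hzd x).fderiv.differentiableAt.hasFDerivAt
      have hs := second_derivative_symmetric (fun y => (hzd y).hasFDerivAt) h2 (1, 0) (0, 1)
      have hv : ∀ v w, fderiv ℂ (fun x => fderiv ℂ z x v) x w = fderiv ℂ (fderiv ℂ z) x w v := by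
        intro v w
        have := h2.clm_apply (hasFDerivAt_const v x)
        rw [this.fderiv]; simp
      rw [hzy, hzx, hv, hv, hs]
    have e1 : (fun x => exp (m x) * (VF φ x).1) = fun x => F x * zy x := by
      funext y; rw [hk1 y]; simp only [F]; ring
    have e2 : (fun x => exp (m x) * (VF φ x).2) = fun x => -(F x * zx x) := by
      funext y; rw [hk2 y]; simp only [F]; ring
    have a1 := ((hm x).hasFDerivAt.cexp.mul (A.V1d x).hasFDerivAt)
    have b1 := (hFd x).hasFDerivAt.mul (dzy x).hasFDerivAt
    have a2 := ((hm x).hasFDerivAt.cexp.mul (A.V2d x).hasFDerivAt)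
    have b2 := ((hFd x).hasFDerivAt.mul (dzx x).hasFDerivAt).neg
    have c1 : HasFDerivAt (fun x => F x * zy x) _ x := a1.congr_of_eventuallyEq (Eventually.of_forall fun x => (congrFun e1 x).symm)
    have c2 : HasFDerivAt (fun x => -(F x * zx x)) _ x := a2.congr_of_eventuallyEq (Eventually.of_forall fun x => (congrFun e2 x).symm)
    have d1 := congrArg (fun L : ℂ² →L[ℂ] ℂ => L (1, 0)) (c1.unique b1)
    have d2 := congrArg (fun L : ℂ² →L[ℂ] ℂ => L (0, 1)) (c2.unique b2)
    simp only [add_apply, neg_apply, smul_apply, smul_eq_mul] at d1 d2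
    have hmx := hmV x
    rw [hdiv, lin_apply] at hmx
    unfold dv at hmx
    unfold Jac
    change fderiv ℂ F x (1, 0) * zy x - fderiv ℂ F x (0, 1) * zx x = _
    linear_combination -d1 - d2 - F x * hsymm + exp (m x) * hmx
  have hFV : Semi φ 1 F := by
    refine A.semi_of_V hFd fun x => ?_
    have h1 := hJF x
    unfold Jac at h1
    change fderiv ℂ F x (1, 0) * zy x - fderiv ℂ F x (0, 1) * zx x = _ at h1
    rw [lin_apply, hk1 x, hk2 x]
    simp only [hFdef]
    push_cast
    linear_combination k x * h1
  refine A.lin_of_pos hneg hFV hz0 (fun p _ => by rw [hJF]; exact exp_ne_zero _) (fun x x' _ h => (hz x x').1 h) ?_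
  intro q
  obtain ⟨x, hx⟩ := hzs q.2
  refine ⟨avg φ x, hfix x, ?_⟩
  have : z (avg φ x) = q.2 := by rw [A.semi_lim hz0 (hlim x), hx]
  rw [this, A.semi_fixed (hfix x) hFV one_ne_zero]
  refine (tendsto_zpow0 one_pos _).prodMk_nhds ?_
  simp only [zpow_zero, one_mul]
  exact tendsto_const_nhds

end Act

lemma Jac_swap (f g : ℂ² → ℂ) (x : ℂ²) : Jac g f x = - Jac f g x := by unfold Jac; ring

lemma Jac_zero_left {f g : ℂ² → ℂ} (h : ∀ x, f x = 0) (x : ℂ²) : Jac f g x = 0 := by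
  have : f = fun _ => 0 := funext h
  unfold Jac; rw [this]; simp

lemma Jac_zero_right {f g : ℂ² → ℂ} (h : ∀ x, g x = 0) (x : ℂ²) : Jac f g x = 0 := by
  rw [Jac_swap, Jac_zero_left h, neg_zero]

namespace Act
variable (A : Act φ)
include A

lemma gcd_of_eff (hE : Eff φ) {x : ℂ²} {k l : ℤ} {f g : ℂ² → ℂ} (hf : Semi φ k f)
    (hg : Semi φ l g) (hJ : Jac f g x ≠ 0) (hst : ∀ s : ℂ, s ≠ 0 → s ^ k = 1 → s ^ l = 1 → φ s x = x) :
    Int.gcd k l = 1 := by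
  by_cases hd : Int.gcd k l = 0
  · rw [Int.gcd_eq_zero_iff] at hd
    have h1 : (2 : ℂ) ^ k = 1 := by rw [hd.1, zpow_zero]
    have h2 : (2 : ℂ) ^ l = 1 := by rw [hd.2, zpow_zero]
    have := hE 2 two_ne_zero (A.eq_id_of_weights two_ne_zero (hst 2 two_ne_zero h1 h2) hf hg hJ h1 h2)
    norm_num at this
  · have hp := isPrimitiveRoot_exp _ hd
    have hs := exp_ne_zero (2 * Real.pi * I / (Int.gcd k l : ℕ))
    set s := exp (2 * Real.pi * I / (Int.gcd k l : ℕ))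
    have h1 : s ^ k = 1 := (hp.zpow_eq_one_iff_dvd k).2 (Int.gcd_dvd_left ..)
    have h2 : s ^ l = 1 := (hp.zpow_eq_one_iff_dvd l).2 (Int.gcd_dvd_right ..)
    have h3 := hE s hs (A.eq_id_of_weights hs (hst s hs h1 h2) hf hg hJ h1 h2)
    have h4 := (hp.zpow_eq_one_iff_dvd 1).1 (by rw [h3, one_zpow])
    have h5 := Int.eq_one_of_dvd_one (by positivity) h4
    exact_mod_cast h5

lemma gcd_fixed (hE : Eff φ) {p : ℂ²} (hp : VF φ p = 0) {k l : ℤ} {f g : ℂ² → ℂ} (hf : Semi φ k f)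
    (hg : Semi φ l g) (hJ : Jac f g p ≠ 0) : Int.gcd k l = 1 :=
  A.gcd_of_eff hE hf hg hJ fun s hs _ _ => (A.fixed_iff p).1 hp s hs

lemma lin_nonneg (hE : Eff φ) (hneg : ∀ x k f, k < 0 → Semi φ k f → f x = 0) : Lin φ := by
  by_cases hell : ∃ p k l f g, VF φ p = 0 ∧ Semi φ k f ∧ Semi φ l g ∧ Jac f g p ≠ 0 ∧ 0 < k ∧ 0 < l
  · obtain ⟨p, k, l, f, g, hp, hf, hg, hJ, hk, hl⟩ := hell
    exact A.lin_elliptic hneg hf hg hk hl hp hJ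
  · refine A.lin_parabolic hneg fun p hp => ?_
    obtain ⟨k, l, f, g, hf, hg, -, -, hJ⟩ := A.two_fixed hp
    have hk : 0 ≤ k := by
      by_contra! h
      exact hJ (Jac_zero_left (fun x => hneg x k f h hf) p)
    have hl : 0 ≤ l := by
      by_contra! h
      exact hJ (Jac_zero_right (fun x => hneg x l g h hg) p)
    have hgcd := A.gcd_fixed hE hp hf hg hJ
    rcases hk.eq_or_lt with h0 | h0
    · rw [← h0, Int.gcd_zero_left] at hgcd
      have : l = 1 := by omega
      exact ⟨g, f, this ▸ hg, h0 ▸ hf, by rw [Jac_swap, neg_ne_zero]; exact hJ⟩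
    · rcases hl.eq_or_lt with h1 | h1
      · rw [← h1, Int.gcd_zero_right] at hgcd
        have : k = 1 := by omega
        exact ⟨f, g, this ▸ hf, h1 ▸ hg, hJ⟩
      · exact absurd ⟨p, k, l, f, g, hp, hf, hg, hJ, h0, h1⟩ hell

end Act

/-- reduction to effective actions -/
lemma lin_of_eff (H : ∀ ψ, Act ψ → Eff ψ → Lin ψ) {φ : ℂ → ℂ² → ℂ²} (A : Act φ) : Lin φ := by
  obtain ⟨d, hd⟩ := Int.subgroup_cyclic (AddSubgroup.closure {k : ℤ | ∃ f x, Semi φ k f ∧ f x ≠ 0})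
  have key : ∀ ζ : ℂ, ζ ≠ 0 → (φ ζ = id ↔ ζ ^ d = 1) := by
    intro ζ hζ
    constructor
    · intro h
      let S : AddSubgroup ℤ :=
        { carrier := {k | ζ ^ k = 1}
          add_mem' := fun {a b} (ha : ζ ^ a = 1) (hb : ζ ^ b = 1) => by
            change ζ ^ (a + b) = 1
            rw [zpow_add₀ hζ, ha, hb, one_mul]
          zero_mem' := zpow_zero ζ
          neg_mem' := fun {a} (ha : ζ ^ a = 1) => by
            change ζ ^ (-a) = 1
            rw [zpow_neg, ha, inv_one] }
      have h1 : AddSubgroup.closure {k : ℤ | ∃ f x, Semi φ k f ∧ f x ≠ 0} ≤ S := by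
        rw [AddSubgroup.closure_le]
        rintro k ⟨f, x, hf, hx⟩
        change ζ ^ k = 1
        have := hf.2 ζ hζ x
        rw [h] at this
        apply mul_right_cancel₀ hx
        rw [← this, one_mul]; rfl
      rw [hd] at h1
      exact h1 (AddSubgroup.subset_closure (mem_singleton d))
    · intro h
      funext x
      refine A.sep fun k f hf => ?_
      rw [hf.2 ζ hζ]
      change _ = f x
      by_cases hx : f x = 0
      · rw [hx, mul_zero]
      · have hk : k ∈ AddSubgroup.closure {k : ℤ | ∃ f x, Semi φ k f ∧ f x ≠ 0} := AddSubgroup.subset_closure ⟨f, x, hf, hx⟩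
        rw [hd, AddSubgroup.mem_closure_singleton] at hk
        obtain ⟨n, rfl⟩ := hk
        rw [smul_eq_mul, mul_comm n d, zpow_mul, h, one_zpow, one_mul]
  by_cases hd0 : d = 0
  · have hid : ∀ s : ℂ, s ≠ 0 → φ s = id := fun s hs => (key s hs).2 (by rw [hd0, zpow_zero])
    have h1 : Semi φ 0 (Prod.fst : ℂ² → ℂ) := ⟨differentiable_fst, fun s hs x => by rw [hid s hs]; simp⟩
    have h2 : Semi φ 0 (Prod.snd : ℂ² → ℂ) := ⟨differentiable_snd, fun s hs x => by rw [hid s hs]; simp⟩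
    refine lin_of h1 h2 (fun x => ?_) Function.bijective_id
    unfold Jac
    have e1 : fderiv ℂ (Prod.fst : ℂ² → ℂ) x = ContinuousLinearMap.fst ℂ ℂ ℂ := fderiv_fst
    have e2 : fderiv ℂ (Prod.snd : ℂ² → ℂ) x = ContinuousLinearMap.snd ℂ ℂ ℂ := fderiv_snd
    rw [e1, e2]; simp
  obtain ⟨e, he⟩ : ∃ e : ℕ, e = d.natAbs := ⟨_, rfl⟩
  have he0 : e ≠ 0 := by omega
  have key' : ∀ ζ : ℂ, ζ ≠ 0 → (φ ζ = id ↔ ζ ^ e = 1) := by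
    intro ζ hζ
    rw [key ζ hζ]
    rcases Int.natAbs_eq d with h | h
    · rw [h, ← he, zpow_natCast]
    · rw [h, ← he, zpow_neg, zpow_natCast, inv_eq_one]
  have same : ∀ s t : ℂ, s ≠ 0 → t ≠ 0 → s ^ e = t ^ e → φ s = φ t := by
    intro s t hs ht h
    have h1 : (s / t) ^ e = 1 := by rw [div_pow, h, div_self (pow_ne_zero e ht)]
    have h2 := (key' _ (div_ne_zero hs ht)).2 h1
    have h3 := A.mul (s / t) t (div_ne_zero hs ht) ht
    rw [div_mul_cancel₀ _ ht, h2] at h3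
    exact h3
  have hroot : ∀ w : ℂ, w ≠ 0 → w ^ (1 / (e : ℂ)) ≠ 0 ∧ (w ^ (1 / (e : ℂ))) ^ e = w := by
    intro w hw
    have : (w ^ (1 / (e : ℂ))) ^ e = w := by
      rw [one_div]; exact cpow_nat_inv_pow w he0
    refine ⟨fun h => hw ?_, this⟩
    rw [← this, h, zero_pow he0]
  have B : Act (fun w => φ (w ^ (1 / (e : ℂ)))) := by
    refine ⟨?_, ?_, ?_⟩
    · rintro ⟨w0, x⟩ hp
      have hw0 : w0 ≠ 0 := hp.1
      obtain ⟨c0, hc⟩ := hroot w0 hw0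
      set c := w0 ^ (1 / (e : ℂ)) with hcdef
      apply DifferentiableAt.differentiableWithinAt
      have h1 : DifferentiableAt ℂ (fun p : ℂ × ℂ² => (c * (p.1 / w0) ^ (1 / (e : ℂ)), p.2)) (w0, x) := by
        refine DifferentiableAt.prodMk ?_ differentiableAt_snd
        refine DifferentiableAt.const_mul (DifferentiableAt.cpow_const ?_ ?_) _
        · simp only [div_eq_mul_inv]
          exact differentiableAt_fst.mul_const _
        · simp [div_self hw0]
      have h2 : DifferentiableAt ℂ (fun p : ℂ × ℂ² => φ p.1 p.2) (c * (w0 / w0) ^ (1 / (e : ℂ)), x) := by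
        rw [div_self hw0, one_cpow, mul_one]
        exact A.dAt c0 x
      refine (h2.comp (w0, x) (f := fun p : ℂ × ℂ² => (c * (p.1 / w0) ^ (1 / (e : ℂ)), p.2)) h1).congr_of_eventuallyEq ?_
      have : ∀ᶠ p : ℂ × ℂ² in 𝓝 (w0, x), p.1 ≠ 0 := continuous_fst.continuousAt.eventually_ne hw0
      filter_upwards [this] with p hp
      have hq := hroot (p.1 / w0) (div_ne_zero hp hw0)
      have hr := hroot p.1 hp
      simp only [Function.comp]
      rw [same _ _ hr.1 (mul_ne_zero c0 hq.1)]
      rw [hr.2, mul_pow, hc, hq.2]; field_simp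
    · simp only [one_cpow]
      exact A.one
    · intro z w hz hw
      have h1 := hroot z hz
      have h2 := hroot w hw
      have h3 := hroot _ (mul_ne_zero hz hw)
      rw [← A.mul _ _ h1.1 h2.1]
      apply same _ _ h3.1 (mul_ne_zero h1.1 h2.1)
      rw [h3.2, mul_pow, h1.2, h2.2]
  have hE : Eff (fun w => φ (w ^ (1 / (e : ℂ)))) := by
    intro w hw h
    have h1 := hroot w hw
    rw [← h1.2]
    exact (key' _ h1.1).1 h
  obtain ⟨n, m, F, hb, h1, h2, h3⟩ := H _ B hE
  refine ⟨e * n, e * m, F, hb, h1, h2, fun s hs x y => ?_⟩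
  have hse := pow_ne_zero e hs
  have h4 := h3 (s ^ e) hse x y
  have h5 := hroot _ hse
  simp only [same _ _ h5.1 hs h5.2] at h4
  rw [h4, zpow_mul, zpow_mul, zpow_natCast]

structure Hyp (φ : ℂ → ℂ² → ℂ²) : Prop where
  act : Act φ
  eff : Eff φ
  pos : ∃ k f x, 0 < k ∧ Semi φ k f ∧ f x ≠ 0
  neg : ∃ k f x, k < 0 ∧ Semi φ k f ∧ f x ≠ 0

def Kp (φ : ℂ → ℂ² → ℂ²) : Set ℂ² := {x | ∀ k f, k < 0 → Semi φ k f → f x = 0}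
def Km (φ : ℂ → ℂ² → ℂ²) : Set ℂ² := {x | ∀ k f, 0 < k → Semi φ k f → f x = 0}
def KK (φ : ℂ → ℂ² → ℂ²) : Set ℂ² := Kp φ ∪ Km φ

lemma Kp_symm (φ : ℂ → ℂ² → ℂ²) : Kp (fun s => φ s⁻¹) = Km φ := by
  ext x
  constructor
  · intro h k f hk hf
    exact h (-k) f (by omega) hf.symm
  · intro h k f hk hf
    exact h (-k) f (by omega) hf.symm'

lemma Km_symm (φ : ℂ → ℂ² → ℂ²) : Km (fun s => φ s⁻¹) = Kp φ := by
  ext x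
  constructor
  · intro h k f hk hf
    exact h (-k) f (by omega) hf.symm
  · intro h k f hk hf
    exact h (-k) f (by omega) hf.symm'

lemma Semi.cont {k : ℤ} {f : ℂ² → ℂ} (h : Semi φ k f) : Continuous f := h.1.continuous

lemma Kp_closed (φ : ℂ → ℂ² → ℂ²) : IsClosed (Kp φ) := by
  have : Kp φ = ⋂ (k : ℤ) (f : ℂ² → ℂ) (_ : k < 0) (_ : Semi φ k f), {x | f x = 0} := by
    ext x; simp [Kp]
  rw [this]
  exact isClosed_iInter fun k => isClosed_iInter fun f => isClosed_iInter fun _ => isClosed_iInter fun hf =>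
    isClosed_eq hf.cont continuous_const

lemma Km_closed (φ : ℂ → ℂ² → ℂ²) : IsClosed (Km φ) := by
  rw [← Kp_symm]; exact Kp_closed _

lemma KK_closed (φ : ℂ → ℂ² → ℂ²) : IsClosed (KK φ) := (Kp_closed φ).union (Km_closed φ)

lemma Kp_inv {s : ℂ} (hs : s ≠ 0) (x : ℂ²) : φ s x ∈ Kp φ ↔ x ∈ Kp φ := by
  refine forall_congr' fun k => forall_congr' fun f => forall_congr' fun _ => forall_congr' fun hf => ?_
  rw [hf.2 s hs, mul_eq_zero, or_iff_right (zpow_ne_zero k hs)]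

lemma Km_inv {s : ℂ} (hs : s ≠ 0) (x : ℂ²) : φ s x ∈ Km φ ↔ x ∈ Km φ := by
  refine forall_congr' fun k => forall_congr' fun f => forall_congr' fun _ => forall_congr' fun hf => ?_
  rw [hf.2 s hs, mul_eq_zero, or_iff_right (zpow_ne_zero k hs)]

lemma KK_inv {s : ℂ} (hs : s ≠ 0) (x : ℂ²) : φ s x ∈ KK φ ↔ x ∈ KK φ := by
  unfold KK; rw [mem_union, mem_union, Kp_inv hs, Km_inv hs]

lemma cpt_symm (h : ℂ² → ℂ) (x : ℂ²) : cpt (fun s => φ s⁻¹) 0 h x = cpt φ 0 h x := by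
  unfold cpt
  have h1 := intervalIntegral.integral_comp_sub_left (a := 0) (b := 1)
    (fun t : ℝ => exp (-(2 * Real.pi * I * (0 : ℤ) * t)) * h (φ (ec t) x)) 1
  rw [sub_self, sub_zero] at h1
  rw [← h1]
  congr 1
  funext t
  have : (ec t)⁻¹ = ec (1 - t) := inv_eq_of_mul_eq_one_right (by rw [← ec_add, add_sub_cancel, ec_one])
  simp [this]

lemma avg_symm : avg (fun s => φ s⁻¹) = avg φ := by
  funext x; unfold avg; rw [cpt_symm, cpt_symm]

/-- coprime root extraction -/
lemma coprime_root {n : ℕ} (hn : 0 < n) {j : ℤ} (hc : Int.gcd n j = 1) {a a' b b' s : ℂ} (ha : a ≠ 0) (ha' : a' ≠ 0)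
    (h : b ^ n * a' ^ j = b' ^ n * a ^ j) (hs : s ^ n * a = a') :
    ∃ η : ℂ, η ^ n = 1 ∧ (η * s) ^ j * b = b' := by
  have hs0 : s ≠ 0 := by rintro rfl; rw [zero_pow hn.ne', zero_mul] at hs; exact ha' hs.symm
  by_cases hb' : b' = 0
  · rw [hb', zero_pow hn.ne', zero_mul] at h
    have hb : b = 0 := (pow_eq_zero_iff hn.ne').1 ((mul_eq_zero.1 h).resolve_right (zpow_ne_zero j ha'))
    exact ⟨1, one_pow n, by rw [hb, hb', mul_zero]⟩
  have e1 : (s ^ j * b) ^ n = b' ^ n := by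
    have h2 : (s ^ j) ^ n * a ^ j = a' ^ j := by
      rw [← hs, mul_zpow, ← zpow_natCast (s ^ j), ← zpow_mul, mul_comm j, zpow_mul, zpow_natCast]
    apply mul_right_cancel₀ (zpow_ne_zero j ha)
    rw [← h, ← h2, mul_pow]; ring
  have hb0 : s ^ j * b ≠ 0 := by
    intro h0
    rw [h0, zero_pow hn.ne'] at e1
    exact hb' ((pow_eq_zero_iff hn.ne').1 e1.symm)
  set ζ := b' / (s ^ j * b) with hζ
  have hζ0 : ζ ≠ 0 := div_ne_zero hb' hb0
  have hζn : ζ ^ n = 1 := by rw [hζ, div_pow, e1, div_self (pow_ne_zero n hb')]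
  have hbez := Int.gcd_eq_gcd_ab n j
  rw [hc] at hbez
  refine ⟨ζ ^ (Int.gcdB n j), ?_, ?_⟩
  · rw [← zpow_natCast, ← zpow_mul, mul_comm, zpow_mul, zpow_natCast, hζn, one_zpow]
  · have : (ζ ^ (Int.gcdB n j)) ^ j = ζ := by
      have h3 : (ζ ^ (n : ℤ)) ^ (Int.gcdA n j) * (ζ ^ (Int.gcdB n j)) ^ j = ζ ^ (1 : ℤ) := by
        rw [← zpow_mul, ← zpow_mul, ← zpow_add₀ hζ0]
        congr 1
        push_cast at hbez
        rw [hbez]; ring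
      rw [zpow_natCast, hζn, one_zpow, one_mul, zpow_one] at h3
      exact h3
    have hbb : b ≠ 0 := right_ne_zero_of_mul hb0
    have hsj := zpow_ne_zero j hs0
    rw [mul_zpow, this, mul_assoc, hζ]
    field_simp

namespace Act
variable (A : Act φ)
include A

lemma Kp_of_lim {x p : ℂ²} (h : Tendsto (fun s => φ s x) (𝓝[≠] 0) (𝓝 p)) : x ∈ Kp φ := by
  intro k f hk hf
  have h1 : Tendsto (fun s => s ^ (-k) * f (φ s x)) (𝓝[≠] 0) (𝓝 (0 * f p)) := by
    have := (tendsto_zpow0 (n := -k) (by omega) 1)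
    simp only [mul_one] at this
    exact this.mul ((hf.cont.tendsto p).comp h)
  rw [zero_mul] at h1
  refine tendsto_nhds_unique (tendsto_const_nhds.congr' ?_) h1
  filter_upwards [self_mem_nhdsWithin] with s hs
  rw [hf.2 s hs, zpow_neg, inv_mul_cancel_left₀ (zpow_ne_zero k hs)]

lemma lim_m {x : ℂ²} (hx : x ∈ Km φ) : Tendsto (fun s => φ s⁻¹ x) (𝓝[≠] 0) (𝓝 (avg φ x)) := by
  rw [← Kp_symm] at hx
  have := A.symm.lim hx
  rwa [avg_symm] at this

lemma avg_fixed_K {x : ℂ²} (hx : x ∈ KK φ) : VF φ (avg φ x) = 0 := by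
  rcases hx with hx | hx
  · exact A.avg_fixed hx
  · rw [← Kp_symm] at hx
    have := A.symm.avg_fixed hx
    rw [avg_symm] at this
    have h2 := VF_symm A.symm this
    simpa using h2

lemma fixed_K {p : ℂ²} (hp : VF φ p = 0) : p ∈ KK φ :=
  Or.inl fun _ _ hk hf => A.semi_fixed hp hf hk.ne

/-- points of K can be moved arbitrarily near to the fixed point -/
lemma K_move {x : ℂ²} (hx : x ∈ KK φ) {U : Set ℂ²} (hU : U ∈ 𝓝 (avg φ x)) : ∃ s, s ≠ 0 ∧ φ s x ∈ U := by
  rcases hx with hx | hx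
  · obtain ⟨s, h1, h2⟩ := (((A.lim hx).eventually hU).and self_mem_nhdsWithin).exists
    exact ⟨s, h2, h1⟩
  · obtain ⟨s, h1, h2⟩ := (((A.lim_m hx).eventually hU).and self_mem_nhdsWithin).exists
    exact ⟨s⁻¹, inv_ne_zero h2, h1⟩

lemma semi_avg {z : ℂ² → ℂ} (hz : Semi φ 0 z) {x : ℂ²} (hx : x ∈ KK φ) : z (avg φ x) = z x := by
  rcases hx with hx | hx
  · exact A.semi_lim hz (A.lim hx)
  · exact A.symm.semi_lim (by simpa using hz.symm) (A.lim_m hx)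

/-- a fixed point with non-negative weights excludes functions of negative weight -/
lemma neg_zero_of_fixed {p : ℂ²} (hp : VF φ p = 0) {k l : ℤ} {f g : ℂ² → ℂ} (hf : Semi φ k f) (hg : Semi φ l g)
    (hf0 : f p = 0) (hg0 : g p = 0) (hJ : Jac f g p ≠ 0) (hk : 0 ≤ k) (hl : 0 ≤ l) {i : ℤ} (hi : i < 0)
    {h : ℂ² → ℂ} (hh : Semi φ i h) (x : ℂ²) : h x = 0 := by
  obtain ⟨N, ε, G, hN, hpN, -, hε, hinj, hj, hG, hGd, hGF, hGφ⟩ := A.fix_chart hp hf hg hf0 hg0 hJ isOpen_univ (mem_univ _)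
  have hlimw : ∀ (k : ℤ) (a : ℂ), 0 ≤ k → ‖a‖ < ε → ∃ b, ‖b‖ < ε ∧ Tendsto (fun s : ℂ => s ^ k * a) (𝓝[≠] 0) (𝓝 b) := by
    intro k a hk ha
    rcases hk.eq_or_lt with h | h
    · exact ⟨a, ha, by rw [← h]; simp only [zpow_zero, one_mul]; exact tendsto_const_nhds⟩
    · exact ⟨0, by simpa using hε, tendsto_zpow0 h a⟩
  have key : ∀ q ∈ ball (0 : ℂ²) ε, G q ∈ Kp φ := by
    intro q hq
    obtain ⟨b1, hb1, t1⟩ := hlimw k q.1 hk (mem_ball0.1 hq).1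
    obtain ⟨b2, hb2, t2⟩ := hlimw l q.2 hl (mem_ball0.1 hq).2
    have hb : (b1, b2) ∈ ball (0 : ℂ²) ε := mem_ball0.2 ⟨hb1, hb2⟩
    have t := t1.prodMk_nhds t2
    have hGc : ContinuousAt G (b1, b2) := hGd.continuousOn.continuousAt (isOpen_ball.mem_nhds hb)
    refine A.Kp_of_lim (p := G (b1, b2)) ?_
    refine (hGc.tendsto.comp t).congr' ?_
    filter_upwards [t.eventually (isOpen_ball.mem_nhds hb), self_mem_nhdsWithin] with s hs hs0
    exact (hGφ q hq s hs0 hs).symm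
  have hev : ∀ᶠ x in 𝓝 p, h x = 0 := by
    have hc : ∀ᶠ x in 𝓝 p, (f x, g x) ∈ ball (0 : ℂ²) ε := by
      have : ContinuousAt (fun x => (f x, g x)) p := (hf.cont.prodMk hg.cont).continuousAt
      apply this.eventually
      change ∀ᶠ y in 𝓝 (f p, g p), y ∈ ball (0 : ℂ²) ε
      rw [hf0, hg0]
      exact ball_mem_nhds _ hε
    filter_upwards [hc, hN.mem_nhds hpN] with x hx hxN
    rw [← hGF x hxN hx]
    exact key _ hx i h hi hh
  have hha : AnalyticOnNhd ℂ h univ := fun y _ => analytic_of_diff hh.1 y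
  exact hha.eqOn_of_preconnected_of_eventuallyEq (g := fun _ => 0)
    (fun _ _ => analyticAt_const) isPreconnected_univ (mem_univ p) hev (mem_univ x)

/-- a function of nonzero weight has a zero -/
lemma no_unit {k : ℤ} (hk : k ≠ 0) {f : ℂ² → ℂ} (hf : Semi φ k f) : ∃ x, f x = 0 := by
  by_contra! h0
  obtain ⟨R, hR, hRf⟩ := exists_log convex_univ isOpen_univ (fun y _ => analytic_of_diff hf.1 y) (fun x _ => h0 x)
  have hRd : ∀ x, DifferentiableAt ℂ R x := fun x => (hR x (mem_univ x)).differentiableAt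
  have hV : ∀ x, fderiv ℂ R x (VF φ x) = k := by
    intro x
    have h1 := A.semi_V hf x
    have h2 : HasFDerivAt f (exp (R x) • fderiv ℂ R x) x :=
      (hRd x).hasFDerivAt.cexp.congr_of_eventuallyEq (Eventually.of_forall fun y => (hRf y (mem_univ y)).symm)
    rw [h2.fderiv, hRf x (mem_univ x)] at h1
    simp only [smul_apply, smul_eq_mul] at h1
    apply mul_left_cancel₀ (h0 x)
    rw [h1]; ring
  have hd : ∀ u : ℂ, HasDerivAt (fun u => R (φ (exp u) 0) - k * u) 0 u := by
    intro u
    have h1 := A.along (x := 0) (exp_ne_zero u) (hRd (φ (exp u) 0))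
    rw [hV] at h1
    have h2 := (h1.comp u (hasDerivAt_exp u)).sub ((hasDerivAt_id u).const_mul (k : ℂ))
    convert! h2 using 1
    have := exp_ne_zero u
    field_simp
    ring
  have h3 := is_const_of_deriv_eq_zero (fun u => (hd u).differentiableAt) (fun u => (hd u).deriv) (2 * Real.pi * I) 0
  simp only [exp_two_pi_mul_I, exp_zero, mul_zero, sub_zero] at h3
  have h4 : (k : ℂ) * (2 * Real.pi * I) = 0 := by linear_combination -h3
  have : (2 * Real.pi * I : ℂ) ≠ 0 := by simp [Real.pi_ne_zero]
  have h5 := (mul_eq_zero.1 h4).resolve_right this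
  exact hk (by exact_mod_cast h5)

end Act

namespace Hyp
variable (hH : Hyp φ)
include hH

/-- weights at fixed points -/
lemma fixed_weights {p : ℂ²} (hp : VF φ p = 0) : ∃ (n m : ℕ) (f g : ℂ² → ℂ), 0 < n ∧ 0 < m ∧ Nat.Coprime n m ∧
    Semi φ n f ∧ Semi φ (-m) g ∧ f p = 0 ∧ g p = 0 ∧ Jac f g p ≠ 0 := by
  have A := hH.act
  have aux : ∀ k l f g, Semi φ k f → Semi φ l g → f p = 0 → g p = 0 → Jac f g p ≠ 0 → 0 < k → l < 0 →
      ∃ (n m : ℕ) (f g : ℂ² → ℂ), 0 < n ∧ 0 < m ∧ Nat.Coprime n m ∧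
    Semi φ n f ∧ Semi φ (-m) g ∧ f p = 0 ∧ g p = 0 ∧ Jac f g p ≠ 0 := by
    intro k l f g hf hg hf0 hg0 hJ hk hl
    have hgcd := A.gcd_fixed hH.eff hp hf hg hJ
    refine ⟨k.natAbs, l.natAbs, f, g, by omega, by omega, hgcd, ?_, ?_, hf0, hg0, hJ⟩
    · rwa [Int.natAbs_of_nonneg hk.le]
    · rwa [Int.ofNat_natAbs_of_nonpos hl.le, neg_neg]
  obtain ⟨k, l, f, g, hf, hg, hf0, hg0, hJ⟩ := A.two_fixed hp
  rcases lt_or_ge k 0 with hk | hk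
  · rcases lt_or_ge 0 l with hl | hl
    · exact aux l k g f hg hf hg0 hf0 (by rw [Jac_swap, neg_ne_zero]; exact hJ) hl hk
    · exfalso
      obtain ⟨i, h, x, hi, hh, hx⟩ := hH.pos
      exact hx (A.symm.neg_zero_of_fixed (VF_symm A hp) hf.symm hg.symm hf0 hg0 hJ (by omega) (by omega)
        (by omega : -i < 0) hh.symm x)
  · rcases lt_or_ge l 0 with hl | hl
    · rcases hk.eq_or_lt with h0 | h0
      · exfalso
        obtain ⟨i, h, x, hi, hh, hx⟩ := hH.pos
        exact hx (A.symm.neg_zero_of_fixed (VF_symm A hp) hf.symm hg.symm hf0 hg0 hJ (by omega) (by omega)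
          (by omega : -i < 0) hh.symm x)
      · exact aux k l f g hf hg hf0 hg0 hJ h0 hl
    · exfalso
      obtain ⟨i, h, x, hi, hh, hx⟩ := hH.neg
      exact hx (A.neg_zero_of_fixed hp hf hg hf0 hg0 hJ hk hl hi hh x)

/-- nonconstant invariant -/
lemma exists_inv : ∃ h, Semi φ 0 h ∧ ∃ x x', h x ≠ h x' := by
  have A := hH.act
  obtain ⟨a, f, x, ha, hf, hx⟩ := hH.pos
  obtain ⟨b, g, x', hb, hg, hx'⟩ := hH.neg
  have h1 := (hf.pow b.natAbs).mul (hg.pow a.natAbs)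
  have e : a * (b.natAbs : ℤ) + b * (a.natAbs : ℤ) = 0 := by
    rw [Int.natAbs_of_nonneg ha.le, Int.ofNat_natAbs_of_nonpos hb.le]; ring
  rw [e] at h1
  refine ⟨_, h1, ?_⟩
  obtain ⟨y, hy⟩ := A.no_unit ha.ne' hf
  by_contra! hc
  have hz : ∀ x, f x ^ b.natAbs * g x ^ a.natAbs = 0 := by
    intro x
    rw [hc x y, hy, zero_pow (by omega), zero_mul]
  have hz' : ∀ x, f x * g x = 0 := by
    intro x
    rcases mul_eq_zero.1 (hz x) with h | h
    · rw [eq_zero_of_pow_eq_zero h, zero_mul]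
    · rw [eq_zero_of_pow_eq_zero h, mul_zero]
  have hfa : AnalyticOnNhd ℂ f univ := fun y _ => analytic_of_diff hf.1 y
  have hga : AnalyticOnNhd ℂ g univ := fun y _ => analytic_of_diff hg.1 y
  rcases mul_zero_germ (hfa x (mem_univ x)) (hga x (mem_univ x)) (Eventually.of_forall hz') with h | h
  · exact hx (hfa.eqOn_of_preconnected_of_eventuallyEq (g := fun _ => 0)
      (fun _ _ => analyticAt_const) isPreconnected_univ (mem_univ x) h (mem_univ x))
  · exact hx' (hga.eqOn_of_preconnected_of_eventuallyEq (g := fun _ => 0)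
      (fun _ _ => analyticAt_const) isPreconnected_univ (mem_univ x) h (mem_univ x'))

end Hyp

lemma Jac_comb {f g g' : ℂ² → ℂ} {x : ℂ²} {a b : ℂ}
    (h : fderiv ℂ g' x = a • fderiv ℂ g x + b • fderiv ℂ f x) : Jac f g' x = a * Jac f g x := by
  unfold Jac
  rw [h]
  simp only [add_apply, smul_apply, smul_eq_mul]
  ring

lemma finite_roots {n : ℕ} (hn : 0 < n) : {η : ℂ | η ^ n = 1}.Finite := by
  refine (Polynomial.nthRoots n (1 : ℂ)).toFinset.finite_toSet.subset fun η hη => ?_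
  simpa [Polynomial.mem_nthRoots hn] using hη

lemma root_of {n : ℕ} (hn : 0 < n) {a : ℂ} (ha : a ≠ 0) : ∃ s, s ≠ 0 ∧ s ^ n = a := by
  refine ⟨exp (log a / n), exp_ne_zero _, ?_⟩
  rw [← exp_nat_mul, mul_div_cancel₀ _ (by exact_mod_cast hn.ne'), exp_log ha]

lemma semi_one (φ : ℂ → ℂ² → ℂ²) : Semi φ 0 (fun _ => 1) :=
  ⟨differentiable_const _, fun s _ x => by rw [zpow_zero, one_mul]⟩

/-- the saturation of a set -/
def sat (φ : ℂ → ℂ² → ℂ²) (U : Set ℂ²) : Set ℂ² := {x | ∃ s, s ≠ 0 ∧ φ s x ∈ U}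

namespace Act
variable (A : Act φ)
include A

lemma sat_open {U : Set ℂ²} (hU : IsOpen U) : IsOpen (sat φ U) := by
  rw [isOpen_iff_mem_nhds]
  rintro x ⟨s, hs, hx⟩
  filter_upwards [(A.diff hs).continuous.continuousAt.preimage_mem_nhds (hU.mem_nhds hx)] with y hy
  exact ⟨s, hs, hy⟩

lemma sub_sat {U : Set ℂ²} {x : ℂ²} (hx : x ∈ U) : x ∈ sat φ U := ⟨1, one_ne_zero, by rwa [A.one']⟩

lemma sat_inv {U : Set ℂ²} {x : ℂ²} (hx : x ∈ sat φ U) {s : ℂ} (hs : s ≠ 0) : φ s x ∈ sat φ U := by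
  obtain ⟨t, ht, h⟩ := hx
  refine ⟨t * s⁻¹, mul_ne_zero ht (inv_ne_zero hs), ?_⟩
  rwa [A.mul' (mul_ne_zero ht (inv_ne_zero hs)) hs, inv_mul_cancel_right₀ hs]

/-- the equivalence relation: same orbit or same component of the null cone -/
def rel : Setoid ℂ² where
  r x x' := (∃ s, s ≠ 0 ∧ x' = φ s x) ∨ (x ∈ KK φ ∧ x' ∈ KK φ ∧ avg φ x = avg φ x')
  iseqv :=
    { refl := fun x => Or.inl ⟨1, one_ne_zero, (A.one' x).symm⟩
      symm := by
        rintro x x' (⟨s, hs, rfl⟩ | ⟨h1, h2, h3⟩)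
        · exact Or.inl ⟨s⁻¹, inv_ne_zero hs, (A.inv hs x).symm⟩
        · exact Or.inr ⟨h2, h1, h3.symm⟩
      trans := by
        rintro x y z (⟨s, hs, rfl⟩ | ⟨h1, h2, h3⟩) (⟨t, ht, rfl⟩ | ⟨h4, h5, h6⟩)
        · exact Or.inl ⟨t * s, mul_ne_zero ht hs, A.mul' ht hs x⟩
        · exact Or.inr ⟨(KK_inv hs x).1 h4, h5, by rw [← h6, A.avg_inv hs]⟩
        · exact Or.inr ⟨h1, (KK_inv ht y).2 h2, by rw [h3, A.avg_inv ht]⟩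
        · exact Or.inr ⟨h1, h5, h3.trans h6⟩ }

lemma rel_iff {x x' : ℂ²} : A.rel x x' ↔ (∃ s, s ≠ 0 ∧ x' = φ s x) ∨ (x ∈ KK φ ∧ x' ∈ KK φ ∧ avg φ x = avg φ x') := Iff.rfl

lemma rel_semi {z : ℂ² → ℂ} (hz : Semi φ 0 z) {x x' : ℂ²} (h : A.rel x x') : z x = z x' := by
  rcases A.rel_iff.1 h with ⟨s, hs, rfl⟩ | ⟨h1, h2, h3⟩
  · rw [hz.2 s hs, zpow_zero, one_mul]
  · rw [← A.semi_avg hz h1, ← A.semi_avg hz h2, h3]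

lemma rel_orb {x : ℂ²} {s : ℂ} (hs : s ≠ 0) : A.rel x (φ s x) := A.rel_iff.2 (Or.inl ⟨s, hs, rfl⟩)

lemma rel_of_sat {U : Set ℂ²} {y : ℂ² → ℂ} (hy : ∀ s, s ≠ 0 → ∀ x, y (φ s x) = y x)
    (h : ∀ x ∈ U, ∀ x' ∈ U, y x = y x' → A.rel x x') {x x' : ℂ²} (hx : x ∈ sat φ U) (hx' : x' ∈ sat φ U)
    (hxx : y x = y x') : A.rel x x' := by
  obtain ⟨s, hs, hxs⟩ := hx
  obtain ⟨t, ht, hxt⟩ := hx'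
  have := h _ hxs _ hxt (by rw [hy s hs, hy t ht, hxx])
  exact A.rel.trans' (A.rel.trans' (A.rel_orb hs) this) (A.rel.symm' (A.rel_orb ht))

/-- good local data off the null cone -/
lemma offK (hE : Eff φ) {x : ℂ²} (hx : x ∉ KK φ) : ∃ (l j : ℕ) (f g : ℂ² → ℂ), 0 < l ∧ Semi φ l f ∧ Semi φ j g ∧
    f x ≠ 0 ∧ g x = 0 ∧ Jac f g x ≠ 0 ∧ Int.gcd l j = 1 ∧ ∀ s : ℂ, s ^ l = 1 → φ s x = x := by
  have hx1 : x ∉ Kp φ := fun h => hx (Or.inl h)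
  have hx2 : x ∉ Km φ := fun h => hx (Or.inr h)
  simp only [Kp, Km, mem_setOf_eq] at hx1 hx2
  push Not at hx1 hx2
  obtain ⟨a, fa, ha, hfa, hfa0⟩ := hx1
  obtain ⟨b, fb, hb, hfb, hfb0⟩ := hx2
  let M : AddSubgroup ℤ :=
    { carrier := {k | ∃ f, Semi φ k f ∧ f x ≠ 0}
      add_mem' := by
        rintro k l ⟨f, hf, hf0⟩ ⟨g, hg, hg0⟩
        exact ⟨_, hf.mul hg, mul_ne_zero hf0 hg0⟩
      zero_mem' := ⟨_, semi_one φ, one_ne_zero⟩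
      neg_mem' := by
        rintro k ⟨f, hf, hf0⟩
        rcases lt_trichotomy k 0 with hk | hk | hk
        · have h := (hf.pow (b.natAbs - 1)).mul (hfb.pow k.natAbs)
          refine ⟨fun x => f x ^ (b.natAbs - 1) * fb x ^ k.natAbs, ?_,
            mul_ne_zero (pow_ne_zero (b.natAbs - 1) hf0) (pow_ne_zero k.natAbs hfb0)⟩
          convert h using 1
          rw [Nat.cast_sub (by omega), Int.natAbs_of_nonneg hb.le, Int.ofNat_natAbs_of_nonpos hk.le]
          push_cast; ring
        · exact ⟨f, by rwa [hk, neg_zero, ← hk], hf0⟩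
        · have h := (hf.pow (a.natAbs - 1)).mul (hfa.pow k.natAbs)
          refine ⟨fun x => f x ^ (a.natAbs - 1) * fa x ^ k.natAbs, ?_,
            mul_ne_zero (pow_ne_zero (a.natAbs - 1) hf0) (pow_ne_zero k.natAbs hfa0)⟩
          convert h using 1
          rw [Nat.cast_sub (by omega), Int.natAbs_of_nonneg hk.le, Int.ofNat_natAbs_of_nonpos ha.le]
          push_cast; ring }
  obtain ⟨d, hd⟩ := Int.subgroup_cyclic M
  have hmem : ∀ k, k ∈ M ↔ d ∣ k := by
    intro k; rw [hd, ← AddSubgroup.zmultiples_eq_closure, Int.mem_zmultiples_iff]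
  have hd0 : d ≠ 0 := by
    rintro rfl
    have := (hmem b).1 ⟨fb, hfb, hfb0⟩
    rw [zero_dvd_iff] at this
    omega
  have hl : 0 < d.natAbs := by omega
  obtain ⟨f, hf, hf0⟩ : (d.natAbs : ℤ) ∈ M := (hmem _).2 (Int.dvd_natAbs.2 dvd_rfl)
  set l := d.natAbs with hldef
  have hstab : ∀ s : ℂ, s ^ l = 1 → φ s x = x := by
    intro s hs
    have hs0 : s ≠ 0 := by rintro rfl; rw [zero_pow hl.ne'] at hs; exact zero_ne_one hs
    refine A.sep fun k h hh => ?_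
    rw [hh.2 s hs0]
    by_cases h0 : h x = 0
    · rw [h0, mul_zero]
    · obtain ⟨c, hc⟩ : (l : ℤ) ∣ k := Int.natAbs_dvd.2 ((hmem k).1 ⟨h, hh, h0⟩)
      rw [hc, zpow_mul, zpow_natCast, hs, one_zpow, one_mul]
  obtain ⟨k, g, hg, hJ⟩ := A.two_of (x := x) (u := VF φ x) (f := f) (by
    rw [A.semi_V hf]
    exact mul_ne_zero (by exact_mod_cast hl.ne') hf0)
  have hg1 := hg.mul (hf.pow k.natAbs)
  have hJ1 : Jac f (fun x => g x * f x ^ k.natAbs) x ≠ 0 := by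
    rw [Jac_comb (g := g) (a := f x ^ k.natAbs) (b := g x * (k.natAbs * f x ^ (k.natAbs - 1)))]
    · exact mul_ne_zero (pow_ne_zero _ hf0) hJ
    · have := (hg.1 x).hasFDerivAt.mul ((hf.1 x).hasFDerivAt.pow k.natAbs)
      rw [show fderiv ℂ (fun x => g x * f x ^ k.natAbs) x = _ from this.fderiv]
      ext <;> simp <;> ring
  set g1 := fun x => g x * f x ^ k.natAbs
  have hj0 : 0 ≤ k + l * (k.natAbs : ℤ) := by
    have : (k.natAbs : ℤ) ≤ l * (k.natAbs : ℤ) := le_mul_of_one_le_left (by positivity) (by exact_mod_cast hl)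
    omega
  obtain ⟨j, hj⟩ := Int.eq_ofNat_of_zero_le hj0
  rw [hj] at hg1
  obtain ⟨g2, hg2, hg20, hJ2⟩ : ∃ g2, Semi φ j g2 ∧ g2 x = 0 ∧ Jac f g2 x ≠ 0 := by
    by_cases h0 : g1 x = 0
    · exact ⟨g1, hg1, h0, hJ1⟩
    obtain ⟨c, hc⟩ : (l : ℤ) ∣ j := Int.natAbs_dvd.2 ((hmem j).1 ⟨g1, hg1, h0⟩)
    have hc0 : 0 ≤ c := by
      by_contra! h
      have : (l : ℤ) * c < 0 := mul_neg_of_pos_of_neg (by exact_mod_cast hl) h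
      omega
    obtain ⟨e, rfl⟩ := Int.eq_ofNat_of_zero_le hc0
    have h2 := hf.pow e
    rw [← hc] at h2
    refine ⟨_, hg1.sub h2 (g1 x / f x ^ e), ?_, ?_⟩
    · have := pow_ne_zero e hf0
      field_simp
      ring
    · rw [Jac_comb (g := g1) (a := 1) (b := -(g1 x / f x ^ e * (e * f x ^ (e - 1))))]
      · rwa [one_mul]
      · have := (hg1.1 x).hasFDerivAt.sub (((hf.1 x).hasFDerivAt.pow e).const_mul (g1 x / f x ^ e))
        rw [show fderiv ℂ (fun y => g1 y - g1 x / f x ^ e * f y ^ e) x = _ from this.fderiv]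
        ext <;> simp <;> ring
  exact ⟨l, j, f, g2, hl, hf, hg2, hf0, hg20, hJ2, A.gcd_of_eff hE hf hg2 hJ2 (fun s _ h1 _ => hstab s (by
    rwa [zpow_natCast] at h1)), hstab⟩

/-- near a point off the null cone: motions -/
lemma offK_move {x : ℂ²} {l : ℕ} (hl : 0 < l) (hst : ∀ s : ℂ, s ^ l = 1 → φ s x = x) {U : Set ℂ²} (hU : U ∈ 𝓝 x) :
    ∃ δ > 0, ∀ u ∈ ball (0 : ℂ) δ, ∀ x' ∈ ball x δ, ∀ η : ℂ, η ^ l = 1 → φ (η * exp u) x' ∈ U := by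
  have h1 : ∀ᶠ q : ℂ × ℂ² in 𝓝 (0, x), ∀ η ∈ {η : ℂ | η ^ l = 1}, φ (η * exp q.1) q.2 ∈ U := by
    rw [eventually_all_finite (finite_roots hl)]
    intro η hη
    have hη0 : η ≠ 0 := by rintro rfl; rw [mem_setOf_eq, zero_pow hl.ne'] at hη; exact zero_ne_one hη
    have hc : ContinuousAt (fun q : ℂ × ℂ² => φ (η * exp q.1) q.2) (0, x) := by
      have h2 : ContinuousAt (fun p : ℂ × ℂ² => φ p.1 p.2) (η * exp 0, x) :=
        (A.dAt (by simpa using hη0) x).continuousAt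
      exact ContinuousAt.comp (x := ((0, x) : ℂ × ℂ²)) (g := fun p : ℂ × ℂ² => φ p.1 p.2)
        (f := fun q : ℂ × ℂ² => (η * exp q.1, q.2)) h2 (by fun_prop)
    apply hc.eventually
    change U ∈ 𝓝 (φ (η * exp 0) x)
    rwa [exp_zero, mul_one, hst η hη]
  obtain ⟨δ, hδ, h⟩ := eventually_nhds_iff_ball.1 h1
  refine ⟨δ, hδ, fun u hu x' hx' η hη => h (u, x') ?_ η hη⟩
  rw [← ball_prod_same]
  exact ⟨hu, hx'⟩

include A

/-- functions killed by the vector field are constant along paths -/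
lemma const_path {V : Set ℂ²} {Θ : ℂ² → ℂ} (hV : IsOpen V) (hΘ : DifferentiableOn ℂ Θ V)
    (hΘV : ∀ x ∈ V, fderiv ℂ Θ x (VF φ x) = 0) {S : Set ℂ} (hS : IsOpen S) (hSc : Convex ℝ S) {a : ℂ²}
    (ha : ∀ u ∈ S, φ (exp u) a ∈ V) {u v : ℂ} (hu : u ∈ S) (hv : v ∈ S) : Θ (φ (exp u) a) = Θ (φ (exp v) a) := by
  have hd : ∀ u ∈ S, HasDerivAt (fun u => Θ (φ (exp u) a)) 0 u := by
    intro u hu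
    have h1 := A.along (x := a) (exp_ne_zero u) (hΘ.differentiableAt (hV.mem_nhds (ha u hu)))
    rw [hΘV _ (ha u hu)] at h1
    have h2 := h1.comp u (hasDerivAt_exp u)
    simp only [mul_zero, zero_mul] at h2
    exact h2
  exact hS.is_const_of_deriv_eq_zero hSc.isPreconnected
    (fun u hu => (hd u hu).differentiableAt.differentiableWithinAt) (fun u hu => (hd u hu).deriv) hu hv

lemma offK_local {x : ℂ²} {l j : ℕ} {f g : ℂ² → ℂ} (hl : 0 < l) (hf : Semi φ l f) (hg : Semi φ j g) (hf0 : f x ≠ 0)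
    (hJ : Jac f g x ≠ 0) (hc : Int.gcd l j = 1) (hst : ∀ s : ℂ, s ^ l = 1 → φ s x = x) {V : Set ℂ²} (hV : IsOpen V)
    (hx : x ∈ V) : ∃ δ > 0, ∃ U, IsOpen U ∧ x ∈ U ∧ U ⊆ V ∧ (∀ a ∈ U, f a ≠ 0) ∧
    (∀ u ∈ ball (0 : ℂ) δ, ∀ a ∈ U, ∀ η : ℂ, η ^ l = 1 → φ (η * exp u) a ∈ V) ∧
    ∀ a ∈ U, ∀ b ∈ U, g a ^ l * f b ^ j = g b ^ l * f a ^ j → ∃ u ∈ ball (0 : ℂ) δ, ∃ η : ℂ, η ^ l = 1 ∧ b = φ (η * exp u) a := by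
  obtain ⟨N, -, -, hN, hxN, hNV, -, hinj, -⟩ := loc_inv hV hf.1.differentiableOn hg.1.differentiableOn hx hJ
  obtain ⟨δ, hδ, hmv⟩ := A.offK_move hl hst (hN.mem_nhds hxN)
  have hl0 : (l : ℂ) ≠ 0 := by exact_mod_cast hl.ne'
  have hcu : ContinuousAt (fun a => log (f a / f x) / l) x := by
    refine ContinuousAt.div_const (ContinuousAt.clog ?_ (by rw [div_self hf0]; exact one_mem_slitPlane)) _
    exact (hf.cont.div_const _).continuousAt
  have he : ∀ᶠ a in 𝓝 x, log (f a / f x) / l ∈ ball (0 : ℂ) (δ / 2) := by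
    apply hcu.eventually
    change ball (0 : ℂ) (δ / 2) ∈ 𝓝 (log (f x / f x) / l)
    rw [div_self hf0, log_one, zero_div]
    exact ball_mem_nhds _ (by positivity)
  have hN' : ∀ᶠ a in 𝓝 x, a ∈ N := hN.mem_nhds hxN
  have hall := (he.and (hf.cont.continuousAt.eventually_ne hf0)).and (hN'.and (ball_mem_nhds x hδ))
  obtain ⟨U, hU, hUo, hxU⟩ := _root_.eventually_nhds_iff.1 hall
  refine ⟨δ, hδ, U, hUo, hxU, fun a ha => hNV (hU a ha).2.1, fun a ha => (hU a ha).1.2,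
    fun u hu a ha η hη => hNV (hmv u hu a (hU a ha).2.2 η hη), fun a ha b hb hab => ?_⟩
  have hfa := (hU a ha).1.2
  have hfb := (hU b hb).1.2
  set u := log (f b / f x) / l - log (f a / f x) / l with hu
  have hub : u ∈ ball (0 : ℂ) δ := by
    have h1 := mem_ball_zero_iff.1 (hU a ha).1.1
    have h2 := mem_ball_zero_iff.1 (hU b hb).1.1
    rw [mem_ball_zero_iff]
    exact (norm_sub_le _ _).trans_lt (by linarith)
  have hs : exp u ^ l * f a = f b := by
    rw [← exp_nat_mul, hu, mul_sub, mul_div_cancel₀ _ hl0, mul_div_cancel₀ _ hl0, exp_sub,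
      exp_log (div_ne_zero hfb hf0), exp_log (div_ne_zero hfa hf0)]
    field_simp
  obtain ⟨η, hη, hη2⟩ := coprime_root (j := j) hl hc hfa hfb (b := g a) (b' := g b) (by
    rw [zpow_natCast, zpow_natCast]; exact hab) hs
  have hη0 : η ≠ 0 := by rintro rfl; rw [zero_pow hl.ne'] at hη; exact zero_ne_one hη
  refine ⟨u, hub, η, hη, hinj (hU b hb).2.1 (hmv u hub a (hU a ha).2.2 η hη) ?_⟩
  have hne := mul_ne_zero hη0 (exp_ne_zero u)
  change (f b, g b) = (f _, g _)
  rw [hf.2 _ hne, hg.2 _ hne, hη2, zpow_natCast, mul_pow, hη, one_mul, hs]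

lemma K_local {p : ℂ²} (hp : VF φ p = 0) {n m : ℕ} {f g : ℂ² → ℂ} (hn : 0 < n) (hm : 0 < m) (hc : Nat.Coprime n m)
    (hf : Semi φ n f) (hg : Semi φ (-m) g) (hf0 : f p = 0) (hg0 : g p = 0) (hJ : Jac f g p ≠ 0) {V : Set ℂ²}
    (hV : IsOpen V) (hpV : p ∈ V) : ∃ U, IsOpen U ∧ p ∈ U ∧ U ⊆ V ∧ (∀ a ∈ U, a ∈ KK φ → avg φ a = p) ∧
    (∀ a ∈ U, ∀ b ∈ U, f a ^ m * g a ^ n = f b ^ m * g b ^ n → A.rel a b) ∧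
    ∀ Θ : ℂ² → ℂ, DifferentiableOn ℂ Θ V → (∀ x ∈ V, fderiv ℂ Θ x (VF φ x) = 0) →
      ∀ a ∈ U, ∀ b ∈ U, f a ^ m * g a ^ n = f b ^ m * g b ^ n → Θ a = Θ b := by
  obtain ⟨N, ε, G, hN, hpN, hNV, hε, hinj, hj, hG, hGd, hGF, hGφ⟩ := A.fix_chart hp hf hg hf0 hg0 hJ hV hpV
  have hfix : ∀ q ∈ N, VF φ q = 0 → q = p := by
    intro q hq hq0
    apply hinj hq hpN
    change (f q, g q) = (f p, g p)
    rw [hf0, hg0, A.semi_fixed hq0 hf (by omega), A.semi_fixed hq0 hg (by omega)]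
  have hbo : IsOpen {x | (f x, g x) ∈ ball (0 : ℂ²) ε} := isOpen_ball.preimage (hf.cont.prodMk hg.cont)
  have havg : ∀ a, a ∈ N ∧ avg φ a ∈ N ∧ (f a, g a) ∈ ball (0 : ℂ²) ε → a ∈ KK φ → avg φ a = p :=
    fun a ha hK => hfix _ ha.2.1 (A.avg_fixed_K hK)
  have h0b : ((0, 0) : ℂ²) ∈ ball (0 : ℂ²) ε := mem_ball_self hε
  have hG0 : G (0, 0) = p := by
    have := hGF p hpN (by rw [hf0, hg0]; exact h0b)
    rwa [hf0, hg0] at this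
  have hmove : ∀ a ∈ N, (f a, g a) ∈ ball (0 : ℂ²) ε → ∀ s, s ≠ 0 → (s ^ (n : ℤ) * f a, s ^ (-m : ℤ) * g a) ∈ ball (0 : ℂ²) ε →
      φ s a = G (s ^ (n : ℤ) * f a, s ^ (-m : ℤ) * g a) := by
    intro a ha hab s hs h
    have := hGφ _ hab s hs h
    rwa [hGF a ha hab] at this
  have hΘc : ∀ Θ : ℂ² → ℂ, DifferentiableOn ℂ Θ V → (∀ x ∈ V, fderiv ℂ Θ x (VF φ x) = 0) → ∀ a ∈ N,
      (f a, g a) ∈ ball (0 : ℂ²) ε → ∀ s, s ≠ 0 → (s ^ (n : ℤ) * f a, s ^ (-m : ℤ) * g a) ∈ ball (0 : ℂ²) ε →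
      Θ (φ s a) = Θ a := by
    intro Θ h1 h2 a ha hab s hs h
    have hSm : ∀ v, v ∈ {u : ℂ | ‖exp ((n : ℤ) * u) * f a‖ < ε} ∩ {u : ℂ | ‖exp ((-m : ℤ) * u) * g a‖ < ε} ↔
        (exp v ^ (n : ℤ) * f a, exp v ^ (-m : ℤ) * g a) ∈ ball (0 : ℂ²) ε := by
      intro v
      rw [mem_ball0, ← exp_int_mul, ← exp_int_mul]
      rfl
    have := A.const_path hV h1 h2 (S := {u : ℂ | ‖exp ((n : ℤ) * u) * f a‖ < ε} ∩ {u : ℂ | ‖exp ((-m : ℤ) * u) * g a‖ < ε})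
      ((isOpen_lt (by fun_prop) continuous_const).inter (isOpen_lt (by fun_prop) continuous_const))
      ((convex_exp n _ _).inter (convex_exp (-m) _ _)) (a := a) (u := log s) (v := 0) (fun v hv => by
        have hv' := (hSm v).1 hv
        rw [hmove a ha hab _ (exp_ne_zero v) hv']
        exact hNV (hG _ hv').1) ((hSm _).2 (by rwa [exp_log hs])) ((hSm 0).2 (by simpa using hab))
    rwa [exp_log hs, exp_zero, A.one'] at this
  have hlim : ∀ a ∈ N, (f a, g a) ∈ ball (0 : ℂ²) ε → ∀ τ : ℂ → ℂ, (∀ s, s ≠ 0 → τ s ≠ 0) →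
      Tendsto (fun s => (τ s ^ (n : ℤ) * f a, τ s ^ (-m : ℤ) * g a)) (𝓝[≠] 0) (𝓝 (0, 0)) →
      Tendsto (fun s => φ (τ s) a) (𝓝[≠] 0) (𝓝 p) ∧
      ∀ Θ : ℂ² → ℂ, DifferentiableOn ℂ Θ V → (∀ x ∈ V, fderiv ℂ Θ x (VF φ x) = 0) → Θ a = Θ p := by
    intro a ha hab τ hτ h
    have hev := (h.eventually (isOpen_ball.mem_nhds h0b)).and (self_mem_nhdsWithin : ∀ᶠ s in 𝓝[≠] (0 : ℂ), s ∈ ({0}ᶜ : Set ℂ))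
    have h1 : Tendsto (fun s => φ (τ s) a) (𝓝[≠] 0) (𝓝 p) := by
      rw [← hG0]
      refine ((hGd.continuousOn.continuousAt (isOpen_ball.mem_nhds h0b)).tendsto.comp h).congr' ?_
      filter_upwards [hev] with s hs
      exact (hmove a ha hab _ (hτ s hs.2) hs.1).symm
    refine ⟨h1, fun Θ h2 h3 => ?_⟩
    refine tendsto_nhds_unique (tendsto_const_nhds.congr' ?_)
      ((h2.continuousOn.continuousAt (hV.mem_nhds hpV)).tendsto.comp h1)
    filter_upwards [hev] with s hs
    exact (hΘc Θ h2 h3 a ha hab _ (hτ s hs.2) hs.1).symm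
  have hzero : ∀ a ∈ N, (f a, g a) ∈ ball (0 : ℂ²) ε → f a ^ m * g a ^ n = 0 → a ∈ KK φ ∧
      ∀ Θ : ℂ² → ℂ, DifferentiableOn ℂ Θ V → (∀ x ∈ V, fderiv ℂ Θ x (VF φ x) = 0) → Θ a = Θ p := by
    intro a ha hab h
    rcases mul_eq_zero.1 h with h | h
    · have h0 := (pow_eq_zero_iff hm.ne').1 h
      obtain ⟨t, ht⟩ := hlim a ha hab (fun s => s⁻¹) (fun s hs => inv_ne_zero hs) (by
        simp only [h0, mul_zero, inv_zpow', neg_neg]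
        exact tendsto_const_nhds.prodMk_nhds (tendsto_zpow0 (by omega) _))
      refine ⟨Or.inr ?_, ht⟩
      rw [← Kp_symm]
      exact A.symm.Kp_of_lim t
    · have h0 := (pow_eq_zero_iff hn.ne').1 h
      obtain ⟨t, ht⟩ := hlim a ha hab (fun s => s) (fun s hs => hs) (by
        simp only [h0, mul_zero]
        exact (tendsto_zpow0 (by omega) _).prodMk_nhds tendsto_const_nhds)
      exact ⟨Or.inl (A.Kp_of_lim t), ht⟩
  have hnz : ∀ a ∈ N, (f a, g a) ∈ ball (0 : ℂ²) ε → ∀ b ∈ N, (f b, g b) ∈ ball (0 : ℂ²) ε →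
      f a ^ m * g a ^ n = f b ^ m * g b ^ n → f a ^ m * g a ^ n ≠ 0 → ∃ s, s ≠ 0 ∧ b = φ s a ∧
      (s ^ (n : ℤ) * f a, s ^ (-m : ℤ) * g a) ∈ ball (0 : ℂ²) ε := by
    intro a ha hab b hb hbb h h0
    have hfa : f a ≠ 0 := fun h' => h0 (by rw [h', zero_pow hm.ne', zero_mul])
    have hfb : f b ≠ 0 := fun h' => h0 (by rw [h, h', zero_pow hm.ne', zero_mul])
    obtain ⟨s, hs0, hs⟩ := root_of hn (div_ne_zero hfb hfa)
    have hs' : s ^ n * f a = f b := by rw [hs, div_mul_cancel₀ _ hfa]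
    obtain ⟨η, hη, hη2⟩ := coprime_root (j := -(m : ℤ)) hn (by rw [Int.gcd_neg]; exact_mod_cast hc) hfa hfb (b := g a) (b' := g b) (by
      have := pow_ne_zero m hfa
      have := pow_ne_zero m hfb
      simp only [zpow_neg, zpow_natCast]
      field_simp
      linear_combination h) hs'
    have hη0 : η ≠ 0 := by rintro rfl; rw [zero_pow hn.ne'] at hη; exact zero_ne_one hη
    have hne := mul_ne_zero hη0 hs0
    have he : (((η * s) ^ (n : ℤ) * f a, (η * s) ^ (-m : ℤ) * g a) : ℂ²) = (f b, g b) := by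
      rw [hη2, zpow_natCast, mul_pow, hη, one_mul, hs']
    refine ⟨η * s, hne, ?_, by rwa [he]⟩
    rw [hmove a ha hab _ hne (by rwa [he]), he, hGF b hb hbb]
  refine ⟨{x | x ∈ N ∧ avg φ x ∈ N ∧ (f x, g x) ∈ ball (0 : ℂ²) ε},
    hN.inter ((hN.preimage A.avg_diff.continuous).inter hbo), ⟨hpN, by rwa [A.avg_fix hp], by rw [hf0, hg0]; exact h0b⟩,
    fun a ha => hNV ha.1, havg, ?_, ?_⟩
  · intro a ha b hb hab
    by_cases h0 : f a ^ m * g a ^ n = 0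
    · have h1 := (hzero a ha.1 ha.2.2 h0).1
      have h2 := (hzero b hb.1 hb.2.2 (hab ▸ h0)).1
      exact A.rel_iff.2 (Or.inr ⟨h1, h2, by rw [havg a ha h1, havg b hb h2]⟩)
    · obtain ⟨s, hs, h, -⟩ := hnz a ha.1 ha.2.2 b hb.1 hb.2.2 hab h0
      exact A.rel_iff.2 (Or.inl ⟨s, hs, h⟩)
  · intro Θ h2 h3 a ha b hb hab
    by_cases h0 : f a ^ m * g a ^ n = 0
    · rw [(hzero a ha.1 ha.2.2 h0).2 Θ h2 h3, (hzero b hb.1 hb.2.2 (hab ▸ h0)).2 Θ h2 h3]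
    · obtain ⟨s, hs, h, h'⟩ := hnz a ha.1 ha.2.2 b hb.1 hb.2.2 hab h0
      rw [h, hΘc Θ h2 h3 a ha.1 ha.2.2 s hs h']

lemma rel_closed : IsClosed {q : ℂ² × ℂ² | A.rel q.1 q.2} := by
  have hOc : ∀ q ∈ closure {q : ℂ² × ℂ² | ∃ s, s ≠ 0 ∧ q.2 = φ s q.1}, A.rel q.1 q.2 := by
    have aux : ∀ {ψ : ℂ → ℂ² → ℂ²}, Act ψ → ∀ (F : Ultrafilter ((ℂ²) × ℂ²)) (q : ℂ² × ℂ²)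
        (S : ℂ² × ℂ² → ℂ), Tendsto id (F : Filter ((ℂ²) × ℂ²)) (𝓝 q) →
        (∀ᶠ y in (F : Filter _), S y ≠ 0 ∧ y.2 = ψ (S y) y.1) → (∀ᶠ y in (F : Filter _), S y ∈ closedBall (0 : ℂ) 1) →
        (∃ s, s ≠ 0 ∧ q.2 = ψ s q.1) ∨ (q.1 ∈ Kp ψ ∧ q.2 ∈ Km ψ ∧ avg ψ q.1 = avg ψ q.2) := by
      intro ψ B F q S hF h1 h2
      obtain ⟨s0, -, hs0⟩ := (isCompact_closedBall (0 : ℂ) 1).ultrafilter_le_nhds (F.map S) (by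
        rw [le_principal_iff]; exact h2)
      have hS : Tendsto S F (𝓝 s0) := hs0
      have hq1 : Tendsto Prod.fst (F : Filter ((ℂ²) × ℂ²)) (𝓝 q.1) := (continuous_fst.tendsto q).comp hF
      have hq2 : Tendsto Prod.snd (F : Filter ((ℂ²) × ℂ²)) (𝓝 q.2) := (continuous_snd.tendsto q).comp hF
      by_cases h0 : s0 = 0
      · right
        subst h0
        have hz : ∀ k : ℤ, 0 < k → Tendsto (fun y => S y ^ k) F (𝓝 0) := by
          intro k hk
          have := (tendsto_zpow0 hk 1).comp (tendsto_nhdsWithin_iff.2 ⟨hS, h1.mono fun y hy => hy.1⟩)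
          simpa [Function.comp_def] using this
        refine ⟨fun k f hk hf => ?_, fun k f hk hf => ?_, ?_⟩
        · refine tendsto_nhds_unique ((hf.cont.tendsto _).comp hq1) (Tendsto.congr' ?_
            (((hz (-k) (by omega)).mul ((hf.cont.tendsto _).comp hq2)).trans (by rw [zero_mul])))
          filter_upwards [h1] with y hy
          simp only [Function.comp_apply]
          rw [hy.2, hf.2 _ hy.1, zpow_neg, inv_mul_cancel_left₀ (zpow_ne_zero k hy.1)]
        · refine tendsto_nhds_unique ((hf.cont.tendsto _).comp hq2) (Tendsto.congr' ?_
            (((hz k hk).mul ((hf.cont.tendsto _).comp hq1)).trans (by rw [zero_mul])))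
          filter_upwards [h1] with y hy
          simp only [Function.comp_apply]
          rw [hy.2, hf.2 _ hy.1]
        · have hc := B.avg_diff.continuous
          refine tendsto_nhds_unique ((hc.tendsto _).comp hq1) (Tendsto.congr' ?_ ((hc.tendsto _).comp hq2))
          filter_upwards [h1] with y hy
          simp only [Function.comp_apply]
          rw [hy.2, B.avg_inv hy.1]
      · left
        refine ⟨s0, h0, tendsto_nhds_unique hq2 (Tendsto.congr' ?_
          ((B.dAt h0 q.1).continuousAt.tendsto.comp (hS.prodMk_nhds hq1)))⟩
        filter_upwards [h1] with y hy
        exact hy.2.symm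
    intro q hq
    obtain ⟨F, hF, hq⟩ := mem_closure_iff_ultrafilter.1 hq
    choose! S hS using (fun (y : ℂ² × ℂ²) (hy : ∃ s, s ≠ 0 ∧ y.2 = φ s y.1) => hy)
    have h1 : ∀ᶠ y in (F : Filter _), S y ≠ 0 ∧ y.2 = φ (S y) y.1 := by
      filter_upwards [hF] with y hy using hS y hy
    by_cases hb : ∀ᶠ y in (F : Filter _), S y ∈ closedBall (0 : ℂ) 1
    · rcases aux A F q S hq h1 hb with h | ⟨h1, h2, h3⟩
      · exact A.rel_iff.2 (Or.inl h)
      · exact A.rel_iff.2 (Or.inr ⟨Or.inl h1, Or.inr h2, h3⟩)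
    · have hb' := Ultrafilter.eventually_not.2 hb
      rcases aux A.symm F q (fun y => (S y)⁻¹) hq (h1.mono fun y hy => ⟨inv_ne_zero hy.1, by rw [inv_inv]; exact hy.2⟩)
        (hb'.mono fun y hy => by
          rw [mem_closedBall_zero_iff, norm_inv]
          rw [mem_closedBall_zero_iff, not_le] at hy
          exact inv_le_one_of_one_le₀ hy.le) with ⟨s, hs, h⟩ | ⟨h1, h2, h3⟩
      · exact A.rel_iff.2 (Or.inl ⟨s⁻¹, inv_ne_zero hs, h⟩)
      · rw [Kp_symm] at h1
        rw [Km_symm] at h2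
        rw [avg_symm] at h3
        exact A.rel_iff.2 (Or.inr ⟨Or.inr h1, Or.inl h2, h3⟩)
  have hc : Continuous (avg φ) := A.avg_diff.continuous
  have hB : IsClosed {q : ℂ² × ℂ² | q.1 ∈ KK φ ∧ q.2 ∈ KK φ ∧ avg φ q.1 = avg φ q.2} :=
    ((KK_closed φ).preimage continuous_fst).inter (((KK_closed φ).preimage continuous_snd).inter
      (isClosed_eq (hc.comp continuous_fst) (hc.comp continuous_snd)))
  rw [← closure_subset_iff_isClosed]
  intro q hq
  have e : {q : ℂ² × ℂ² | A.rel q.1 q.2} = {q | ∃ s, s ≠ 0 ∧ q.2 = φ s q.1} ∪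
    {q | q.1 ∈ KK φ ∧ q.2 ∈ KK φ ∧ avg φ q.1 = avg φ q.2} := rfl
  rw [e, closure_union] at hq
  rcases hq with h | h
  · exact hOc q h
  · rw [hB.closure_eq] at h
    exact A.rel_iff.2 (Or.inr h)

lemma rel_conn (x : ℂ²) : IsPreconnected {x' | A.rel x x'} := by
  by_cases hx : x ∈ KK φ
  · refine isPreconnected_of_forall (avg φ x) fun y hy => ?_
    have hpr : ∀ y, A.rel x y → y ∈ KK φ ∧ avg φ y = avg φ x := by
      intro y hy
      rcases A.rel_iff.1 hy with ⟨s, hs, rfl⟩ | ⟨h1, h2, h3⟩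
      · exact ⟨(KK_inv hs x).2 hx, A.avg_inv hs x⟩
      · exact ⟨h2, h3.symm⟩
    have hfix := A.avg_fixed_K hx
    obtain ⟨hyK, hya⟩ := hpr y hy
    have hc : IsPreconnected (insert (avg φ x) ((fun s => φ s y) '' {s | s ≠ 0})) := by
      rcases hyK with h | h
      · have := A.orbit_lim_conn (A.lim h)
        rwa [hya] at this
      · have := A.symm.orbit_lim_conn (A.lim_m h)
        rw [hya] at this
        convert this using 2
        ext w
        constructor
        · rintro ⟨s, hs, rfl⟩
          exact ⟨s⁻¹, inv_ne_zero hs, by simp⟩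
        · rintro ⟨s, hs, rfl⟩
          exact ⟨s⁻¹, inv_ne_zero hs, by simp⟩
    refine ⟨insert (avg φ x) ((fun s => φ s y) '' {s | s ≠ 0}), ?_, mem_insert _ _, mem_insert_of_mem _ ⟨1, one_ne_zero, A.one' y⟩, hc⟩
    rintro w (rfl | ⟨s, hs, rfl⟩)
    · exact A.rel_iff.2 (Or.inr ⟨hx, A.fixed_K hfix, (A.avg_fix hfix).symm⟩)
    · exact A.rel.trans' hy (A.rel_orb hs)
  · convert A.orbit_conn x using 1
    ext y
    constructor
    · intro hy
      rcases A.rel_iff.1 hy with ⟨s, hs, rfl⟩ | ⟨h1, h2, h3⟩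
      · exact ⟨s, hs, rfl⟩
      · exact absurd h1 hx
    · rintro ⟨s, hs, rfl⟩
      exact A.rel_orb hs

end Act

lemma Hyp.fol (hH : Hyp φ) : Fol hH.act.rel := by
  have A := hH.act
  refine ⟨fun a => ?_, A.rel_closed, A.rel_conn, ?_⟩
  · by_cases ha : a ∈ KK φ
    · obtain ⟨n, m, f, g, hn, hm, hc, hf, hg, hf0, hg0, hJ⟩ := hH.fixed_weights (A.avg_fixed_K ha)
      obtain ⟨U, hU, hpU, -, hUK, hUr, -⟩ := A.K_local (A.avg_fixed_K ha) hn hm hc hf hg hf0 hg0 hJ isOpen_univ (mem_univ _)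
      have hy : Semi φ 0 (fun x => f x ^ m * g x ^ n) := by
        have h := (hf.pow m).mul (hg.pow n)
        have e : (n : ℤ) * m + -m * n = 0 := by ring
        rwa [e] at h
      refine ⟨sat φ U, _, A.sat_open hU, A.K_move ha (hU.mem_nhds hpU), ?_, hy.1.differentiableOn, fun x hx x' hx' =>
        ⟨A.rel_of_sat (y := fun x => f x ^ m * g x ^ n) (fun s hs x => by simpa using hy.2 s hs x) hUr hx hx', A.rel_semi hy⟩⟩
      intro x x' hr hx
      rcases A.rel_iff.1 hr with ⟨s, hs, rfl⟩ | ⟨h1, h2, h3⟩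
      · exact A.sat_inv hx hs
      · obtain ⟨s, hs, hsx⟩ := hx
        have := hUK _ hsx ((KK_inv hs x).2 h1)
        rw [A.avg_inv hs, h3] at this
        exact A.K_move h2 (by rw [this]; exact hU.mem_nhds hpU)
    · obtain ⟨l, j, f, g, hl, hf, hg, hf0, hg0, hJ, hc, hst⟩ := A.offK hH.eff ha
      obtain ⟨δ, hδ, U, hU, haU, hUK, hUf, -, hUr⟩ := A.offK_local hl hf hg hf0 hJ hc hst (KK_closed φ).isOpen_compl ha
      have hWK : ∀ x ∈ sat φ U, x ∉ KK φ := by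
        rintro x ⟨s, hs, hx⟩ h
        exact hUK hx ((KK_inv hs x).2 h)
      have hWf : ∀ x ∈ sat φ U, f x ≠ 0 := by
        rintro x ⟨s, hs, hx⟩ h
        have := hUf _ hx
        rw [hf.2 s hs, h, mul_zero] at this
        exact this rfl
      have hy : ∀ s, s ≠ 0 → ∀ x, (fun x => g x ^ l * (f x ^ j)⁻¹) (φ s x) = (fun x => g x ^ l * (f x ^ j)⁻¹) x := by
        intro s hs x
        have h1 := pow_ne_zero (l * j) hs
        simp only [hf.2 s hs, hg.2 s hs, zpow_natCast, mul_pow, mul_inv, ← pow_mul]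
        rw [mul_comm j l]
        field_simp
      have hrel : ∀ x ∈ sat φ U, ∀ x', A.rel x x' → ∃ s, s ≠ 0 ∧ x' = φ s x := by
        intro x hx x' hr
        rcases A.rel_iff.1 hr with h | ⟨h1, h2, h3⟩
        · exact h
        · exact absurd h1 (hWK x hx)
      refine ⟨sat φ U, fun x => g x ^ l * (f x ^ j)⁻¹, A.sat_open hU, A.sub_sat haU, ?_, ?_, fun x hx x' hx' =>
        ⟨A.rel_of_sat (y := fun x => g x ^ l * (f x ^ j)⁻¹) hy ?_ hx hx', ?_⟩⟩
      · intro x x' hr hx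
        obtain ⟨s, hs, rfl⟩ := hrel x hx x' hr
        exact A.sat_inv hx hs
      · intro x hx
        exact (((hg.1 x).pow l).mul (((hf.1 x).pow j).inv (pow_ne_zero j (hWf x hx)))).differentiableWithinAt
      · intro x hx x' hx' h
        have h1 := pow_ne_zero j (hUf x hx)
        have h2 := pow_ne_zero j (hUf x' hx')
        obtain ⟨u, -, η, hη, h⟩ := hUr x hx x' hx' (by field_simp at h; rw [h, mul_comm])
        exact A.rel_iff.2 (Or.inl ⟨_, mul_ne_zero (by
          rintro rfl; rw [zero_pow hl.ne'] at hη; exact zero_ne_one hη) (exp_ne_zero u), h⟩)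
      · intro hr
        obtain ⟨s, hs, rfl⟩ := hrel x hx x' hr
        exact (hy s hs x).symm
  · obtain ⟨h, hh, hne⟩ := hH.exists_inv
    exact ⟨h, hh.1, fun x x' hr => A.rel_semi hh hr, hne⟩

lemma dsymm {h : ℂ² → ℂ} {x : ℂ²} (hh : AnalyticAt ℂ h x) (v v' : ℂ²) :
    fderiv ℂ (fun y => fderiv ℂ h y v) x v' = fderiv ℂ (fun y => fderiv ℂ h y v') x v := by
  have h2 : HasFDerivAt (fderiv ℂ h) (fderiv ℂ (fderiv ℂ h) x) x := hh.fderiv.differentiableAt.hasFDerivAt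
  have hs := second_derivative_symmetric_of_eventually
    (hh.eventually_analyticAt.mono fun y hy => hy.differentiableAt.hasFDerivAt) h2 v v'
  have hv : ∀ v w, fderiv ℂ (fun x => fderiv ℂ h x v) x w = fderiv ℂ (fderiv ℂ h) x w v := by
    intro v w
    rw [(h2.clm_apply (hasFDerivAt_const v x)).fderiv]; simp
  rw [hv, hv, hs]

lemma exists_xprim {w : ℂ² → ℂ} (hw : Differentiable ℂ w) : ∃ Λ, Differentiable ℂ Λ ∧ ∀ x, fderiv ℂ Λ x (1, 0) = w x := by
  have hd : Differentiable ℂ (fun x : ℂ² => x.1 * ∫ t in (0 : ℝ)..1, w (t * x.1, x.2)) := by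
    refine differentiable_fst.mul (diff_integral ?_ ?_ 0 1)
    · have := hw.continuous
      simp only [Function.uncurry_def]
      fun_prop
    · intro t
      exact hw.comp (f := fun x : ℂ² => ((t : ℂ) * x.1, x.2)) (by fun_prop)
  refine ⟨_, hd, fun x => ?_⟩
  obtain ⟨P, hP⟩ := (hw.comp (f := fun a : ℂ => (a, x.2)) (by fun_prop)).isExactOn_univ
  have e : ∀ a : ℂ, a * ∫ t in (0 : ℝ)..1, w (t * a, x.2) = P a - P 0 := by
    intro a
    have h1 : ∀ t ∈ uIcc (0 : ℝ) 1, HasDerivAt (fun t : ℝ => P (t * a)) (a * w (t * a, x.2)) t := by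
      intro t _
      have h2 : HasDerivAt (fun t : ℝ => (t : ℂ) * a) a t := by
        simpa using (hasDerivAt_id (t : ℂ)).comp_ofReal.mul_const a
      have h3 := (hP (t * a) (mem_univ _)).comp t h2
      rw [mul_comm] at h3
      exact h3
    have h2 := intervalIntegral.integral_eq_sub_of_hasDerivAt h1 (by
      have := hw.continuous
      exact Continuous.intervalIntegrable (by fun_prop) _ _)
    rw [intervalIntegral.integral_const_mul] at h2
    simpa using h2
  have h1 : HasDerivAt (fun a : ℂ => a * ∫ t in (0 : ℝ)..1, w (t * a, x.2)) (w x) x.1 := by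
    simp only [e]
    exact (hP x.1 (mem_univ _)).sub_const _
  have h2 := (hd x).hasFDerivAt.comp_hasDerivAt x.1 ((hasDerivAt_id x.1).prodMk (hasDerivAt_const x.1 x.2))
  exact h2.unique h1

namespace Act
variable (A : Act φ)
include A

lemma push_deriv {h : ℂ² → ℂ} (hh : Differentiable ℂ h) (x u : ℂ²) {s : ℂ} (hs : s ≠ 0) :
    HasDerivAt (fun s => fderiv ℂ h (φ s x) (fderiv ℂ (φ s) x u))
      (s⁻¹ * fderiv ℂ (fun y => fderiv ℂ h y (VF φ y)) (φ s x) (fderiv ℂ (φ s) x u)) s := by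
  set F : ℂ² → ℂ := fun p => h (φ p.1 (x + p.2 • u)) with hF
  have hFd : DifferentiableOn ℂ F ({s : ℂ | s ≠ 0} ×ˢ univ) := by
    intro p hp
    refine DifferentiableAt.differentiableWithinAt ?_
    exact (hh _).comp p ((A.dAt hp.1 (x + p.2 • u)).comp p (f := fun p : ℂ² => (p.1, x + p.2 • u)) (by fun_prop))
  have hUo : IsOpen ({s : ℂ | s ≠ 0} ×ˢ (univ : Set ℂ)) := punct_open.prod isOpen_univ
  have hFa := analyticOn_of_diff hUo hFd
  have hline : ∀ τ : ℂ, HasDerivAt (fun τ : ℂ => x + τ • u) u τ := fun τ => by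
    simpa using ((hasDerivAt_id τ).smul_const u).const_add x
  have h1 : ∀ t : ℂ, t ≠ 0 → fderiv ℂ F (t, 0) (0, 1) = fderiv ℂ h (φ t x) (fderiv ℂ (φ t) x u) := by
    intro t ht
    have e1 := (hFa (t, 0) ⟨ht, mem_univ _⟩).differentiableAt.hasFDerivAt.comp_hasDerivAt (0 : ℂ)
      ((hasDerivAt_const (0 : ℂ) t).prodMk (hasDerivAt_id (0 : ℂ)))
    have e2 := (hh (φ t (x + (0 : ℂ) • u))).hasFDerivAt.comp_hasDerivAt (0 : ℂ)
      ((A.diff ht (x + (0 : ℂ) • u)).hasFDerivAt.comp_hasDerivAt (0 : ℂ) (hline 0))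
    have := e1.unique e2
    simpa using this
  have h2 : ∀ t τ : ℂ, t ≠ 0 → fderiv ℂ F (t, τ) (1, 0) = t⁻¹ * fderiv ℂ h (φ t (x + τ • u)) (VF φ (φ t (x + τ • u))) := by
    intro t τ ht
    have e1 := (hFa (t, τ) ⟨ht, mem_univ _⟩).differentiableAt.hasFDerivAt.comp_hasDerivAt t
      ((hasDerivAt_id t).prodMk (hasDerivAt_const t τ))
    exact e1.unique (A.along (f := h) (x := x + τ • u) ht (hh _))
  have hsym := dsymm (hFa (s, 0) ⟨hs, mem_univ _⟩) (0, 1) (1, 0)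
  have hdd : ∀ v, DifferentiableAt ℂ (fun y => fderiv ℂ F y v) (s, 0) := fun v =>
    (fderiv_diff hUo hFd v).differentiableAt (hUo.mem_nhds ⟨hs, mem_univ _⟩)
  have e3 := (hdd (0, 1)).hasFDerivAt.comp_hasDerivAt s ((hasDerivAt_id s).prodMk (hasDerivAt_const s (0 : ℂ)))
  have e4 := (hdd (1, 0)).hasFDerivAt.comp_hasDerivAt (0 : ℂ) ((hasDerivAt_const (0 : ℂ) s).prodMk (hasDerivAt_id (0 : ℂ)))
  have hVh : Differentiable ℂ (fun y => fderiv ℂ h y (VF φ y)) := by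
    have : (fun y => fderiv ℂ h y (VF φ y)) = fun y => (VF φ y).1 * fderiv ℂ h y (1, 0) + (VF φ y).2 * fderiv ℂ h y (0, 1) := by
      funext y; exact lin_apply _ _
    rw [this]
    exact (A.V1d.mul (A.dfun hh _)).add (A.V2d.mul (A.dfun hh _))
  have e5 : HasDerivAt (fun τ : ℂ => fderiv ℂ F (s, τ) (1, 0))
      (s⁻¹ * fderiv ℂ (fun y => fderiv ℂ h y (VF φ y)) (φ s x) (fderiv ℂ (φ s) x u)) 0 := by
    have := ((hVh (φ s (x + (0 : ℂ) • u))).hasFDerivAt.comp_hasDerivAt (0 : ℂ)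
      ((A.diff hs (x + (0 : ℂ) • u)).hasFDerivAt.comp_hasDerivAt (0 : ℂ) (hline 0))).const_mul s⁻¹
    rw [zero_smul, add_zero] at this
    exact this.congr_of_eventuallyEq (Eventually.of_forall fun τ => h2 s τ hs)
  have e6 := e4.unique e5
  rw [← e6, ← hsym]
  refine e3.congr_of_eventuallyEq ?_
  filter_upwards [punct_open.mem_nhds hs] with t ht
  exact (h1 t ht).symm

/-- Cartan's formula -/
lemma cartan {z w a b : ℂ² → ℂ} (hz : Semi φ 0 z) (hzw : ∀ x v, fderiv ℂ z x v = w x * ((VF φ x).1 * v.2 - (VF φ x).2 * v.1))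
    (ha : Differentiable ℂ a) (hb : Differentiable ℂ b) (hab : ∀ x, fderiv ℂ b x (1, 0) - fderiv ℂ a x (0, 1) = w x)
    (hK : Semi φ 0 (fun x => a x * (VF φ x).1 + b x * (VF φ x).2)) (x u : ℂ²) :
    fderiv ℂ (fun x => a x * (VF φ x).1 + b x * (VF φ x).2) x u + fderiv ℂ z x u = 0 ∧
    ∀ s, s ≠ 0 → a (φ s x) * (fderiv ℂ (φ s) x u).1 + b (φ s x) * (fderiv ℂ (φ s) x u).2 = a x * u.1 + b x * u.2 := by
  set K := fun x => a x * (VF φ x).1 + b x * (VF φ x).2 with hKdef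
  set c : ℂ → ℂ := fun s => a (φ s x) * (fderiv ℂ (φ s) x u).1 + b (φ s x) * (fderiv ℂ (φ s) x u).2 with hc
  have hinv : ∀ {h : ℂ² → ℂ}, Semi φ 0 h → ∀ s, s ≠ 0 → fderiv ℂ h (φ s x) (fderiv ℂ (φ s) x u) = fderiv ℂ h x u := by
    intro h hh s hs
    have e : (fun y => h (φ s y)) = h := by funext y; rw [hh.2 s hs, zpow_zero, one_mul]
    have h1 := (hh.1 (φ s x)).hasFDerivAt.comp x (A.diff hs x).hasFDerivAt
    rw [← e, show fderiv ℂ (fun y => h (φ s y)) x = _ from h1.fderiv, e]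
    rfl
  have hcd : ∀ s, s ≠ 0 → HasDerivAt c (s⁻¹ * (fderiv ℂ K x u + fderiv ℂ z x u)) s := by
    intro s hs
    have p1 := A.push_deriv (h := Prod.fst) differentiable_fst x u hs
    have p2 := A.push_deriv (h := Prod.snd) differentiable_snd x u hs
    simp only [fderiv_fst, fderiv_snd, ContinuousLinearMap.coe_fst', ContinuousLinearMap.coe_snd'] at p1 p2
    have h1 := ((A.along (x := x) hs (ha _)).mul p1).add ((A.along (x := x) hs (hb _)).mul p2)
    have hKf := ((ha (φ s x)).hasFDerivAt.mul (A.V1d (φ s x)).hasFDerivAt).add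
        ((hb (φ s x)).hasFDerivAt.mul (A.V2d (φ s x)).hasFDerivAt)
    rw [← hinv hK s hs, ← hinv hz s hs, show fderiv ℂ K (φ s x) = _ from hKf.fderiv, hzw, ← hab]
    refine HasDerivAt.congr_deriv (f := c) h1 ?_
    simp only [add_apply, smul_apply, smul_eq_mul]
    rw [lin_apply (fderiv ℂ a (φ s x)) (VF φ (φ s x)), lin_apply (fderiv ℂ b (φ s x)) (VF φ (φ s x)),
      lin_apply (fderiv ℂ a (φ s x)) (fderiv ℂ (φ s) x u), lin_apply (fderiv ℂ b (φ s x)) (fderiv ℂ (φ s) x u)]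
    ring
  set κ := fderiv ℂ K x u + fderiv ℂ z x u
  have hd : ∀ v : ℂ, HasDerivAt (fun v => c (exp v) - κ * v) 0 v := by
    intro v
    have h2 := ((hcd (exp v) (exp_ne_zero v)).comp v (hasDerivAt_exp v)).sub ((hasDerivAt_id v).const_mul κ)
    convert! h2 using 1
    have := exp_ne_zero v
    field_simp
    ring
  have h3 := is_const_of_deriv_eq_zero (fun u => (hd u).differentiableAt) (fun u => (hd u).deriv)
  have h4 := h3 (2 * Real.pi * I) 0
  simp only [exp_two_pi_mul_I, exp_zero, mul_zero, sub_zero] at h4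
  have h5 : κ * (2 * Real.pi * I) = 0 := by linear_combination -h4
  have h6 : κ = 0 := (mul_eq_zero.1 h5).resolve_right (by simp [Real.pi_ne_zero])
  refine ⟨h6, fun s hs => ?_⟩
  have h7 := h3 (log s) 0
  simp only [h6, zero_mul, sub_zero, exp_log hs, exp_zero] at h7
  change c s = _
  rw [h7, hc]
  have : φ 1 = id := by funext y; exact A.one' y
  simp [this]

end Act

/-- the data of the invariant coordinate and the invariant one-form -/
structure Frm {φ : ℂ → ℂ² → ℂ²} (A : Act φ) (z w a b : ℂ² → ℂ) (z0 : ℂ) : Prop where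
  zs : Semi φ 0 z
  surj : Function.Surjective z
  zr : ∀ x x', z x = z x' ↔ A.rel x x'
  wd : Differentiable ℂ w
  zw : ∀ x v, fderiv ℂ z x v = w x * ((VF φ x).1 * v.2 - (VF φ x).2 * v.1)
  ad : Differentiable ℂ a
  bd : Differentiable ℂ b
  ab : ∀ x, fderiv ℂ b x (1, 0) - fderiv ℂ a x (0, 1) = w x
  lV : ∀ x, a x * (VF φ x).1 + b x * (VF φ x).2 = z0 - z x
  inv : ∀ x u s, s ≠ 0 → a (φ s x) * (fderiv ℂ (φ s) x u).1 + b (φ s x) * (fderiv ℂ (φ s) x u).2 = a x * u.1 + b x * u.2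

namespace Hyp
variable (hH : Hyp φ)
include hH

lemma semi_y {n m : ℕ} {f g : ℂ² → ℂ} (hf : Semi φ n f) (hg : Semi φ (-m) g) : Semi φ 0 (fun x => f x ^ m * g x ^ n) := by
  have h := (hf.pow m).mul (hg.pow n)
  have e : (n : ℤ) * m + -m * n = 0 := by ring
  rwa [e] at h

/-- the invariant coordinate near a fixed point -/
lemma z_fixed {z : ℂ² → ℂ} (hz : Semi φ 0 z) (hr : ∀ x x', z x = z x' ↔ hH.act.rel x x')
    {p : ℂ²} (hp : VF φ p = 0) {n m : ℕ} {f g : ℂ² → ℂ} (hn : 0 < n) (hm : 0 < m) (hc : Nat.Coprime n m)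
    (hf : Semi φ n f) (hg : Semi φ (-m) g) (hf0 : f p = 0) (hg0 : g p = 0) (hJ : Jac f g p ≠ 0) :
    ∃ T : ℂ → ℂ, AnalyticAt ℂ T 0 ∧ deriv T 0 ≠ 0 ∧ T 0 = z p ∧ ∀ᶠ x in 𝓝 p, z x = T (f x ^ m * g x ^ n) := by
  have hy := hH.semi_y hf hg
  obtain ⟨U, hU, hpU, -, -, hUr, -⟩ := hH.act.K_local hp hn hm hc hf hg hf0 hg0 hJ isOpen_univ (mem_univ _)
  have hyr : ∀ x ∈ U, ∀ x' ∈ U, f x ^ m * g x ^ n = f x' ^ m * g x' ^ n ↔ hH.act.rel x x' := fun x hx x' hx' =>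
    ⟨hUr x hx x' hx', fun h => hH.act.rel_semi hy h⟩
  obtain ⟨T, hT, hT', hzT⟩ := factor hU hpU hy.1.differentiableOn hz.1.differentiableOn
    (fun x hx x' hx' => by rw [hr]; exact hyr x hx x' hx') (hH.fol.chart_open hU hy.1.differentiableOn hyr hpU)
  have h0 : f p ^ m * g p ^ n = 0 := by rw [hf0, zero_pow hm.ne', zero_mul]
  have hTp := hzT p hpU
  rw [h0] at hT hT' hTp
  exact ⟨T, hT, hT', hTp.symm, by filter_upwards [hU.mem_nhds hpU] with x hx using hzT x hx⟩

lemma w_loc {z : ℂ² → ℂ} (hz : Semi φ 0 z) (hr : ∀ x x', z x = z x' ↔ hH.act.rel x x') (x : ℂ²) :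
    ∃ w : ℂ² → ℂ, AnalyticAt ℂ w x ∧ ∀ᶠ y in 𝓝 x, ∀ v, fderiv ℂ z y v = w y * ((VF φ y).1 * v.2 - (VF φ y).2 * v.1) := by
  have A := hH.act
  have hzV : ∀ y, (VF φ y).1 * fderiv ℂ z y (1, 0) + (VF φ y).2 * fderiv ℂ z y (0, 1) = 0 := by
    intro y; rw [← lin_apply, A.semi_V hz]; simp
  by_cases h1 : (VF φ x).1 = 0
  · by_cases h2 : (VF φ x).2 = 0
    · have hp : VF φ x = 0 := Prod.ext h1 h2
      obtain ⟨n, m, f, g, hn, hm, hc, hf, hg, hf0, hg0, hJ⟩ := hH.fixed_weights hp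
      obtain ⟨T, hT, -, -, hzT⟩ := hH.z_fixed hz hr hp hn hm hc hf hg hf0 hg0 hJ
      have hy := hH.semi_y hf hg
      have h0 : f x ^ m * g x ^ n = 0 := by rw [hf0, zero_pow hm.ne', zero_mul]
      have hJd : Differentiable ℂ (Jac f g) := ((A.dfun hf.1 _).mul (A.dfun hg.1 _)).sub ((A.dfun hf.1 _).mul (A.dfun hg.1 _))
      refine ⟨fun y => deriv T (f y ^ m * g y ^ n) * (f y ^ (m - 1) * g y ^ (n - 1) * Jac f g y), ?_, ?_⟩
      · refine AnalyticAt.mul ?_ (analytic_of_diff (((hf.1.pow _).mul (hg.1.pow _)).mul hJd) x)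
        exact AnalyticAt.comp (g := deriv T) (f := fun y => f y ^ m * g y ^ n) (by rw [h0]; exact hT.deriv)
          (analytic_of_diff hy.1 x)
      · have hTe : ∀ᶠ y in 𝓝 x, AnalyticAt ℂ T (f y ^ m * g y ^ n) := by
          have : ContinuousAt (fun y => f y ^ m * g y ^ n) x := hy.cont.continuousAt
          apply this.eventually
          change ∀ᶠ t in 𝓝 (f x ^ m * g x ^ n), AnalyticAt ℂ T t
          rw [h0]; exact hT.eventually_analyticAt
        filter_upwards [hzT.eventually_nhds, hTe] with y hzy hTy v
        have e1 : HasFDerivAt z (deriv T (f y ^ m * g y ^ n) • fderiv ℂ (fun y => f y ^ m * g y ^ n) y) y :=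
          (HasDerivAt.comp_hasFDerivAt y hTy.differentiableAt.hasDerivAt (hy.1 y).hasFDerivAt).congr_of_eventuallyEq hzy
        have e2 := ((hf.1 y).hasFDerivAt.pow m).mul ((hg.1 y).hasFDerivAt.pow n)
        rw [e1.fderiv, show fderiv ℂ (fun y => f y ^ m * g y ^ n) y = _ from e2.fderiv]
        have e3 := A.semi_V hf y
        have e4 := A.semi_V hg y
        obtain ⟨m', rfl⟩ := Nat.exists_eq_add_of_lt hm
        obtain ⟨n', rfl⟩ := Nat.exists_eq_add_of_lt hn
        rw [lin_apply] at e3 e4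
        simp only [add_apply, smul_apply, smul_eq_mul, nsmul_eq_mul, Jac, lin_apply (fderiv ℂ f y) v, lin_apply (fderiv ℂ g y) v]
        simp only [zero_add, add_tsub_cancel_right, pow_succ] at e3 e4 ⊢
        push_cast at e3 e4 ⊢
        linear_combination deriv T (f y ^ m' * f y * (g y ^ n' * g y)) * f y ^ m' * g y ^ n' *
          ((v.1 * fderiv ℂ f y (1, 0) + v.2 * fderiv ℂ f y (0, 1)) * e4 - (v.1 * fderiv ℂ g y (1, 0) + v.2 * fderiv ℂ g y (0, 1)) * e3)
    · refine ⟨fun y => -(fderiv ℂ z y (1, 0) * ((VF φ y).2)⁻¹), ?_, ?_⟩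
      · exact ((analytic_of_diff (A.dfun hz.1 _) x).mul ((analytic_of_diff A.V2d x).inv h2)).neg
      · filter_upwards [A.V2d.continuous.continuousAt.eventually_ne h2] with y hy v
        rw [lin_apply]
        field_simp
        linear_combination v.2 * hzV y
  · refine ⟨fun y => fderiv ℂ z y (0, 1) * ((VF φ y).1)⁻¹, ?_, ?_⟩
    · exact (analytic_of_diff (A.dfun hz.1 _) x).mul ((analytic_of_diff A.V1d x).inv h1)
    · filter_upwards [A.V1d.continuous.continuousAt.eventually_ne h1] with y hy v
      rw [lin_apply]
      field_simp
      linear_combination v.1 * hzV y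

lemma fixed_iso (x : ℂ²) : ∀ᶠ y in 𝓝 x, y ≠ x → VF φ y ≠ 0 := by
  have A := hH.act
  by_cases h : VF φ x = 0
  · obtain ⟨n, m, f, g, hn, hm, hc, hf, hg, hf0, hg0, hJ⟩ := hH.fixed_weights h
    obtain ⟨U, hU, hpU, -, hUK, -⟩ := A.K_local h hn hm hc hf hg hf0 hg0 hJ isOpen_univ (mem_univ _)
    filter_upwards [hU.mem_nhds hpU] with y hy hne hy0
    exact hne (by rw [← hUK y hy (A.fixed_K hy0), A.avg_fix hy0])
  · filter_upwards [A.V_diff.continuous.continuousAt.eventually_ne h] with y hy _ using hy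

lemma form : ∃ z w a b z0, Frm hH.act z w a b z0 := by
  have A := hH.act
  obtain ⟨z, hzd, hsurj, hr⟩ := hH.fol.exists_coord
  have hz : Semi φ 0 z := ⟨hzd, fun s hs x => by rw [zpow_zero, one_mul]; exact ((hr _ _).2 (A.rel_orb hs)).symm⟩
  choose W hW hWz using hH.w_loc hz hr
  have hzw : ∀ x v, fderiv ℂ z x v = W x x * ((VF φ x).1 * v.2 - (VF φ x).2 * v.1) := fun x => (hWz x).self_of_nhds
  have hwd : Differentiable ℂ (fun x => W x x) := by
    intro x
    refine (hW x).differentiableAt.congr_of_eventuallyEq ?_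
    filter_upwards [hWz x, hH.fixed_iso x] with y h1 h2
    by_cases hyx : y = x
    · rw [hyx]
    have hV := h2 hyx
    by_contra hne
    have h3 : ∀ v : ℂ², (VF φ y).1 * v.2 - (VF φ y).2 * v.1 = 0 := fun v =>
      (mul_eq_mul_right_iff.1 ((hzw y v).symm.trans (h1 v))).resolve_left hne
    exact hV (Prod.ext (by simpa using h3 (0, 1)) (by simpa using h3 (1, 0)))
  obtain ⟨Λ, hΛ, hΛw⟩ := exists_xprim hwd
  obtain ⟨μ, hμ, hμV⟩ := A.exists_primitive (hΛ.mul A.V2d)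
  have ha := A.dfun hμ (1, 0)
  have hb := hΛ.add (A.dfun hμ (0, 1))
  have hab : ∀ x, fderiv ℂ (fun x => Λ x + fderiv ℂ μ x (0, 1)) x (1, 0) - fderiv ℂ (fun x => fderiv ℂ μ x (1, 0)) x (0, 1) = W x x := by
    intro x
    rw [show fderiv ℂ (fun x => Λ x + fderiv ℂ μ x (0, 1)) x = _ from fderiv_add (hΛ x) (A.dfun hμ (0, 1) x), add_apply,
      hΛw, dsymm (analytic_of_diff hμ x) (0, 1) (1, 0)]
    ring
  have hKe : (fun x => fderiv ℂ μ x (1, 0) * (VF φ x).1 + (Λ x + fderiv ℂ μ x (0, 1)) * (VF φ x).2) =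
      cpt φ 0 (Λ * fun x => (VF φ x).2) := by
    funext x
    have := hμV x
    rw [lin_apply] at this
    simp only [Pi.mul_apply] at this
    linear_combination this
  have hK : Semi φ 0 (fun x => fderiv ℂ μ x (1, 0) * (VF φ x).1 + (Λ x + fderiv ℂ μ x (0, 1)) * (VF φ x).2) := by
    rw [hKe]
    exact A.cpt_semi (hΛ.mul A.V2d) 0
  have hC := fun x u => A.cartan hz hzw ha hb hab hK x u
  set K := (fun x => fderiv ℂ μ x (1, 0) * (VF φ x).1 + (Λ x + fderiv ℂ μ x (0, 1)) * (VF φ x).2) with hKdef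
  have hconst : ∀ x, K x + z x = K 0 + z 0 := by
    intro x
    refine is_const_of_fderiv_eq_zero (𝕜 := ℂ) (f := fun x => K x + z x) (hK.1.add hzd) (fun y => ?_) x 0
    rw [show fderiv ℂ (fun x => K x + z x) y = _ from fderiv_add (hK.1 y) (hzd y)]
    refine ContinuousLinearMap.ext fun u => ?_
    exact (hC y u).1
  refine ⟨z, fun x => W x x, _, _, K 0 + z 0, hz, hsurj, hr, hwd, hzw, ha, hb, hab, fun x => ?_, fun x u => (hC x u).2⟩
  have := hconst x
  change K x = _
  linear_combination this

end Hyp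

lemma Act.semi_d (A : Act φ) {k : ℤ} {h : ℂ² → ℂ} (hh : Semi φ k h) {s : ℂ} (hs : s ≠ 0) (x u : ℂ²) :
    fderiv ℂ h (φ s x) (fderiv ℂ (φ s) x u) = s ^ k * fderiv ℂ h x u := by
  have h1 := (hh.1 (φ s x)).hasFDerivAt.comp x (A.diff hs x).hasFDerivAt
  have h2 : HasFDerivAt (fun y => h (φ s y)) (s ^ k • fderiv ℂ h x) x := by
    rw [show (fun y => h (φ s y)) = fun y => s ^ k * h y from funext fun y => hh.2 s hs y]
    exact (hh.1 x).hasFDerivAt.const_mul _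
  have := congrArg (fun l => l u) (h1.unique h2)
  simpa using this

namespace Frm
variable (hH : Hyp φ) {z w a b : ℂ² → ℂ} {z0 : ℂ} (F : Frm hH.act z w a b z0)
include hH F

lemma znc (x : ℂ²) : ¬ ∀ᶠ x' in 𝓝 x, z x' = z x :=
  hH.fol.chart_open isOpen_univ F.zs.1.differentiableOn (fun x _ x' _ => F.zr x x') (mem_univ x)

lemma zK {x : ℂ²} (hx : x ∈ KK φ) : z x = z0 := by
  have h1 := hH.act.avg_fixed_K hx
  have h2 := F.lV (avg φ x)
  rw [h1, hH.act.semi_avg F.zs hx] at h2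
  simp only [Prod.fst_zero, Prod.snd_zero, mul_zero, add_zero] at h2
  linear_combination h2

lemma orb_of {x x' : ℂ²} (hx : z x ≠ z0) (h : z x = z x') : ∃ s, s ≠ 0 ∧ x' = φ s x := by
  rcases hH.act.rel_iff.1 ((F.zr x x').1 h) with h | ⟨h, -⟩
  · exact h
  · exact absurd (F.zK hH h) hx

/-- local primitive near the special point -/
lemma theta {xs : ℂ²} {n : ℕ} {f σ : ℂ² → ℂ} (hn : 0 < n) (hf : Semi φ n f) {r : ℝ}
    (hσ : DifferentiableOn ℂ σ (ball xs r)) (hfσ : ∀ x ∈ ball xs r, z x - z0 = f x * σ x) :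
    ∃ Θ : ℂ² → ℂ, (∀ x ∈ ball xs r, HasFDerivAt Θ (dxy (a x + σ x * (fderiv ℂ f x (1, 0) / n)) (b x + σ x * (fderiv ℂ f x (0, 1) / n))) x) ∧
      ∀ x ∈ ball xs r, fderiv ℂ Θ x (VF φ x) = 0 := by
  have A := hH.act
  have hn0 : (n : ℂ) ≠ 0 := by exact_mod_cast hn.ne'
  have ho := isOpen_ball (x := xs) (ε := r)
  have hσa := analyticOn_of_diff ho hσ
  have hfV : ∀ x, (VF φ x).1 * fderiv ℂ f x (1, 0) + (VF φ x).2 * fderiv ℂ f x (0, 1) = n * f x := fun x => by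
    rw [← lin_apply, A.semi_V hf x]; simp
  have hdz : ∀ x ∈ ball xs r, ∀ v, fderiv ℂ z x v = f x * fderiv ℂ σ x v + σ x * fderiv ℂ f x v := by
    intro x hx v
    have h1 : HasFDerivAt z (f x • fderiv ℂ σ x + σ x • fderiv ℂ f x) x := by
      refine (((hf.1 x).hasFDerivAt.mul (hσa x hx).differentiableAt.hasFDerivAt).add_const z0).congr_of_eventuallyEq ?_
      filter_upwards [ho.mem_nhds hx] with y hy
      rw [Pi.mul_apply, ← hfσ y hy]; ring
    rw [h1.fderiv]; simp
  have hJ : ∀ x ∈ ball xs r, f x * (Jac σ f x + n * w x) = 0 := by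
    intro x hx
    have e1 := hdz x hx (1, 0)
    have e2 := hdz x hx (0, 1)
    rw [F.zw] at e1 e2
    simp only [Jac, mul_one, mul_zero, sub_zero, zero_sub] at e1 e2 ⊢
    linear_combination -fderiv ℂ f x (0, 1) * e1 + fderiv ℂ f x (1, 0) * e2 - w x * hfV x
  have hJ0 : ∀ x ∈ ball xs r, Jac σ f x + n * w x = 0 := by
    intro x hx
    have hJd := (Jac_diff ho hσ hf.1.differentiableOn).add ((F.wd.const_mul (n : ℂ)).differentiableOn)
    refine ((mul_zero_germ (analytic_of_diff hf.1 x) (analyticOn_of_diff ho hJd x hx) ?_).resolve_left ?_).self_of_nhds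
    · filter_upwards [ho.mem_nhds hx] with y hy using hJ y hy
    · intro h0
      refine F.znc hH x ?_
      filter_upwards [h0, ho.mem_nhds hx] with y hy hyb
      have e1 := hfσ y hyb
      have e2 := hfσ x hx
      rw [hy] at e1
      rw [h0.self_of_nhds] at e2
      linear_combination e1 - e2
  have hp : ∀ v, Differentiable ℂ (fun x => fderiv ℂ f x v / n) := fun v => by
    simpa only [div_eq_mul_inv] using (A.dfun hf.1 v).mul_const ((n : ℂ)⁻¹)
  have hder : ∀ x ∈ ball xs r, ∀ v u c, Differentiable ℂ c → fderiv ℂ (fun x => c x + σ x * (fderiv ℂ f x v / n)) x u =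
      fderiv ℂ c x u + (σ x * (fderiv ℂ (fun x => fderiv ℂ f x v) x u / n) + fderiv ℂ f x v / n * fderiv ℂ σ x u) := by
    intro x hx v u c hc
    have h1 := (hc x).hasFDerivAt.add ((hσa x hx).differentiableAt.hasFDerivAt.mul ((A.dfun hf.1 v x).hasFDerivAt.mul_const ((n : ℂ)⁻¹)))
    simp only [div_eq_mul_inv]
    rw [show fderiv ℂ (fun x => c x + σ x * (fderiv ℂ f x v * (n : ℂ)⁻¹)) x = _ from h1.fderiv]
    simp only [add_apply, smul_apply, smul_eq_mul]
    ring
  obtain ⟨Θ, hΘ⟩ := poincare (convex_ball xs r) ho (p := fun x => a x + σ x * (fderiv ℂ f x (1, 0) / n))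
    (q := fun x => b x + σ x * (fderiv ℂ f x (0, 1) / n)) (F.ad.differentiableOn.add (hσ.mul (hp _).differentiableOn))
    (F.bd.differentiableOn.add (hσ.mul (hp _).differentiableOn)) (by
      intro x hx
      rw [hder x hx _ _ _ F.ad, hder x hx _ _ _ F.bd]
      have e1 := F.ab x
      have e2 := hJ0 x hx
      have e3 := dsymm (analytic_of_diff hf.1 x) (1, 0) (0, 1)
      rw [e3]
      simp only [Jac] at e2
      field_simp
      linear_combination -n * e1 - e2)
  refine ⟨Θ, hΘ, fun x hx => ?_⟩
  rw [(hΘ x hx).fderiv]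
  have e1 := F.lV x
  have e2 := hfσ x hx
  simp only [dxy, add_apply, smul_apply, smul_eq_mul, ContinuousLinearMap.coe_fst', ContinuousLinearMap.coe_snd']
  have e3 : σ x * ((VF φ x).1 * fderiv ℂ f x (1, 0) + (VF φ x).2 * fderiv ℂ f x (0, 1)) / n = σ x * f x := by
    rw [hfV]; field_simp
  linear_combination e1 + e3 - e2

/-- the local solution near the special fibre -/
lemma exists_h {xs : ℂ²} (hz0 : z xs = z0) {n : ℕ} {f σ Θ : ℂ² → ℂ} (hn : 0 < n) (hf : Semi φ n f) {U : Set ℂ²} (hU : IsOpen U)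
    (hxU : xs ∈ U) (hfσ : ∀ x ∈ U, z x - z0 = f x * σ x)
    (hΘ : ∀ x ∈ U, HasFDerivAt Θ (dxy (a x + σ x * (fderiv ℂ f x (1, 0) / n)) (b x + σ x * (fderiv ℂ f x (0, 1) / n))) x)
    (hc : ∀ x ∈ U, ∀ y ∈ U, z x = z y → Θ x = Θ y) :
    ∃ (h : ℂ → ℂ) (ρ : ℂ), ∀ᶠ ζ in 𝓝 z0, DifferentiableAt ℂ h ζ ∧ ∀ y, z y = ζ → ζ ≠ z0 → f y ≠ 0 ∧
      ∀ v, (ζ - z0) * (fderiv ℂ f y v + f y * (deriv h ζ * fderiv ℂ z y v)) = f y * (n * (ρ * fderiv ℂ z y v - (a y * v.1 + b y * v.2))) := by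
  classical
  have A := hH.act
  have hn0 : (n : ℂ) ≠ 0 := by exact_mod_cast hn.ne'
  let Q : ℂ → ℂ := fun t => if ht : ∃ x ∈ U, z x = t then Θ ht.choose else 0
  have hQ : ∀ x ∈ U, Θ x = Q (z x) := by
    intro x hx
    have ht : ∃ x' ∈ U, z x' = z x := ⟨x, hx, rfl⟩
    simp only [Q, dif_pos ht]
    exact hc _ hx _ ht.choose_spec.1 ht.choose_spec.2.symm
  have hQa : AnalyticAt ℂ Q z0 := by
    have h1 : AnalyticAt ℂ Θ xs := analyticOn_of_diff hU (fun x hx => (hΘ x hx).differentiableAt.differentiableWithinAt) xs hxU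
    have h2 := push (T := Q) (analytic_of_diff F.zs.1 xs) (F.znc hH xs) (h1.congr (by
      filter_upwards [hU.mem_nhds hxU] with x hx using hQ x hx))
    rwa [hz0] at h2
  obtain ⟨ε, hε, hball⟩ := eventually_nhds_iff_ball.1 hQa.eventually_analyticAt
  have hQ'd : DifferentiableOn ℂ (deriv Q) (ball z0 ε) := fun t ht => (hball t ht).deriv.differentiableAt.differentiableWithinAt
  have hds := ((differentiableOn_dslope (ball_mem_nhds z0 hε)).2 hQ'd).const_mul (-(n : ℂ))
  obtain ⟨h, hh⟩ := hds.isExactOn_ball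
  refine ⟨h, deriv Q z0, ?_⟩
  have hop : z '' (U ∩ z ⁻¹' ball z0 ε) ∈ 𝓝 z0 := by
    have h1 := open_at (analytic_of_diff F.zs.1 xs) (F.znc hH xs)
    rw [← hz0, ← h1]
    refine image_mem_map (inter_mem (hU.mem_nhds hxU) (F.zs.cont.continuousAt ?_))
    rw [hz0]
    exact ball_mem_nhds z0 hε
  filter_upwards [hop, ball_mem_nhds z0 hε] with ζ hx hζ
  obtain ⟨x, ⟨hxU, -⟩, hxζ⟩ := hx
  refine ⟨(hh ζ hζ).differentiableAt, fun y hy hne => ?_⟩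
  rw [(hh ζ hζ).deriv]
  obtain ⟨s, hs, rfl⟩ := F.orb_of hH (x := y) (x' := x) (by rwa [hy]) (by rw [hy, hxζ])
  have hfx : f (φ s y) ≠ 0 := by
    intro h0
    have := hfσ _ hxU
    rw [h0, zero_mul, hxζ] at this
    exact hne (sub_eq_zero.1 this)
  have hfs := hf.2 s hs y
  refine ⟨fun h0 => hfx (by rw [hfs, h0, mul_zero]), fun v => ?_⟩
  have e1 : HasFDerivAt Θ (deriv Q (z (φ s y)) • fderiv ℂ z (φ s y)) (φ s y) := by
    refine (HasDerivAt.comp_hasFDerivAt (φ s y) (h₂ := Q) (hball _ (by rwa [hxζ])).differentiableAt.hasDerivAt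
      (F.zs.1 _).hasFDerivAt).congr_of_eventuallyEq ?_
    filter_upwards [hU.mem_nhds hxU] with x hx using hQ x hx
  have e2 := congrArg (fun l => l (fderiv ℂ (φ s) y v)) ((hΘ _ hxU).unique e1)
  simp only [dxy, add_apply, smul_apply, smul_eq_mul, ContinuousLinearMap.coe_fst', ContinuousLinearMap.coe_snd'] at e2
  rw [A.semi_d F.zs hs, hxζ, zpow_zero, one_mul] at e2
  have e3 := F.inv y v s hs
  have e4 := A.semi_d hf hs y v
  rw [lin_apply] at e4
  have e5 := hfσ _ hxU
  rw [hxζ] at e5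
  have e6 := sub_smul_dslope (deriv Q) z0 ζ
  rw [smul_eq_mul] at e6
  have hsn : s ^ (n : ℤ) ≠ 0 := zpow_ne_zero _ hs
  set S := s ^ (n : ℤ)
  have e7 : f (φ s y) * (n * (a y * v.1 + b y * v.2) + σ (φ s y) * (S * fderiv ℂ f y v)) = f (φ s y) * (n * (deriv Q ζ * fderiv ℂ z y v)) := by
    rw [← e2, ← e3, ← e4]
    field_simp
    ring
  apply mul_left_cancel₀ hsn
  rw [hfs] at e5 e7
  have e8 : S * (n * (deriv Q ζ * fderiv ℂ z y v)* f y) = S * ((ζ - z0) * fderiv ℂ f y v + f y * (n * (a y * v.1 + b y * v.2))) := by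
    linear_combination -e7 - S * fderiv ℂ f y v * e5
  linear_combination -e8 - S * n * f y * fderiv ℂ z y v * e6

/-- logarithmic primitives off the special fibre -/
lemma exists_P (n : ℕ) (ρ : ℂ) {x : ℂ²} (hx : z x ≠ z0) : ∃ P : ℂ² → ℂ, ∀ᶠ y in 𝓝 x, DifferentiableAt ℂ P y ∧
    ∀ v, (z y - z0) * fderiv ℂ P y v = n * (ρ * fderiv ℂ z y v - (a y * v.1 + b y * v.2)) := by
  have A := hH.act
  obtain ⟨r, hr, hb⟩ := eventually_nhds_iff_ball.1 (F.zs.cont.continuousAt.eventually_ne hx)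
  have ho := isOpen_ball (x := x) (ε := r)
  have hi : ∀ y ∈ ball x r, HasFDerivAt (fun y => (z y - z0)⁻¹) (-((z y - z0) ^ 2)⁻¹ • fderiv ℂ z y) y := fun y hy =>
    HasDerivAt.comp_hasFDerivAt (h₂ := Inv.inv) y (hasDerivAt_inv (sub_ne_zero.2 (hb y hy))) ((F.zs.1 y).hasFDerivAt.sub_const z0)
  have hd : ∀ v c, Differentiable ℂ c → ∀ y ∈ ball x r, HasFDerivAt (fun y => n * (ρ * fderiv ℂ z y v - c y) * (z y - z0)⁻¹)
      ((n * (ρ * fderiv ℂ z y v - c y)) • (-((z y - z0) ^ 2)⁻¹ • fderiv ℂ z y) +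
        (z y - z0)⁻¹ • ((n : ℂ) • (ρ • fderiv ℂ (fun y => fderiv ℂ z y v) y - fderiv ℂ c y))) y := fun v c hc y hy =>
    ((((A.dfun F.zs.1 v y).hasFDerivAt.const_mul ρ).sub (hc y).hasFDerivAt).const_mul (n : ℂ)).mul (hi y hy)
  obtain ⟨P, hP⟩ := poincare (convex_ball x r) ho (p := fun y => n * (ρ * fderiv ℂ z y (1, 0) - a y) * (z y - z0)⁻¹)
    (q := fun y => n * (ρ * fderiv ℂ z y (0, 1) - b y) * (z y - z0)⁻¹)
    (fun y hy => (hd _ a F.ad y hy).differentiableAt.differentiableWithinAt)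
    (fun y hy => (hd _ b F.bd y hy).differentiableAt.differentiableWithinAt) (by
      intro y hy
      rw [(hd _ a F.ad y hy).fderiv, (hd _ b F.bd y hy).fderiv]
      have h0 := sub_ne_zero.2 (hb y hy)
      have e1 := F.ab y
      have e2 := F.lV y
      have e3 := dsymm (analytic_of_diff F.zs.1 y) (1, 0) (0, 1)
      simp only [add_apply, smul_apply, smul_eq_mul, sub_apply]
      rw [e3, F.zw y (1, 0), F.zw y (0, 1)]
      simp only [mul_one, mul_zero, sub_zero, zero_sub]
      field_simp
      linear_combination n * (z y - z0) * e1 + n * w y * e2)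
  refine ⟨P, ?_⟩
  filter_upwards [ho.mem_nhds (mem_ball_self hr)] with y hy
  refine ⟨(hP y hy).differentiableAt, fun v => ?_⟩
  have h0 := sub_ne_zero.2 (hb y hy)
  rw [(hP y hy).fderiv, lin_apply (fderiv ℂ z y) v]
  simp only [dxy, add_apply, smul_apply, smul_eq_mul, ContinuousLinearMap.coe_fst', ContinuousLinearMap.coe_snd']
  field_simp
  ring

lemma exists_R {n : ℕ} {f : ℂ² → ℂ} (hf : Semi φ n f) {h : ℂ → ℂ} {ρ : ℂ}
    (hh : ∀ᶠ ζ in 𝓝 z0, DifferentiableAt ℂ h ζ ∧ ∀ y, z y = ζ → ζ ≠ z0 → f y ≠ 0 ∧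
      ∀ v, (ζ - z0) * (fderiv ℂ f y v + f y * (deriv h ζ * fderiv ℂ z y v)) = f y * (n * (ρ * fderiv ℂ z y v - (a y * v.1 + b y * v.2)))) :
    ∃ R, Semi φ n R ∧ (∀ x, z x ≠ z0 → R x ≠ 0) ∧ ∀ x, z x = z0 → ∃ u, AnalyticAt ℂ u x ∧ u x ≠ 0 ∧ ∀ᶠ y in 𝓝 x, R y = f y * u y := by
  classical
  have A := hH.act
  let S : (ℂ² → ℂ) → ℂ² → Prop := fun E y => DifferentiableAt ℂ E y ∧ E y ≠ 0 ∧
    ∀ v, (z y - z0) * fderiv ℂ E y v = E y * (n * (ρ * fderiv ℂ z y v - (a y * v.1 + b y * v.2)))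
  have huniq : ∀ {E E' : ℂ² → ℂ} {y}, z y ≠ z0 → (∀ᶠ x in 𝓝 y, S E x) → (∀ᶠ x in 𝓝 y, S E' x) →
      ∃ c : ℂˣ, ∀ᶠ x in 𝓝 y, E x = c • E' x := by
    intro E E' y hy hE hE'
    obtain ⟨r, hr, hb⟩ := eventually_nhds_iff_ball.1 ((F.zs.cont.continuousAt.eventually_ne hy).and (hE.and hE'))
    have hd : ∀ x ∈ ball y r, HasFDerivAt (fun x => E x * (E' x)⁻¹) (0 : ℂ² →L[ℂ] ℂ) x := by
      intro x hx
      obtain ⟨h0, ⟨d1, n1, v1⟩, d2, n2, v2⟩ := hb x hx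
      have e := d1.hasFDerivAt.mul (HasDerivAt.comp_hasFDerivAt (h₂ := Inv.inv) x (hasDerivAt_inv n2) d2.hasFDerivAt)
      convert! e using 1
      refine ContinuousLinearMap.ext fun v => ?_
      simp only [add_apply, smul_apply, smul_eq_mul, zero_apply, Function.comp_apply]
      have h0 := sub_ne_zero.2 h0
      have e3 : E' x * fderiv ℂ E x v = E x * fderiv ℂ E' x v := by
        apply mul_left_cancel₀ h0
        linear_combination E' x * v1 v - E x * v2 v
      field_simp
      linear_combination -e3
    have hc : ∀ x ∈ ball y r, E x * (E' x)⁻¹ = E y * (E' y)⁻¹ := fun x hx =>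
      isOpen_ball.is_const_of_fderiv_eq_zero (𝕜 := ℂ) (convex_ball y r).isPreconnected
        (fun x hx => (hd x hx).differentiableAt.differentiableWithinAt) (fun x hx => (hd x hx).fderiv) hx (mem_ball_self hr)
    obtain ⟨-, ⟨-, n1, -⟩, -, n2, -⟩ := hb y (mem_ball_self hr)
    refine ⟨Units.mk0 (E y * (E' y)⁻¹) (mul_ne_zero n1 (inv_ne_zero n2)), ?_⟩
    filter_upwards [ball_mem_nhds y hr] with x hx
    have n3 := (hb x hx).2.2.2.1
    rw [Units.smul_mk0, ← hc x hx, smul_eq_mul, inv_mul_cancel_right₀ n3]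
  choose! P hP using fun x (hx : z x ≠ z0) => F.exists_P hH n ρ hx
  let E0 : ℂ² → ℂ := fun y => f y * exp (h (z y))
  have hE0d : ∀ y, DifferentiableAt ℂ h (z y) → HasFDerivAt E0
      (f y • exp (h (z y)) • deriv h (z y) • fderiv ℂ z y + exp (h (z y)) • fderiv ℂ f y) y := fun y hy =>
    (hf.1 y).hasFDerivAt.mul (HasDerivAt.comp_hasFDerivAt (h₂ := h) y hy.hasDerivAt (F.zs.1 y).hasFDerivAt).cexp
  let L : ℂ² → ℂ² → ℂ := fun x => if z x = z0 then E0 else fun y => exp (P x y)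
  have hL0 : ∀ {x}, z x = z0 → L x = E0 := fun hx => if_pos hx
  have hL1 : ∀ {x}, z x ≠ z0 → L x = fun y => exp (P x y) := fun hx => if_neg hx
  have hz' : ∀ {x}, z x = z0 → ∀ᶠ y in 𝓝 x, DifferentiableAt ℂ h (z y) ∧ (z y ≠ z0 → f y ≠ 0 ∧
      ∀ v, (z y - z0) * (fderiv ℂ f y v + f y * (deriv h (z y) * fderiv ℂ z y v)) =
        f y * (n * (ρ * fderiv ℂ z y v - (a y * v.1 + b y * v.2)))) := by
    intro x hx
    have : Tendsto z (𝓝 x) (𝓝 z0) := by rw [← hx]; exact F.zs.cont.continuousAt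
    filter_upwards [this.eventually hh] with y hy using ⟨hy.1, hy.2 y rfl⟩
  have hLS : ∀ x, ∀ᶠ y in 𝓝 x, z y ≠ z0 → S (L x) y := by
    intro x
    by_cases hx : z x = z0
    · rw [hL0 hx]
      filter_upwards [hz' hx] with y hy hyz
      refine ⟨(hE0d y hy.1).differentiableAt, mul_ne_zero (hy.2 hyz).1 (exp_ne_zero _), fun v => ?_⟩
      rw [(hE0d y hy.1).fderiv]
      simp only [add_apply, smul_apply, smul_eq_mul, E0]
      linear_combination exp (h (z y)) * (hy.2 hyz).2 v
    · rw [hL1 hx]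
      filter_upwards [hP x hx] with y hy _
      have e := hy.1.hasFDerivAt.cexp
      refine ⟨e.differentiableAt, exp_ne_zero _, fun v => ?_⟩
      rw [e.fderiv]
      simp only [smul_apply, smul_eq_mul]
      linear_combination exp (P x y) * hy.2 v
  have hne : ∀ {x}, z x ≠ z0 → ∀ᶠ y in 𝓝 x, z y ≠ z0 := fun hx => F.zs.cont.continuousAt.eventually_ne hx
  have hLS' : ∀ {x}, z x ≠ z0 → ∀ᶠ y in 𝓝 x, S (L x) y := fun {x} hx => by
    filter_upwards [hLS x, hne hx] with y h1 h2 using h1 h2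
  obtain ⟨R, hR⟩ := global_of_local (G := ℂˣ) L (by
    intro x g g' hg
    have hfr : ∃ᶠ y in 𝓝 x, z y ≠ z0 := by
      intro h0
      push Not at h0
      exact F.znc hH x (by filter_upwards [h0] with y hy; rw [hy, h0.self_of_nhds])
    obtain ⟨y, h1, h2, h3⟩ := (hfr.and_eventually ((hLS x).and hg)).exists
    have h4 := (h2 h1).2.1
    simp only [Units.smul_def, smul_eq_mul] at h3
    exact Units.ext (mul_right_cancel₀ h4 h3)) (by
    intro x
    by_cases hx : z x = z0
    · filter_upwards [(hLS x).eventually_nhds] with y hy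
      by_cases hyz : z y = z0
      · exact ⟨1, Eventually.of_forall fun x' => by rw [hL0 hx, hL0 hyz, one_smul]⟩
      · refine huniq hyz ?_ (hLS' hyz)
        filter_upwards [hy, hne hyz] with x' h1 h2 using h1 h2
    · filter_upwards [(hLS' hx).eventually_nhds, hne hx] with y hy hyz using huniq hyz hy (hLS' hyz))
  have hRd : ∀ x, DifferentiableAt ℂ R x ∧ fderiv ℂ R x (VF φ x) = ((n : ℤ) : ℂ) * R x := by
    intro x
    obtain ⟨c, hc⟩ := hR x
    have hzV := A.semi_V F.zs x
    simp only [Units.smul_def, smul_eq_mul] at hc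
    have hd : DifferentiableAt ℂ (L x) x ∧ fderiv ℂ (L x) x (VF φ x) = ((n : ℤ) : ℂ) * L x x := by
      by_cases hx : z x = z0
      · rw [hL0 hx]
        have e := hE0d x (hz' hx).self_of_nhds.1
        refine ⟨e.differentiableAt, ?_⟩
        rw [e.fderiv]
        simp only [add_apply, smul_apply, smul_eq_mul, E0, hzV, A.semi_V hf]
        push_cast
        ring
      · obtain ⟨h1, -, h2⟩ := (hLS' hx).self_of_nhds
        refine ⟨h1, mul_left_cancel₀ (sub_ne_zero.2 hx) ?_⟩
        rw [h2, F.lV, hzV]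
        push_cast
        ring
    have e := (hd.1.hasFDerivAt.const_mul (c : ℂ)).congr_of_eventuallyEq hc
    refine ⟨e.differentiableAt, ?_⟩
    rw [e.fderiv, hc.self_of_nhds, smul_apply, hd.2, smul_eq_mul]
    ring
  refine ⟨R, A.semi_of_V (fun x => (hRd x).1) (fun x => (hRd x).2), fun x hx => ?_, fun x hx => ?_⟩
  · obtain ⟨c, hc⟩ := hR x
    rw [hc.self_of_nhds, Units.smul_def, smul_eq_mul]
    exact mul_ne_zero c.ne_zero (hLS' hx).self_of_nhds.2.1
  · obtain ⟨c, hc⟩ := hR x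
    have ha : AnalyticAt ℂ h (z x) := by
      obtain ⟨r, hr, hb⟩ := eventually_nhds_iff_ball.1 hh
      rw [hx]
      exact DifferentiableOn.analyticAt (fun t ht => (hb t ht).1.differentiableWithinAt) (ball_mem_nhds z0 hr)
    refine ⟨fun y => c * exp (h (z y)), ?_, mul_ne_zero c.ne_zero (exp_ne_zero _), ?_⟩
    · exact analyticAt_const.mul (AnalyticAt.comp (g := h) (f := z) (x := x) ha (analytic_of_diff F.zs.1 x)).cexp
    · filter_upwards [hc] with y hy
      rw [hy, hL0 hx, Units.smul_def, smul_eq_mul]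
      ring
end Frm

namespace Frm
variable (hH : Hyp φ) {z w a b : ℂ² → ℂ} {z0 : ℂ} (F : Frm hH.act z w a b z0)
include hH F

lemma exists_fixed : ∃ p, VF φ p = 0 := by
  have A := hH.act
  by_contra! hno
  have hK : ∀ x, x ∉ KK φ := fun x hx => hno _ (A.avg_fixed_K hx)
  obtain ⟨xs, hxs⟩ := F.surj z0
  obtain ⟨l, j, f, g, hl, hf, hg, hfx, -, hJ, hc, hst⟩ := A.offK hH.eff (hK xs)
  obtain ⟨r, hr, hb⟩ := eventually_nhds_iff_ball.1 (hf.cont.continuousAt.eventually_ne hfx)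
  set σ : ℂ² → ℂ := fun x => (z x - z0) * (f x)⁻¹ with hσ
  have hfσ : ∀ x ∈ ball xs r, z x - z0 = f x * σ x := fun x hx => by
    rw [hσ]; have := hb x hx; field_simp
  obtain ⟨Θ, hΘ, hΘV⟩ := F.theta hH hl hf (xs := xs) (r := r) (σ := σ) (fun x hx =>
    (((F.zs.1 x).sub_const z0).mul ((hf.1 x).inv (hb x hx))).differentiableWithinAt) hfσ
  obtain ⟨δ, hδ, hmv⟩ := A.offK_move hl hst (ball_mem_nhds xs hr)
  have hroot0 : ∀ {η : ℂ}, η ^ l = 1 → η ≠ 0 := by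
    rintro η h rfl; rw [zero_pow hl.ne'] at h; exact zero_ne_one h
  have hδr : ∀ x ∈ ball xs δ, ∀ η : ℂ, η ^ l = 1 → φ η x ∈ ball xs r := fun x hx η hη => by
    have := hmv 0 (mem_ball_self hδ) x hx η hη
    rwa [exp_zero, mul_one] at this
  have hsub : ball xs δ ⊆ ball xs r := fun x hx => by
    have := hδr x hx 1 (one_pow l)
    rwa [A.one'] at this
  have hinv : ∀ η : ℂ, η ^ l = 1 → ∀ x ∈ ball xs δ, Θ (φ η x) = Θ x := by
    intro η hη x hx
    have hη0 := hroot0 hη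
    have hηz : η ^ (l : ℤ) = 1 := by rw [zpow_natCast, hη]
    have hd : ∀ y ∈ ball xs δ, HasFDerivAt (fun y => Θ (φ η y) - Θ y) (0 : ℂ² →L[ℂ] ℂ) y := by
      intro y hy
      have e := ((hΘ _ (hδr y hy η hη)).comp y (A.diff hη0 y).hasFDerivAt).sub (hΘ y (hsub hy))
      convert! e using 1
      refine ContinuousLinearMap.ext fun v => ?_
      have e1 := F.inv y v η hη0
      have e2 := A.semi_d hf hη0 y v
      have e3 : σ (φ η y) = σ y := by simp only [hσ]; rw [hf.2 η hη0, F.zs.2 η hη0, hηz, zpow_zero, one_mul, one_mul]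
      rw [hηz, lin_apply, lin_apply (fderiv ℂ f y) v] at e2
      simp only [dxy, add_apply, sub_apply, smul_apply, smul_eq_mul, ContinuousLinearMap.coe_fst', ContinuousLinearMap.coe_snd',
        zero_apply, ContinuousLinearMap.comp_apply, e3]
      linear_combination -e1 - σ y / l * e2
    have h1 := isOpen_ball.is_const_of_fderiv_eq_zero (𝕜 := ℂ) (convex_ball xs δ).isPreconnected
        (fun x hx => (hd x hx).differentiableAt.differentiableWithinAt) (fun x hx => (hd x hx).fderiv) hx (mem_ball_self hδ)
    beta_reduce at h1
    rw [hst η hη, sub_self] at h1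
    exact sub_eq_zero.1 h1
  obtain ⟨ε, hε, U, hU, hxU, hUV, -, hUm, hUo⟩ := A.offK_local hl hf hg hfx hJ hc hst isOpen_ball (mem_ball_self hδ)
  have hcon : ∀ x ∈ U, ∀ y ∈ U, z x = z y → Θ x = Θ y := by
    intro x hx y hy hxy
    obtain ⟨s, hs, hsy⟩ := (A.rel_iff.1 ((F.zr x y).1 hxy)).resolve_right fun h => hK x h.1
    obtain ⟨u, hu, η, hη, rfl⟩ := hUo x hx y hy (by
      rw [hsy, hf.2 s hs, hg.2 s hs, zpow_natCast, zpow_natCast]; ring)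
    have hin : ∀ u ∈ ball (0 : ℂ) ε, φ (exp u) x ∈ ball xs δ := fun u hu => by
      have := hUm u hu x hx 1 (one_pow l)
      rwa [one_mul] at this
    have e1 := A.const_path (V := ball xs δ) isOpen_ball (fun y hy => (hΘ y (hsub hy)).differentiableAt.differentiableWithinAt)
      (fun y hy => hΘV y (hsub hy)) isOpen_ball (convex_ball 0 ε) hin hu (mem_ball_self hε)
    rw [exp_zero, A.one'] at e1
    rw [← A.mul' (hroot0 hη) (exp_ne_zero u), hinv η hη _ (hin u hu), e1]
  obtain ⟨h, ρ, hh⟩ := F.exists_h hH hxs hl hf hU hxU (fun x hx => hfσ x (hsub (hUV hx))) (fun x hx => hΘ x (hsub (hUV hx))) hcon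
  obtain ⟨R, hR, hR0, hRf⟩ := F.exists_R hH hf hh
  obtain ⟨x, hx⟩ := A.no_unit (k := l) (by exact_mod_cast hl.ne') hR
  have hxz : z x = z0 := by by_contra h0; exact hR0 x h0 hx
  obtain ⟨u, -, hu, hRu⟩ := hRf x hxz
  rw [hRu.self_of_nhds] at hx
  have hfx0 := (mul_eq_zero.1 hx).resolve_right hu
  obtain ⟨s, hs, rfl⟩ := (A.rel_iff.1 ((F.zr xs x).1 (hxs.trans hxz.symm))).resolve_right fun h => hK xs h.1
  rw [hf.2 s hs] at hfx0
  exact (mul_ne_zero (zpow_ne_zero _ hs) hfx) hfx0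

lemma z_p {p : ℂ²} (hp : VF φ p = 0) : z p = z0 := F.zK hH (hH.act.fixed_K hp)

lemma K_avg {p x : ℂ²} (hp : VF φ p = 0) (hx : z x = z0) : x ∈ KK φ ∧ avg φ x = p := by
  have A := hH.act
  rcases A.rel_iff.1 ((F.zr p x).1 ((F.z_p hH hp).trans hx.symm)) with ⟨s, hs, rfl⟩ | ⟨-, h1, h2⟩
  · rw [(A.fixed_iff p).1 hp s hs]
    exact ⟨A.fixed_K hp, A.avg_fix hp⟩
  · exact ⟨h1, by rw [← h2, A.avg_fix hp]⟩

lemma freq (x : ℂ²) : ∃ᶠ y in 𝓝 x, z y ≠ z0 := by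
  intro h0
  push Not at h0
  exact F.znc hH x (by filter_upwards [h0] with y hy; rw [hy, h0.self_of_nhds])

/-- the first coordinate, and the second one near the fixed point -/
lemma first {p : ℂ²} (hp : VF φ p = 0) : ∃ (n m : ℕ) (R e : ℂ² → ℂ), 0 < n ∧ 0 < m ∧ Nat.Coprime n m ∧ Semi φ n R ∧
    (∀ x, z x ≠ z0 → R x ≠ 0) ∧ AnalyticAt ℂ e p ∧ Jac R e p ≠ 0 ∧ ∀ᶠ x in 𝓝 p, e x ^ n * R x ^ m = z x - z0 := by
  have A := hH.act
  obtain ⟨n, m, f, g, hn, hm, hc, hf, hg, hf0, hg0, hJ⟩ := hH.fixed_weights hp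
  obtain ⟨T, hT, hT', hTp, hzT⟩ := hH.z_fixed F.zs F.zr hp hn hm hc hf hg hf0 hg0 hJ
  obtain ⟨k, hk, hTk, hk0⟩ := factor_zero (f := fun t => T t - T 0) (hT.sub analyticAt_const) (sub_self _)
  rw [deriv_sub_const] at hk0
  rw [F.z_p hH hp] at hTp
  have hy := hH.semi_y hf hg
  have hy0 : f p ^ m * g p ^ n = 0 := by rw [hf0, zero_pow hm.ne', zero_mul]
  have hκ : AnalyticAt ℂ (fun x => k (f x ^ m * g x ^ n)) p :=
    AnalyticAt.comp (g := k) (f := fun x => f x ^ m * g x ^ n) (by rw [hy0]; exact hk) (analytic_of_diff hy.1 p)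
  have hκ0 : k (f p ^ m * g p ^ n) ≠ 0 := by rw [hy0, hk0]; exact hT'
  have hzk : ∀ᶠ x in 𝓝 p, z x - z0 = f x ^ m * g x ^ n * k (f x ^ m * g x ^ n) := by
    filter_upwards [hzT] with x hx
    rw [← hTk, hx, hTp]
  obtain ⟨r, hr, hb⟩ := eventually_nhds_iff_ball.1 (hzk.and hκ.eventually_analyticAt)
  have hfσ : ∀ x ∈ ball p r, z x - z0 = f x * (f x ^ (m - 1) * g x ^ n * k (f x ^ m * g x ^ n)) := fun x hx => by
    rw [(hb x hx).1, ← mul_assoc, ← mul_assoc, mul_pow_sub_one hm.ne']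
  obtain ⟨Θ, hΘ, hΘV⟩ := F.theta hH hn hf (fun x hx =>
    (((hf.1.pow (m - 1)).mul (hg.1.pow n) x).mul (hb x hx).2.differentiableAt).differentiableWithinAt) hfσ
  obtain ⟨U, hU, hpU, hUV, -, -, hUΘ⟩ := A.K_local hp hn hm hc hf hg hf0 hg0 hJ isOpen_ball (mem_ball_self hr)
  obtain ⟨h, ρ, hh⟩ := F.exists_h hH (F.z_p hH hp) hn hf hU hpU (fun x hx => hfσ x (hUV hx)) (fun x hx => hΘ x (hUV hx))
    (fun x hx y hy' hxy => hUΘ Θ (fun x hx => (hΘ x hx).differentiableAt.differentiableWithinAt) hΘV x hx y hy'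
      (A.rel_semi hy ((F.zr x y).1 hxy)))
  obtain ⟨R, hR, hR0, hRf⟩ := F.exists_R hH hf hh
  obtain ⟨u, hu, hu0, hRu⟩ := hRf p (F.z_p hH hp)
  have hq := hκ.mul ((hu.pow m).inv (pow_ne_zero m hu0))
  have hq0 : k (f p ^ m * g p ^ n) * (u p ^ m)⁻¹ ≠ 0 := mul_ne_zero hκ0 (inv_ne_zero (pow_ne_zero m hu0))
  obtain ⟨ε, hε, hbε⟩ := eventually_nhds_iff_ball.1 (hq.eventually_analyticAt.and (hq.continuousAt.eventually_ne hq0))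
  obtain ⟨l, hl, hlq⟩ := exists_log (convex_ball p ε) isOpen_ball (fun x hx => (hbε x hx).1) (fun x hx => (hbε x hx).2)
  have hv : AnalyticAt ℂ (fun x => exp (l x * (n : ℂ)⁻¹)) p := ((hl p (mem_ball_self hε)).mul analyticAt_const).cexp
  have hn0 : (n : ℂ) ≠ 0 := by exact_mod_cast hn.ne'
  refine ⟨n, m, R, fun x => g x * exp (l x * (n : ℂ)⁻¹), hn, hm, hc, hR, hR0, (analytic_of_diff hg.1 p).mul hv, ?_, ?_⟩
  · have d1 : HasFDerivAt R (f p • fderiv ℂ u p + u p • fderiv ℂ f p) p :=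
      ((hf.1 p).hasFDerivAt.mul hu.differentiableAt.hasFDerivAt).congr_of_eventuallyEq hRu
    have d2 := (hg.1 p).hasFDerivAt.mul hv.differentiableAt.hasFDerivAt
    have : Jac R (fun x => g x * exp (l x * (n : ℂ)⁻¹)) p = u p * exp (l p * (n : ℂ)⁻¹) * Jac f g p := by
      unfold Jac
      rw [d1.fderiv, show fderiv ℂ (fun x => g x * exp (l x * (n : ℂ)⁻¹)) p = _ from d2.fderiv]
      simp only [add_apply, smul_apply, smul_eq_mul, hf0, hg0]
      ring
    rw [this]
    exact mul_ne_zero (mul_ne_zero hu0 (exp_ne_zero _)) hJ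
  · filter_upwards [hzk, hRu, ball_mem_nhds p hε, hu.continuousAt.eventually_ne hu0] with x h1 h2 h3 h4
    have h5 : exp (l x * (n : ℂ)⁻¹) ^ n = k (f x ^ m * g x ^ n) * (u x ^ m)⁻¹ := by
      rw [← exp_nat_mul, mul_comm, inv_mul_cancel_right₀ hn0]
      exact hlq x h3
    rw [h1, h2, mul_pow, mul_pow, h5]
    field_simp

/-- the second coordinate -/
lemma second {p : ℂ²} (hp : VF φ p = 0) : ∃ (n m : ℕ) (R G : ℂ² → ℂ), 0 < n ∧ 0 < m ∧ Nat.Coprime n m ∧ Semi φ n R ∧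
    Semi φ (-m) G ∧ Jac R G p ≠ 0 ∧ ∀ x, G x ^ n * R x ^ m = z x - z0 := by
  classical
  have A := hH.act
  obtain ⟨n, m, R, e, hn, hm, hc, hR, hR0, he, hJ, hez⟩ := F.first hH hp
  have hn0 : (n : ℂ) ≠ 0 := by exact_mod_cast hn.ne'
  have hz : ∀ {x}, z x ≠ z0 → ∀ᶠ y in 𝓝 x, z y ≠ z0 := fun hx => F.zs.cont.continuousAt.eventually_ne hx
  have hex : ∀ x, ∃ E : ℂ² → ℂ, AnalyticAt ℂ E x ∧ ∀ᶠ y in 𝓝 x, E y ^ n * R y ^ m = z y - z0 := by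
    intro x
    by_cases hx : z x = z0
    · obtain ⟨h1, h2⟩ := F.K_avg hH hp hx
      obtain ⟨s, hs, hsx⟩ := A.K_move h1 (by rw [h2]; exact hez.eventually_nhds.and he.eventually_analyticAt)
      refine ⟨fun y => s ^ m * e (φ s y), ?_, ?_⟩
      · obtain ⟨r, hr, hb⟩ := eventually_nhds_iff_ball.1 hsx.2.eventually_analyticAt
        refine analyticAt_const.mul (analyticOn_of_diff (isOpen_ball.preimage (A.diff hs).continuous) (fun y hy => ?_) x
          (mem_ball_self hr))
        exact ((hb _ hy).differentiableAt.comp y (A.diff hs y)).differentiableWithinAt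
      · filter_upwards [(A.diff hs).continuous.continuousAt.eventually hsx.1] with y hy
        rw [hR.2 s hs, F.zs.2 s hs, zpow_zero, one_mul, zpow_natCast] at hy
        rw [← hy]
        ring
    · obtain ⟨r, hr, hb⟩ := eventually_nhds_iff_ball.1 (hz hx)
      obtain ⟨l, hl, hlq⟩ := exists_log (f := fun y => (z y - z0) * (R y ^ m)⁻¹) (convex_ball x r) isOpen_ball (fun y hy =>
        ((analytic_of_diff F.zs.1 y).sub analyticAt_const).mul (((analytic_of_diff hR.1 y).pow m).inv (pow_ne_zero m (hR0 y (hb y hy)))))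
        (fun y hy => mul_ne_zero (sub_ne_zero.2 (hb y hy)) (inv_ne_zero (pow_ne_zero m (hR0 y (hb y hy)))))
      refine ⟨fun y => exp (l y * (n : ℂ)⁻¹), ((hl x (mem_ball_self hr)).mul analyticAt_const).cexp, ?_⟩
      filter_upwards [ball_mem_nhds x hr] with y hy
      rw [← exp_nat_mul, mul_comm (n : ℂ), inv_mul_cancel_right₀ hn0, hlq y hy, inv_mul_cancel_right₀]
      exact pow_ne_zero m (hR0 y (hb y hy))
  have huniq : ∀ {E E' : ℂ² → ℂ} {x}, AnalyticAt ℂ E x → AnalyticAt ℂ E' x → (∀ᶠ y in 𝓝 x, E y ^ n * R y ^ m = z y - z0) →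
      (∀ᶠ y in 𝓝 x, E' y ^ n * R y ^ m = z y - z0) → ∃ ζ : ℂ, ζ ^ n = 1 ∧ ∀ᶠ y in 𝓝 x, E y = ζ * E' y := by
    intro E E' x h1 h2 h3 h4
    refine root_unique hn h1 h2 ?_
    have h5 := (mul_zero_germ ((h1.pow n).sub (h2.pow n)) ((analytic_of_diff hR.1 x).pow m) (by
      filter_upwards [h3, h4] with y e1 e2
      simp only [Pi.sub_apply, Pi.pow_apply]
      linear_combination e1 - e2)).resolve_right fun h0 => by
        obtain ⟨y, h6, h7⟩ := ((F.freq hH x).and_eventually h0).exists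
        exact pow_ne_zero m (hR0 y h6) h7
    filter_upwards [h5] with y hy using sub_eq_zero.1 hy
  choose L hLa hLz using hex
  obtain ⟨G, hG⟩ := global_of_local (G := rootsOfUnity n ℂ) L (by
    intro x g g' hg
    obtain ⟨y, h1, h2, h3⟩ := ((F.freq hH x).and_eventually ((hLz x).and hg)).exists
    have h4 : L x y ≠ 0 := by
      intro h0
      rw [h0, zero_pow hn.ne', zero_mul] at h2
      exact h1 (sub_eq_zero.1 h2.symm)
    exact Subtype.ext (Units.ext (mul_right_cancel₀ h4 h3))) (by
    intro x
    filter_upwards [(hLz x).eventually_nhds, (hLa x).eventually_analyticAt] with y h1 h2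
    obtain ⟨ζ, hζ, h3⟩ := huniq h2 (hLa y) h1 (hLz y)
    haveI : NeZero n := ⟨hn.ne'⟩
    exact ⟨rootsOfUnity.mkOfPowEq ζ hζ, h3⟩)
  have hGd : ∀ x, AnalyticAt ℂ G x := by
    intro x
    obtain ⟨g, hg⟩ := hG x
    exact (analyticAt_const.mul (hLa x)).congr (hg.mono fun y hy => hy.symm)
  have hGz : ∀ x, G x ^ n * R x ^ m = z x - z0 := by
    intro x
    obtain ⟨g, hg⟩ := hG x
    rw [hg.self_of_nhds, ← (hLz x).self_of_nhds]
    change (((g : ℂˣ) : ℂ) * L x x) ^ n * _ = _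
    have : ((g : ℂˣ) : ℂ) ^ n = 1 := by
      have h : (g : ℂˣ) ^ n = 1 := g.2
      rw [← Units.val_pow_eq_pow_val, h, Units.val_one]
    rw [mul_pow, this, one_mul]
  refine ⟨n, m, R, G, hn, hm, hc, hR, A.semi_of_V (fun x => (hGd x).differentiableAt) ?_, ?_, hGz⟩
  · intro x
    have hGe : Differentiable ℂ G := fun x => (hGd x).differentiableAt
    have hVd : Differentiable ℂ (fun y => fderiv ℂ G y (VF φ y) + m * G y) := by
      have : (fun y => fderiv ℂ G y (VF φ y) + m * G y) = fun y => (VF φ y).1 * fderiv ℂ G y (1, 0) + (VF φ y).2 * fderiv ℂ G y (0, 1) + m * G y := by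
        funext y; rw [lin_apply]
      rw [this]
      exact ((A.V1d.mul (A.dfun hGe _)).add (A.V2d.mul (A.dfun hGe _))).add (hGe.const_mul _)
    have h1 := (mul_zero_germ ((analytic_of_diff F.zs.1 x).sub (analyticAt_const (v := z0))) (analytic_of_diff hVd x) (Eventually.of_forall fun y => by
      have d := ((hGe y).hasFDerivAt.pow n).mul ((hR.1 y).hasFDerivAt.pow m)
      have d' : HasFDerivAt (fun x => G x ^ n * R x ^ m) (fderiv ℂ z y) y := by
        rw [funext hGz]; exact (F.zs.1 y).hasFDerivAt.sub_const z0
      have e := congrArg (fun l => l (VF φ y)) (d.unique d')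
      simp only [add_apply, smul_apply, smul_eq_mul, nsmul_eq_mul, A.semi_V hR, A.semi_V F.zs, Pi.pow_apply, Pi.sub_apply] at e ⊢
      rw [← hGz]
      obtain ⟨n', rfl⟩ := Nat.exists_eq_add_of_lt hn
      obtain ⟨m', rfl⟩ := Nat.exists_eq_add_of_lt hm
      apply mul_left_cancel₀ hn0
      simp only [zero_add, add_tsub_cancel_right, pow_succ] at e ⊢
      push_cast at e ⊢
      linear_combination G y * e)).resolve_left fun h0 => by
        obtain ⟨y, h6, h7⟩ := ((F.freq hH x).and_eventually h0).exists
        exact h6 (sub_eq_zero.1 h7)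
    have h2 := h1.self_of_nhds
    push_cast
    linear_combination h2
  · obtain ⟨ζ, hζ, h1⟩ := huniq (hGd p) he (Eventually.of_forall hGz) hez
    have d := (he.differentiableAt.hasFDerivAt.const_mul ζ).congr_of_eventuallyEq h1
    rw [Jac_comb (f := R) (g := e) (g' := G) (a := ζ) (b := 0) (by rw [d.fderiv]; ext <;> simp)]
    refine mul_ne_zero ?_ hJ
    rintro rfl
    rw [zero_pow hn.ne'] at hζ
    exact zero_ne_one hζ
end Frm

lemma cop_one {n m : ℕ} (hc : Nat.Coprime n m) {s : ℂ} (h1 : s ^ n = 1) (h2 : s ^ m = 1) : s = 1 := by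
  have := pow_gcd_eq_one.2 ⟨h1, h2⟩
  rwa [hc, pow_one] at this

lemma semi_stab {k : ℤ} {f : ℂ² → ℂ} (hf : Semi φ k f) {x : ℂ²} (hx : f x ≠ 0) {s : ℂ} (hs : s ≠ 0)
    (h : f (φ s x) = f x) : s ^ k = 1 := by
  rw [hf.2 s hs] at h
  exact (mul_eq_right₀ hx).1 h

lemma npow_one {m : ℕ} {s : ℂ} (h : s ^ (-(m : ℤ)) = 1) : s ^ m = 1 := by
  rwa [zpow_neg, zpow_natCast, inv_eq_one] at h

namespace Frm
variable (hH : Hyp φ) {z w a b : ℂ² → ℂ} {z0 : ℂ} (F : Frm hH.act z w a b z0)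
include F

lemma dz_ne {n m : ℕ} (hc : Nat.Coprime n m) {R G : ℂ² → ℂ} (hR : Semi φ n R) (hG : Semi φ (-m) G) {x : ℂ²}
    (hx : z x ≠ z0) (hRx : R x ≠ 0) (hGx : G x ≠ 0) : ∃ v, fderiv ℂ z x v ≠ 0 := by
  have A := hH.act
  obtain ⟨l, j, f, g, hl, hf, hg, hf0, hg0, hJ, hc', hst⟩ := A.offK hH.eff (fun h => hx (F.zK hH h))
  have hl1 : l = 1 := by
    have h1 := isPrimitiveRoot_exp l hl.ne'
    have hη := hst _ h1.pow_eq_one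
    have hη0 := h1.ne_zero hl.ne'
    have e1 := semi_stab hR hRx hη0 (by rw [hη])
    have e2 := npow_one (semi_stab hG hGx hη0 (by rw [hη]))
    rw [zpow_natCast] at e1
    rw [cop_one hc e1 e2] at h1
    exact h1.unique (IsPrimitiveRoot.one)
  subst hl1
  have hV : IsOpen {x | z x ≠ z0} := isOpen_ne_fun F.zs.1.continuous continuous_const
  obtain ⟨δ, hδ, U, hU, hxU, hUV, hUf, -, hUr⟩ := A.offK_local hl hf hg hf0 hJ hc' hst hV hx
  have hyd : ∀ a ∈ U, DifferentiableAt ℂ (fun a => (f a ^ j)⁻¹) a := fun a ha =>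
    ((hf.1 a).pow j).inv (pow_ne_zero _ (hUf a ha))
  have hy : HasFDerivAt (fun a => g a * (f a ^ j)⁻¹) ((f x ^ j)⁻¹ • fderiv ℂ g x) x := by
    have := (hg.1 x).hasFDerivAt.mul (hyd x hxU).hasFDerivAt
    convert! this using 1
    rw [hg0]
    ext <;> simp
  have hv : ∃ v, fderiv ℂ g x v ≠ 0 := by
    by_contra! h
    apply hJ
    simp [Jac, h]
  obtain ⟨v, hv⟩ := hv
  have hyv : ((f x ^ j)⁻¹ • fderiv ℂ g x) v ≠ 0 := by
    rw [smul_apply, smul_eq_mul]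
    exact mul_ne_zero (inv_ne_zero (pow_ne_zero _ hf0)) hv
  obtain ⟨T, hT, hT0, hTz⟩ := factor hU hxU (y := fun a => g a * (f a ^ j)⁻¹) (z := z)
    (fun a ha => ((hg.1 a).mul (hyd a ha)).differentiableWithinAt) F.zs.1.differentiableOn (by
      intro a ha b hb
      have ea := hUf a ha
      have eb := hUf b hb
      beta_reduce
      constructor
      · intro h
        obtain ⟨u, -, η, hη, rfl⟩ := hUr a ha b hb (by field_simp at h; simp only [pow_one]; rw [h, mul_comm])
        rw [F.zs.2 _ (mul_ne_zero (by rintro rfl; simp at hη) (exp_ne_zero u)), zpow_zero, one_mul]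
      · intro h
        obtain ⟨s, hs, rfl⟩ := F.orb_of hH (hUV ha) h
        rw [hf.2 s hs, hg.2 s hs, zpow_natCast, zpow_natCast, pow_one, mul_pow]
        field_simp) (by
      intro h
      have h1 := (hasFDerivAt_const (𝕜 := ℂ) (g x * (f x ^ j)⁻¹) x).congr_of_eventuallyEq h
      rw [hy.unique h1] at hyv
      exact hyv rfl)
  refine ⟨v, ?_⟩
  have h1 := (hT.differentiableAt.hasDerivAt.comp_hasFDerivAt x hy).congr_of_eventuallyEq
    (f₁ := z) (by filter_upwards [hU.mem_nhds hxU] with a ha using hTz a ha)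
  rw [h1.fderiv, smul_apply, smul_eq_mul]
  exact mul_ne_zero hT0 hyv

lemma lin : Lin φ := by
  have A := hH.act
  obtain ⟨p, hp⟩ := F.exists_fixed hH
  obtain ⟨n, m, R, G, hn, hm, hc, hR, hG, hJ, hGz⟩ := F.second hH hp
  have hRp : R p = 0 := A.semi_fixed hp hR (by exact_mod_cast hn.ne')
  have hGp : G p = 0 := A.semi_fixed hp hG (by simpa using hm.ne')
  have hne : ∀ x, z x ≠ z0 ↔ R x ≠ 0 ∧ G x ≠ 0 := by
    intro x
    rw [← sub_ne_zero, ← hGz x]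
    simp [hn.ne', hm.ne']
    tauto
  obtain ⟨N, ε, I, hN, hpN, -, hε, hinj, hNJ, hI, -⟩ := loc_inv isOpen_univ hR.1.differentiableOn hG.1.differentiableOn
    (mem_univ p) hJ
  rw [hRp, hGp] at hI
  have hmv : ∀ {x}, z x = z0 → ∃ s, s ≠ 0 ∧ φ s x ∈ N := fun {x} hx => by
    obtain ⟨h1, h2⟩ := F.K_avg hH hp hx
    exact A.K_move h1 (by rw [h2]; exact hN.mem_nhds hpN)
  have hfix := (A.fixed_iff p).1 hp
  have hcan : ∀ {x y : ℂ²} {s : ℂ}, s ≠ 0 → φ s x = φ s y → x = y := fun {x y s} hs h => by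
    rw [← A.inv hs x, h, A.inv hs]
  refine lin_of hR hG ?_ ⟨?_, ?_⟩
  · intro x
    by_cases hx : z x = z0
    · obtain ⟨s, hs, h⟩ := hmv hx
      exact jac_move A hR hG hs (hNJ _ h)
    · obtain ⟨hRx, hGx⟩ := (hne x).1 hx
      obtain ⟨v, hv⟩ := F.dz_ne hH hc hR hG hx hRx hGx
      have h1 : Jac R z x ≠ 0 := by
        apply Jac_ne_of (u := VF φ x) (v := v)
        rw [A.semi_V hR, A.semi_V F.zs]
        simp [hn.ne', hRx, hv]
      have d := (((hG.1 x).hasFDerivAt.pow n).mul ((hR.1 x).hasFDerivAt.pow m)).add_const z0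
      have d' : HasFDerivAt z _ x := d.congr_of_eventuallyEq (Eventually.of_forall fun y => by
        change z y = G y ^ n * R y ^ m + z0
        rw [hGz]; ring)
      rw [Jac_comb (f := R) (g := G) (g' := z) (a := R x ^ m * (n * G x ^ (n - 1))) (b := G x ^ n * (m * R x ^ (m - 1)))
        (by rw [d'.fderiv]; ext <;> simp <;> ring)] at h1
      exact right_ne_zero_of_mul h1
  · intro x x' h
    obtain ⟨e1, e2⟩ := Prod.ext_iff.1 h
    simp only at e1 e2
    have e3 : z x = z x' := by
      have := hGz x
      rw [e1, e2, hGz] at this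
      exact (sub_left_inj.1 this).symm
    by_cases hx : z x = z0
    · have hz : ∀ {y}, z y = z0 → R y = 0 → G y = 0 → y = p := fun {y} h1 h2 h3 => by
        obtain ⟨s, hs, h⟩ := hmv h1
        refine hcan hs ((hinj h hpN ?_).trans (hfix s hs).symm)
        simp only [hR.2 s hs, hG.2 s hs, h2, h3, hRp, hGp, mul_zero]
      have hx' : z x' = z0 := e3 ▸ hx
      by_cases h0 : R x = 0 ∧ G x = 0
      · rw [hz hx h0.1 h0.2, hz hx' (e1 ▸ h0.1) (e2 ▸ h0.2)]
      obtain ⟨k1, k2⟩ := F.K_avg hH hp hx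
      obtain ⟨k1', k2'⟩ := F.K_avg hH hp hx'
      have hst : ∀ s, s ≠ 0 → φ s x ∈ N → φ s x' ∈ N → x = x' := fun s hs h1 h2 => by
        refine hcan hs (hinj h1 h2 ?_)
        simp only [hR.2 s hs, hG.2 s hs, e1, e2]
      have hKp : ∀ {y}, y ∈ Kp φ → G y = 0 := fun {y} hy => hy _ _ (by omega) hG
      have hKm : ∀ {y}, y ∈ Km φ → R y = 0 := fun {y} hy => hy _ _ (by omega) hR
      have hNp := hN.mem_nhds hpN
      rcases k1 with k1 | k1 <;> rcases k1' with k1' | k1'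
      · have l1 := A.lim k1
        have l2 := A.lim k1'
        rw [k2] at l1
        rw [k2'] at l2
        obtain ⟨s, ⟨h1, h2⟩, h3⟩ := (((l1.eventually hNp).and (l2.eventually hNp)).and self_mem_nhdsWithin).exists
        exact hst s h3 h1 h2
      · exact absurd ⟨e1.trans (hKm k1'), hKp k1⟩ h0
      · exact absurd ⟨hKm k1, e2.trans (hKp k1')⟩ h0
      · have l1 := A.lim_m k1
        have l2 := A.lim_m k1'
        rw [k2] at l1
        rw [k2'] at l2
        obtain ⟨s, ⟨h1, h2⟩, h3⟩ := (((l1.eventually hNp).and (l2.eventually hNp)).and self_mem_nhdsWithin).exists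
        exact hst s⁻¹ (inv_ne_zero h3) h1 h2
    · obtain ⟨hRx, hGx⟩ := (hne x).1 hx
      obtain ⟨s, hs, rfl⟩ := F.orb_of hH hx e3
      have h1 := semi_stab hR hRx hs e1.symm
      have h2 := npow_one (semi_stab hG hGx hs e2.symm)
      rw [zpow_natCast] at h1
      rw [cop_one hc h1 h2, A.one', ]
  · rintro ⟨r, t⟩
    by_cases h0 : r = 0 ∨ t = 0
    · have hs : ∃ s : ℂ, s ≠ 0 ∧ (s ^ (n : ℤ) * r, s ^ (-(m : ℤ)) * t) ∈ ball ((0, 0) : ℂ²) ε := by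
        have hb : ball ((0, 0) : ℂ²) ε ∈ 𝓝 ((0, 0) : ℂ²) := ball_mem_nhds _ hε
        rcases h0 with rfl | rfl
        · have l := (tendsto_const_nhds (x := (0 : ℂ))).prodMk_nhds (tendsto_zpow0 (n := m) (by omega) t)
          obtain ⟨s, h1, h2⟩ := ((l.eventually hb).and self_mem_nhdsWithin).exists
          refine ⟨s⁻¹, inv_ne_zero h2, ?_⟩
          rw [mul_zero, zpow_neg, inv_zpow, inv_inv]
          exact h1
        · have l := (tendsto_zpow0 (n := n) (by omega) r).prodMk_nhds (tendsto_const_nhds (x := (0 : ℂ)))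
          obtain ⟨s, h1, h2⟩ := ((l.eventually hb).and self_mem_nhdsWithin).exists
          refine ⟨s, h2, ?_⟩
          rw [mul_zero]
          exact h1
      obtain ⟨s, hs, hq⟩ := hs
      obtain ⟨e1, e2⟩ := Prod.ext_iff.1 (hI _ hq).2
      simp only at e1 e2
      refine ⟨φ s⁻¹ (I (s ^ (n : ℤ) * r, s ^ (-(m : ℤ)) * t)), Prod.ext ?_ ?_⟩
      · simp only [hR.2 _ (inv_ne_zero hs), e1, inv_zpow]
        exact inv_mul_cancel_left₀ (zpow_ne_zero _ hs) r
      · simp only [hG.2 _ (inv_ne_zero hs), e2, inv_zpow]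
        exact inv_mul_cancel_left₀ (zpow_ne_zero _ hs) t
    · push Not at h0
      obtain ⟨x, hx⟩ := F.surj (z0 + t ^ n * r ^ m)
      have hx2 := hGz x
      rw [hx, add_sub_cancel_left] at hx2
      have hx0 : R x ≠ 0 ∧ G x ≠ 0 := (hne x).1 (by
        rw [hx, ne_eq, add_eq_left]
        exact mul_ne_zero (pow_ne_zero _ h0.2) (pow_ne_zero _ h0.1))
      obtain ⟨s, hs, hs1⟩ := root_of hn (div_ne_zero h0.1 hx0.1)
      have e1 : s ^ n * R x = r := by rw [hs1, div_mul_cancel₀ _ hx0.1]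
      have hxm := pow_ne_zero m hx0.1
      have hrm := pow_ne_zero m h0.1
      obtain ⟨η, hη, e2⟩ := coprime_root hn (j := -(m : ℤ)) (by simpa using hc) (b := G x) (b' := t) hx0.1 h0.1
        (by rw [zpow_neg, zpow_neg, zpow_natCast, zpow_natCast]; field_simp; rw [hx2, mul_comm]) e1
      have hη0 : η ≠ 0 := by rintro rfl; rw [zero_pow hn.ne'] at hη; exact zero_ne_one hη
      refine ⟨φ (η * s) x, Prod.ext ?_ ?_⟩
      · simp only [hR.2 _ (mul_ne_zero hη0 hs), zpow_natCast, mul_pow, hη, one_mul, e1]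
      · simp only [hG.2 _ (mul_ne_zero hη0 hs), e2]
end Frm

lemma Act.lin (A : Act φ) : Lin φ := by
  refine lin_of_eff (fun ψ A hE => ?_) A
  by_cases h1 : ∃ k f x, k < 0 ∧ Semi ψ k f ∧ f x ≠ 0
  · by_cases h2 : ∃ k f x, 0 < k ∧ Semi ψ k f ∧ f x ≠ 0
    · have hH : Hyp ψ := ⟨A, hE, h2, h1⟩
      obtain ⟨z, w, a, b, z0, F⟩ := hH.form
      exact F.lin hH
    · push Not at h2
      exact Lin.symm (A.symm.lin_nonneg hE.symm fun x k f hk hf => h2 (-k) f x (by omega) hf.symm')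
  · push Not at h1
    exact A.lin_nonneg hE fun x k f hk hf => h1 k f x hk hf
end Suz
/-- **Suzuki's linearization theorem.** Every holomorphic action of the multiplicative
group `ℂ*` on `ℂ²` is analytically linearizable: there exist integers `n, m` and a
biholomorphism `H : ℂ² → ℂ²` such that `(H ∘ φˢ ∘ H⁻¹)(x, y) = (sⁿ • x, sᵐ • y)`
for every `s ∈ ℂ*` and every `(x, y) ∈ ℂ²`. -/
theorem suzuki_linearization
    (φ : ℂ → ℂ × ℂ → ℂ × ℂ)
    (hφ_hol : DifferentiableOn ℂ (fun p : ℂ × (ℂ × ℂ) => φ p.1 p.2)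
      ({z : ℂ | z ≠ 0} ×ˢ (Set.univ : Set (ℂ × ℂ))))
    (hφ_one : φ 1 = id)
    (hφ_mul : ∀ z w : ℂ, z ≠ 0 → w ≠ 0 → φ (z * w) = φ z ∘ φ w) :
    ∃ (n m : ℤ) (H : ℂ × ℂ → ℂ × ℂ),
      Function.Bijective H ∧ Differentiable ℂ H ∧
      Differentiable ℂ (Function.invFun H) ∧
      ∀ s : ℂ, s ≠ 0 → ∀ x y : ℂ,
        H (φ s (Function.invFun H (x, y))) = (s ^ n * x, s ^ m * y) := by
  exact Suz.Act.lin ⟨hφ_hol, hφ_one, hφ_mul⟩
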